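/- Let d ≥ 3 be an integer. There exists κ > 0, depending only on d, with the following property. Let R > 0, let μ₀ be an SL_{d−1}(ℝ)-invariant Borel probability measure on X₀ = SL_{d−1}(ℝ)/SL_{d−1}(ℤ), and let 𝒟 be an open subset of the open unit cube (0,1)^d for which there is a constant C' > 0 with vol({x ∈ ℝ^d : dist(x, ∂𝒟) < r}) < C'·r for all r ∈ (0,1) (e.g. 𝒟 with piecewise smooth boundary). Then there exists a constant C > 0 such that for every real T ≥ 1: | T^{−d}·#{a ∈ ℤ^d : gcd(a_1,…,a_d) = 1, a_i ≥ 2 for all i, a/T ∈ 𝒟, and F(a) + Σ_{i=1}^d a_i ≤ R·(a_1⋯a_d)^{1/(d−1)}} − (vol(𝒟)/ζ(d))·μ₀(E_R) | < C·T^{−κ}, where ζ(d) = Σ_{n=1}^∞ n^{−d}, vol is Lebesgue measure, and E_R = {⟦g⟧ ∈ X₀ : Q(Δ_{d−1}, g·ℤ^{d−1}) ≤ R}. -/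

import Mathlib

noncomputable section

open MeasureTheory Matrix Pointwise

/-- `SL_n(ℝ)` -/
abbrev SLR (n : ℕ) := Matrix.SpecialLinearGroup (Fin n) ℝ

instance (n : ℕ) : TopologicalSpace (SLR n) :=
  TopologicalSpace.induced (fun g => (g : Matrix (Fin n) (Fin n) ℝ)) inferInstance

/-- `SL_n(ℤ)` viewed as a subgroup of `SL_n(ℝ)`. -/
def SLZsub (n : ℕ) : Subgroup (SLR n) :=
  (Matrix.SpecialLinearGroup.map (n := Fin n) (Int.castRingHom ℝ)).range

/-- The space of unimodular lattices `X = SL_n(ℝ)/SL_n(ℤ)`. -/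
abbrev XQuot (n : ℕ) := SLR n ⧸ SLZsub n

instance (n : ℕ) : MeasurableSpace (XQuot n) := borel _

/-- The lattice `M·ℤ^n` associated to a matrix `M`. -/
def matLattice {n : ℕ} (M : Matrix (Fin n) (Fin n) ℝ) : Set (Fin n → ℝ) :=
  {x | ∃ v : Fin n → ℤ, x = M.mulVec fun i => (v i : ℝ)}

/-- The covering radius `Q(K, L) = inf{t > 0 : tK + L = ℝ^n}`. -/
def covRad (n : ℕ) (K L : Set (Fin n → ℝ)) : ℝ :=
  sInf {t : ℝ | 0 < t ∧ ∀ x : Fin n → ℝ, ∃ k ∈ K, ∃ l ∈ L, x = t • k + l}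

/-- The standard simplex `Δ_n = {x : x_i ≥ 0, ∑ x_i ≤ 1}`. -/
def simplexStd (n : ℕ) : Set (Fin n → ℝ) :=
  {x | (∀ i, 0 ≤ x i) ∧ ∑ i, x i ≤ 1}

/-- The unimodular lattice `g·ℤ^n` of `g ∈ SL_n(ℝ)`. -/
def latticeOf {n : ℕ} (g : SLR n) : Set (Fin n → ℝ) :=
  matLattice (g : Matrix (Fin n) (Fin n) ℝ)

/-- The set of natural numbers not representable as a nonnegative integer
combination of the coordinates of `a`. -/
def nonRepresentable (d : ℕ) (a : Fin d → ℤ) : Set ℕ :=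
  {m : ℕ | ¬ ∃ k : Fin d → ℕ, (m : ℤ) = ∑ i, (k i : ℤ) * a i}

/-- The Frobenius number `F(a)`: the largest natural number not representable
as a nonnegative integer combination of the coordinates of `a`. -/
def frobNum (d : ℕ) (a : Fin d → ℤ) : ℕ := sSup (nonRepresentable d a)

/-- `ζ(d) = ∑_{n ≥ 1} n^{-d}`. -/
def zetaVal (d : ℕ) : ℝ := ∑' k : ℕ, 1 / ((k : ℝ) + 1) ^ d

/-- Every point lies in a translate `l + t·Δ_n` with `l ∈ L`. -/
def SimplexCovers {n : ℕ} (L : Set (Fin n → ℝ)) (t : ℝ) : Prop :=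
  ∀ x : Fin n → ℝ, ∃ l ∈ L, (∀ i, l i ≤ x i) ∧ ∑ i, (x i - l i) ≤ t

lemma SimplexCovers.mono {n : ℕ} {L : Set (Fin n → ℝ)} {s t : ℝ} (h : SimplexCovers L s)
    (hst : s ≤ t) : SimplexCovers L t := fun x => by
  obtain ⟨l, hl, h1, h2⟩ := h x
  exact ⟨l, hl, h1, h2.trans hst⟩

lemma covRad_set_eq {n : ℕ} (L : Set (Fin n → ℝ)) :
    {t : ℝ | 0 < t ∧ ∀ x : Fin n → ℝ, ∃ k ∈ simplexStd n, ∃ l ∈ L, x = t • k + l} =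
      {t : ℝ | 0 < t ∧ SimplexCovers L t} := by
  ext t
  refine and_congr_right fun ht => forall_congr' fun x => ?_
  constructor
  · rintro ⟨k, ⟨hk0, hk1⟩, l, hl, rfl⟩
    refine ⟨l, hl, fun i => ?_, ?_⟩
    · simpa using mul_nonneg ht.le (hk0 i)
    · simp only [Pi.add_apply, Pi.smul_apply, smul_eq_mul, add_sub_cancel_right,
        ← Finset.mul_sum]
      nlinarith
  · rintro ⟨l, hl, h1, h2⟩
    refine ⟨t⁻¹ • (x - l), ⟨fun i => ?_, ?_⟩, l, hl, ?_⟩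
    · simpa using mul_nonneg (inv_nonneg.2 ht.le) (sub_nonneg.2 (h1 i))
    · simp only [Pi.smul_apply, Pi.sub_apply, smul_eq_mul, ← Finset.mul_sum]
      rw [inv_mul_le_iff₀ ht]; simpa using h2
    · rw [smul_smul, mul_inv_cancel₀ ht.ne', one_smul, sub_add_cancel]

lemma covRad_le_iff {n : ℕ} {L : Set (Fin n → ℝ)} (hL : ∃ t, 0 < t ∧ SimplexCovers L t)
    {R : ℝ} (hR : 0 < R) :
    covRad n (simplexStd n) L ≤ R ↔ ∀ t, R < t → SimplexCovers L t := by
  rw [covRad, covRad_set_eq]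
  constructor
  · intro h t ht
    obtain ⟨s, ⟨_, hs⟩, hst⟩ := exists_lt_of_csInf_lt (s := {t : ℝ | 0 < t ∧ SimplexCovers L t})
      hL (h.trans_lt ht)
    exact hs.mono hst.le
  · intro h
    refine le_of_forall_gt_imp_ge_of_dense fun t ht => ?_
    exact csInf_le ⟨0, fun s hs => hs.1.le⟩ ⟨hR.trans ht, h t ht⟩

lemma simplexCovers_smul {n : ℕ} {L L' : Set (Fin n → ℝ)} {c : ℝ} (hc : 0 < c)
    (hL : ∀ x, x ∈ L' ↔ c⁻¹ • x ∈ L) {t : ℝ} :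
    SimplexCovers L' (c * t) ↔ SimplexCovers L t := by
  constructor
  · intro h x
    obtain ⟨l, hl, h1, h2⟩ := h (c • x)
    refine ⟨c⁻¹ • l, (hL l).1 hl, fun i => ?_, ?_⟩
    · simp only [Pi.smul_apply, smul_eq_mul]
      rw [inv_mul_le_iff₀ hc]; exact h1 i
    · have : ∑ i, ((c • x) i - l i) = c * ∑ i, (x i - (c⁻¹ • l) i) := by
        rw [Finset.mul_sum]; refine Finset.sum_congr rfl fun i _ => ?_
        simp; field_simp
      rw [this] at h2
      exact le_of_mul_le_mul_left h2 hc
  · intro h x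
    obtain ⟨l, hl, h1, h2⟩ := h (c⁻¹ • x)
    refine ⟨c • l, (hL _).2 (by rwa [smul_smul, inv_mul_cancel₀ hc.ne', one_smul]), fun i => ?_, ?_⟩
    · have := h1 i
      simp only [Pi.smul_apply, smul_eq_mul] at this ⊢
      rwa [← le_inv_mul_iff₀ hc]
    · have : ∑ i, (x i - (c • l) i) = c * ∑ i, ((c⁻¹ • x) i - l i) := by
        rw [Finset.mul_sum]; refine Finset.sum_congr rfl fun i _ => ?_
        simp; field_simp
      rw [this]
      exact mul_le_mul_of_nonneg_left h2 hc.le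

/-- The lattice `diag(a_1,…,a_n)·{w ∈ ℤ^n : a_{n+1} ∣ ∑ a_i w_i}`. -/
def frobLattice {n : ℕ} (a : Fin (n + 1) → ℤ) : Set (Fin n → ℝ) :=
  {x | ∃ w : Fin n → ℤ, a (Fin.last n) ∣ ∑ i : Fin n, a i.castSucc * w i ∧
    ∀ i, x i = a i.castSucc * w i}

lemma finite_nonRepresentable {d : ℕ} {a : Fin d → ℤ} (hg : Finset.univ.gcd a = 1)
    (ha : ∀ i, 2 ≤ a i) : (nonRepresentable d a).Finite := by
  obtain ⟨N, hN⟩ := Nat.exists_mem_closure_of_ge (Set.range fun i => (a i).toNat)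
  refine (Set.finite_Iio N).subset fun m hm => ?_
  by_contra hmN
  simp only [Set.mem_Iio, not_lt] at hmN
  have h1 : Nat.setGcd (Set.range fun i => (a i).toNat) = 1 := by
    refine Nat.dvd_one.1 ?_
    have : ((Nat.setGcd (Set.range fun i => (a i).toNat) : ℕ) : ℤ) ∣ Finset.univ.gcd a := by
      refine Finset.dvd_gcd fun i _ => ?_
      have := Nat.setGcd_dvd_of_mem (s := Set.range fun i => (a i).toNat) ⟨i, rfl⟩
      rw [← Int.toNat_of_nonneg (by linarith [ha i] : 0 ≤ a i)]
      exact_mod_cast this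
    rw [hg] at this
    exact_mod_cast this
  have h2 := hN m hmN (by rw [h1]; exact one_dvd _)
  apply hm
  clear hm hmN hN h1
  induction h2 using AddSubmonoid.closure_induction with
  | mem x hx =>
    obtain ⟨i, rfl⟩ := hx
    refine ⟨Pi.single i 1, ?_⟩
    rw [Finset.sum_eq_single i]
    · simp; linarith [ha i]
    · intro j _ hj; simp [hj]
    · simp
  | zero => exact ⟨0, by simp⟩
  | add x y _ _ hx hy =>
    obtain ⟨k, hk⟩ := hx
    obtain ⟨l, hl⟩ := hy
    refine ⟨k + l, ?_⟩
    push_cast [hk, hl]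
    simp [add_mul, Finset.sum_add_distrib]

lemma frobNum_mem {d : ℕ} {a : Fin d → ℤ} (hg : Finset.univ.gcd a = 1)
    (ha : ∀ i, 2 ≤ a i) : frobNum d a ∈ nonRepresentable d a := by
  refine Nat.sSup_mem ⟨1, ?_⟩ (finite_nonRepresentable hg ha).bddAbove
  rintro ⟨k, hk⟩
  by_cases h : ∃ i, k i ≠ 0
  · obtain ⟨i, hi⟩ := h
    have h1 : (k i : ℤ) * a i ≤ ∑ j, (k j : ℤ) * a j :=
      Finset.single_le_sum (f := fun j => (k j : ℤ) * a j)
        (fun j _ => mul_nonneg (by positivity) (by linarith [ha j])) (Finset.mem_univ i)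
    have h2 : (1 : ℤ) ≤ k i := by exact_mod_cast Nat.one_le_iff_ne_zero.2 hi
    have := ha i
    rw [← hk] at h1
    push_cast at h1
    nlinarith
  · push Not at h
    simp [h] at hk

lemma exists_rep_of_frobNum_lt {d : ℕ} {a : Fin d → ℤ} (hg : Finset.univ.gcd a = 1)
    (ha : ∀ i, 2 ≤ a i) {m : ℤ} (hm : (frobNum d a : ℤ) < m) :
    ∃ k : Fin d → ℕ, m = ∑ i, (k i : ℤ) * a i := by
  by_contra h
  have hm0 : 0 ≤ m := (Int.natCast_nonneg _).trans hm.le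
  have : m.toNat ∈ nonRepresentable d a := by
    intro ⟨k, hk⟩
    exact h ⟨k, by rw [← hk, Int.toNat_of_nonneg hm0]⟩
  have := le_csSup (finite_nonRepresentable hg ha).bddAbove this
  change m.toNat ≤ frobNum d a at this
  omega

/-- Kannan's identity between the Frobenius number and a covering radius. -/
lemma simplexCovers_frobLattice_iff {n : ℕ} {a : Fin (n + 1) → ℤ}
    (hg : Finset.univ.gcd a = 1) (ha : ∀ i, 2 ≤ a i) (X : ℝ) :
    (∀ t, X < t → SimplexCovers (frobLattice a) t) ↔
      (frobNum (n + 1) a : ℝ) + ∑ i, (a i : ℝ) ≤ X := by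
  set F := frobNum (n + 1) a with hF
  set q := a (Fin.last n) with hq
  have hq2 : 2 ≤ q := ha _
  have haR : ∀ i, (0 : ℝ) < a i := fun i => by exact_mod_cast (by linarith [ha i] : 0 < a i)
  rw [Fin.sum_univ_castSucc]
  constructor
  · intro h
    -- integers `u` with `∑ a_i u_i ≡ F mod q`
    obtain ⟨u, hu⟩ : ∃ u : Fin (n + 1) → ℤ, (F : ℤ) = ∑ i, u i * a i := by
      obtain ⟨g, hg'⟩ := Finset.gcd_eq_sum_mul Finset.univ a
      refine ⟨fun i => F * g i, ?_⟩
      rw [hg] at hg'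
      simp only [mul_assoc, ← Finset.mul_sum, mul_comm (g _), ← hg', mul_one]
    have key : ∀ ε : ℝ, 0 < ε →
        (F : ℝ) + (∑ i : Fin n, (a i.castSucc : ℝ) + q) - n * ε ≤ X + ε := by
      intro ε hε
      obtain ⟨l, ⟨w, hw, hlw⟩, h1, h2⟩ := h (X + ε) (by linarith)
        fun i => a i.castSucc * (u i.castSucc + 1) - ε
      have hwu : ∀ i : Fin n, w i ≤ u i.castSucc := by
        intro i
        have h3 := h1 i
        rw [hlw] at h3
        have h4 : (w i : ℝ) < u i.castSucc + 1 :=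
          lt_of_mul_lt_mul_left (by linarith : (a i.castSucc : ℝ) * w i < a i.castSucc * (u i.castSucc + 1)) (haR _).le
        exact Int.lt_add_one_iff.1 (by exact_mod_cast h4)
      have hsum : ∑ i : Fin n, ((a i.castSucc : ℝ) * (u i.castSucc + 1) - ε - l i) =
          ((∑ i : Fin n, a i.castSucc * (u i.castSucc - w i) : ℤ) : ℝ) +
            ∑ i : Fin n, (a i.castSucc : ℝ) - n * ε := by
        push_cast
        simp only [hlw]
        have : (n : ℝ) * ε = ∑ i : Fin n, ε := by simp
        rw [this, ← Finset.sum_add_distrib, ← Finset.sum_sub_distrib]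
        exact Finset.sum_congr rfl fun i _ => by ring
      rw [hsum] at h2
      have hN : (F : ℤ) + q ≤ ∑ i : Fin n, a i.castSucc * (u i.castSucc - w i) := by
        set N := ∑ i : Fin n, a i.castSucc * (u i.castSucc - w i) with hNdef
        have hdvd : q ∣ (F : ℤ) - N := by
          have : (F : ℤ) - N = ∑ i : Fin n, a i.castSucc * w i + u (Fin.last n) * q := by
            rw [hu, hNdef, Fin.sum_univ_castSucc]
            simp only [mul_sub, Finset.sum_sub_distrib, mul_comm (u _)]
            rw [← hq]; ring
          rw [this]
          exact dvd_add hw (dvd_mul_left _ _)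
        by_contra hlt
        push Not at hlt
        obtain ⟨c, hc⟩ := hdvd
        have hc0 : 0 ≤ c := by
          by_contra hneg
          push Not at hneg
          nlinarith
        apply frobNum_mem hg ha
        refine ⟨Fin.snoc (fun i => (u i.castSucc - w i).toNat) c.toNat, ?_⟩
        rw [Fin.sum_univ_castSucc, ← hF]
        simp only [Fin.snoc_castSucc, Fin.snoc_last, Int.toNat_of_nonneg hc0]
        have : ∀ i : Fin n, (((u i.castSucc - w i).toNat : ℕ) : ℤ) = u i.castSucc - w i :=
          fun i => Int.toNat_of_nonneg (by linarith [hwu i])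
        simp only [this]
        rw [← hq]
        have h5 : ∑ i : Fin n, (u i.castSucc - w i) * a i.castSucc = N :=
          Finset.sum_congr rfl fun i _ => mul_comm _ _
        rw [h5]; linarith
      have hN' : (F : ℝ) + q ≤ ((∑ i : Fin n, a i.castSucc * (u i.castSucc - w i) : ℤ) : ℝ) := by
        exact_mod_cast hN
      linarith
    refine le_of_forall_pos_le_add fun δ hδ => ?_
    have := key (δ / (n + 1)) (by positivity)
    have h3 : ((n : ℝ) + 1) * (δ / (n + 1)) = δ := by field_simp
    linarith
  · intro h t ht x
    set u : Fin n → ℤ := fun i => ⌊x i / a i.castSucc⌋ with hu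
    have hu1 : ∀ i, (a i.castSucc : ℝ) * u i ≤ x i := fun i => by
      have := Int.floor_le (x i / a i.castSucc)
      rw [le_div_iff₀ (haR _)] at this
      linarith
    have hu2 : ∀ i, x i ≤ (a i.castSucc : ℝ) * (u i + 1) := fun i => by
      have := (Int.lt_floor_add_one (x i / a i.castSucc)).le
      rw [div_le_iff₀ (haR _)] at this
      linarith
    set A := ∑ i : Fin n, a i.castSucc * u i with hA
    set m := (F : ℤ) + 1 + (A - F - 1) % q with hm
    have hm1 : (F : ℤ) < m := by have := Int.emod_nonneg (A - F - 1) (by linarith : q ≠ 0); linarith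
    have hm2 : m ≤ F + q := by have := Int.emod_lt_of_pos (A - F - 1) (by linarith : 0 < q); linarith
    have hm3 : q ∣ A - m := by
      refine ⟨(A - F - 1) / q, ?_⟩
      have := Int.emod_add_mul_ediv (A - F - 1) q
      linarith
    obtain ⟨k, hk⟩ := exists_rep_of_frobNum_lt hg ha hm1
    refine ⟨fun i => a i.castSucc * (u i - k i.castSucc : ℤ), ⟨fun i => u i - k i.castSucc, ?_, fun i => rfl⟩, fun i => ?_, ?_⟩
    · rw [Fin.sum_univ_castSucc] at hk
      have : ∑ i : Fin n, a i.castSucc * (u i - k i.castSucc) = (A - m) + k (Fin.last n) * q := by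
        rw [hk, hA]
        simp only [mul_sub, Finset.sum_sub_distrib, mul_comm (k _ : ℤ)]
        rw [← hq]; ring
      rw [this]
      exact dvd_add hm3 (dvd_mul_left _ _)
    · refine le_trans ?_ (hu1 i)
      push_cast
      have := haR i.castSucc
      have h2 : (0 : ℝ) ≤ k i.castSucc := by positivity
      nlinarith
    · have hk' : ∑ i : Fin n, (k i.castSucc : ℝ) * a i.castSucc ≤ F + q := by
        rw [Fin.sum_univ_castSucc] at hk
        have h3 : ∑ i : Fin n, (k i.castSucc : ℤ) * a i.castSucc ≤ F + q := by
          have : (0 : ℤ) ≤ k (Fin.last n) * a (Fin.last n) :=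
            mul_nonneg (by positivity) (by linarith)
          linarith
        exact_mod_cast h3
      have : ∑ i : Fin n, (x i - a i.castSucc * ((u i - k i.castSucc : ℤ) : ℝ)) ≤
          ∑ i : Fin n, (a i.castSucc : ℝ) + ∑ i : Fin n, (k i.castSucc : ℝ) * a i.castSucc := by
        rw [← Finset.sum_add_distrib]
        refine Finset.sum_le_sum fun i _ => ?_
        have := hu2 i
        push_cast
        linarith
      linarith

instance SLR.isTopologicalGroup (n : ℕ) : IsTopologicalGroup (SLR n) :=
  Matrix.SpecialLinearGroup.topologicalGroup (n := Fin n) (R := ℝ)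

lemma SLR.isInducing_coe (n : ℕ) :
    Topology.IsInducing (fun g : SLR n => (g : Matrix (Fin n) (Fin n) ℝ)) := ⟨rfl⟩

lemma SLR.continuous_coe (n : ℕ) :
    Continuous (fun g : SLR n => (g : Matrix (Fin n) (Fin n) ℝ)) :=
  (SLR.isInducing_coe n).continuous

instance SLR.secondCountableTopology (n : ℕ) : SecondCountableTopology (SLR n) :=
  have : SecondCountableTopology (Matrix (Fin n) (Fin n) ℝ) :=
    inferInstanceAs (SecondCountableTopology (Fin n → Fin n → ℝ))
  (SLR.isInducing_coe n).secondCountableTopology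

instance SLR.measurableSpace (n : ℕ) : MeasurableSpace (SLR n) := borel _

instance SLR.borelSpace (n : ℕ) : BorelSpace (SLR n) := ⟨rfl⟩

instance XQuot.borelSpace (n : ℕ) : BorelSpace (XQuot n) := ⟨rfl⟩

lemma exists_isOpen_one_mem_injOn_mk (n : ℕ) : ∃ U : Set (SLR n), IsOpen U ∧ 1 ∈ U ∧
    Set.InjOn (QuotientGroup.mk : SLR n → XQuot n) U := by
  have hcont : Continuous (fun p : SLR n × SLR n => ((p.1⁻¹ * p.2 : SLR n) :
      Matrix (Fin n) (Fin n) ℝ)) :=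
    (SLR.continuous_coe n).comp (by fun_prop)
  have hV : IsOpen {p : SLR n × SLR n | ∀ i j, |((p.1⁻¹ * p.2 : SLR n) :
      Matrix (Fin n) (Fin n) ℝ) i j - (1 : Matrix (Fin n) (Fin n) ℝ) i j| < 1} := by
    simp only [Set.ofPred_forall]
    refine isOpen_iInter_of_finite fun i => isOpen_iInter_of_finite fun j => ?_
    refine isOpen_lt ?_ continuous_const
    exact ((hcont.matrix_elem i j).sub continuous_const).abs
  have h1 : ((1 : SLR n), (1 : SLR n)) ∈ {p : SLR n × SLR n | ∀ i j, |((p.1⁻¹ * p.2 : SLR n) :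
      Matrix (Fin n) (Fin n) ℝ) i j - (1 : Matrix (Fin n) (Fin n) ℝ) i j| < 1} := by
    intro i j; simp
  obtain ⟨u, v, hu, hv, h1u, h1v, huv⟩ := isOpen_prod_iff.1 hV 1 1 h1
  refine ⟨u ∩ v, hu.inter hv, ⟨h1u, h1v⟩, ?_⟩
  intro g hg h hh hgh
  have hmem : g⁻¹ * h ∈ SLZsub n := QuotientGroup.eq.1 hgh
  obtain ⟨m, hm⟩ := hmem
  have hlt := huv (Set.mk_mem_prod hg.1 hh.2)
  have hm1 : m = 1 := by
    ext i j
    have := hlt i j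
    simp only at this
    rw [← hm] at this
    simp only [Matrix.SpecialLinearGroup.map_apply_coe, RingHom.mapMatrix_apply,
      Matrix.map_apply, Matrix.one_apply] at this
    have h2 : |(m : Matrix (Fin n) (Fin n) ℤ) i j - (if i = j then 1 else 0 : ℤ)| < 1 := by
      have h3 : ((|(m : Matrix (Fin n) (Fin n) ℤ) i j - (if i = j then 1 else 0 : ℤ)| : ℤ) : ℝ)
          < 1 := by
        push_cast
        simpa using this
      exact_mod_cast h3
    rw [Int.abs_lt_one_iff, sub_eq_zero] at h2
    simpa [Matrix.one_apply] using h2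
  rw [hm1, map_one] at hm
  exact (inv_mul_eq_one.1 hm.symm)

lemma measurableSet_image_mk_of_subset {n : ℕ} {U A : Set (SLR n)} (hU : IsOpen U)
    (hinj : Set.InjOn (QuotientGroup.mk : SLR n → XQuot n) U) (hA : MeasurableSet A)
    (hAU : A ⊆ U) : MeasurableSet ((QuotientGroup.mk : SLR n → XQuot n) '' A) := by
  have hemb : Topology.IsOpenEmbedding (fun x : U => (QuotientGroup.mk (x : SLR n) : XQuot n)) := by
    refine Topology.IsOpenEmbedding.of_continuous_injective_isOpenMap ?_ ?_ ?_
    · exact QuotientGroup.continuous_mk.comp continuous_subtype_val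
    · exact Set.injOn_iff_injective.1 hinj
    · exact QuotientGroup.isOpenMap_coe.comp hU.isOpenMap_subtype_val
  have hm := hemb.measurableEmbedding.measurableSet_image' (s := ((↑) : U → SLR n) ⁻¹' A)
    (measurable_subtype_coe hA)
  convert hm using 1
  ext x
  constructor
  · rintro ⟨a, ha, rfl⟩
    exact ⟨⟨a, hAU ha⟩, ha, rfl⟩
  · rintro ⟨a, ha, rfl⟩
    exact ⟨a, ha, rfl⟩

lemma exists_measurable_partition_injOn_mk (n : ℕ) : ∃ P : ℕ → Set (SLR n),
    (∀ i, MeasurableSet (P i)) ∧ Pairwise (Function.onFun Disjoint P) ∧ (⋃ i, P i) = Set.univ ∧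
    (∀ i, Set.InjOn (QuotientGroup.mk : SLR n → XQuot n) (P i)) ∧
    (∀ i, ∀ A ⊆ P i, MeasurableSet A →
      MeasurableSet ((QuotientGroup.mk : SLR n → XQuot n) '' A)) := by
  obtain ⟨U, hU, h1, hinj⟩ := exists_isOpen_one_mem_injOn_mk n
  have hg : ∀ g : SLR n, IsOpen (g • U) := fun g => hU.smul g
  have hinjg : ∀ g : SLR n, Set.InjOn (QuotientGroup.mk : SLR n → XQuot n) (g • U) := by
    rintro g _ ⟨a, ha, rfl⟩ _ ⟨b, hb, rfl⟩ hab
    have : (QuotientGroup.mk a : XQuot n) = QuotientGroup.mk b := by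
      rw [QuotientGroup.eq] at hab ⊢
      simpa [mul_assoc] using hab
    simp [hinj ha hb this]
  obtain ⟨T, hT, hcov⟩ := TopologicalSpace.isOpen_iUnion_countable (fun g : SLR n => g • U) hg
  have huniv : (⋃ g : SLR n, g • U) = Set.univ := by
    refine Set.eq_univ_of_forall fun g => Set.mem_iUnion.2 ⟨g, 1, h1, by simp⟩
  rw [huniv] at hcov
  have hTne : T.Nonempty := by
    by_contra h
    rw [Set.not_nonempty_iff_eq_empty] at h
    subst h
    simp at hcov
    exact (Set.univ_nonempty (α := SLR n)).ne_empty hcov.symm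
  obtain ⟨f, hf⟩ := hT.exists_eq_range hTne
  let Q : ℕ → Set (SLR n) := fun i => f i • U
  have hQ : ∀ i, MeasurableSet (Q i) := fun i => (hg _).measurableSet
  refine ⟨disjointed Q, fun i => MeasurableSet.disjointed hQ i, disjoint_disjointed Q, ?_, ?_, ?_⟩
  · rw [iUnion_disjointed, ← hcov, hf, Set.biUnion_range]
  · exact fun i => (hinjg _).mono (disjointed_subset Q i)
  · intro i A hA hAm
    exact measurableSet_image_mk_of_subset (hg (f i)) (hinjg _) hAm
      (hA.trans (disjointed_subset Q i))

/-- The determinant of a square array of real numbers. -/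
def arrDet {n : ℕ} (M : Fin n → Fin n → ℝ) : ℝ := (Matrix.of M).det

/-- The `n`-th root of the determinant. -/
def arrRoot {n : ℕ} (M : Fin n → Fin n → ℝ) : ℝ := arrDet M ^ (1 / (n : ℝ))

/-- Transpose and rescale to determinant one (junk value `1` when this is impossible). -/
def arrNormalize {n : ℕ} (M : Fin n → Fin n → ℝ) : SLR n :=
  if h : ((arrRoot M)⁻¹ • (Matrix.of M)ᵀ).det = 1 then ⟨_, h⟩ else 1

lemma continuous_arrDet {n : ℕ} : Continuous (arrDet : (Fin n → Fin n → ℝ) → ℝ) := by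
  unfold arrDet
  exact Continuous.matrix_det (continuous_id)

lemma measurable_arrDet {n : ℕ} : Measurable (arrDet : (Fin n → Fin n → ℝ) → ℝ) :=
  continuous_arrDet.measurable

lemma measurable_arrRoot {n : ℕ} : Measurable (arrRoot : (Fin n → Fin n → ℝ) → ℝ) :=
  measurable_arrDet.pow_const _

lemma arrRoot_pos {n : ℕ} {M : Fin n → Fin n → ℝ} (h : 0 < arrDet M) : 0 < arrRoot M :=
  Real.rpow_pos_of_pos h _

lemma arrRoot_pow {n : ℕ} (hn : n ≠ 0) {M : Fin n → Fin n → ℝ} (h : 0 < arrDet M) :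
    arrRoot M ^ n = arrDet M := by
  unfold arrRoot
  rw [← Real.rpow_natCast, ← Real.rpow_mul h.le]
  field_simp
  simp

lemma coe_arrNormalize {n : ℕ} (hn : n ≠ 0) {M : Fin n → Fin n → ℝ} (h : 0 < arrDet M) :
    ((arrNormalize M : SLR n) : Matrix (Fin n) (Fin n) ℝ) =
      (arrRoot M)⁻¹ • (Matrix.of M)ᵀ := by
  have hdet : ((arrRoot M)⁻¹ • (Matrix.of M)ᵀ).det = 1 := by
    rw [Matrix.det_smul, Matrix.det_transpose, Fintype.card_fin, inv_pow, arrRoot_pow hn h]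
    exact inv_mul_cancel₀ h.ne'
  have h2 : arrNormalize M = ⟨_, hdet⟩ := dif_pos hdet
  rw [h2]

lemma SLR.measurable_iff {n : ℕ} {α : Type*} [MeasurableSpace α] {f : α → SLR n} :
    Measurable f ↔ ∀ i j, Measurable fun a => (f a : Matrix (Fin n) (Fin n) ℝ) i j := by
  constructor
  · intro hf i j
    exact (((SLR.continuous_coe n).matrix_elem i j).measurable).comp hf
  · intro hf
    have h1 : SLR.measurableSpace n = MeasurableSpace.comap
        (fun g : SLR n => ((g : Matrix (Fin n) (Fin n) ℝ) : Fin n → Fin n → ℝ))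
        (inferInstance : MeasurableSpace (Fin n → Fin n → ℝ)) := by
      have : (inferInstance : MeasurableSpace (Fin n → Fin n → ℝ)) = borel _ :=
        BorelSpace.measurable_eq
      rw [this]
      exact borel_comap
    rw [h1]
    refine measurable_comap_iff.2 ?_
    exact measurable_pi_iff.2 fun i => measurable_pi_iff.2 fun j => hf i j

lemma measurable_arrNormalize {n : ℕ} :
    Measurable (arrNormalize : (Fin n → Fin n → ℝ) → SLR n) := by
  refine SLR.measurable_iff.2 fun i j => ?_
  have : (fun M : Fin n → Fin n → ℝ => (arrNormalize M : Matrix (Fin n) (Fin n) ℝ) i j) =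
      fun M => if ((arrRoot M)⁻¹) ^ n * arrDet M = 1 then (arrRoot M)⁻¹ * M j i
        else (1 : Matrix (Fin n) (Fin n) ℝ) i j := by
    ext M
    have hdet : ((arrRoot M)⁻¹ • (Matrix.of M)ᵀ).det = ((arrRoot M)⁻¹) ^ n * arrDet M := by
      rw [Matrix.det_smul, Matrix.det_transpose, Fintype.card_fin]; rfl
    by_cases h : ((arrRoot M)⁻¹ • (Matrix.of M)ᵀ).det = 1
    · have h2 : arrNormalize M = ⟨_, h⟩ := dif_pos h
      rw [h2, if_pos (hdet ▸ h)]
      simp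
    · have h2 : arrNormalize M = 1 := dif_neg h
      rw [h2, if_neg (hdet ▸ h)]
      simp
  rw [this]
  refine Measurable.ite ?_ ?_ measurable_const
  · exact measurableSet_eq_fun ((measurable_arrRoot.inv.pow_const n).mul measurable_arrDet)
      measurable_const
  · exact measurable_arrRoot.inv.mul ((measurable_pi_apply i).comp (measurable_pi_apply j))

lemma map_mul_right_volume {n : ℕ} (K : Matrix (Fin n) (Fin n) ℝ) (hK : K.det ≠ 0) :
    Measure.map (fun M : Fin n → Fin n → ℝ => fun i => M i ᵥ* K) volume =
      ENNReal.ofReal (|K.det|⁻¹ ^ n) • volume := by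
  set c : ENNReal := ENNReal.ofReal (|K.det|⁻¹) with hc
  have hrow : MeasurePreserving (fun v : Fin n → ℝ => v ᵥ* K) volume (c • volume) := by
    refine ⟨by fun_prop, ?_⟩
    have := Real.map_matrix_volume_pi_eq_smul_volume_pi (M := Kᵀ) (by simpa using hK)
    rw [Matrix.det_transpose, abs_inv] at this
    rw [← this]
    congr 1
    ext v i
    simp [Matrix.mulVec_transpose]
  have : SigmaFinite (c • volume : Measure (Fin n → ℝ)) :=
    SMul.sigmaFinite (|K.det|⁻¹).toNNReal
  have := (measurePreserving_pi (fun _ : Fin n => (volume : Measure (Fin n → ℝ)))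
    (fun _ : Fin n => (c • volume : Measure (Fin n → ℝ))) (fun _ => hrow)).map_eq
  rw [volume_pi, this]
  refine (Measure.pi_eq fun s hs => ?_)
  rw [Measure.smul_apply, Measure.pi_pi]
  simp only [Measure.smul_apply, smul_eq_mul]
  rw [Finset.prod_mul_distrib, Finset.prod_const, Finset.card_univ, Fintype.card_fin, hc,
    ENNReal.ofReal_pow (by positivity)]

lemma arrDet_mul_right {n : ℕ} (M : Fin n → Fin n → ℝ) (K : Matrix (Fin n) (Fin n) ℝ) :
    arrDet (fun i => M i ᵥ* K) = arrDet M * K.det := by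
  unfold arrDet
  rw [← Matrix.det_mul]
  congr 1

lemma arrNormalize_mul_right {n : ℕ} (hn : n ≠ 0) (g : SLR n) {M : Fin n → Fin n → ℝ}
    (h : 0 < arrDet M) :
    arrNormalize (fun i => M i ᵥ* (g : Matrix (Fin n) (Fin n) ℝ)ᵀ) = g * arrNormalize M := by
  have hd : arrDet (fun i => M i ᵥ* (g : Matrix (Fin n) (Fin n) ℝ)ᵀ) = arrDet M := by
    rw [arrDet_mul_right, Matrix.det_transpose, g.2, mul_one]
  have hr : arrRoot (fun i => M i ᵥ* (g : Matrix (Fin n) (Fin n) ℝ)ᵀ) = arrRoot M := by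
    unfold arrRoot; rw [hd]
  refine Subtype.ext ?_
  rw [coe_arrNormalize hn (hd ▸ h), Matrix.SpecialLinearGroup.coe_mul, coe_arrNormalize hn h, hr,
    Matrix.mul_smul]
  congr 1
  rw [← Matrix.transpose_transpose (g : Matrix (Fin n) (Fin n) ℝ), ← Matrix.transpose_mul,
    Matrix.transpose_transpose]
  rfl

/-- The cone measure on `SL_n(ℝ)`. -/
def coneMeasure (n : ℕ) : Measure (SLR n) :=
  Measure.map arrNormalize (volume.restrict {M : Fin n → Fin n → ℝ | 0 < arrDet M ∧ arrDet M ≤ 1})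

lemma measurableSet_arrDet_Ioc (n : ℕ) :
    MeasurableSet {M : Fin n → Fin n → ℝ | 0 < arrDet M ∧ arrDet M ≤ 1} :=
  measurable_arrDet measurableSet_Ioc

lemma coneMeasure_apply {n : ℕ} {A : Set (SLR n)} (hA : MeasurableSet A) :
    coneMeasure n A = volume {M : Fin n → Fin n → ℝ |
      0 < arrDet M ∧ arrDet M ≤ 1 ∧ arrNormalize M ∈ A} := by
  unfold coneMeasure
  rw [Measure.map_apply measurable_arrNormalize hA,
    Measure.restrict_apply (measurable_arrNormalize hA)]
  congr 1
  ext M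
  simp only [Set.mem_inter_iff, Set.mem_preimage, Set.mem_ofPred_eq]
  tauto

lemma coneMeasure_isMulLeftInvariant {n : ℕ} (hn : n ≠ 0) :
    (coneMeasure n).IsMulLeftInvariant := by
  refine ⟨fun g => ?_⟩
  ext A hA
  rw [Measure.map_apply (measurable_const_mul g) hA,
    coneMeasure_apply (measurable_const_mul g hA), coneMeasure_apply hA]
  have hp : MeasurePreserving (fun M : Fin n → Fin n → ℝ => fun i =>
      M i ᵥ* (g : Matrix (Fin n) (Fin n) ℝ)ᵀ) volume volume := by
    refine ⟨by fun_prop, ?_⟩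
    rw [map_mul_right_volume _ (by simp)]
    simp
  have hS : MeasurableSet {M : Fin n → Fin n → ℝ |
      0 < arrDet M ∧ arrDet M ≤ 1 ∧ arrNormalize M ∈ A} := by
    have := (measurableSet_arrDet_Ioc n).inter (measurable_arrNormalize hA)
    convert this using 1
    ext M
    simp only [Set.mem_inter_iff, Set.mem_preimage, Set.mem_ofPred_eq]
    tauto
  rw [← hp.measure_preimage hS.nullMeasurableSet]
  congr 1
  ext M
  simp only [Set.mem_preimage, Set.mem_ofPred_eq]
  have hd : arrDet (fun i => M i ᵥ* (g : Matrix (Fin n) (Fin n) ℝ)ᵀ) = arrDet M := by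
    rw [arrDet_mul_right, Matrix.det_transpose, g.2, mul_one]
  rw [hd]
  constructor
  · rintro ⟨h1, h2, h3⟩
    exact ⟨h1, h2, by rw [arrNormalize_mul_right hn g h1]; exact h3⟩
  · rintro ⟨h1, h2, h3⟩
    exact ⟨h1, h2, by rw [arrNormalize_mul_right hn g h1] at h3; exact h3⟩

lemma coneMeasure_lt_top {n : ℕ} (hn : n ≠ 0) (ρ : ℝ) :
    coneMeasure n {g : SLR n | ∀ i j, |(g : Matrix (Fin n) (Fin n) ℝ) i j| < ρ} < ⊤ := by
  have hm : MeasurableSet {g : SLR n | ∀ i j, |(g : Matrix (Fin n) (Fin n) ℝ) i j| < ρ} := by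
    simp only [Set.ofPred_forall]
    refine MeasurableSet.iInter fun i => MeasurableSet.iInter fun j => ?_
    exact measurableSet_lt (((SLR.continuous_coe n).matrix_elem i j).abs).measurable
      measurable_const
  rw [coneMeasure_apply hm]
  refine lt_of_le_of_lt (measure_mono (t := Set.univ.pi fun _ => Set.univ.pi fun _ =>
    Set.Icc (-ρ) ρ) ?_) ?_
  · rintro M ⟨h0, h1, h⟩ i - j -
    have h2 := h j i
    rw [coe_arrNormalize hn h0] at h2
    have ht := arrRoot_pos h0
    have ht1 : arrRoot M ≤ 1 := Real.rpow_le_one h0.le h1 (by positivity)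
    simp only [Matrix.smul_apply, Matrix.transpose_apply, Matrix.of_apply, smul_eq_mul, abs_mul,
      abs_inv, abs_of_pos ht] at h2
    rw [inv_mul_lt_iff₀ ht] at h2
    have hρ : 0 ≤ ρ := by
      by_contra hneg
      push Not at hneg
      nlinarith [abs_nonneg (M i j)]
    have h3 : |M i j| ≤ ρ := by nlinarith
    exact abs_le.1 h3
  · rw [volume_pi_pi]
    refine ENNReal.prod_lt_top fun i _ => ?_
    rw [volume_pi_pi]
    exact ENNReal.prod_lt_top fun i _ => by rw [Real.volume_Icc]; exact ENNReal.ofReal_lt_top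

instance coneMeasure_sigmaFinite (n : ℕ) [NeZero n] : SigmaFinite (coneMeasure n) := by
  refine ⟨⟨⟨fun k : ℕ => {g : SLR n | ∀ i j, |(g : Matrix (Fin n) (Fin n) ℝ) i j| < k},
    fun _ => trivial, fun k => coneMeasure_lt_top (NeZero.ne n) k, ?_⟩⟩⟩
  refine Set.eq_univ_of_forall fun g => Set.mem_iUnion.2 ?_
  obtain ⟨k, hk⟩ := exists_nat_gt (∑ i, ∑ j, |(g : Matrix (Fin n) (Fin n) ℝ) i j|)
  refine ⟨k, fun i j => lt_of_le_of_lt ?_ hk⟩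
  calc |(g : Matrix (Fin n) (Fin n) ℝ) i j|
      ≤ ∑ j, |(g : Matrix (Fin n) (Fin n) ℝ) i j| :=
        Finset.single_le_sum (f := fun j => |(g : Matrix (Fin n) (Fin n) ℝ) i j|)
          (fun _ _ => abs_nonneg _) (Finset.mem_univ j)
    _ ≤ _ := Finset.single_le_sum (f := fun i => ∑ j, |(g : Matrix (Fin n) (Fin n) ℝ) i j|)
          (fun _ _ => Finset.sum_nonneg fun _ _ => abs_nonneg _) (Finset.mem_univ i)

lemma coneMeasure_pos {n : ℕ} (hn : n ≠ 0) :
    0 < coneMeasure n {g : SLR n | ∀ i j, |(g : Matrix (Fin n) (Fin n) ℝ) i j| < 2} := by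
  have hm : MeasurableSet {g : SLR n | ∀ i j, |(g : Matrix (Fin n) (Fin n) ℝ) i j| < 2} := by
    simp only [Set.ofPred_forall]
    refine MeasurableSet.iInter fun i => MeasurableSet.iInter fun j => ?_
    exact measurableSet_lt (((SLR.continuous_coe n).matrix_elem i j).abs).measurable
      measurable_const
  rw [coneMeasure_apply hm]
  have hroot : Continuous (arrRoot : (Fin n → Fin n → ℝ) → ℝ) :=
    continuous_arrDet.rpow_const fun _ => Or.inr (by positivity)
  have hopen : IsOpen {M : Fin n → Fin n → ℝ | 0 < arrDet M ∧ arrDet M < 1 ∧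
      ∀ i j, |M i j| < 2 * arrRoot M} := by
    refine (isOpen_lt continuous_const continuous_arrDet).inter
      ((isOpen_lt continuous_arrDet continuous_const).inter ?_)
    change IsOpen {M : Fin n → Fin n → ℝ | ∀ i j, |M i j| < 2 * arrRoot M}
    simp only [Set.ofPred_forall]
    refine isOpen_iInter_of_finite fun i => isOpen_iInter_of_finite fun j => ?_
    exact isOpen_lt (by fun_prop) (by fun_prop)
  refine lt_of_lt_of_le (hopen.measure_pos volume ?_) (measure_mono ?_)
  · refine ⟨fun i j => if i = j then 1 / 2 else 0, ?_⟩
    have hd : arrDet (fun i j : Fin n => if i = j then (1 / 2 : ℝ) else 0) = (1 / 2) ^ n := by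
      have : (Matrix.of fun i j : Fin n => if i = j then (1 / 2 : ℝ) else 0) =
          Matrix.diagonal (fun _ => 1 / 2) := by
        ext i j; simp [Matrix.diagonal_apply]
      unfold arrDet
      rw [this, Matrix.det_diagonal]
      simp
    have hr : arrRoot (fun i j : Fin n => if i = j then (1 / 2 : ℝ) else 0) = 1 / 2 := by
      unfold arrRoot
      rw [hd, ← Real.rpow_natCast, ← Real.rpow_mul (by norm_num)]
      field_simp
      simp
    refine ⟨by rw [hd]; positivity, by rw [hd]; exact pow_lt_one₀ (by norm_num) (by norm_num) hn, ?_⟩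
    intro i j
    rw [hr]
    dsimp only
    split_ifs <;> norm_num
  · rintro M ⟨h0, h1, h⟩
    refine ⟨h0, h1.le, fun i j => ?_⟩
    have ht := arrRoot_pos h0
    rw [coe_arrNormalize hn h0]
    simp only [Matrix.smul_apply, Matrix.transpose_apply, Matrix.of_apply, smul_eq_mul, abs_mul,
      abs_inv, abs_of_pos ht]
    rw [inv_mul_lt_iff₀ ht]
    linarith [h j i]

lemma exists_lift_measure {n : ℕ} (μ₀ : Measure (XQuot n)) [IsProbabilityMeasure μ₀]
    (hinv : ∀ g : SLR n, Measure.map (fun x => g • x) μ₀ = μ₀) :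
    ∃ μB : Measure (SLR n), SigmaFinite μB ∧ μB.IsMulLeftInvariant ∧
      (∃ s, μB s ≠ 0 ∧ μB s ≠ ⊤) ∧
      ∀ A : Set (SLR n), MeasurableSet A → ∀ k : ℕ, k ≠ 0 →
        (∀ g ∈ A, {h ∈ A | (QuotientGroup.mk h : XQuot n) = QuotientGroup.mk g}.encard = k) →
        MeasurableSet ((QuotientGroup.mk : SLR n → XQuot n) '' A) ∧
        μB A = k * μ₀ ((QuotientGroup.mk : SLR n → XQuot n) '' A) := by
  obtain ⟨P, hPm, hPd, hPu, hPi, hPA⟩ := exists_measurable_partition_injOn_mk n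
  let π : SLR n → XQuot n := QuotientGroup.mk
  have hemb : ∀ i, MeasurableEmbedding (fun x : P i => π x) := by
    intro i
    refine ⟨Set.injOn_iff_injective.1 (hPi i),
      QuotientGroup.continuous_mk.measurable.comp measurable_subtype_coe, ?_⟩
    intro s hs
    have := hPA i ((↑) '' s) (by simp) ((hPm i).subtype_image hs)
    rwa [Set.image_image] at this
  let μB : Measure (SLR n) := Measure.sum fun i =>
    Measure.map (Subtype.val : P i → SLR n) (Measure.comap (fun x : P i => π x) μ₀)
  have happ : ∀ A, MeasurableSet A → μB A = ∑' i, μ₀ (π '' (A ∩ P i)) := by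
    intro A hA
    rw [Measure.sum_apply _ hA]
    congr 1
    ext i
    rw [Measure.map_apply measurable_subtype_coe hA, (hemb i).comap_apply]
    congr 1
    ext x
    constructor
    · rintro ⟨⟨a, ha⟩, ha', rfl⟩
      exact ⟨a, ⟨ha', ha⟩, rfl⟩
    · rintro ⟨a, ⟨ha', ha⟩, rfl⟩
      exact ⟨⟨a, ha⟩, ha', rfl⟩
  have himg : ∀ A, MeasurableSet A → ∀ i, MeasurableSet (π '' (A ∩ P i)) := fun A hA i =>
    hPA i _ Set.inter_subset_right (hA.inter (hPm i))
  have hsmul : ∀ (g : SLR n) (A : Set (SLR n)), MeasurableSet (π '' A) →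
      μ₀ (π '' ((fun h => g * h) '' A)) = μ₀ (π '' A) := by
    intro g A hA
    have hcont : Continuous (fun x : XQuot n => g⁻¹ • x) := continuous_const_smul g⁻¹
    conv_rhs => rw [← hinv g⁻¹]
    rw [Measure.map_apply hcont.measurable hA]
    congr 1
    ext x
    simp only [Set.mem_image, Set.mem_preimage]
    constructor
    · rintro ⟨_, ⟨a, ha, rfl⟩, rfl⟩
      refine ⟨a, ha, ?_⟩
      change (QuotientGroup.mk a : XQuot n) = g⁻¹ • (QuotientGroup.mk (g * a) : XQuot n)
      rw [MulAction.Quotient.smul_mk]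
      simp
    · rintro ⟨a, ha, hax⟩
      refine ⟨g * a, ⟨a, ha, rfl⟩, ?_⟩
      change (QuotientGroup.mk (g * a) : XQuot n) = x
      have h2 : (QuotientGroup.mk (g * a) : XQuot n) = g • (QuotientGroup.mk a : XQuot n) := by
        rw [MulAction.Quotient.smul_mk]; rfl
      rw [h2]
      change (QuotientGroup.mk a : XQuot n) = g⁻¹ • x at hax
      rw [hax, smul_inv_smul]
  have hle : ∀ i, μB (P i) ≤ 1 := by
    intro i
    rw [happ _ (hPm i), tsum_eq_single i]
    · exact prob_le_one
    · intro j hj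
      rw [(hPd hj.symm).inter_eq]
      simp
  have hle' : ∀ i, μB (P i) ≠ ⊤ := fun i => ((hle i).trans_lt ENNReal.one_lt_top).ne
  refine ⟨μB, ?_, ?_, ?_, ?_⟩
  · exact ⟨⟨⟨P, fun _ => trivial, fun i => (hle' i).lt_top, hPu⟩⟩⟩
  · refine ⟨fun g => ?_⟩
    ext A hA
    have hmul : Measurable (fun h : SLR n => g * h) := measurable_const_mul g
    have hmul' : Measurable (fun h : SLR n => g⁻¹ * h) := measurable_const_mul g⁻¹
    rw [Measure.map_apply hmul hA, happ _ (hmul hA), happ _ hA]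
    have key1 : ∀ j, μ₀ (π '' ((fun h => g * h) ⁻¹' A ∩ P j)) =
        ∑' i, μ₀ (π '' (((fun h => g * h) ⁻¹' (A ∩ P i)) ∩ P j)) := by
      intro j
      rw [← measure_iUnion]
      · rw [← Set.image_iUnion]
        congr 2
        ext h
        have : g * h ∈ ⋃ i, P i := by rw [hPu]; trivial
        simp only [Set.mem_iUnion] at this
        simp only [Set.mem_inter_iff, Set.mem_preimage, Set.mem_iUnion]
        tauto
      · intro i i' hii'
        refine Set.disjoint_left.2 ?_
        rintro _ ⟨a, ha, rfl⟩ ⟨b, hb, hab⟩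
        have := hPi j ha.2 hb.2 hab.symm
        subst this
        exact Set.disjoint_left.1 (hPd hii') ha.1.2 hb.1.2
      · exact fun i => himg _ (hmul (hA.inter (hPm i))) j
    have key2 : ∀ i, μ₀ (π '' (A ∩ P i)) =
        ∑' j, μ₀ (π '' (A ∩ P i ∩ (fun h => g⁻¹ * h) ⁻¹' P j)) := by
      intro i
      rw [← measure_iUnion]
      · rw [← Set.image_iUnion]
        congr 2
        ext h
        have : g⁻¹ * h ∈ ⋃ i, P i := by rw [hPu]; trivial
        simp only [Set.mem_iUnion] at this
        simp only [Set.mem_inter_iff, Set.mem_preimage, Set.mem_iUnion]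
        tauto
      · intro j j' hjj'
        refine Set.disjoint_left.2 ?_
        rintro _ ⟨a, ha, rfl⟩ ⟨b, hb, hab⟩
        have := hPi i ha.1.2 hb.1.2 hab.symm
        subst this
        exact Set.disjoint_left.1 (hPd hjj') ha.2 hb.2
      · intro j
        rw [Set.inter_right_comm]
        exact himg _ (hA.inter (hmul' (hPm j))) i
    simp_rw [key1, key2]
    rw [ENNReal.tsum_comm]
    congr 1; ext i
    congr 1; ext j
    rw [← hsmul g _ (himg _ (hmul (hA.inter (hPm i))) j)]
    congr 2
    ext h
    constructor
    · rintro ⟨a, ⟨ha, ha'⟩, rfl⟩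
      exact ⟨ha, by simpa using ha'⟩
    · rintro ⟨ha, ha'⟩
      exact ⟨g⁻¹ * h, ⟨by simpa using ha, ha'⟩, by simp⟩
  · have : μB Set.univ ≠ 0 := by
      rw [happ _ MeasurableSet.univ]
      intro h0
      have h1 : μ₀ (⋃ i, π '' (Set.univ ∩ P i)) ≤ 0 := (measure_iUnion_le _).trans h0.le
      rw [← Set.image_iUnion, ← Set.inter_iUnion, hPu, Set.inter_univ,
        Set.image_univ_of_surjective (QuotientGroup.mk_surjective), measure_univ] at h1
      simp at h1
    rw [← hPu] at this
    by_contra hcon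
    push Not at hcon
    refine this (measure_iUnion_null fun i => ?_)
    by_contra hi
    exact hle' i (hcon _ hi)
  · intro A hA k hk hfib
    have hAU : π '' A = ⋃ i, π '' (A ∩ P i) := by
      rw [← Set.image_iUnion, ← Set.inter_iUnion, hPu, Set.inter_univ]
    have hmA : MeasurableSet (π '' A) := by
      rw [hAU]; exact MeasurableSet.iUnion fun i => himg A hA i
    refine ⟨hmA, ?_⟩
    rw [happ A hA]
    have h1 : ∀ i, μ₀ (π '' (A ∩ P i)) = ∫⁻ x, (π '' (A ∩ P i)).indicator 1 x ∂μ₀ := fun i => by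
      rw [lintegral_indicator_one (himg A hA i)]
    simp_rw [h1]
    rw [← lintegral_tsum fun i => (measurable_one.indicator (himg A hA i)).aemeasurable]
    have h2 : ∀ x, ∑' i, (π '' (A ∩ P i)).indicator (1 : XQuot n → ENNReal) x =
        (π '' A).indicator (fun _ => (k : ENNReal)) x := by
      intro x
      by_cases hx : x ∈ π '' A
      · rw [Set.indicator_of_mem hx]
        obtain ⟨g, hg, rfl⟩ := hx
        have hf := hfib g hg
        have : ∀ i, (π '' (A ∩ P i)).indicator (1 : XQuot n → ENNReal) (π g) =
            ({i | π g ∈ π '' (A ∩ P i)} : Set ℕ).indicator 1 i := by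
          intro i
          rfl
        simp_rw [this]
        rw [← tsum_subtype]
        refine (ENNReal.tsum_set_one _).trans ?_
        suffices h : ({i | π g ∈ π '' (A ∩ P i)} : Set ℕ).encard = k by
          rw [h]; simp
        rw [← hf]
        symm
        have hex : ∀ h : SLR n, ∃ i, h ∈ P i := fun h => by
          have : h ∈ ⋃ i, P i := by rw [hPu]; trivial
          simpa using this
        choose idx hidx using hex
        have himage : ({i | π g ∈ π '' (A ∩ P i)} : Set ℕ) =
            idx '' {h ∈ A | (QuotientGroup.mk h : XQuot n) = QuotientGroup.mk g} := by
          ext i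
          constructor
          · rintro ⟨h, ⟨hA', hP'⟩, hh⟩
            refine ⟨h, ⟨hA', hh⟩, ?_⟩
            by_contra hne
            exact Set.disjoint_left.1 (hPd hne) (hidx h) hP'
          · rintro ⟨h, ⟨hA', hh⟩, rfl⟩
            exact ⟨h, ⟨hA', hidx h⟩, hh⟩
        rw [himage, Set.InjOn.encard_image]
        intro a ha b hb hab
        have hb' := hidx b
        rw [← hab] at hb'
        exact hPi (idx a) (hidx a) hb' (ha.2.trans hb.2.symm)
      · rw [Set.indicator_of_notMem hx]
        refine ENNReal.tsum_eq_zero.2 fun i => Set.indicator_of_notMem ?_ _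
        exact fun h => hx (Set.image_mono Set.inter_subset_left h)
    simp_rw [h2]
    rw [lintegral_indicator_const hmA]

/-- The cone measure on `SL_n(ℝ)` is a positive multiple of the lift of `μ₀`. -/
lemma exists_coneMeasure_eq {n : ℕ} (hn : n ≠ 0) (μ₀ : Measure (XQuot n)) [IsProbabilityMeasure μ₀]
    (hinv : ∀ g : SLR n, Measure.map (fun x => g • x) μ₀ = μ₀) :
    ∃ b : ℝ, 0 < b ∧
      ∀ A : Set (SLR n), MeasurableSet A → ∀ k : ℕ, k ≠ 0 →
        (∀ g ∈ A, {h ∈ A | (QuotientGroup.mk h : XQuot n) = QuotientGroup.mk g}.encard = k) →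
        MeasurableSet ((QuotientGroup.mk : SLR n → XQuot n) '' A) ∧
        coneMeasure n A =
          ENNReal.ofReal b * (k * μ₀ ((QuotientGroup.mk : SLR n → XQuot n) '' A)) := by
  have : NeZero n := ⟨hn⟩
  obtain ⟨μB, h1, h2, ⟨s, hs0, hs⟩, hA⟩ := exists_lift_measure μ₀ hinv
  have h3 := coneMeasure_isMulLeftInvariant hn
  have h4 := measure_eq_div_smul (coneMeasure n) μB hs0 hs
  set c := coneMeasure n s / μB s
  have h5 := coneMeasure_pos hn
  have h6 := coneMeasure_lt_top hn 2
  rw [h4, Measure.smul_apply, smul_eq_mul] at h5 h6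
  have hc0 : c ≠ 0 := by
    intro h; rw [h] at h5; simp at h5
  have hct : c ≠ ⊤ := by
    intro h
    rw [h] at h5 h6
    rw [ENNReal.top_mul (by rintro h'; rw [h'] at h5; simp at h5)] at h6
    exact lt_irrefl _ h6
  refine ⟨c.toReal, ENNReal.toReal_pos hc0 hct, ?_⟩
  intro A hAm k hk hfib
  refine ⟨(hA A hAm k hk hfib).1, ?_⟩
  rw [ENNReal.ofReal_toReal hct, ← (hA A hAm k hk hfib).2, h4, Measure.smul_apply, smul_eq_mul]

lemma exists_simplexCovers_matLattice {n : ℕ} (g : SLR n) :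
    ∃ t, 0 < t ∧ SimplexCovers (latticeOf g) t := by
  refine ⟨2 * ∑ i, ∑ j, |(g : Matrix (Fin n) (Fin n) ℝ) i j| + 1, by positivity, fun x => ?_⟩
  set G : Matrix (Fin n) (Fin n) ℝ := (g : Matrix (Fin n) (Fin n) ℝ) with hG
  set s : Fin n → ℝ := fun i => ∑ j, |G i j| with hs
  set y : Fin n → ℝ := G⁻¹.mulVec (x - s) with hy
  have hGy : G.mulVec y = x - s := by
    rw [hy, Matrix.mulVec_mulVec, Matrix.mul_nonsing_inv _ (by rw [hG, g.2]; exact isUnit_one),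
      Matrix.one_mulVec]
  have hbound : ∀ i, |(G.mulVec (fun j => ((⌊y j⌋ : ℤ) : ℝ))) i - (x - s) i| ≤ s i := by
    intro i
    rw [← hGy, ← Pi.sub_apply, ← Matrix.mulVec_sub]
    simp only [Matrix.mulVec, dotProduct, Pi.sub_apply]
    refine (Finset.abs_sum_le_sum_abs _ _).trans (Finset.sum_le_sum fun j _ => ?_)
    rw [abs_mul]
    refine mul_le_of_le_one_right (abs_nonneg _) ?_
    rw [abs_le]
    constructor <;> linarith [Int.floor_le (y j), Int.lt_floor_add_one (y j)]
  refine ⟨G.mulVec (fun j => ((⌊y j⌋ : ℤ) : ℝ)), ⟨fun j => ⌊y j⌋, rfl⟩, fun i => ?_, ?_⟩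
  · have := abs_le.1 (hbound i)
    simp only [Pi.sub_apply] at this
    linarith [this.2]
  · have : ∀ i ∈ Finset.univ, x i - G.mulVec (fun j => ((⌊y j⌋ : ℤ) : ℝ)) i ≤ 2 * s i := by
      intro i _
      have := abs_le.1 (hbound i)
      simp only [Pi.sub_apply] at this
      linarith [this.1]
    refine (Finset.sum_le_sum this).trans ?_
    rw [← Finset.mul_sum]
    linarith

lemma covRad_latticeOf_le_iff {n : ℕ} (g : SLR n) {R : ℝ} (hR : 0 < R) :
    covRad n (simplexStd n) (latticeOf g) ≤ R ↔ ∀ t, R < t → SimplexCovers (latticeOf g) t :=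
  covRad_le_iff (exists_simplexCovers_matLattice g) hR

lemma exists_det_near_one (n : ℕ) : ∃ ε : ℝ, 0 < ε ∧ ∀ E : Matrix (Fin n) (Fin n) ℝ,
    (∀ i j, |E i j| ≤ ε) → 1 / 2 < (1 + E).det ∧ (1 + E).det < 2 := by
  have hc : Continuous (fun E : Fin n → Fin n → ℝ => (1 + Matrix.of E : Matrix _ _ ℝ).det) :=
    Continuous.matrix_det (continuous_const.add continuous_id)
  obtain ⟨ε, hε, hball⟩ := Metric.eventually_nhds_iff_ball.1
    (Metric.continuous_iff'.1 hc 0 (1 / 2) (by norm_num))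
  refine ⟨ε / 2, by linarith, fun E hE => ?_⟩
  have hE' : (Matrix.of.symm E : Fin n → Fin n → ℝ) ∈ Metric.ball (0 : Fin n → Fin n → ℝ) ε := by
    rw [mem_ball_zero_iff]
    refine lt_of_le_of_lt ((pi_norm_le_iff_of_nonneg (by linarith)).2 fun i =>
      (pi_norm_le_iff_of_nonneg (by linarith)).2 fun j => hE i j) (by linarith : ε / 2 < ε)
  have := hball _ hE'
  have h : (Matrix.of (0 : Fin n → Fin n → ℝ)) = 0 := rfl
  simp only [h, add_zero, Matrix.det_one, Real.dist_eq, Equiv.apply_symm_apply] at this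
  rw [abs_lt] at this
  constructor <;> linarith

lemma exists_finite_representatives (n : ℕ) (m₀ : ℤ) : ∃ B : ℝ, 0 < B ∧
    ∀ H : Matrix (Fin n) (Fin n) ℤ, 1 ≤ H.det → H.det ≤ m₀ →
    ∃ γ H₀ : Matrix (Fin n) (Fin n) ℤ, γ.det = 1 ∧ H = γ * H₀ ∧ H₀.det = H.det ∧
      ∀ i j, |(H₀.adjugate i j : ℝ)| ≤ B := by
  let Φ : Matrix (Fin n) (Fin n) ℤ → ℤ × (Fin n → Fin n → ℤ) := fun H =>
    (H.det, fun i j => H i j % H.det)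
  let s : Set (Matrix (Fin n) (Fin n) ℤ) := {H | 1 ≤ H.det ∧ H.det ≤ m₀}
  have hfin : (Φ '' s).Finite := by
    refine ((Set.finite_Icc (1 : ℤ) m₀).prod (Set.Finite.pi' fun _ : Fin n => Set.Finite.pi'
      fun _ : Fin n => Set.finite_Icc (0 : ℤ) m₀)).subset ?_
    rintro _ ⟨H, ⟨h1, h2⟩, rfl⟩
    refine ⟨⟨h1, h2⟩, fun i j => ⟨Int.emod_nonneg _ (by omega), ?_⟩⟩
    exact ((Int.emod_lt_of_pos _ (by omega)).le).trans h2
  have hch : ∀ c ∈ Φ '' s, ∃ H ∈ s, Φ H = c := fun c hc => hc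
  choose! rep hrep1 hrep2 using hch
  obtain ⟨B, hB⟩ := (hfin.image fun c => ∑ i, ∑ j, |((rep c).adjugate i j : ℝ)|).bddAbove
  refine ⟨|B| + 1, by positivity, fun H h1 h2 => ?_⟩
  have hmem : Φ H ∈ Φ '' s := ⟨H, ⟨h1, h2⟩, rfl⟩
  set H₀ := rep (Φ H) with hH₀
  have hΦ : Φ H₀ = Φ H := hrep2 _ hmem
  have hdet : H₀.det = H.det := congrArg Prod.fst hΦ
  have hmod : ∀ i j, H.det ∣ H i j - H₀ i j := by
    intro i j
    have h3 : H₀ i j % H₀.det = H i j % H.det := congrFun (congrFun (congrArg Prod.snd hΦ) i) j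
    rw [hdet] at h3
    exact Int.ModEq.dvd h3
  choose X hX using hmod
  have hXm : H = H₀ + H.det • Matrix.of X := by
    ext i j
    simp only [Matrix.add_apply, Matrix.smul_apply, Matrix.of_apply, smul_eq_mul]
    linarith [hX i j]
  refine ⟨1 + Matrix.of X * H₀.adjugate, H₀, ?_, ?_, hdet, ?_⟩
  · have h3 : H = (1 + Matrix.of X * H₀.adjugate) * H₀ := by
      rw [Matrix.add_mul, Matrix.one_mul, Matrix.mul_assoc, Matrix.adjugate_mul, hdet,
        Matrix.mul_smul, Matrix.mul_one]
      exact hXm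
    have h4 := congrArg Matrix.det h3
    rw [Matrix.det_mul, hdet] at h4
    have h5 : H.det ≠ 0 := by omega
    exact mul_right_cancel₀ h5 (by rw [one_mul]; exact h4.symm)
  · rw [Matrix.add_mul, Matrix.one_mul, Matrix.mul_assoc, Matrix.adjugate_mul, hdet,
      Matrix.mul_smul, Matrix.mul_one]
    exact hXm
  · intro i j
    have h3 := hB (Set.mem_image_of_mem _ hmem)
    refine le_trans ?_ ((h3.trans (le_abs_self B)).trans (by linarith))
    calc |(H₀.adjugate i j : ℝ)| ≤ ∑ j, |(H₀.adjugate i j : ℝ)| :=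
          Finset.single_le_sum (f := fun j => |(H₀.adjugate i j : ℝ)|)
            (fun _ _ => abs_nonneg _) (Finset.mem_univ j)
      _ ≤ _ := Finset.single_le_sum (f := fun i => ∑ j, |(H₀.adjugate i j : ℝ)|)
            (fun _ _ => Finset.sum_nonneg fun _ _ => abs_nonneg _) (Finset.mem_univ i)

/-- A lattice with bounded covering radius has a bounded basis. -/
lemma exists_bounded_basis (n : ℕ) {R : ℝ} (hR : 0 < R) : ∃ ρ : ℝ, 0 < ρ ∧ ∀ g : SLR n,
    SimplexCovers (latticeOf g) R → ∃ γ : Matrix.SpecialLinearGroup (Fin n) ℤ, ∀ i j,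
      |((g : Matrix (Fin n) (Fin n) ℝ) *
        (γ : Matrix (Fin n) (Fin n) ℤ).map (Int.cast : ℤ → ℝ)) i j| < ρ := by
  obtain ⟨ε, hε, hdet⟩ := exists_det_near_one n
  set r : ℝ := R / ε with hr
  have hr0 : 0 < r := by positivity
  obtain ⟨B, hB, hrep⟩ := exists_finite_representatives n ⌈r ^ n * 2⌉
  refine ⟨n * ((r + R) * B) + 1, by positivity, fun g hg => ?_⟩
  choose l hl hle hsum using fun j : Fin n => hg (fun i => if i = j then r else 0)
  choose v hv using hl
  let H : Matrix (Fin n) (Fin n) ℤ := Matrix.of fun i j => v j i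
  have hGH : ∀ i j, ((g : Matrix (Fin n) (Fin n) ℝ) * H.map (Int.cast : ℤ → ℝ)) i j = l j i := by
    intro i j
    rw [hv j]
    rfl
  have hnear : ∀ i j, |l j i - if i = j then r else 0| ≤ R := by
    intro i j
    have h1 := hle j i
    have h2 : (if i = j then r else 0) - l j i ≤ R :=
      (Finset.single_le_sum (f := fun i => (if i = j then r else 0) - l j i)
        (fun i _ => sub_nonneg.2 (hle j i)) (Finset.mem_univ i)).trans (hsum j)
    rw [abs_le]
    constructor <;> linarith
  have hbd : ∀ i j, |l j i| ≤ r + R := by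
    intro i j
    have h1 := abs_le.1 (hnear i j)
    rw [abs_le]
    split_ifs at h1 <;> constructor <;> linarith [h1.1, h1.2]
  let E : Matrix (Fin n) (Fin n) ℝ := Matrix.of fun i j => r⁻¹ * (l j i - if i = j then r else 0)
  have hE := hdet E (fun i j => by
    simp only [E, Matrix.of_apply, abs_mul, abs_inv, abs_of_pos hr0]
    rw [inv_mul_le_iff₀ hr0, hr, div_mul_cancel₀ _ hε.ne']
    exact hnear i j)
  have hV : (g : Matrix (Fin n) (Fin n) ℝ) * H.map (Int.cast : ℤ → ℝ) = r • (1 + E) := by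
    ext i j
    rw [hGH]
    simp only [E, Matrix.smul_apply, Matrix.add_apply, Matrix.of_apply, Matrix.one_apply,
      smul_eq_mul]
    split_ifs <;> field_simp <;> ring
  have hcast : (H.map (Int.cast : ℤ → ℝ)).det = (H.det : ℝ) :=
    (RingHom.map_det (Int.castRingHom ℝ) H).symm
  have hdetH : (H.det : ℝ) = r ^ n * (1 + E).det := by
    have := congrArg Matrix.det hV
    rw [Matrix.det_mul, g.2, one_mul, Matrix.det_smul, Fintype.card_fin] at this
    rw [← hcast, this]
  have hpos : (0 : ℝ) < H.det := by
    rw [hdetH]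
    have : 0 < (1 + E).det := by linarith [hE.1]
    positivity
  have h1 : 1 ≤ H.det := by
    have : 0 < H.det := by exact_mod_cast hpos
    omega
  have h2 : H.det ≤ ⌈r ^ n * 2⌉ := by
    have h3 : (H.det : ℝ) ≤ ⌈r ^ n * 2⌉ := by
      refine le_trans ?_ (Int.le_ceil _)
      rw [hdetH]
      exact mul_le_mul_of_nonneg_left hE.2.le (by positivity)
    exact_mod_cast h3
  obtain ⟨γ, H₀, hγ, hH, hdet0, hadj⟩ := hrep H h1 h2
  refine ⟨⟨γ, hγ⟩, fun i j => ?_⟩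
  set Γ : Matrix (Fin n) (Fin n) ℝ := γ.map (Int.cast : ℤ → ℝ) with hΓ
  have hkey : (H.det : ℝ) • ((g : Matrix (Fin n) (Fin n) ℝ) * Γ) =
      ((g : Matrix (Fin n) (Fin n) ℝ) * H.map (Int.cast : ℤ → ℝ)) *
        H₀.adjugate.map (Int.cast : ℤ → ℝ) := by
    have h5 : H.map (Int.cast : ℤ → ℝ) * H₀.adjugate.map (Int.cast : ℤ → ℝ) =
        (H.det : ℝ) • Γ := by
      rw [hΓ, ← Matrix.map_mul_intCast, ← hdet0]
      conv_lhs => rw [hH]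
      rw [Matrix.mul_assoc, Matrix.mul_adjugate, Matrix.mul_smul, Matrix.mul_one]
      ext a b
      rw [Matrix.map_apply, Matrix.smul_apply, Matrix.smul_apply, Matrix.map_apply]
      push_cast [smul_eq_mul]
      rfl
    rw [Matrix.mul_assoc, h5, Matrix.mul_smul]
  have hent : (H.det : ℝ) * ((g : Matrix (Fin n) (Fin n) ℝ) * Γ) i j =
      ∑ k, l k i * (H₀.adjugate k j : ℝ) := by
    have := congrFun (congrFun hkey i) j
    rw [Matrix.smul_apply, smul_eq_mul] at this
    rw [this, Matrix.mul_apply]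
    exact Finset.sum_congr rfl fun k _ => by rw [hGH]; rfl
  have hone : (1 : ℝ) ≤ H.det := by exact_mod_cast h1
  calc |((g : Matrix (Fin n) (Fin n) ℝ) * Γ) i j|
      ≤ |(H.det : ℝ) * ((g : Matrix (Fin n) (Fin n) ℝ) * Γ) i j| := by
        rw [abs_mul, abs_of_pos hpos]
        exact le_mul_of_one_le_left (abs_nonneg _) hone
    _ ≤ ∑ k : Fin n, (r + R) * B := by
        rw [hent]
        refine (Finset.abs_sum_le_sum_abs _ _).trans (Finset.sum_le_sum fun k _ => ?_)
        rw [abs_mul]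
        exact mul_le_mul (hbd i k) (hadj k j) (abs_nonneg _) (by positivity)
    _ < _ := by simp

lemma exists_adjugate_bound (n : ℕ) (A : ℝ) : ∃ β : ℝ, 0 < β ∧ ∀ M : Matrix (Fin n) (Fin n) ℝ,
    (∀ i j, |M i j| ≤ A) → ∀ i j, |M.adjugate i j| ≤ β := by
  have hK : IsCompact (Set.univ.pi fun _ : Fin n => Set.univ.pi fun _ : Fin n => Set.Icc (-A) A) :=
    isCompact_univ_pi fun _ => isCompact_univ_pi fun _ => isCompact_Icc
  have hc : Continuous (fun M : Fin n → Fin n → ℝ => ∑ i, ∑ j, |(Matrix.of M).adjugate i j|) := by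
    have h1 : Continuous (fun M : Fin n → Fin n → ℝ => (Matrix.of M).adjugate) :=
      Continuous.matrix_adjugate continuous_id
    exact continuous_finsetSum _ fun i _ => continuous_finsetSum _ fun j _ =>
      (h1.matrix_elem i j).abs
  obtain ⟨C, hC⟩ := hK.exists_bound_of_continuousOn hc.continuousOn
  refine ⟨|C| + 1, by positivity, fun M hM i j => ?_⟩
  have h := hC M (fun i _ j _ => abs_le.1 (hM i j))
  rw [Real.norm_eq_abs] at h
  refine le_trans ?_ ((le_abs_self _).trans (h.trans ((le_abs_self C).trans (by linarith))))
  calc |M.adjugate i j| ≤ ∑ j, |M.adjugate i j| :=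
        Finset.single_le_sum (f := fun j => |M.adjugate i j|)
          (fun _ _ => abs_nonneg _) (Finset.mem_univ j)
    _ ≤ _ := Finset.single_le_sum (f := fun i => ∑ j, |M.adjugate i j|)
          (fun _ _ => Finset.sum_nonneg fun _ _ => abs_nonneg _) (Finset.mem_univ i)

lemma abs_mulVec_le {n : ℕ} {M : Matrix (Fin n) (Fin n) ℝ} {A B : ℝ}
    (hM : ∀ i j, |M i j| ≤ A) {v : Fin n → ℝ} (hv : ∀ i, |v i| ≤ B) (i : Fin n) :
    |(M *ᵥ v) i| ≤ n * (A * B) := by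
  have hA : 0 ≤ A := (abs_nonneg _).trans (hM i i)
  calc |(M *ᵥ v) i| ≤ ∑ j, |M i j * v j| := by
        simp only [mulVec, dotProduct]
        exact Finset.abs_sum_le_sum_abs _ _
    _ ≤ ∑ _j : Fin n, A * B := Finset.sum_le_sum fun j _ => by
        rw [abs_mul]; exact mul_le_mul (hM i j) (hv j) (abs_nonneg _) hA
    _ = n * (A * B) := by simp

lemma SLR.adjugate_mulVec {n : ℕ} (g : SLR n) (v : Fin n → ℝ) :
    (g : Matrix (Fin n) (Fin n) ℝ).adjugate *ᵥ ((g : Matrix (Fin n) (Fin n) ℝ) *ᵥ v) = v := by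
  rw [Matrix.mulVec_mulVec, Matrix.adjugate_mul, g.2, one_smul, Matrix.one_mulVec]

lemma SLR.mulVec_adjugate {n : ℕ} (g : SLR n) (v : Fin n → ℝ) :
    (g : Matrix (Fin n) (Fin n) ℝ) *ᵥ ((g : Matrix (Fin n) (Fin n) ℝ).adjugate *ᵥ v) = v := by
  rw [Matrix.mulVec_mulVec, Matrix.mul_adjugate, g.2, one_smul, Matrix.one_mulVec]

/-- The integer vectors with entries bounded by `Z`. -/
def intBox (n : ℕ) (Z : ℤ) : Finset (Fin n → ℤ) := Fintype.piFinset fun _ => Finset.Icc (-Z) Z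

lemma mem_intBox {n : ℕ} {Z : ℤ} {v : Fin n → ℤ} : v ∈ intBox n Z ↔ ∀ i, |v i| ≤ Z := by
  simp [intBox, Fintype.mem_piFinset, abs_le]

lemma mem_intBox_of_abs_mulVec_le {n : ℕ} {g : SLR n} {β X : ℝ}
    (hβ : ∀ i j, |(g : Matrix (Fin n) (Fin n) ℝ).adjugate i j| ≤ β) {u : Fin n → ℤ}
    (hu : ∀ i, |((g : Matrix (Fin n) (Fin n) ℝ) *ᵥ fun i => (u i : ℝ)) i| ≤ X) {Z : ℤ}
    (hZ : n * (β * X) ≤ Z) : u ∈ intBox n Z := by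
  refine mem_intBox.2 fun i => ?_
  have h := abs_mulVec_le hβ hu i
  rw [SLR.adjugate_mulVec] at h
  have h2 : ((|u i| : ℤ) : ℝ) ≤ Z := by push_cast; exact h.trans hZ
  exact_mod_cast h2

lemma abs_mulVec_floor_sub_le {n : ℕ} {g : SLR n} {ρ : ℝ}
    (hg : ∀ i j, |(g : Matrix (Fin n) (Fin n) ℝ) i j| ≤ ρ) (x : Fin n → ℝ) (i : Fin n) :
    |x i - ((g : Matrix (Fin n) (Fin n) ℝ) *ᵥ fun j =>
      ((⌊((g : Matrix (Fin n) (Fin n) ℝ).adjugate *ᵥ x) j⌋ : ℤ) : ℝ)) i| ≤ n * ρ := by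
  conv_lhs => rw [← SLR.mulVec_adjugate g x]
  rw [SLR.adjugate_mulVec, ← Pi.sub_apply, ← Matrix.mulVec_sub]
  refine (abs_mulVec_le hg (B := 1) (fun j => ?_) i).trans (by simp)
  rw [Pi.sub_apply, abs_le]
  constructor <;> linarith [Int.floor_le (((g : Matrix (Fin n) (Fin n) ℝ).adjugate *ᵥ x) j),
    Int.lt_floor_add_one (((g : Matrix (Fin n) (Fin n) ℝ).adjugate *ᵥ x) j)]

/-- Finitely many linear inequalities decide whether the covering radius is at most `R`, uniformly
over lattices given by a bounded basis. -/
lemma exists_covering_criterion (n : ℕ) {ρ R : ℝ} (hρ : 0 < ρ) (hR : 0 < R) :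
    ∃ F F' : Finset (Fin n → ℤ), ∀ g : SLR n,
      (∀ i j, |(g : Matrix (Fin n) (Fin n) ℝ) i j| < ρ) →
      ((¬ ∀ t, R < t → SimplexCovers (latticeOf g) t) ↔
        ∃ v : Fin n → (Fin n → ℤ), (∀ i, v i ∈ F) ∧ ∀ u ∈ F',
          (∀ i, ((g : Matrix (Fin n) (Fin n) ℝ) *ᵥ fun j => (u j : ℝ)) i <
            ((g : Matrix (Fin n) (Fin n) ℝ) *ᵥ fun j => (v i j : ℝ)) i) →
          R < ∑ i, (((g : Matrix (Fin n) (Fin n) ℝ) *ᵥ fun j => (v i j : ℝ)) i -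
            ((g : Matrix (Fin n) (Fin n) ℝ) *ᵥ fun j => (u j : ℝ)) i)) := by
  obtain ⟨β, hβ0, hβ⟩ := exists_adjugate_bound n ρ
  set Z₀ : ℤ := ⌈n * (β * (3 * (n * ρ) + R))⌉ with hZ₀
  set Z₁ : ℤ := ⌈n * (β * (n * (ρ * Z₀) + R + 2))⌉ with hZ₁
  refine ⟨intBox n Z₀, intBox n Z₁, fun g hg => ?_⟩
  have hgρ : ∀ i j, |(g : Matrix (Fin n) (Fin n) ℝ) i j| ≤ ρ := fun i j => (hg i j).le
  have hgβ := hβ _ hgρ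
  have hnρ : 0 ≤ (n : ℝ) * ρ := by positivity
  set E : (Fin n → ℤ) → Fin n → ℝ := fun u =>
    (g : Matrix (Fin n) (Fin n) ℝ) *ᵥ fun j => (u j : ℝ) with hE
  change _ ↔ ∃ v : Fin n → (Fin n → ℤ), (∀ i, v i ∈ _) ∧ ∀ u ∈ intBox n Z₁,
    (∀ i, E u i < E (v i) i) → R < ∑ i, (E (v i) i - E u i)
  constructor
  · intro hbad
    push Not at hbad
    obtain ⟨τ, hτ, hnc⟩ := hbad
    unfold SimplexCovers at hnc
    push Not at hnc
    obtain ⟨x₀, hx₀⟩ := hnc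
    set f : Fin n → ℤ := fun j => ⌊((g : Matrix (Fin n) (Fin n) ℝ).adjugate *ᵥ x₀) j⌋ with hf
    set x : Fin n → ℝ := x₀ - E f with hx
    have hxb : ∀ i, |x i| ≤ n * ρ := fun i => abs_mulVec_floor_sub_le hgρ x₀ i
    have hunc : ∀ u : Fin n → ℤ, (∀ i, E u i ≤ x i) → τ < ∑ i, (x i - E u i) := by
      intro u hu
      have hadd : E (u + f) = E u + E f := by
        rw [hE]
        simp only [Pi.add_apply, Int.cast_add]
        rw [← Matrix.mulVec_add]
        rfl
      have := hx₀ (E (u + f)) ⟨u + f, rfl⟩ (fun i => by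
        rw [hadd, Pi.add_apply]
        have := hu i
        rw [hx, Pi.sub_apply] at this
        linarith)
      refine this.trans_eq (Finset.sum_congr rfl fun i _ => ?_)
      rw [hadd, hx, Pi.add_apply, Pi.sub_apply]
      ring
    obtain ⟨w, hw⟩ : ∃ w : Fin n → ℤ, ∀ i, x i ≤ E w i ∧ E w i ≤ 3 * (n * ρ) := by
      refine ⟨fun j => ⌊((g : Matrix (Fin n) (Fin n) ℝ).adjugate *ᵥ (fun i => x i + n * ρ)) j⌋,
        fun i => ?_⟩
      have h1 := abs_le.1 (abs_mulVec_floor_sub_le hgρ (fun i => x i + n * ρ) i)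
      have h2 := abs_le.1 (hxb i)
      constructor
      · linarith [h1.2]
      · linarith [h1.1]
    have hwF : w ∈ intBox n Z₀ := by
      refine mem_intBox_of_abs_mulVec_le hgβ (X := 3 * (n * ρ) + R) (fun i => ?_) (Int.le_ceil _)
      have h2 := abs_le.1 (hxb i)
      have h3 := hw i
      rw [abs_le]
      constructor <;> linarith [h3.1, h3.2]
    have hmin : ∀ i, ∃ v ∈ (intBox n Z₀).filter (fun v => x i ≤ E v i),
        ∀ v' ∈ (intBox n Z₀).filter (fun v => x i ≤ E v i), E v i ≤ E v' i := fun i =>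
      Finset.exists_min_image _ (fun v => E v i) ⟨w, Finset.mem_filter.2 ⟨hwF, (hw i).1⟩⟩
    choose v hv hvmin using hmin
    refine ⟨v, fun i => (Finset.mem_filter.1 (hv i)).1, fun u _ hlt => ?_⟩
    by_contra hle
    push Not at hle
    have hlow : ∀ i, x i ≤ E (v i) i := fun i => (Finset.mem_filter.1 (hv i)).2
    have huF : u ∈ intBox n Z₀ := by
      refine mem_intBox_of_abs_mulVec_le hgβ (X := 3 * (n * ρ) + R) (fun i => ?_) (Int.le_ceil _)
      have h1 : E (v i) i - E u i ≤ R :=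
        (Finset.single_le_sum (f := fun i => E (v i) i - E u i)
          (fun i _ => (sub_pos.2 (hlt i)).le) (Finset.mem_univ i)).trans hle
      have h2 := abs_le.1 (hxb i)
      have h3 := hvmin i w (Finset.mem_filter.2 ⟨hwF, (hw i).1⟩)
      change |E u i| ≤ _
      rw [abs_le]
      constructor
      · linarith [hlow i, h2.1]
      · linarith [hlt i, (hw i).2]
    have hux : ∀ i, E u i ≤ x i := by
      intro i
      by_contra hcon
      push Not at hcon
      have := hvmin i u (Finset.mem_filter.2 ⟨huF, hcon.le⟩)
      linarith [hlt i]
    have h1 := hunc u hux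
    have h2 : ∑ i, (x i - E u i) ≤ ∑ i, (E (v i) i - E u i) :=
      Finset.sum_le_sum fun i _ => by linarith [hlow i]
    linarith
  · rintro ⟨v, hv, hprop⟩ hgood
    set xh : Fin n → ℝ := fun i => E (v i) i with hxh
    obtain ⟨m, hm0, hm1, hm⟩ : ∃ m : ℝ, 0 < m ∧ m ≤ 1 ∧ ∀ u ∈ intBox n Z₁,
        (∀ i, E u i < xh i) → R + m ≤ ∑ i, (xh i - E u i) := by
      by_cases hne : ((intBox n Z₁).filter fun u => ∀ i, E u i < xh i).Nonempty
      · obtain ⟨u₀, hu₀, hmin⟩ := Finset.exists_min_image _ (fun u => ∑ i, (xh i - E u i)) hne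
        have h1 := hprop u₀ (Finset.mem_filter.1 hu₀).1 (Finset.mem_filter.1 hu₀).2
        refine ⟨min 1 (∑ i, (xh i - E u₀ i) - R), lt_min one_pos (sub_pos.2 h1),
          min_le_left _ _, fun u hu hlt => ?_⟩
        have h2 := hmin u (Finset.mem_filter.2 ⟨hu, hlt⟩)
        have h3 := min_le_right 1 (∑ i, (xh i - E u₀ i) - R)
        linarith
      · refine ⟨1, one_pos, le_rfl, fun u hu hlt => absurd ⟨u, Finset.mem_filter.2 ⟨hu, hlt⟩⟩ hne⟩
    set η : ℝ := m / (4 * (n + 1)) with hη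
    have hη0 : 0 < η := by positivity
    have hnη : n * η ≤ m / 4 := by
      rw [hη, mul_div_assoc', div_le_div_iff₀ (by positivity) (by norm_num)]
      nlinarith
    have hη1 : η ≤ 1 := by
      rw [hη, div_le_one (by positivity)]
      have : (0 : ℝ) ≤ n := by positivity
      linarith
    obtain ⟨l, ⟨u, rfl⟩, hle, hsum⟩ := hgood (R + m / 4) (by linarith) (fun i => xh i - η)
    change ∀ i, E u i ≤ xh i - η at hle
    change ∑ i, (xh i - η - E u i) ≤ R + m / 4 at hsum
    have huF : u ∈ intBox n Z₁ := by
      refine mem_intBox_of_abs_mulVec_le hgβ (X := n * (ρ * Z₀) + R + 2) (fun i => ?_)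
        (Int.le_ceil _)
      have h1 : xh i - η - E u i ≤ R + m / 4 :=
        (Finset.single_le_sum (f := fun i => xh i - η - E u i)
          (fun i _ => sub_nonneg.2 (hle i)) (Finset.mem_univ i)).trans hsum
      have h2 : |xh i| ≤ n * (ρ * Z₀) := by
        refine abs_mulVec_le hgρ (fun j => ?_) i
        have := mem_intBox.1 (hv i) j
        exact_mod_cast this
      have h3 := abs_le.1 h2
      change |E u i| ≤ _
      rw [abs_le]
      constructor <;> linarith [hle i, h3.1, h3.2]
    have h1 := hm u huF (fun i => by linarith [hle i])
    have h2 : ∑ i, (xh i - η - E u i) = ∑ i, (xh i - E u i) - n * η := by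
      simp only [Finset.sum_sub_distrib, Finset.sum_const, Finset.card_univ, Fintype.card_fin,
        nsmul_eq_mul]
      ring
    linarith

/-- The entrywise pairing of two square arrays. -/
def arrPair {n : ℕ} (W M : Fin n → Fin n → ℝ) : ℝ := ∑ i, ∑ j, W i j * M i j

/-- Membership is a Boolean function of finitely many affine linear inequalities in the entries. -/
def SignDefinable {n : ℕ} (A : Set (SLR n)) : Prop :=
  ∃ 𝓦 : Finset ((Fin n → Fin n → ℝ) × ℝ), (∀ w ∈ 𝓦, w.1 ≠ 0) ∧ ∀ g h : SLR n,
    (∀ w ∈ 𝓦, (w.2 < arrPair w.1 (g : Matrix (Fin n) (Fin n) ℝ) ↔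
      w.2 < arrPair w.1 (h : Matrix (Fin n) (Fin n) ℝ))) → (g ∈ A ↔ h ∈ A)

lemma SignDefinable.of_finite {n : ℕ} {ι : Type*} [Finite ι] {P : ι → Set (SLR n)}
    (hP : ∀ i, SignDefinable (P i)) {A : Set (SLR n)}
    (hA : ∀ g h, (∀ i, g ∈ P i ↔ h ∈ P i) → (g ∈ A ↔ h ∈ A)) : SignDefinable A := by
  classical
  cases nonempty_fintype ι
  choose 𝓦 h0 h𝓦 using hP
  refine ⟨Finset.univ.biUnion 𝓦, fun w hw => ?_, fun g h hgh => hA g h fun i => h𝓦 i g h ?_⟩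
  · obtain ⟨i, -, hi⟩ := Finset.mem_biUnion.1 hw
    exact h0 i w hi
  · exact fun w hw => hgh w (Finset.mem_biUnion.2 ⟨i, Finset.mem_univ i, hw⟩)

lemma SignDefinable.lt_arrPair {n : ℕ} (c : ℝ) (W : Fin n → Fin n → ℝ) :
    SignDefinable {g : SLR n | c < arrPair W (g : Matrix (Fin n) (Fin n) ℝ)} := by
  by_cases hW : W = 0
  · refine ⟨∅, by simp, fun g h _ => ?_⟩
    simp [hW, arrPair]
  · refine ⟨{(W, c)}, by simpa using hW, fun g h hgh => ?_⟩
    simpa using hgh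

lemma SignDefinable.inter {n : ℕ} {A B : Set (SLR n)} (hA : SignDefinable A)
    (hB : SignDefinable B) : SignDefinable (A ∩ B) :=
  SignDefinable.of_finite (ι := Bool) (P := fun b => if b then A else B)
    (by rintro (_ | _) <;> simpa) fun g h hgh => by
      have h1 := hgh true
      have h2 := hgh false
      simp at h1 h2
      simp [h1, h2]

lemma SignDefinable.compl {n : ℕ} {A : Set (SLR n)} (hA : SignDefinable A) :
    SignDefinable Aᶜ :=
  SignDefinable.of_finite (ι := Unit) (P := fun _ => A) (fun _ => hA) fun g h hgh => by
    simp [hgh ()]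

lemma SignDefinable.iInter {n : ℕ} {ι : Type*} [Finite ι] {P : ι → Set (SLR n)}
    (hP : ∀ i, SignDefinable (P i)) : SignDefinable {g | ∀ i, g ∈ P i} :=
  SignDefinable.of_finite hP fun g h hgh => by
    simp only [Set.mem_ofPred_eq]
    exact forall_congr' hgh

lemma measurable_arrPair_coe {n : ℕ} (W : Fin n → Fin n → ℝ) :
    Measurable fun g : SLR n => arrPair W (g : Matrix (Fin n) (Fin n) ℝ) := by
  unfold arrPair
  refine Finset.measurable_sum _ fun i _ => Finset.measurable_sum _ fun j _ => ?_
  exact (((SLR.continuous_coe n).matrix_elem i j).measurable).const_mul _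

lemma SignDefinable.measurableSet {n : ℕ} {A : Set (SLR n)} (hA : SignDefinable A) :
    MeasurableSet A := by
  obtain ⟨𝓦, -, h𝓦⟩ := hA
  let φ : SLR n → (𝓦 → Prop) := fun g w => w.1.2 < arrPair w.1.1 (g : Matrix (Fin n) (Fin n) ℝ)
  have hφ : Measurable φ := by
    refine measurable_pi_iff.2 fun w => ?_
    exact measurable_to_prop (by
      have : (fun g : SLR n => w.1.2 < arrPair w.1.1 (g : Matrix (Fin n) (Fin n) ℝ)) ⁻¹' {True} =
          {g : SLR n | w.1.2 < arrPair w.1.1 (g : Matrix (Fin n) (Fin n) ℝ)} := by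
        ext g; simp
      rw [this]
      exact measurableSet_lt measurable_const (measurable_arrPair_coe _))
  have : A = φ ⁻¹' (φ '' A) := by
    ext g
    refine ⟨fun h => ⟨g, h, rfl⟩, ?_⟩
    rintro ⟨h, hh, hgh⟩
    refine (h𝓦 h g fun w hw => ?_).1 hh
    exact iff_of_eq (congrFun hgh ⟨w, hw⟩)
  rw [this]
  exact hφ (Set.toFinite _).measurableSet

lemma signDefinable_abs_mul_lt {n : ℕ} (K : Matrix (Fin n) (Fin n) ℝ) (i j : Fin n) (ρ : ℝ) :
    SignDefinable {g : SLR n | |((g : Matrix (Fin n) (Fin n) ℝ) * K) i j| < ρ} := by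
  have key : ∀ (g : SLR n) (ε : ℝ), arrPair (fun i' k => if i' = i then ε * K k j else 0)
      (g : Matrix (Fin n) (Fin n) ℝ) = ε * ((g : Matrix (Fin n) (Fin n) ℝ) * K) i j := by
    intro g ε
    unfold arrPair
    rw [Finset.sum_eq_single i (fun i' _ hi' => by simp [hi']) (by simp), Matrix.mul_apply,
      Finset.mul_sum]
    refine Finset.sum_congr rfl fun k _ => ?_
    simp only [if_true]
    ring
  have h1 := SignDefinable.lt_arrPair (-ρ) (fun i' k => if i' = i then 1 * K k j else 0)
  have h2 := SignDefinable.lt_arrPair (-ρ) (fun i' k => if i' = i then (-1) * K k j else 0)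
  have := h1.inter h2
  convert this using 1
  ext g
  simp only [Set.mem_ofPred_eq, Set.mem_inter_iff, key, abs_lt]
  constructor
  · rintro ⟨h1, h2⟩; constructor <;> linarith
  · rintro ⟨h1, h2⟩; constructor <;> linarith

lemma signDefinable_mulVec_lt {n : ℕ} (i : Fin n) (u v : Fin n → ℝ) :
    SignDefinable {g : SLR n | ((g : Matrix (Fin n) (Fin n) ℝ) *ᵥ u) i <
      ((g : Matrix (Fin n) (Fin n) ℝ) *ᵥ v) i} := by
  have := SignDefinable.lt_arrPair 0 (fun i' k => if i' = i then v k - u k else 0)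
  convert this using 1
  ext g
  have key : arrPair (fun i' k => if i' = i then v k - u k else 0)
      (g : Matrix (Fin n) (Fin n) ℝ) = ((g : Matrix (Fin n) (Fin n) ℝ) *ᵥ v) i -
      ((g : Matrix (Fin n) (Fin n) ℝ) *ᵥ u) i := by
    unfold arrPair
    rw [Finset.sum_eq_single i (fun i' _ hi' => by simp [hi']) (by simp)]
    simp only [if_true, mulVec, dotProduct]
    rw [← Finset.sum_sub_distrib]
    exact Finset.sum_congr rfl fun k _ => by ring
  simp only [Set.mem_ofPred_eq, key, sub_pos]

lemma signDefinable_lt_sum_mulVec {n : ℕ} (R : ℝ) (v : Fin n → Fin n → ℝ) (u : Fin n → ℝ) :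
    SignDefinable {g : SLR n | R < ∑ i, (((g : Matrix (Fin n) (Fin n) ℝ) *ᵥ v i) i -
      ((g : Matrix (Fin n) (Fin n) ℝ) *ᵥ u) i)} := by
  have := SignDefinable.lt_arrPair R (fun i k => v i k - u k)
  convert this using 1
  ext g
  have key : arrPair (fun i k => v i k - u k)
      (g : Matrix (Fin n) (Fin n) ℝ) = ∑ i, (((g : Matrix (Fin n) (Fin n) ℝ) *ᵥ v i) i -
      ((g : Matrix (Fin n) (Fin n) ℝ) *ᵥ u) i) := by
    unfold arrPair
    refine Finset.sum_congr rfl fun i _ => ?_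
    simp only [mulVec, dotProduct]
    rw [← Finset.sum_sub_distrib]
    exact Finset.sum_congr rfl fun k _ => by ring
  simp only [Set.mem_ofPred_eq, key]

/-- The embedding `SL_n(ℤ) → SL_n(ℝ)`. -/
def toSLR {n : ℕ} : Matrix.SpecialLinearGroup (Fin n) ℤ →* SLR n :=
  Matrix.SpecialLinearGroup.map (n := Fin n) (Int.castRingHom ℝ)

lemma toSLR_injective {n : ℕ} : Function.Injective (toSLR (n := n)) := by
  intro γ γ' h
  ext i j
  have := congrArg (fun g : SLR n => (g : Matrix (Fin n) (Fin n) ℝ) i j) h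
  simpa [toSLR] using this

lemma coe_mul_toSLR {n : ℕ} (g : SLR n) (γ : Matrix.SpecialLinearGroup (Fin n) ℤ) :
    ((g * toSLR γ : SLR n) : Matrix (Fin n) (Fin n) ℝ) =
      (g : Matrix (Fin n) (Fin n) ℝ) *
        (γ : Matrix (Fin n) (Fin n) ℤ).map (Int.cast : ℤ → ℝ) := by
  rw [Matrix.SpecialLinearGroup.coe_mul]
  rfl

lemma latticeOf_mul_toSLR_subset {n : ℕ} (g : SLR n) (γ : Matrix.SpecialLinearGroup (Fin n) ℤ) :
    latticeOf (g * toSLR γ) ⊆ latticeOf g := by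
  rintro x ⟨v, rfl⟩
  refine ⟨(γ : Matrix (Fin n) (Fin n) ℤ) *ᵥ v, ?_⟩
  rw [coe_mul_toSLR, ← Matrix.mulVec_mulVec]
  congr 1
  ext i
  simp [mulVec, dotProduct]

lemma latticeOf_mul_toSLR {n : ℕ} (g : SLR n) (γ : Matrix.SpecialLinearGroup (Fin n) ℤ) :
    latticeOf (g * toSLR γ) = latticeOf g := by
  refine (latticeOf_mul_toSLR_subset g γ).antisymm ?_
  have := latticeOf_mul_toSLR_subset (g * toSLR γ) γ⁻¹
  rwa [map_inv, mul_inv_cancel_right] at this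

lemma mk_eq_mk_iff_toSLR {n : ℕ} (g h : SLR n) :
    (QuotientGroup.mk h : XQuot n) = QuotientGroup.mk g ↔ ∃ γ, h = g * toSLR γ := by
  rw [eq_comm, QuotientGroup.eq]
  constructor
  · rintro ⟨γ, hγ⟩
    exact ⟨γ, by unfold toSLR; rw [hγ]; group⟩
  · rintro ⟨γ, rfl⟩
    exact ⟨γ, by unfold toSLR; group⟩

/-- The integral base changes keeping the entries of a basis below `ρ`. -/
def boundedBaseChange {n : ℕ} (ρ : ℝ) (g : SLR n) : Set (Matrix.SpecialLinearGroup (Fin n) ℤ) :=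
  {γ | ∀ i j, |((g * toSLR γ : SLR n) : Matrix (Fin n) (Fin n) ℝ) i j| < ρ}

/-- Bases with entries below `ρ` of lattices with covering radius at most `R`, for which there are
exactly `k` such bases. -/
def reducedSet (n : ℕ) (ρ R : ℝ) (k : ℕ) : Set (SLR n) :=
  {g | (∀ i j, |(g : Matrix (Fin n) (Fin n) ℝ) i j| < ρ) ∧
    (∀ t, R < t → SimplexCovers (latticeOf g) t) ∧ (boundedBaseChange ρ g).ncard = k}

lemma exists_finite_boundedBaseChange (n : ℕ) (ρ : ℝ) :
    ∃ 𝓔 : Finset (Matrix.SpecialLinearGroup (Fin n) ℤ), ∀ g : SLR n,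
      (∀ i j, |(g : Matrix (Fin n) (Fin n) ℝ) i j| < ρ) →
        boundedBaseChange ρ g ⊆ 𝓔 := by
  obtain ⟨β, -, hβ⟩ := exists_adjugate_bound n ρ
  set Z : ℤ := ⌈n * (β * ρ)⌉ with hZ
  have hfin : {γ : Matrix.SpecialLinearGroup (Fin n) ℤ | ∀ j, (fun i => γ i j) ∈ intBox n Z}.Finite := by
    refine Set.Finite.of_finite_image
      (f := fun γ : Matrix.SpecialLinearGroup (Fin n) ℤ => fun j i => γ i j)
      (s := {γ : Matrix.SpecialLinearGroup (Fin n) ℤ | ∀ j, (fun i => γ i j) ∈ intBox n Z}) ?_ ?_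
    · refine (Set.Finite.pi' (fun _ : Fin n => (intBox n Z).finite_toSet)).subset ?_
      rintro _ ⟨γ, hγ, rfl⟩ j
      exact hγ j
    · intro γ _ γ' _ h
      ext i j
      exact congrFun (congrFun h j) i
  refine ⟨hfin.toFinset, fun g hg γ hγ => ?_⟩
  rw [Set.Finite.coe_toFinset]
  intro j
  refine mem_intBox_of_abs_mulVec_le (hβ _ fun i j => (hg i j).le) (X := ρ) (fun i => ?_)
    (Int.le_ceil _)
  have := (hγ i j).le
  rw [coe_mul_toSLR, Matrix.mul_apply] at this
  exact this

lemma signDefinable_reducedSet (n : ℕ) {ρ R : ℝ} (hρ : 0 < ρ) (hR : 0 < R) (k : ℕ) :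
    SignDefinable (reducedSet n ρ R k) := by
  classical
  obtain ⟨𝓔, h𝓔⟩ := exists_finite_boundedBaseChange n ρ
  obtain ⟨F, F', hF⟩ := exists_covering_criterion n hρ hR
  set T₁ : Set (SLR n) := {g | ∀ ij : Fin n × Fin n,
    g ∈ {g : SLR n | |((g : Matrix (Fin n) (Fin n) ℝ) *
      (1 : Matrix (Fin n) (Fin n) ℝ)) ij.1 ij.2| < ρ}} with hT₁
  have h1 : SignDefinable T₁ := SignDefinable.iInter fun ij => signDefinable_abs_mul_lt 1 _ _ _
  set T₂ : Set (SLR n) := {g | ∀ v : Fin n → F,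
    g ∈ {g : SLR n | ∀ u : F',
      g ∈ ({g : SLR n | ∀ i, g ∈ {g : SLR n |
        ((g : Matrix (Fin n) (Fin n) ℝ) *ᵥ fun j => (u.1 j : ℝ)) i <
            ((g : Matrix (Fin n) (Fin n) ℝ) *ᵥ fun j => ((v i).1 j : ℝ)) i}} ∩
        {g : SLR n | R < ∑ i, (((g : Matrix (Fin n) (Fin n) ℝ) *ᵥ fun j => ((v i).1 j : ℝ)) i -
            ((g : Matrix (Fin n) (Fin n) ℝ) *ᵥ fun j => (u.1 j : ℝ)) i)}ᶜ)ᶜ}ᶜ} with hT₂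
  have h2 : SignDefinable T₂ := by
    refine SignDefinable.iInter fun v => SignDefinable.compl <| SignDefinable.iInter fun u =>
      SignDefinable.compl <| SignDefinable.inter (SignDefinable.iInter fun i => ?_)
        (SignDefinable.compl ?_)
    · exact signDefinable_mulVec_lt _ _ _
    · exact signDefinable_lt_sum_mulVec _ _ _
  set Q : 𝓔 → Set (SLR n) := fun γ => {g | ∀ ij : Fin n × Fin n,
    g ∈ {g : SLR n | |((g : Matrix (Fin n) (Fin n) ℝ) *
      (γ.1 : Matrix (Fin n) (Fin n) ℤ).map (Int.cast : ℤ → ℝ)) ij.1 ij.2| < ρ}} with hQ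
  have hmemQ : ∀ (γ : 𝓔) (g : SLR n), g ∈ Q γ ↔ γ.1 ∈ boundedBaseChange ρ g := by
    intro γ g
    simp only [hQ, boundedBaseChange, coe_mul_toSLR, Set.mem_ofPred_eq, Prod.forall]
  set T₃ : Set (SLR n) := {g | (boundedBaseChange ρ g ∩ 𝓔).ncard = k} with hT₃
  have h3 : SignDefinable T₃ := by
    refine SignDefinable.of_finite (P := Q)
      (fun γ => SignDefinable.iInter fun ij => signDefinable_abs_mul_lt _ _ _ _)
      fun g h hgh => ?_
    have : boundedBaseChange ρ g ∩ 𝓔 = boundedBaseChange ρ h ∩ (𝓔 : Set _) := by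
      ext γ
      simp only [Set.mem_inter_iff, and_congr_left_iff]
      intro hγ
      rw [← hmemQ ⟨γ, hγ⟩ g, ← hmemQ ⟨γ, hγ⟩ h]
      exact hgh _
    simp only [hT₃, Set.mem_ofPred_eq, this]
  have hA : reducedSet n ρ R k = (T₁ ∩ T₂) ∩ T₃ := by
    ext g
    by_cases hg : ∀ i j, |(g : Matrix (Fin n) (Fin n) ℝ) i j| < ρ
    · have e1 : g ∈ T₁ := by
        simp only [hT₁, Set.mem_ofPred_eq, mul_one]
        exact fun ij => hg _ _
      have e2 : g ∈ T₂ ↔ ∀ t, R < t → SimplexCovers (latticeOf g) t := by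
        rw [← not_iff_not, hF g hg]
        simp only [hT₂, Set.mem_ofPred_eq, Set.mem_compl_iff, Set.mem_inter_iff]
        push Not
        constructor
        · rintro ⟨v, hv⟩
          exact ⟨fun i => (v i).1, fun i => (v i).2, fun u hu h => hv ⟨u, hu⟩ h⟩
        · rintro ⟨v, hv, h⟩
          exact ⟨fun i => ⟨v i, hv i⟩, fun u h' => h u.1 u.2 h'⟩
      have e3 : g ∈ T₃ ↔ (boundedBaseChange ρ g).ncard = k := by
        simp only [hT₃, Set.mem_ofPred_eq]
        rw [Set.inter_eq_left.2 (h𝓔 g hg)]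
      simp only [reducedSet, Set.mem_ofPred_eq, Set.mem_inter_iff, e1, e2, e3, true_and]
      tauto
    · have e1 : g ∉ T₁ := by
        simp only [hT₁, Set.mem_ofPred_eq, mul_one]
        exact fun h => hg fun i j => h (i, j)
      simp only [reducedSet, Set.mem_ofPred_eq, Set.mem_inter_iff, e1, hg, false_and]
  rw [hA]
  exact (h1.inter h2).inter h3

lemma encard_fiber_reducedSet {n : ℕ} {ρ R : ℝ} {k : ℕ} {g : SLR n}
    (hg : g ∈ reducedSet n ρ R k) :
    {h ∈ reducedSet n ρ R k | (QuotientGroup.mk h : XQuot n) = QuotientGroup.mk g}.encard = k := by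
  have heq : {h ∈ reducedSet n ρ R k | (QuotientGroup.mk h : XQuot n) = QuotientGroup.mk g} =
      (fun γ => g * toSLR γ) '' boundedBaseChange ρ g := by
    ext h
    simp only [Set.mem_ofPred_eq, mk_eq_mk_iff_toSLR, Set.mem_image]
    constructor
    · rintro ⟨hh, γ, rfl⟩
      exact ⟨γ, hh.1, rfl⟩
    · rintro ⟨γ, hγ, rfl⟩
      refine ⟨⟨hγ, ?_, ?_⟩, γ, rfl⟩
      · rw [latticeOf_mul_toSLR]; exact hg.2.1
      · rw [← hg.2.2]
        have : boundedBaseChange ρ g = (fun γ' => γ * γ') '' boundedBaseChange ρ (g * toSLR γ) := by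
          ext γ'
          simp only [boundedBaseChange, Set.mem_ofPred_eq, Set.mem_image]
          constructor
          · intro h'
            refine ⟨γ⁻¹ * γ', ?_, by group⟩
            rw [mul_assoc, ← map_mul]
            simpa using h'
          · rintro ⟨δ, hδ, rfl⟩
            rw [map_mul, ← mul_assoc]
            exact hδ
        rw [this, Set.ncard_image_of_injective _ (mul_right_injective γ)]
  obtain ⟨𝓔, h𝓔⟩ := exists_finite_boundedBaseChange n ρ
  rw [heq, Function.Injective.encard_image (fun γ γ' h => toSLR_injective (mul_left_cancel h)),
    ← (𝓔.finite_toSet.subset (h𝓔 g hg.1)).cast_ncard_eq, hg.2.2]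

/-- The set of unimodular lattices of covering radius at most `R` splits into finitely many
pieces, each covered with constant multiplicity by a bounded sign-definable set. -/
lemma exists_reducedSet_decomposition (n : ℕ) {R : ℝ} (hR : 0 < R) :
    ∃ ρ : ℝ, 0 < ρ ∧ ∃ K : ℕ,
      ((QuotientGroup.mk : SLR n → XQuot n) ''
        {g : SLR n | covRad n (simplexStd n) (latticeOf g) ≤ R} =
        ⋃ k ∈ Finset.Icc 1 K, QuotientGroup.mk '' reducedSet n ρ R k) ∧
      (∀ g : SLR n, (∀ t, R < t → SimplexCovers (latticeOf g) t) →
        (boundedBaseChange ρ g).Nonempty ∧ (boundedBaseChange ρ g).Finite ∧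
        (boundedBaseChange ρ g).ncard ≤ K) := by
  obtain ⟨ρ, hρ, hb⟩ := exists_bounded_basis n (R := R + 1) (by linarith)
  obtain ⟨𝓔, h𝓔⟩ := exists_finite_boundedBaseChange n ρ
  have key : ∀ g : SLR n, (∀ t, R < t → SimplexCovers (latticeOf g) t) →
      ∃ γ, γ ∈ boundedBaseChange ρ g := by
    intro g hg
    obtain ⟨γ, hγ⟩ := hb g (hg _ (by linarith))
    exact ⟨γ, fun i j => by rw [coe_mul_toSLR]; exact hγ i j⟩
  have hsub : ∀ g γ, γ ∈ boundedBaseChange (n := n) ρ g →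
      boundedBaseChange ρ g = (fun δ => γ * δ) '' boundedBaseChange ρ (g * toSLR γ) := by
    intro g γ _
    ext γ'
    simp only [boundedBaseChange, Set.mem_ofPred_eq, Set.mem_image]
    constructor
    · intro h'
      refine ⟨γ⁻¹ * γ', ?_, by group⟩
      rw [mul_assoc, ← map_mul]
      simpa using h'
    · rintro ⟨δ, hδ, rfl⟩
      rw [map_mul, ← mul_assoc]
      exact hδ
  have hcard : ∀ g : SLR n, (∀ t, R < t → SimplexCovers (latticeOf g) t) →
        (boundedBaseChange ρ g).Nonempty ∧ (boundedBaseChange ρ g).Finite ∧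
        (boundedBaseChange ρ g).ncard ≤ 𝓔.card := by
    intro g hg
    obtain ⟨γ, hγ⟩ := key g hg
    have hs := h𝓔 (g * toSLR γ) hγ
    rw [hsub g γ hγ]
    have hfin := 𝓔.finite_toSet.subset hs
    refine ⟨?_, hfin.image _, ?_⟩
    · rw [← hsub g γ hγ]; exact ⟨γ, hγ⟩
    · rw [Set.ncard_image_of_injective _ (mul_right_injective γ), ← Set.ncard_coe_finset]
      exact Set.ncard_le_ncard hs 𝓔.finite_toSet
  refine ⟨ρ, hρ, 𝓔.card, ?_, hcard⟩
  ext x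
  simp only [Set.mem_image, Set.mem_ofPred_eq, Set.mem_iUnion, Finset.mem_Icc, exists_prop]
  constructor
  · rintro ⟨g, hg, rfl⟩
    rw [covRad_latticeOf_le_iff g hR] at hg
    obtain ⟨γ, hγ⟩ := key g hg
    have hg' : ∀ t, R < t → SimplexCovers (latticeOf (g * toSLR γ)) t := by
      rw [latticeOf_mul_toSLR]; exact hg
    obtain ⟨hne, hfin, hle⟩ := hcard _ hg'
    refine ⟨_, ⟨(Set.ncard_pos hfin).2 hne, hle⟩, g * toSLR γ, ⟨hγ, hg', rfl⟩, ?_⟩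
    exact (mk_eq_mk_iff_toSLR _ _).2 ⟨γ, rfl⟩
  · rintro ⟨k, -, g, hg, rfl⟩
    exact ⟨g, (covRad_latticeOf_le_iff g hR).2 hg.2.1, rfl⟩

lemma measure_lattices_eq_sum {n : ℕ} (hn : n ≠ 0) (μ₀ : Measure (XQuot n))
    [IsProbabilityMeasure μ₀] (hinv : ∀ g : SLR n, Measure.map (fun x => g • x) μ₀ = μ₀) :
    ∃ b : ℝ, 0 < b ∧ ∀ R : ℝ, 0 < R → ∃ ρ : ℝ, 0 < ρ ∧ ∃ K : ℕ,
      (∀ g : SLR n, (∀ t, R < t → SimplexCovers (latticeOf g) t) →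
        (boundedBaseChange ρ g).Nonempty ∧ (boundedBaseChange ρ g).Finite ∧
        (boundedBaseChange ρ g).ncard ≤ K) ∧
      (μ₀ (QuotientGroup.mk ''
        {g : SLR n | covRad n (simplexStd n) (latticeOf g) ≤ R})).toReal =
        ∑ k ∈ Finset.Icc 1 K, (coneMeasure n (reducedSet n ρ R k)).toReal / (b * k) := by
  obtain ⟨b, hb, hbA⟩ := exists_coneMeasure_eq hn μ₀ hinv
  refine ⟨b, hb, fun R hR => ?_⟩
  obtain ⟨ρ, hρ, K, hE, hK⟩ := exists_reducedSet_decomposition n hR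
  refine ⟨ρ, hρ, K, hK, ?_⟩
  have hA := fun k : ℕ => fun hk : k ≠ 0 => hbA (reducedSet n ρ R k)
    (signDefinable_reducedSet n hρ hR k).measurableSet k hk
    fun g hg => encard_fiber_reducedSet hg
  rw [hE, measure_biUnion_finset, ENNReal.toReal_sum (fun _ _ => measure_ne_top _ _)]
  · refine Finset.sum_congr rfl fun k hk => ?_
    have hk1 : k ≠ 0 := by have := (Finset.mem_Icc.1 hk).1; omega
    rw [(hA k hk1).2, ENNReal.toReal_mul, ENNReal.toReal_mul, ENNReal.toReal_ofReal hb.le,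
      ENNReal.toReal_natCast]
    have : (k : ℝ) ≠ 0 := by exact_mod_cast hk1
    field_simp
  · intro k _ k' _ hkk'
    rw [Function.onFun, Set.disjoint_left]
    rintro _ ⟨g, hg, rfl⟩ ⟨h, hh, hgh⟩
    apply hkk'
    obtain ⟨γ, rfl⟩ := (mk_eq_mk_iff_toSLR _ _).1 hgh
    rw [← hg.2.2, ← hh.2.2]
    have : boundedBaseChange ρ g = (fun γ' => γ * γ') '' boundedBaseChange ρ (g * toSLR γ) := by
      ext γ'
      simp only [boundedBaseChange, Set.mem_ofPred_eq, Set.mem_image]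
      constructor
      · intro h'
        refine ⟨γ⁻¹ * γ', ?_, by group⟩
        rw [mul_assoc, ← map_mul]
        simpa using h'
      · rintro ⟨δ, hδ, rfl⟩
        rw [map_mul, ← mul_assoc]
        exact hδ
    rw [this, Set.ncard_image_of_injective _ (mul_right_injective γ)]
  · intro k hk
    exact (hA k (by have := (Finset.mem_Icc.1 hk).1; omega)).1

lemma volume_abs_eval_le {p : Polynomial ℝ} (hp : p.natDegree ≠ 0) {ε : ℝ} (hε : 0 < ε) :
    volume {x : ℝ | |p.eval x| ≤ ε} ≤
      ENNReal.ofReal (p.natDegree * (2 * (ε / |p.leadingCoeff|) ^ (1 / (p.natDegree : ℝ)))) := by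
  classical
  set n := p.natDegree with hn
  have hp0 : p ≠ 0 := by rintro rfl; simp at hn; exact hp hn
  have hl : 0 < |p.leadingCoeff| := abs_pos.2 (Polynomial.leadingCoeff_ne_zero.2 hp0)
  set θ : ℝ := (ε / |p.leadingCoeff|) ^ (1 / (n : ℝ)) with hθ
  have hθ0 : 0 < θ := Real.rpow_pos_of_pos (by positivity) _
  have hθn : |p.leadingCoeff| * θ ^ n = ε := by
    rw [hθ, ← Real.rpow_natCast, ← Real.rpow_mul (by positivity)]
    have : (n : ℝ) ≠ 0 := by exact_mod_cast hp
    field_simp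
    simp
    field_simp
  set P := p.map (algebraMap ℝ ℂ) with hP
  have hcard : P.roots.card = n := by
    rw [← (IsAlgClosed.splits P).natDegree_eq_card_roots, hP, Polynomial.natDegree_map]
  have heval : ∀ x : ℝ, |p.eval x| = |p.leadingCoeff| * (P.roots.map fun z => ‖(x : ℂ) - z‖).prod := by
    intro x
    have h1 : ((p.eval x : ℝ) : ℂ) = P.eval (x : ℂ) := by
      rw [hP, Polynomial.eval_map_algebraMap]
      have := Polynomial.aeval_algebraMap_apply ℂ x p
      simpa using this.symm
    have h2 := (IsAlgClosed.splits P).eval_eq_prod_roots (x : ℂ)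
    have h3 : |p.eval x| = ‖P.eval (x : ℂ)‖ := by rw [← h1, Complex.norm_real, Real.norm_eq_abs]
    rw [h3, h2, norm_mul, hP, Polynomial.leadingCoeff_map, ← hP]
    congr 1
    · simp
    · have h4 := map_multiset_prod (normHom (α := ℂ)) (P.roots.map fun z => (x : ℂ) - z)
      rw [Multiset.map_map] at h4
      exact h4
  have hsub : {x : ℝ | |p.eval x| ≤ ε} ⊆ ⋃ z ∈ P.roots.toFinset, Set.Icc (z.re - θ) (z.re + θ) := by
    intro x hx
    by_contra hcon
    have hfar : ∀ z ∈ P.roots, θ < ‖(x : ℂ) - z‖ := by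
      intro z hz
      by_contra! hle
      refine hcon (Set.mem_iUnion₂.2 ⟨z, Multiset.mem_toFinset.2 hz, ?_⟩)
      have h4 := (Complex.abs_re_le_norm ((x : ℂ) - z)).trans hle
      simp only [Complex.sub_re, Complex.ofReal_re] at h4
      have := abs_le.1 h4
      constructor <;> linarith
    have hprod : ∀ s : Multiset ℂ, s ≠ 0 → (∀ z ∈ s, θ < ‖(x : ℂ) - z‖) →
        θ ^ s.card < (s.map fun z => ‖(x : ℂ) - z‖).prod := by
      intro s
      induction s using Multiset.induction_on with
      | empty => simp
      | cons a s ih =>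
        intro _ h
        rw [Multiset.map_cons, Multiset.prod_cons, Multiset.card_cons, pow_succ']
        have ha := h a (Multiset.mem_cons_self a s)
        by_cases hs : s = 0
        · subst hs; simpa using ha
        · exact mul_lt_mul'' ha (ih hs fun z hz => h z (Multiset.mem_cons_of_mem hz)) hθ0.le
            (by positivity)
    have h5 := hprod P.roots (by rintro h0; rw [h0] at hcard; simp at hcard; exact hp hcard.symm) hfar
    rw [hcard] at h5
    have h6 : |p.eval x| ≤ ε := hx
    rw [heval, ← hθn] at h6
    exact absurd h6 (not_le.2 (mul_lt_mul_of_pos_left h5 hl))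
  calc volume {x : ℝ | |p.eval x| ≤ ε}
      ≤ ∑ z ∈ P.roots.toFinset, volume (Set.Icc (z.re - θ) (z.re + θ)) :=
        (measure_mono hsub).trans (measure_biUnion_finset_le _ _)
    _ = P.roots.toFinset.card * ENNReal.ofReal (2 * θ) := by
        simp only [Real.volume_Icc]
        rw [Finset.sum_congr rfl (g := fun _ => ENNReal.ofReal (2 * θ)) fun z _ => by ring_nf]
        rw [Finset.sum_const, nsmul_eq_mul]
    _ ≤ n * ENNReal.ofReal (2 * θ) := by
        gcongr
        rw [← hcard]
        exact Multiset.toFinset_card_le _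
    _ = ENNReal.ofReal (n * (2 * θ)) := by
        rw [ENNReal.ofReal_mul (p := (n : ℝ)) (by positivity), ENNReal.ofReal_natCast]

lemma volume_le_of_shift {n : ℕ} {S : Set (Fin n → Fin n → ℝ)} (hS : MeasurableSet S) {ρ : ℝ}
    (hρ : ∀ M ∈ S, ∀ i j, |M i j| < ρ) (i₀ j₀ : Fin n) {ε : ENNReal}
    (h : ∀ M : Fin n → Fin n → ℝ,
      volume {x : ℝ | M + Pi.single i₀ (Pi.single j₀ x) ∈ S} ≤ ε) :
    volume S ≤ ε * volume {M : Fin n → Fin n → ℝ | ∀ i j, |M i j| ≤ ρ + 1} := by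
  set T : Set (ℝ × (Fin n → Fin n → ℝ)) := {p | p.2 + Pi.single i₀ (Pi.single j₀ p.1) ∈ S} with hT
  have hTm : MeasurableSet T := by
    have hm : Measurable fun p : ℝ × (Fin n → Fin n → ℝ) =>
        p.2 + Pi.single i₀ (Pi.single j₀ p.1) := by
      refine Measurable.add measurable_snd ?_
      have hc : Continuous fun x : ℝ => (Pi.single i₀ (Pi.single j₀ x) : Fin n → Fin n → ℝ) :=
        (continuous_single (A := fun _ : Fin n => Fin n → ℝ) i₀).comp
          (continuous_single (A := fun _ : Fin n => ℝ) j₀)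
      exact hc.measurable.comp measurable_fst
    exact hm hS
  set μ : Measure ℝ := volume.restrict (Set.Icc 0 1) with hμ
  have h1 : (μ.prod (volume : Measure (Fin n → Fin n → ℝ))) T = volume S := by
    rw [Measure.prod_apply hTm]
    have : ∀ x : ℝ, volume (Prod.mk x ⁻¹' T) = volume S := by
      intro x
      have : Prod.mk x ⁻¹' T = (fun M : Fin n → Fin n → ℝ => M + Pi.single i₀ (Pi.single j₀ x)) ⁻¹' S := rfl
      rw [this, measure_preimage_add_right]
    simp only [this, lintegral_const, hμ, Measure.restrict_apply MeasurableSet.univ, Set.univ_inter,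
      Real.volume_Icc]
    simp
  set Bx : Set (Fin n → Fin n → ℝ) := {M | ∀ i j, |M i j| ≤ ρ + 1} with hBx
  have hBm : MeasurableSet Bx := by
    rw [hBx]
    simp only [Set.ofPred_forall]
    refine MeasurableSet.iInter fun i => MeasurableSet.iInter fun j => ?_
    exact measurableSet_le (by fun_prop) measurable_const
  rw [← h1, Measure.prod_apply_symm hTm, ← lintegral_indicator_const hBm]
  refine lintegral_mono fun M => ?_
  by_cases hM : M ∈ Bx
  · rw [Set.indicator_of_mem hM]
    exact (Measure.restrict_apply_le _ _).trans (h M)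
  · rw [Set.indicator_of_notMem hM, nonpos_iff_eq_zero]
    have : (fun x => (x, M)) ⁻¹' T ∩ Set.Icc 0 1 = ∅ := by
      ext x
      simp only [Set.mem_inter_iff, Set.mem_preimage, Set.mem_empty_iff_false, iff_false, not_and]
      intro hx hx01
      apply hM
      intro i j
      have h2 := hρ _ hx i j
      simp only [Pi.add_apply] at h2
      have h3 : |(Pi.single i₀ (Pi.single j₀ x) : Fin n → Fin n → ℝ) i j| ≤ 1 := by
        by_cases hi : i = i₀
        · subst hi
          by_cases hj : j = j₀
          · subst hj
            simp only [Pi.single_eq_same]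
            exact abs_le.2 ⟨by linarith [hx01.1], hx01.2⟩
          · simp [Pi.single_eq_of_ne hj]
        · simp [Pi.single_eq_of_ne hi]
      have h4 := abs_lt.1 h2
      have h5 := abs_le.1 h3
      exact abs_le.2 ⟨by linarith, by linarith⟩
    have hm1 : MeasurableSet ((fun x => (x, M)) ⁻¹' T) := measurable_prodMk_right hTm
    rw [Measure.restrict_apply hm1, this, measure_empty]

lemma arrDet_add_single {n : ℕ} (M : Fin n → Fin n → ℝ) (i₀ j₀ : Fin n) (x : ℝ) :
    arrDet (M + Pi.single i₀ (Pi.single j₀ x)) =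
      arrDet M + x * ((Matrix.of M).updateRow i₀ (Pi.single j₀ 1)).det := by
  have h1 : Matrix.of (M + Pi.single i₀ (Pi.single j₀ x)) =
      (Matrix.of M).updateRow i₀ (M i₀ + x • Pi.single j₀ 1) := by
    ext i j
    by_cases hi : i = i₀
    · subst hi
      simp [Pi.single_apply]
    · simp [Pi.single_eq_of_ne hi, Matrix.updateRow_ne hi]
  unfold arrDet
  rw [h1, Matrix.det_updateRow_add, Matrix.det_updateRow_smul]
  congr 2
  exact Matrix.updateRow_eq_self _ _

lemma arrPair_add_single {n : ℕ} (W M : Fin n → Fin n → ℝ) (i₀ j₀ : Fin n) (x : ℝ) :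
    arrPair W (M + Pi.single i₀ (Pi.single j₀ x)) = arrPair W M + x * W i₀ j₀ := by
  unfold arrPair
  simp only [Pi.add_apply, mul_add, Finset.sum_add_distrib]
  congr 1
  rw [Finset.sum_eq_single i₀ (fun i _ hi => by simp [Pi.single_eq_of_ne hi]) (by simp),
    Finset.sum_eq_single j₀ (fun j _ hj => by simp [Pi.single_eq_of_ne hj]) (by simp)]
  simp [mul_comm]

lemma volume_slab_le {n : ℕ} (hn : 2 ≤ n) {W : Fin n → Fin n → ℝ} (hW : W ≠ 0) (c ρ : ℝ) :
    ∃ C : ℝ, 0 < C ∧ ∀ ε : ℝ, 0 < ε →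
      volume {M : Fin n → Fin n → ℝ | (∀ i j, |M i j| < ρ) ∧
        |arrPair W M ^ n - c * arrDet M| ≤ ε} ≤ ENNReal.ofReal (C * ε ^ (1 / (n : ℝ))) := by
  obtain ⟨i₀, hi₀⟩ := Function.ne_iff.1 hW
  obtain ⟨j₀, hj₀⟩ := Function.ne_iff.1 hi₀
  set w := W i₀ j₀ with hw
  have hw0 : w ≠ 0 := hj₀
  set Bv := volume {M : Fin n → Fin n → ℝ | ∀ i j, |M i j| ≤ ρ + 1} with hBv
  have hBfin : Bv ≠ ⊤ := by
    have : {M : Fin n → Fin n → ℝ | ∀ i j, |M i j| ≤ ρ + 1} ⊆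
        Set.univ.pi fun _ => Set.univ.pi fun _ => Set.Icc (-(ρ + 1)) (ρ + 1) := by
      intro M hM i _ j _
      exact abs_le.1 (hM i j)
    exact ((measure_mono this).trans_lt (isCompact_univ_pi fun _ => isCompact_univ_pi fun _ =>
      isCompact_Icc).measure_lt_top).ne
  have hnr : (0 : ℝ) < n := by positivity
  set C₁ : ℝ := n * (2 * (1 / |w ^ n|) ^ (1 / (n : ℝ))) with hC₁
  have hC₁0 : 0 ≤ C₁ := by positivity
  refine ⟨C₁ * Bv.toReal + 1, by positivity, fun ε hε => ?_⟩
  have hcp : Continuous (arrPair W) := by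
    unfold arrPair
    fun_prop
  have hS : MeasurableSet {M : Fin n → Fin n → ℝ | (∀ i j, |M i j| < ρ) ∧
        |arrPair W M ^ n - c * arrDet M| ≤ ε} := by
    refine MeasurableSet.inter (s₁ := {M : Fin n → Fin n → ℝ | ∀ i j, |M i j| < ρ}) ?_ ?_
    · simp only [Set.ofPred_forall]
      refine MeasurableSet.iInter fun i => MeasurableSet.iInter fun j => ?_
      exact measurableSet_lt (by fun_prop) measurable_const
    · exact measurableSet_le (((hcp.pow n).sub
        (continuous_const.mul continuous_arrDet)).abs).measurable measurable_const
  have hfib : ∀ M : Fin n → Fin n → ℝ,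
      volume {x : ℝ | M + Pi.single i₀ (Pi.single j₀ x) ∈ {M : Fin n → Fin n → ℝ |
        (∀ i j, |M i j| < ρ) ∧ |arrPair W M ^ n - c * arrDet M| ≤ ε}} ≤
      ENNReal.ofReal (C₁ * ε ^ (1 / (n : ℝ))) := by
    intro M
    set d₁ := ((Matrix.of M).updateRow i₀ (Pi.single j₀ 1)).det with hd₁
    set q : Polynomial ℝ := Polynomial.C w * Polynomial.X + Polynomial.C (arrPair W M) with hq
    set l : Polynomial ℝ := Polynomial.C (c * d₁) * Polynomial.X + Polynomial.C (c * arrDet M)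
      with hl
    have hqd : (q ^ n).natDegree = n := by
      rw [Polynomial.natDegree_pow, hq, Polynomial.natDegree_linear hw0, mul_one]
    have hql : (q ^ n).leadingCoeff = w ^ n := by
      rw [Polynomial.leadingCoeff_pow, hq, Polynomial.leadingCoeff_linear hw0]
    have hlt : l.degree < (q ^ n).degree := by
      have hne : q ^ n ≠ 0 := by
        intro h0; rw [h0] at hqd; simp at hqd; omega
      rw [Polynomial.degree_eq_natDegree hne, hqd]
      refine (Polynomial.degree_linear_le).trans_lt ?_
      exact_mod_cast (by omega : 1 < n)
    have hpd : (q ^ n - l).natDegree = n := by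
      rw [Polynomial.natDegree_sub_eq_left_of_natDegree_lt, hqd]
      rw [hqd]
      exact (Polynomial.natDegree_linear_le).trans_lt (by omega)
    have hpl : (q ^ n - l).leadingCoeff = w ^ n := by
      rw [Polynomial.leadingCoeff_sub_of_degree_lt hlt, hql]
    have hmain := volume_abs_eval_le (p := q ^ n - l) (by rw [hpd]; omega) hε
    rw [hpd, hpl] at hmain
    refine le_trans (measure_mono ?_) (hmain.trans (le_of_eq ?_))
    · intro x hx
      have h2 := hx.2
      rw [arrPair_add_single, arrDet_add_single] at h2
      change |Polynomial.eval x (q ^ n - l)| ≤ ε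
      convert h2 using 2
      simp only [hq, hl, Polynomial.eval_sub, Polynomial.eval_pow, Polynomial.eval_add,
        Polynomial.eval_mul, Polynomial.eval_C, Polynomial.eval_X]
      ring
    · congr 1
      rw [hC₁, div_eq_mul_one_div, Real.mul_rpow hε.le (by positivity)]
      ring
  refine (volume_le_of_shift hS (fun M hM => hM.1) i₀ j₀ hfib).trans ?_
  change _ * Bv ≤ _
  have hB2 : Bv = ENNReal.ofReal Bv.toReal := (ENNReal.ofReal_toReal hBfin).symm
  refine (le_of_eq (congrArg _ hB2)).trans ?_
  rw [← ENNReal.ofReal_mul (by positivity)]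
  refine ENNReal.ofReal_le_ofReal ?_
  have : 0 ≤ ε ^ (1 / (n : ℝ)) := by positivity
  nlinarith

lemma abs_pow_sub_pow_le_mul_abs_sub {x y K : ℝ} (hx : |x| ≤ K) (hy : |y| ≤ K) (n : ℕ) :
    |x ^ n - y ^ n| ≤ n * K ^ (n - 1) * |x - y| := by
  have hK : 0 ≤ K := (abs_nonneg x).trans hx
  rw [← Commute.geom_sum₂_mul (Commute.all x y) n, abs_mul]
  refine mul_le_mul_of_nonneg_right ?_ (abs_nonneg _)
  refine (Finset.abs_sum_le_sum_abs _ _).trans ?_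
  calc ∑ i ∈ Finset.range n, |x ^ i * y ^ (n - 1 - i)|
      ≤ ∑ i ∈ Finset.range n, K ^ (n - 1) := Finset.sum_le_sum fun i hi => by
        rw [abs_mul, abs_pow, abs_pow]
        calc |x| ^ i * |y| ^ (n - 1 - i) ≤ K ^ i * K ^ (n - 1 - i) := by gcongr
          _ = K ^ (n - 1) := by
            rw [← pow_add]; congr 1; have := Finset.mem_range.1 hi; omega
    _ = n * K ^ (n - 1) := by simp

/-- Thin slabs around an affine wall have small cone measure. -/
lemma coneMeasure_slab_le {n : ℕ} (hn : 2 ≤ n) {W : Fin n → Fin n → ℝ} (hW : W ≠ 0) (c ρ : ℝ) :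
    ∃ C : ℝ, 0 < C ∧ ∀ δ : ℝ, 0 < δ → δ ≤ 1 →
      coneMeasure n {g : SLR n | (∀ i j, |(g : Matrix (Fin n) (Fin n) ℝ) i j| < ρ) ∧
        |arrPair W (g : Matrix (Fin n) (Fin n) ℝ) - c| ≤ δ} ≤
        ENNReal.ofReal (C * δ ^ (1 / (n : ℝ))) := by
  have hn0 : n ≠ 0 := by omega
  set V : Fin n → Fin n → ℝ := fun i j => W j i with hV
  have hV0 : V ≠ 0 := by
    intro h
    apply hW
    ext i j
    exact congrFun (congrFun h j) i
  obtain ⟨C, hC, hvol⟩ := volume_slab_le hn hV0 (c ^ n) ρ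
  set K : ℝ := |c| + 1 with hK
  have hK0 : 0 < K := by positivity
  have hnp : (0 : ℝ) < n := by positivity
  refine ⟨C * (n * K ^ (n - 1)) ^ (1 / (n : ℝ)), by positivity, fun δ hδ hδ1 => ?_⟩
  have hA : MeasurableSet {g : SLR n | (∀ i j, |(g : Matrix (Fin n) (Fin n) ℝ) i j| < ρ) ∧
        |arrPair W (g : Matrix (Fin n) (Fin n) ℝ) - c| ≤ δ} := by
    refine MeasurableSet.inter
      (s₁ := {g : SLR n | ∀ i j, |(g : Matrix (Fin n) (Fin n) ℝ) i j| < ρ}) ?_ ?_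
    · simp only [Set.ofPred_forall]
      refine MeasurableSet.iInter fun i => MeasurableSet.iInter fun j => ?_
      exact measurableSet_lt (((SLR.continuous_coe n).matrix_elem i j).abs).measurable
        measurable_const
    · exact measurableSet_le ((measurable_arrPair_coe W).sub_const c).abs measurable_const
  rw [coneMeasure_apply hA]
  refine (measure_mono ?_).trans ((hvol (n * K ^ (n - 1) * δ) (by positivity)).trans (le_of_eq ?_))
  · rintro M ⟨hM0, hM1, hMρ, hMs⟩
    have ht := arrRoot_pos hM0
    have htn := arrRoot_pow hn0 hM0
    have ht1 : arrRoot M ≤ 1 := by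
      by_contra! h
      have := one_lt_pow₀ h hn0
      linarith
    have hval : ∀ i j, (arrNormalize M : Matrix (Fin n) (Fin n) ℝ) i j = (arrRoot M)⁻¹ * M j i := by
      intro i j
      rw [coe_arrNormalize hn0 hM0]
      simp
    have hM : ∀ i j, M i j = arrRoot M * (arrNormalize M : Matrix (Fin n) (Fin n) ℝ) j i := by
      intro i j
      rw [hval]; field_simp
    have hpair : arrPair V M = arrRoot M * arrPair W (arrNormalize M : Matrix (Fin n) (Fin n) ℝ) := by
      unfold arrPair
      rw [Finset.sum_comm, Finset.mul_sum]
      refine Finset.sum_congr rfl fun i _ => ?_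
      rw [Finset.mul_sum]
      refine Finset.sum_congr rfl fun j _ => ?_
      rw [hM j i]; ring
    refine ⟨fun i j => ?_, ?_⟩
    · rw [hM, abs_mul, abs_of_pos ht]
      have := hMρ j i
      nlinarith [abs_nonneg ((arrNormalize M : Matrix (Fin n) (Fin n) ℝ) j i)]
    · rw [hpair, ← htn, mul_pow, mul_comm, ← sub_mul, abs_mul]
      have h1 : |arrPair W (arrNormalize M : Matrix (Fin n) (Fin n) ℝ)| ≤ K := by
        have h2 := abs_sub_abs_le_abs_sub (arrPair W (arrNormalize M : Matrix (Fin n) (Fin n) ℝ)) c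
        linarith
      have h3 := abs_pow_sub_pow_le_mul_abs_sub h1 (by linarith : |c| ≤ K) n
      have h4 : |arrRoot M ^ n| ≤ 1 := by
        rw [abs_of_pos (by positivity)]
        exact pow_le_one₀ ht.le ht1
      calc _ ≤ (n * K ^ (n - 1) * |arrPair W (arrNormalize M : Matrix (Fin n) (Fin n) ℝ) - c|) * 1 :=
            mul_le_mul h3 h4 (abs_nonneg _) (by positivity)
        _ ≤ n * K ^ (n - 1) * δ := by
            rw [mul_one]; gcongr
  · congr 1
    rw [Real.mul_rpow (by positivity) hδ.le]
    ring

/-- The left square block of an `n × (n+1)` array. -/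
def leftBlock {R : Type*} {n : ℕ} (B : Fin n → Fin (n + 1) → R) : Matrix (Fin n) (Fin n) R :=
  Matrix.of fun i j => B i j.castSucc

/-- The last column of an `n × (n+1)` array. -/
def lastCol {R : Type*} {n : ℕ} (B : Fin n → Fin (n + 1) → R) : Fin n → R :=
  fun i => B i (Fin.last n)

/-- The generalized cross product of `n` vectors of length `n + 1`. -/
def crossVec {R : Type*} [CommRing R] {n : ℕ} (B : Fin n → Fin (n + 1) → R) : Fin (n + 1) → R :=
  Fin.snoc (α := fun _ => R) (-((leftBlock B).adjugate *ᵥ lastCol B)) (leftBlock B).det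

/-- The left block with columns scaled by the entries of the cross product. -/
def scaledBlock {R : Type*} [CommRing R] {n : ℕ} (B : Fin n → Fin (n + 1) → R) :
    Fin n → Fin n → R :=
  fun i j => B i j.castSucc * crossVec B j.castSucc

lemma measurable_snoc {n : ℕ} :
    Measurable fun p : (Fin n → ℝ) × ℝ => (Fin.snoc (α := fun _ => ℝ) p.1 p.2 : Fin (n + 1) → ℝ) := by
  refine measurable_pi_iff.2 fun i => ?_
  refine Fin.lastCases ?_ (fun j => ?_) i
  · simpa using measurable_snd
  · simp only [Fin.snoc_castSucc]
    fun_prop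

lemma coneMeasure_det_le {n : ℕ} (hn : n ≠ 0) {A : Set (SLR n)} (hA : MeasurableSet A) {u : ℝ}
    (hu : 0 < u) :
    volume {M : Fin n → Fin n → ℝ | 0 < arrDet M ∧ arrDet M ≤ u ∧ arrNormalize M ∈ A} =
      ENNReal.ofReal (u ^ n) * coneMeasure n A := by
  set s : ℝ := u ^ (1 / (n : ℝ)) with hs
  have hs0 : 0 < s := Real.rpow_pos_of_pos hu _
  have hsn : s ^ n = u := by
    rw [hs, ← Real.rpow_natCast, ← Real.rpow_mul hu.le]
    have : (n : ℝ) ≠ 0 := by exact_mod_cast hn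
    field_simp
    simp
  have hdet : ∀ M : Fin n → Fin n → ℝ, arrDet (s • M) = u * arrDet M := by
    intro M
    unfold arrDet
    rw [← hsn]
    have : Matrix.of (s • M) = s • Matrix.of M := rfl
    rw [this, Matrix.det_smul, Fintype.card_fin]
  have hnorm : ∀ M : Fin n → Fin n → ℝ, 0 < arrDet M → arrNormalize (s • M) = arrNormalize M := by
    intro M hM
    have hM' : 0 < arrDet (s • M) := by rw [hdet]; positivity
    apply Subtype.ext
    rw [coe_arrNormalize hn hM', coe_arrNormalize hn hM]
    have : arrRoot (s • M) = s * arrRoot M := by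
      unfold arrRoot
      rw [hdet, Real.mul_rpow hu.le hM.le]
    rw [this]
    ext i j
    simp only [Matrix.smul_apply, Matrix.transpose_apply, Matrix.of_apply, Pi.smul_apply, smul_eq_mul]
    field_simp
  have hset : {M : Fin n → Fin n → ℝ | 0 < arrDet M ∧ arrDet M ≤ u ∧ arrNormalize M ∈ A} =
      s • {M : Fin n → Fin n → ℝ | 0 < arrDet M ∧ arrDet M ≤ 1 ∧ arrNormalize M ∈ A} := by
    ext M
    rw [Set.mem_smul_set_iff_inv_smul_mem₀ hs0.ne']
    have hM : M = s • (s⁻¹ • M) := by rw [smul_inv_smul₀ hs0.ne']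
    set M' := s⁻¹ • M
    rw [hM]
    simp only [Set.mem_ofPred_eq, hdet]
    constructor
    · rintro ⟨h1, h2, h3⟩
      have h1' := (mul_pos_iff_of_pos_left hu).1 h1
      rw [hnorm _ h1'] at h3
      exact ⟨h1', by nlinarith, h3⟩
    · rintro ⟨h1, h2, h3⟩
      refine ⟨by positivity, by nlinarith, ?_⟩
      rwa [hnorm _ h1]
  rw [hset, coneMeasure_apply hA]
  have := Measure.addHaar_smul (volume : Measure (Fin n → Fin n → ℝ)) s
    {M : Fin n → Fin n → ℝ | 0 < arrDet M ∧ arrDet M ≤ 1 ∧ arrNormalize M ∈ A}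
  rw [this]
  congr 2
  rw [abs_of_pos (by positivity)]
  have : Module.finrank ℝ (Fin n → Fin n → ℝ) = n * n := by simp [Module.finrank_pi_fintype]
  rw [this, pow_mul, hsn]

/-- The distribution of the determinant on a cone. -/
lemma map_arrDet_restrict {n : ℕ} (hn : n ≠ 0) {A : Set (SLR n)} (hA : MeasurableSet A)
    (hfin : coneMeasure n A ≠ ⊤) :
    Measure.map arrDet ((volume : Measure (Fin n → Fin n → ℝ)).restrict
      {M | 0 < arrDet M ∧ arrNormalize M ∈ A}) =
    (volume.restrict (Set.Ioi (0 : ℝ))).withDensity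
      fun u => ENNReal.ofReal (n * u ^ (n - 1)) * coneMeasure n A := by
  have hsetm : MeasurableSet {M : Fin n → Fin n → ℝ | 0 < arrDet M ∧ arrNormalize M ∈ A} :=
    (measurable_arrDet measurableSet_Ioi).inter (measurable_arrNormalize hA)
  have hle : ∀ u : ℝ, volume {M : Fin n → Fin n → ℝ | 0 < arrDet M ∧ arrDet M ≤ u ∧
      arrNormalize M ∈ A} = ENNReal.ofReal ((max u 0) ^ n) * coneMeasure n A := by
    intro u
    rcases lt_or_ge 0 u with hu | hu
    · rw [coneMeasure_det_le hn hA hu, max_eq_left hu.le]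
    · rw [max_eq_right hu, zero_pow hn]
      simp only [ENNReal.ofReal_zero, zero_mul]
      convert measure_empty (μ := (volume : Measure (Fin n → Fin n → ℝ)))
      ext M
      simp only [Set.mem_ofPred_eq, Set.mem_empty_iff_false, iff_false]
      rintro ⟨h1, h2, -⟩
      linarith
  have hleft : ∀ a b : ℝ, a < b → Measure.map arrDet ((volume : Measure (Fin n → Fin n → ℝ)).restrict
      {M | 0 < arrDet M ∧ arrNormalize M ∈ A}) (Set.Ioc a b) =
      (ENNReal.ofReal ((max b 0) ^ n) - ENNReal.ofReal ((max a 0) ^ n)) * coneMeasure n A := by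
    intro a b hab
    rw [Measure.map_apply measurable_arrDet measurableSet_Ioc,
      Measure.restrict_apply (measurable_arrDet measurableSet_Ioc)]
    have hm : ∀ u : ℝ, MeasurableSet {M : Fin n → Fin n → ℝ | 0 < arrDet M ∧ arrDet M ≤ u ∧
        arrNormalize M ∈ A} := fun u =>
      (measurable_arrDet measurableSet_Ioi).inter
        ((measurable_arrDet measurableSet_Iic).inter (measurable_arrNormalize hA))
    have hs : arrDet ⁻¹' Set.Ioc a b ∩ {M : Fin n → Fin n → ℝ | 0 < arrDet M ∧ arrNormalize M ∈ A} =
        {M : Fin n → Fin n → ℝ | 0 < arrDet M ∧ arrDet M ≤ b ∧ arrNormalize M ∈ A} \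
        {M : Fin n → Fin n → ℝ | 0 < arrDet M ∧ arrDet M ≤ a ∧ arrNormalize M ∈ A} := by
      ext M
      simp only [Set.mem_inter_iff, Set.mem_preimage, Set.mem_Ioc, Set.mem_ofPred_eq, Set.mem_sdiff]
      constructor
      · rintro ⟨⟨h1, h2⟩, h3, h4⟩
        exact ⟨⟨h3, h2, h4⟩, fun h => by linarith [h.2.1]⟩
      · rintro ⟨⟨h1, h2, h3⟩, h4⟩
        refine ⟨⟨?_, h2⟩, h1, h3⟩
        by_contra! h
        exact h4 ⟨h1, h, h3⟩
    rw [hs, measure_sdiff _ (hm a).nullMeasurableSet, hle, hle, ENNReal.sub_mul fun _ _ => hfin]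
    · rw [hle]; exact ENNReal.mul_ne_top ENNReal.ofReal_ne_top hfin
    · exact fun M hM => ⟨hM.1, hM.2.1.trans hab.le, hM.2.2⟩
  refine Measure.ext_of_Ioc' _ _ (fun a b hab => ?_) fun a b hab => ?_
  · rw [hleft a b hab]
    exact ENNReal.mul_ne_top (ENNReal.sub_ne_top ENNReal.ofReal_ne_top) hfin
  · rw [hleft a b hab, withDensity_apply _ measurableSet_Ioc,
      Measure.restrict_restrict measurableSet_Ioc,
      lintegral_mul_const _ (by fun_prop)]
    congr 1
    have hs : Set.Ioc a b ∩ Set.Ioi 0 = Set.Ioc (max a 0) (max b 0) := by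
      ext u
      simp only [Set.mem_inter_iff, Set.mem_Ioc, Set.mem_Ioi, max_lt_iff, le_max_iff]
      constructor
      · rintro ⟨⟨h1, h2⟩, h3⟩; exact ⟨⟨h1, h3⟩, Or.inl h2⟩
      · rintro ⟨⟨h1, h3⟩, h2⟩
        exact ⟨⟨h1, h2.resolve_right (not_le.2 h3)⟩, h3⟩
    have hmax : max a 0 ≤ max b 0 := max_le_max_right 0 hab.le
    rw [hs, ← ofReal_integral_eq_lintegral_ofReal, ← intervalIntegral.integral_of_le hmax,
      ← ENNReal.ofReal_sub _ (by positivity)]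
    · congr 1
      rw [intervalIntegral.integral_const_mul, integral_pow]
      have h1 : n - 1 + 1 = n := by omega
      have h2 : ((n - 1 : ℕ) : ℝ) + 1 = n := by exact_mod_cast h1
      rw [h1, h2]
      have : (n : ℝ) ≠ 0 := by exact_mod_cast hn
      field_simp
    · exact (by fun_prop : Continuous fun u : ℝ => (n : ℝ) * u ^ (n - 1)).integrableOn_Icc.mono_set
        Set.Ioc_subset_Icc_self
    · refine (ae_restrict_iff' measurableSet_Ioc).2 (Filter.Eventually.of_forall fun u hu => ?_)
      have : 0 < u := (le_max_right a 0).trans_lt hu.1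
      change (0 : ℝ) ≤ _
      positivity

lemma lintegral_scaled_cone {n : ℕ} (hn : n ≠ 0) {A : Set (SLR n)} (hA : MeasurableSet A)
    (hfin : coneMeasure n A ≠ ⊤) {a : Fin n → ℝ} (ha : ∀ i, 0 < a i) {E : Set ℝ}
    (hE : MeasurableSet E) (hE0 : E ⊆ Set.Ioi 0) :
    ∫⁻ N : Fin n → Fin n → ℝ, ENNReal.ofReal ((arrDet N ^ (n - 1))⁻¹) *
      Set.indicator {N | arrDet N ∈ E ∧ arrNormalize (fun i j => N i j * a j) ∈ A} 1 N =
    n * coneMeasure n A * volume E := by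
  set p : ℝ := ∏ i, a i with hp
  have hp0 : 0 < p := Finset.prod_pos fun i _ => ha i
  set K : Matrix (Fin n) (Fin n) ℝ := Matrix.diagonal a with hK
  have hKdet : K.det = p := by rw [hK, Matrix.det_diagonal]
  have hrow : ∀ N : Fin n → Fin n → ℝ, (fun i => N i ᵥ* K) = fun i j => N i j * a j := by
    intro N
    ext i j
    rw [hK, Matrix.vecMul_diagonal]
  set φ : ℝ → ENNReal := fun u => ENNReal.ofReal (((u / p) ^ (n - 1))⁻¹) *
    Set.indicator {u | u / p ∈ E} 1 u with hφ
  have hEm : MeasurableSet {u : ℝ | u / p ∈ E} := (measurable_id.div_const p) hE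
  have hφm : Measurable φ := by
    refine Measurable.mul (by fun_prop) ?_
    exact measurable_one.indicator hEm
  set S : Set (Fin n → Fin n → ℝ) := {M | 0 < arrDet M ∧ arrNormalize M ∈ A} with hS
  have hSm : MeasurableSet S :=
    (measurable_arrDet measurableSet_Ioi).inter (measurable_arrNormalize hA)
  set F : (Fin n → Fin n → ℝ) → ENNReal := S.indicator fun M => φ (arrDet M) with hF
  have hFm : Measurable F := (hφm.comp measurable_arrDet).indicator hSm
  have h1 : ∀ N : Fin n → Fin n → ℝ, ENNReal.ofReal ((arrDet N ^ (n - 1))⁻¹) *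
      Set.indicator {N | arrDet N ∈ E ∧ arrNormalize (fun i j => N i j * a j) ∈ A} 1 N =
      F (fun i => N i ᵥ* K) := by
    intro N
    have hd : arrDet (fun i => N i ᵥ* K) / p = arrDet N := by
      rw [arrDet_mul_right, hKdet]; field_simp
    have hd0 : 0 < arrDet (fun i => N i ᵥ* K) ↔ 0 < arrDet N := by
      rw [arrDet_mul_right, hKdet]; exact mul_pos_iff_of_pos_right hp0
    by_cases h2 : arrDet N ∈ E
    · have h3 : 0 < arrDet N := hE0 h2
      have h4 : Set.indicator {u : ℝ | u / p ∈ E} (1 : ℝ → ENNReal)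
          (arrDet fun i => N i ᵥ* K) = 1 := by
        rw [Set.indicator_of_mem]
        · rfl
        · change _ / p ∈ E
          rwa [hd]
      by_cases h5 : arrNormalize (fun i j => N i j * a j) ∈ A
      · have h6 : (fun i => N i ᵥ* K) ∈ S := ⟨hd0.2 h3, by rwa [hrow]⟩
        rw [Set.indicator_of_mem (s := {N : Fin n → Fin n → ℝ | arrDet N ∈ E ∧
          arrNormalize (fun i j => N i j * a j) ∈ A}) ⟨h2, h5⟩, hF, Set.indicator_of_mem h6]
        change _ = ENNReal.ofReal (((arrDet (fun i => N i ᵥ* K) / p) ^ (n - 1))⁻¹) * _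
        rw [h4, hd]
        rfl
      · have h6 : (fun i => N i ᵥ* K) ∉ S := fun h => h5 (by rw [← hrow]; exact h.2)
        rw [Set.indicator_of_notMem (show N ∉ {N | _} from fun h => h5 h.2), hF,
          Set.indicator_of_notMem h6, mul_zero]
    · have h4 : Set.indicator {u : ℝ | u / p ∈ E} (1 : ℝ → ENNReal)
          (arrDet fun i => N i ᵥ* K) = 0 := by
        rw [Set.indicator_of_notMem]
        change ¬ _ / p ∈ E
        rwa [hd]
      rw [Set.indicator_of_notMem (show N ∉ {N | _} from fun h => h2 h.1), mul_zero, hF,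
        Set.indicator_apply_eq_zero.2]
      intro _
      change _ * _ = _
      rw [h4, mul_zero]
  rw [lintegral_congr h1, ← lintegral_map (g := fun M : Fin n → Fin n → ℝ => fun i => M i ᵥ* K) hFm
    (by fun_prop), map_mul_right_volume K (by rw [hKdet]; exact hp0.ne'), lintegral_smul_measure,
    hF, lintegral_indicator hSm, ← lintegral_map hφm measurable_arrDet,
    map_arrDet_restrict hn hA hfin, lintegral_withDensity_eq_lintegral_mul _ (by fun_prop) hφm]
  have h4 : ∀ u ∈ Set.Ioi (0 : ℝ), ((fun u => ENNReal.ofReal (n * u ^ (n - 1)) * coneMeasure n A) * φ) u =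
      ENNReal.ofReal (n * p ^ (n - 1)) * coneMeasure n A * Set.indicator {u | u / p ∈ E} 1 u := by
    intro u hu
    have hu0 : (0 : ℝ) < u := hu
    simp only [Pi.mul_apply, hφ]
    have h5 : ENNReal.ofReal (n * u ^ (n - 1)) * ENNReal.ofReal (((u / p) ^ (n - 1))⁻¹) =
        ENNReal.ofReal (n * p ^ (n - 1)) := by
      rw [← ENNReal.ofReal_mul (by positivity)]
      congr 1
      rw [div_pow]
      field_simp
    rw [← h5]
    ring
  rw [setLIntegral_congr_fun measurableSet_Ioi h4,
    lintegral_const_mul _ (measurable_one.indicator hEm), lintegral_indicator_one hEm,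
    Measure.restrict_apply hEm]
  have h6 : {u : ℝ | u / p ∈ E} ∩ Set.Ioi 0 = (fun u => p⁻¹ * u) ⁻¹' E := by
    ext u
    simp only [Set.mem_inter_iff, Set.mem_ofPred_eq, Set.mem_Ioi, Set.mem_preimage,
      div_eq_inv_mul, and_iff_left_iff_imp]
    intro h
    have h7 : 0 < p⁻¹ * u := hE0 h
    exact (mul_pos_iff_of_pos_left (inv_pos.2 hp0)).1 h7
  rw [h6, Real.volume_preimage_mul_left (inv_ne_zero hp0.ne'), hKdet, inv_inv, abs_of_pos hp0,
    smul_eq_mul]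
  have h8 : ENNReal.ofReal (p⁻¹ ^ n) * (ENNReal.ofReal (n * p ^ (n - 1)) * ENNReal.ofReal p) = n := by
    rw [← ENNReal.ofReal_mul (by positivity), ← ENNReal.ofReal_mul (by positivity),
      ← ENNReal.ofReal_natCast]
    congr 1
    have : p ^ n = p ^ (n - 1) * p := by rw [← pow_succ]; congr 1; omega
    rw [inv_pow, this]
    field_simp
  calc _ = ENNReal.ofReal (p⁻¹ ^ n) * (ENNReal.ofReal (n * p ^ (n - 1)) * ENNReal.ofReal p) *
        coneMeasure n A * volume E := by ring
    _ = _ := by rw [h8]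

/-- Splitting off the last column is volume preserving. -/
lemma measurePreserving_split (n : ℕ) :
    MeasurePreserving (fun B : Fin n → Fin (n + 1) → ℝ =>
      (lastCol B, (fun i j => B i (Fin.castSucc j) : Fin n → Fin n → ℝ))) volume
      ((volume : Measure (Fin n → ℝ)).prod (volume : Measure (Fin n → Fin n → ℝ))) := by
  have h1 := volume_preserving_piFinSuccAbove (fun _ : Fin (n + 1) => ℝ) (Fin.last n)
  have h2 := volume_preserving_pi fun _ : Fin n => h1
  have h3 := (volume_measurePreserving_arrowProdEquivProdArrow ℝ (Fin n → ℝ) (Fin n)).comp h2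
  have h4 : (fun B : Fin n → Fin (n + 1) → ℝ =>
      (lastCol B, (fun i j => B i (Fin.castSucc j) : Fin n → Fin n → ℝ))) =
      (MeasurableEquiv.arrowProdEquivProdArrow ℝ (Fin n → ℝ) (Fin n)) ∘ fun a i =>
        (MeasurableEquiv.piFinSuccAbove (fun _ => ℝ) (Fin.last n)) (a i) := by
    funext B
    simp [MeasurableEquiv.arrowProdEquivProdArrow, Equiv.arrowProdEquivProdArrow,
      MeasurableEquiv.piFinSuccAbove]
    exact ⟨rfl, rfl⟩
  rw [h4]
  exact h3

lemma volume_snoc_prod {n : ℕ} {D : Set (Fin (n + 1) → ℝ)} (hD : MeasurableSet D) :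
    ∫⁻ a : Fin n → ℝ, volume {q : ℝ | Fin.snoc (α := fun _ => ℝ) a q ∈ D} = volume D := by
  have h1 := (volume_preserving_piFinSuccAbove (fun _ : Fin (n + 1) => ℝ) (Fin.last n)).symm
  rw [← h1.measure_preimage hD.nullMeasurableSet]
  have hm : MeasurableSet ((MeasurableEquiv.piFinSuccAbove (fun _ : Fin (n + 1) => ℝ) (Fin.last n)).symm ⁻¹' D) :=
    (MeasurableEquiv.measurable _) hD
  have hv : (volume : Measure (ℝ × (Fin n → ℝ))) = volume.prod volume := rfl
  change _ = (volume : Measure (ℝ × (Fin n → ℝ))) _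
  rw [hv, Measure.prod_apply_symm hm]
  refine lintegral_congr fun a => ?_
  congr 1
  ext q
  simp only [Set.mem_ofPred_eq, Set.mem_preimage]
  have : (MeasurableEquiv.piFinSuccAbove (fun _ : Fin (n + 1) => ℝ) (Fin.last n)).symm (q, a) =
      Fin.snoc (α := fun _ => ℝ) a q := by
    simp [MeasurableEquiv.piFinSuccAbove, Fin.insertNthEquiv, Fin.insertNth_last']
  rw [this]

lemma measurableSet_crossVec {n : ℕ} {A : Set (SLR n)} (hA : MeasurableSet A)
    {D : Set (Fin (n + 1) → ℝ)} (hD : MeasurableSet D) :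
    MeasurableSet {p : (Fin n → ℝ) × (Fin n → Fin n → ℝ) |
      Fin.snoc (α := fun _ => ℝ) p.1 (arrDet p.2) ∈ D ∧
        arrNormalize (fun i j => p.2 i j * p.1 j) ∈ A} := by
  refine MeasurableSet.inter
    (s₁ := {p : (Fin n → ℝ) × (Fin n → Fin n → ℝ) |
      Fin.snoc (α := fun _ => ℝ) p.1 (arrDet p.2) ∈ D}) ?_ ?_
  · exact (measurable_snoc.comp (measurable_fst.prodMk (measurable_arrDet.comp measurable_snd))) hD
  · refine (measurable_arrNormalize.comp ?_) hA
    fun_prop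

/-- The volume of the set of bases with prescribed cross product and prescribed scaled shape. -/
lemma volume_crossVec {n : ℕ} (hn : n ≠ 0) {A : Set (SLR n)} (hA : MeasurableSet A)
    (hfin : coneMeasure n A ≠ ⊤) {D : Set (Fin (n + 1) → ℝ)} (hD : MeasurableSet D)
    (hD0 : ∀ x ∈ D, ∀ i, 0 < x i) :
    volume {B : Fin n → Fin (n + 1) → ℝ | crossVec B ∈ D ∧ arrNormalize (scaledBlock B) ∈ A} =
      n * coneMeasure n A * volume D := by
  set T' : Set ((Fin n → ℝ) × (Fin n → Fin n → ℝ)) := {p |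
      Fin.snoc (α := fun _ => ℝ) p.1 (arrDet p.2) ∈ D ∧
        arrNormalize (fun i j => p.2 i j * p.1 j) ∈ A} with hT'
  have hT'm : MeasurableSet T' := measurableSet_crossVec hA hD
  set τ : (Fin n → ℝ) × (Fin n → Fin n → ℝ) → (Fin n → ℝ) × (Fin n → Fin n → ℝ) :=
    fun p => (-((Matrix.of p.2).adjugate *ᵥ p.1), p.2) with hτ
  have hτm : Measurable τ := by
    have hc : Continuous τ := by
      refine Continuous.prodMk ?_ continuous_snd
      have h1 : Continuous fun p : (Fin n → ℝ) × (Fin n → Fin n → ℝ) => (Matrix.of p.2).adjugate :=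
        Continuous.matrix_adjugate continuous_snd
      exact (h1.matrix_mulVec continuous_fst).neg
    exact hc.measurable
  have hset : {B : Fin n → Fin (n + 1) → ℝ | crossVec B ∈ D ∧ arrNormalize (scaledBlock B) ∈ A} =
      (fun B : Fin n → Fin (n + 1) → ℝ =>
      (lastCol B, (fun i j => B i (Fin.castSucc j) : Fin n → Fin n → ℝ))) ⁻¹' (τ ⁻¹' T') := by
    ext B
    have h1 : scaledBlock B = fun i j => B i j.castSucc *
        (-((Matrix.of fun i j => B i (Fin.castSucc j)).adjugate *ᵥ lastCol B)) j := by
      funext i j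
      rw [scaledBlock, crossVec, Fin.snoc_castSucc]
      rfl
    change crossVec B ∈ D ∧ arrNormalize (scaledBlock B) ∈ A ↔ _
    rw [h1]
    rfl
  rw [hset, (measurePreserving_split n).measure_preimage (hτm hT'm).nullMeasurableSet,
    Measure.prod_apply_symm (hτm hT'm)]
  have hstep : ∀ N : Fin n → Fin n → ℝ,
      volume ((fun x => (x, N)) ⁻¹' (τ ⁻¹' T')) = ∫⁻ a : Fin n → ℝ,
        ENNReal.ofReal ((arrDet N ^ (n - 1))⁻¹) * T'.indicator (fun _ => (1 : ENNReal)) (a, N) := by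
    intro N
    have hsec : MeasurableSet ((fun x => (x, N)) ⁻¹' T') := measurable_prodMk_right hT'm
    have hR : ∫⁻ a : Fin n → ℝ,
        ENNReal.ofReal ((arrDet N ^ (n - 1))⁻¹) * T'.indicator (fun _ => (1 : ENNReal)) (a, N) =
        ENNReal.ofReal ((arrDet N ^ (n - 1))⁻¹) * volume ((fun x => (x, N)) ⁻¹' T') := by
      rw [lintegral_const_mul, ← lintegral_indicator_one hsec]
      · rfl
      · exact (measurable_one.indicator hT'm).comp measurable_prodMk_right
    rw [hR]
    by_cases hq : 0 < arrDet N
    · have hlin : ((fun x => (x, N)) ⁻¹' (τ ⁻¹' T')) =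
          (Matrix.toLin' (-(Matrix.of N).adjugate)) ⁻¹' ((fun x => (x, N)) ⁻¹' T') := by
        ext r
        simp only [Set.mem_preimage, hτ, Matrix.toLin'_apply, Matrix.neg_mulVec]
      have hdet : LinearMap.det (Matrix.toLin' (-(Matrix.of N).adjugate)) =
          (-1) ^ n * arrDet N ^ (n - 1) := by
        rw [LinearMap.det_toLin', Matrix.det_neg, Matrix.det_adjugate, Fintype.card_fin]
        rfl
      rw [hlin, Measure.addHaar_preimage_linearMap _ (by rw [hdet]; positivity), hdet]
      congr 2
      rw [abs_inv, abs_mul, abs_pow, abs_neg, abs_one, one_pow, one_mul, abs_of_pos (by positivity)]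
    · have hempty : ∀ x, (x, N) ∉ T' := by
        intro x hx
        have := hD0 _ hx.1 (Fin.last n)
        rw [Fin.snoc_last] at this
        exact hq this
      have e1 : ((fun x => (x, N)) ⁻¹' T') = ∅ := by
        ext x; simp [hempty]
      have e2 : ((fun x => (x, N)) ⁻¹' (τ ⁻¹' T')) = ∅ := by
        ext x
        simp only [Set.mem_preimage, Set.mem_empty_iff_false, iff_false]
        exact hempty _
      rw [e1, e2]
      simp
  have hmeas : Measurable (Function.uncurry fun (N : Fin n → Fin n → ℝ) (a : Fin n → ℝ) =>
      ENNReal.ofReal ((arrDet N ^ (n - 1))⁻¹) * T'.indicator (fun _ => (1 : ENNReal)) (a, N)) := by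
    refine Measurable.mul ?_ ?_
    · exact (((measurable_arrDet.comp measurable_fst).pow_const _).inv).ennreal_ofReal
    · exact (measurable_one.indicator hT'm).comp measurable_swap
  rw [lintegral_congr hstep, lintegral_lintegral_swap hmeas.aemeasurable, ← volume_snoc_prod hD,
    ← lintegral_const_mul]
  · refine lintegral_congr fun a => ?_
    by_cases ha : ∀ i, 0 < a i
    · have hE : MeasurableSet {q : ℝ | Fin.snoc (α := fun _ => ℝ) a q ∈ D} :=
        (measurable_snoc.comp measurable_prodMk_left) hD
      rw [← lintegral_scaled_cone hn hA hfin ha hE]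
      · rfl
      · intro q hq
        have := hD0 _ hq (Fin.last n)
        rwa [Fin.snoc_last] at this
    · push Not at ha
      obtain ⟨i, hi⟩ := ha
      have hno : ∀ q : ℝ, (Fin.snoc (α := fun _ => ℝ) a q : Fin (n + 1) → ℝ) ∉ D := by
        intro q hq
        have := hD0 _ hq i.castSucc
        rw [Fin.snoc_castSucc] at this
        linarith
      have hno' : ∀ N, (a, N) ∉ T' := fun N h => hno _ h.1
      simp [hno, hno']
  · have hm : MeasurableSet {p : (Fin n → ℝ) × ℝ | (Fin.snoc (α := fun _ => ℝ) p.1 p.2 : Fin (n + 1) → ℝ) ∈ D} :=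
      measurable_snoc hD
    exact measurable_measure_prodMk_left hm

lemma abs_prod_sub_pow_le {ι : Type*} (s : Finset ι) (x : ι → ℝ) (y : ℝ) (hy : 1 ≤ y)
    (hx : ∀ i ∈ s, |x i - y| ≤ 1) :
    |∏ i ∈ s, x i - y ^ s.card| ≤ s.card * (2 * y) ^ s.card / y := by
  classical
  induction s using Finset.induction_on with
  | empty => simp
  | insert a s ha ih =>
    have ih' := ih fun i hi => hx i (Finset.mem_insert_of_mem hi)
    have hxa := hx a (Finset.mem_insert_self a s)
    rw [Finset.prod_insert ha, Finset.card_insert_of_notMem ha]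
    set P := ∏ i ∈ s, x i
    have hxa2 : |x a| ≤ 2 * y := by
      have := abs_le.1 hxa
      rw [abs_le]; constructor <;> linarith
    have h1 : x a * P - y ^ (s.card + 1) = x a * (P - y ^ s.card) + (x a - y) * y ^ s.card := by
      ring
    have hpow : y ^ s.card ≤ (2 * y) ^ s.card := by gcongr; linarith
    have hy0 : 0 < y := by linarith
    calc |x a * P - y ^ (s.card + 1)|
        ≤ |x a * (P - y ^ s.card)| + |(x a - y) * y ^ s.card| := by rw [h1]; exact abs_add_le _ _
      _ ≤ 2 * y * (s.card * (2 * y) ^ s.card / y) + 1 * (2 * y) ^ s.card := by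
          rw [abs_mul, abs_mul, abs_of_pos (pow_pos hy0 _)]
          gcongr
      _ ≤ _ := by
          push_cast
          rw [pow_succ]
          have : 0 < (2 * y) ^ s.card := by positivity
          field_simp
          nlinarith

lemma abs_card_Ico_intCast_eq_sub_le (a : ℤ) (h k : ℕ) (hk : 0 < k) (ρ : ZMod k) :
    |((((Finset.Ico a (a + h)).filter fun b : ℤ => (b : ZMod k) = ρ).card : ℝ)) - h / k| ≤ 1 := by
  obtain ⟨v, rfl⟩ := ZMod.intCast_surjective ρ
  have h1 : ((Finset.Ico a (a + h)).filter fun b : ℤ => (b : ZMod k) = (v : ZMod k))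
      = (Finset.Ico a (a + h)).filter fun b : ℤ => b ≡ v [ZMOD k] := by
    ext b; simp [ZMod.intCast_eq_intCast_iff]
  rw [h1]
  have h2 := Int.Ico_filter_modEq_card (a := a) (b := a + h) (r := (k : ℤ)) (by exact_mod_cast hk) v
  have hk' : (0 : ℚ) < k := by exact_mod_cast hk
  set n := ((Finset.Ico a (a + h)).filter fun b : ℤ => b ≡ v [ZMOD k]).card
  set A := ⌈((a + h : ℤ) - v : ℚ) / ((k : ℤ) : ℚ)⌉
  set B := ⌈((a : ℤ) - v : ℚ) / ((k : ℤ) : ℚ)⌉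
  have e1 : (((a + h : ℤ) - v : ℚ) / ((k : ℤ) : ℚ)) = ((a : ℤ) - v : ℚ) / ((k : ℤ) : ℚ) + h / k := by
    push_cast; field_simp; ring
  have hh : (0 : ℚ) ≤ h / k := by positivity
  have hAB : B ≤ A := Int.ceil_mono (by rw [e1]; linarith)
  have h3 : (n : ℤ) = A - B := by rw [h2]; exact max_eq_left (by linarith)
  have a1 := Int.le_ceil (((a + h : ℤ) - v : ℚ) / ((k : ℤ) : ℚ))
  have a2 := Int.ceil_lt_add_one (((a + h : ℤ) - v : ℚ) / ((k : ℤ) : ℚ))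
  have b1 := Int.le_ceil (((a : ℤ) - v : ℚ) / ((k : ℤ) : ℚ))
  have b2 := Int.ceil_lt_add_one (((a : ℤ) - v : ℚ) / ((k : ℤ) : ℚ))
  have h4 : |((n : ℚ)) - h / k| ≤ 1 := by
    have : (n : ℚ) = A - B := by exact_mod_cast h3
    rw [this, abs_le]
    constructor <;> linarith
  have h5 : ((|((n : ℚ)) - h / k| : ℚ) : ℝ) ≤ ((1 : ℚ) : ℝ) := by exact_mod_cast h4
  push_cast at h5
  exact h5

/-- A cube of integer points with side `h`. -/
def intCube {ι : Type*} [Fintype ι] [DecidableEq ι] (x : ι → ℤ) (h : ℕ) : Finset (ι → ℤ) :=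
  Fintype.piFinset fun i => Finset.Ico (x i) (x i + h)

lemma mem_intCube {ι : Type*} [Fintype ι] [DecidableEq ι] {x b : ι → ℤ} {h : ℕ} :
    b ∈ intCube x h ↔ ∀ i, x i ≤ b i ∧ b i < x i + h := by
  simp [intCube]

lemma card_intCube {ι : Type*} [Fintype ι] [DecidableEq ι] (x : ι → ℤ) (h : ℕ) :
    (intCube x h).card = h ^ Fintype.card ι := by
  simp [intCube]

lemma card_good_residues {d : ℕ} (k : ℕ) [NeZero k] (V U : Matrix (Fin d) (Fin d) ℤ)
    (hVU : V * U = 1) (I : Finset (Fin d)) :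
    (Finset.univ.filter fun ρ : Fin d → ZMod k =>
      ∀ i ∈ I, ((V.map (Int.cast : ℤ → ZMod k)) *ᵥ ρ) i = 0).card = k ^ (d - I.card) := by
  classical
  set V' := V.map (Int.cast : ℤ → ZMod k)
  set U' := U.map (Int.cast : ℤ → ZMod k)
  have h1 : V' * U' = 1 := by
    have := congrArg (Int.castRingHom (ZMod k)).mapMatrix hVU
    rwa [map_mul, map_one] at this
  have h2 : U' * V' = 1 := mul_eq_one_comm.1 h1
  have h3 : (Fintype.piFinset fun i => if i ∈ I then ({0} : Finset (ZMod k)) else Finset.univ).card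
      = k ^ (d - I.card) := by
    rw [Fintype.card_piFinset]
    have : ∀ i, (if i ∈ I then ({0} : Finset (ZMod k)) else Finset.univ).card
        = if i ∈ I then 1 else k := by
      intro i; split_ifs <;> simp [ZMod.card]
    simp only [this]
    rw [Finset.prod_ite]
    simp only [Finset.prod_const_one, Finset.prod_const, one_mul]
    congr 1
    rw [Finset.filter_not]
    simp [Finset.card_sdiff]
  rw [← h3]
  refine Finset.card_bij' (fun ρ _ => V' *ᵥ ρ) (fun y _ => U' *ᵥ y) ?_ ?_ ?_ ?_
  · intro ρ hρ
    rw [Fintype.mem_piFinset]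
    intro i
    split_ifs with hi
    · simpa using (Finset.mem_filter.1 hρ).2 i hi
    · simp
  · intro y hy
    rw [Finset.mem_filter]
    refine ⟨Finset.mem_univ _, fun i hi => ?_⟩
    rw [Matrix.mulVec_mulVec, h1, Matrix.one_mulVec]
    have := Fintype.mem_piFinset.1 hy i
    simpa [hi] using this
  · intro ρ _
    simp [Matrix.mulVec_mulVec, h2]
  · intro ρ _
    simp [Matrix.mulVec_mulVec, h1]

lemma abs_card_dvd_sub_le {d : ℕ} (h k : ℕ) (hk : 0 < k) (hkh : k ≤ h) (V U : Matrix (Fin d) (Fin d) ℤ)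
    (hVU : V * U = 1) (I : Finset (Fin d)) (x : Fin d → ℤ) :
    |(((intCube x h).filter fun b => ∀ i ∈ I, (k : ℤ) ∣ (V *ᵥ b) i).card : ℝ)
      - (h : ℝ) ^ d / (k : ℝ) ^ I.card| ≤ d * 2 ^ d * ((h : ℝ) ^ d / (k : ℝ) ^ I.card) * (k / h) := by
  classical
  have : NeZero k := ⟨hk.ne'⟩
  set G := Finset.univ.filter fun ρ : Fin d → ZMod k =>
      ∀ i ∈ I, ((V.map (Int.cast : ℤ → ZMod k)) *ᵥ ρ) i = 0
  have hG := card_good_residues k V U hVU I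
  have hIc : I.card ≤ d := by simpa using Finset.card_le_univ I
  have hk0 : (0 : ℝ) < k := by exact_mod_cast hk
  have hh0 : (0 : ℝ) < h := by exact_mod_cast lt_of_lt_of_le hk hkh
  have hy1 : (1 : ℝ) ≤ h / k := by rw [le_div_iff₀ hk0, one_mul]; exact_mod_cast hkh
  set S := (intCube x h).filter fun b => ∀ i ∈ I, (k : ℤ) ∣ (V *ᵥ b) i
  have hcast : ∀ b : Fin d → ℤ, ∀ i, ((V.map (Int.cast : ℤ → ZMod k)) *ᵥ fun i => (b i : ZMod k)) i
      = (((V *ᵥ b) i : ℤ) : ZMod k) := by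
    intro b i
    simp [Matrix.mulVec, dotProduct]
  have hmaps : ∀ b ∈ S, (fun i => (b i : ZMod k)) ∈ G := by
    intro b hb
    refine Finset.mem_filter.2 ⟨Finset.mem_univ _, fun i hi => ?_⟩
    rw [hcast, ZMod.intCast_zmod_eq_zero_iff_dvd]
    exact (Finset.mem_filter.1 hb).2 i hi
  have hfib : ∀ ρ ∈ G, (S.filter fun b => (fun i => (b i : ZMod k)) = ρ).card
      = ∏ i, ((Finset.Ico (x i) (x i + h)).filter fun b : ℤ => (b : ZMod k) = ρ i).card := by
    intro ρ hρ
    rw [← Fintype.card_piFinset]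
    congr 1
    ext b
    simp only [S, intCube, Finset.mem_filter, Fintype.mem_piFinset]
    constructor
    · rintro ⟨⟨h1, -⟩, rfl⟩ i
      exact ⟨h1 i, rfl⟩
    · intro h1
      have hb : (fun i => (b i : ZMod k)) = ρ := funext fun i => (h1 i).2
      refine ⟨⟨fun i => (h1 i).1, fun i hi => ?_⟩, hb⟩
      rw [← ZMod.intCast_zmod_eq_zero_iff_dvd, ← hcast, hb]
      exact (Finset.mem_filter.1 hρ).2 i hi
  have hcard : (S.card : ℝ) = ∑ ρ ∈ G,
      ∏ i, (((Finset.Ico (x i) (x i + h)).filter fun b : ℤ => (b : ZMod k) = ρ i).card : ℝ) := by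
    rw [Finset.card_eq_sum_card_fiberwise hmaps]
    push_cast
    refine Finset.sum_congr rfl fun ρ hρ => ?_
    rw [hfib ρ hρ]; push_cast; rfl
  have hmain : (h : ℝ) ^ d / (k : ℝ) ^ I.card = ∑ ρ ∈ G, ((h : ℝ) / k) ^ d := by
    rw [Finset.sum_const, hG, nsmul_eq_mul]
    push_cast
    rw [div_pow]
    have : (k : ℝ) ^ d = k ^ (d - I.card) * k ^ I.card := by rw [← pow_add]; congr 1; omega
    rw [this]
    field_simp
  rw [hcard, hmain, ← Finset.sum_sub_distrib]
  refine (Finset.abs_sum_le_sum_abs _ _).trans ?_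
  rw [Finset.mul_sum, Finset.sum_mul]
  refine Finset.sum_le_sum fun ρ _ => ?_
  have := abs_prod_sub_pow_le Finset.univ (fun i => (((Finset.Ico (x i) (x i + h)).filter
    fun b : ℤ => (b : ZMod k) = ρ i).card : ℝ)) ((h : ℝ) / k) hy1
    (fun i _ => abs_card_Ico_intCast_eq_sub_le (x i) h k hk (ρ i))
  simp only [Finset.card_univ, Fintype.card_fin] at this
  refine this.trans (le_of_eq ?_)
  rw [mul_pow]
  field_simp

lemma card_dvd_le {d : ℕ} (h k : ℕ) (hk : 0 < k) (hkh : k ≤ h) (V U : Matrix (Fin d) (Fin d) ℤ)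
    (hVU : V * U = 1) (I : Finset (Fin d)) (x : Fin d → ℤ) :
    (((intCube x h).filter fun b => ∀ i ∈ I, (k : ℤ) ∣ (V *ᵥ b) i).card : ℝ)
      ≤ (d * 2 ^ d + 1) * ((h : ℝ) ^ d / (k : ℝ) ^ I.card) := by
  have h1 := (abs_le.1 (abs_card_dvd_sub_le h k hk hkh V U hVU I x)).2
  have hk0 : (0 : ℝ) < k := by exact_mod_cast hk
  have hh0 : (0 : ℝ) < h := by exact_mod_cast lt_of_lt_of_le hk hkh
  have : (k : ℝ) / h ≤ 1 := by rw [div_le_one hh0]; exact_mod_cast hkh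
  have h2 : d * 2 ^ d * ((h : ℝ) ^ d / (k : ℝ) ^ I.card) * (k / h) ≤
    d * 2 ^ d * ((h : ℝ) ^ d / (k : ℝ) ^ I.card) * 1 := by gcongr
  linarith

lemma exists_dvd_mem_Ioc {g s : ℕ} (hs : 2 ≤ s) (hg : s * s < g ∨ g = 0)
    (hp : ∀ p, p.Prime → p ∣ g → p ≤ s * s) : ∃ k, s < k ∧ k ≤ s * s ∧ k ∣ g := by
  classical
  rcases hg with hg | rfl
  · have hne : ((Finset.Icc 1 (s * s)).filter fun k => k ∣ g).Nonempty :=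
      ⟨1, by simp; nlinarith⟩
    obtain ⟨k, hk, hmax⟩ := Finset.exists_max_image _ id hne
    simp only [Finset.mem_filter, Finset.mem_Icc, id] at hk hmax
    refine ⟨k, ?_, hk.1.2, hk.2⟩
    by_contra hks
    push Not at hks
    obtain ⟨c, rfl⟩ := hk.2
    have hc : c ≠ 1 := by rintro rfl; nlinarith
    obtain ⟨p, hp1, hp2⟩ := Nat.exists_prime_and_dvd hc
    have hpg : p ∣ k * c := hp2.mul_left k
    have hps := hp p hp1 hpg
    have h2 := hp1.two_le
    by_cases hp3 : p ≤ s
    · have h5 := hmax (k * p) ⟨⟨by nlinarith, by nlinarith⟩, mul_dvd_mul_left k hp2⟩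
      nlinarith
    · have h5 := hmax p ⟨⟨by omega, hps⟩, hpg⟩
      omega
  · exact ⟨s * s, by nlinarith, le_rfl, dvd_zero _⟩

open Classical in
lemma abs_ite_sub_sum_moebius_le {g s z : ℕ} (hs : 2 ≤ s) (hz : 1 ≤ z) (hzs : z ≤ s * s) :
    |(if g = 1 then (1 : ℝ) else 0) - ∑ k ∈ (Finset.Icc 1 z),
      (if k ∣ g then ((ArithmeticFunction.moebius k : ℤ) : ℝ) else 0)| ≤
    ∑ k ∈ Finset.Ioc z (s * s), (if k ∣ g then (1 : ℝ) else 0)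
      + z * (∑ k ∈ Finset.Ioc s (s * s), (if k ∣ g then (1 : ℝ) else 0)
        + if ∃ p, p.Prime ∧ s * s < p ∧ p ∣ g then 1 else 0) := by
  classical
  have hmu : ∀ k, |((ArithmeticFunction.moebius k : ℤ) : ℝ)| ≤ 1 := by
    intro k; exact_mod_cast ArithmeticFunction.abs_moebius_le_one
  have hnn1 : 0 ≤ ∑ k ∈ Finset.Ioc z (s * s), (if k ∣ g then (1 : ℝ) else 0) :=
    Finset.sum_nonneg fun k _ => by split_ifs <;> norm_num
  have hnn2 : 0 ≤ ∑ k ∈ Finset.Ioc s (s * s), (if k ∣ g then (1 : ℝ) else 0) :=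
    Finset.sum_nonneg fun k _ => by split_ifs <;> norm_num
  by_cases hg : s * s < g ∨ g = 0
  · have hg1 : g ≠ 1 := by rcases hg with hg | hg <;> nlinarith
    rw [if_neg hg1, zero_sub, abs_neg]
    have h1 : |∑ k ∈ (Finset.Icc 1 z),
      (if k ∣ g then ((ArithmeticFunction.moebius k : ℤ) : ℝ) else 0)| ≤ z := by
      refine (Finset.abs_sum_le_sum_abs _ _).trans ?_
      calc _ ≤ ∑ k ∈ Finset.Icc 1 z, (1 : ℝ) := by
            refine Finset.sum_le_sum fun k _ => ?_
            split_ifs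
            · exact hmu k
            · simp
        _ = z := by simp
    have h2 : (1 : ℝ) ≤ ∑ k ∈ Finset.Ioc s (s * s), (if k ∣ g then (1 : ℝ) else 0)
        + if ∃ p, p.Prime ∧ s * s < p ∧ p ∣ g then 1 else 0 := by
      by_cases hp : ∃ p, p.Prime ∧ s * s < p ∧ p ∣ g
      · rw [if_pos hp]; linarith
      · rw [if_neg hp, add_zero]
        push Not at hp
        obtain ⟨k, hk1, hk2, hk3⟩ := exists_dvd_mem_Ioc hs hg
          (fun p hp1 hp2 => by by_contra h; exact hp p hp1 (by omega) hp2)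
        have := Finset.single_le_sum (f := fun k => if k ∣ g then (1 : ℝ) else 0)
          (fun k _ => by split_ifs <;> norm_num) (Finset.mem_Ioc.2 ⟨hk1, hk2⟩)
        simpa [hk3] using this
    have hz0 : (0 : ℝ) ≤ z := by positivity
    nlinarith
  · push Not at hg
    have hsum : (if g = 1 then (1 : ℝ) else 0) = ∑ k ∈ Finset.Icc 1 (s * s),
        (if k ∣ g then ((ArithmeticFunction.moebius k : ℤ) : ℝ) else 0) := by
      have h1 := congrArg (fun f : ArithmeticFunction ℤ => f g)
        ArithmeticFunction.moebius_mul_coe_zeta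
      simp only [ArithmeticFunction.coe_mul_zeta_apply, ArithmeticFunction.one_apply] at h1
      rw [← Finset.sum_filter]
      have h2 : (Finset.Icc 1 (s * s)).filter (fun k => k ∣ g) = g.divisors := by
        ext k
        simp only [Finset.mem_filter, Finset.mem_Icc, Nat.mem_divisors]
        constructor
        · rintro ⟨_, h⟩; exact ⟨h, hg.2⟩
        · rintro ⟨h, _⟩
          exact ⟨⟨Nat.pos_of_dvd_of_pos h (Nat.pos_of_ne_zero hg.2),
            (Nat.le_of_dvd (Nat.pos_of_ne_zero hg.2) h).trans hg.1⟩, h⟩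
      rw [h2]
      exact_mod_cast h1.symm
    have hsplit : Finset.Icc 1 (s * s) = Finset.Icc 1 z ∪ Finset.Ioc z (s * s) := by
      ext k; simp; omega
    have hdisj : Disjoint (Finset.Icc 1 z) (Finset.Ioc z (s * s)) := by
      rw [Finset.disjoint_left]; intro k; simp; omega
    rw [hsum, hsplit, Finset.sum_union hdisj, add_sub_cancel_left]
    have h3 : |∑ k ∈ Finset.Ioc z (s * s),
        (if k ∣ g then ((ArithmeticFunction.moebius k : ℤ) : ℝ) else 0)| ≤
        ∑ k ∈ Finset.Ioc z (s * s), (if k ∣ g then (1 : ℝ) else 0) := by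
      refine (Finset.abs_sum_le_sum_abs _ _).trans (Finset.sum_le_sum fun k _ => ?_)
      split_ifs
      · exact hmu k
      · simp
    have h4 : 0 ≤ (z : ℝ) * (∑ k ∈ Finset.Ioc s (s * s), (if k ∣ g then (1 : ℝ) else 0)
        + if ∃ p, p.Prime ∧ s * s < p ∧ p ∣ g then 1 else 0) := by
      refine mul_nonneg (by positivity) (add_nonneg hnn2 ?_)
      split_ifs <;> norm_num
    linarith

lemma exists_submatrix_det_ne_zero {K ι κ : Type*} [Field K] [Fintype ι] [Fintype κ]
    [DecidableEq ι] [DecidableEq κ] (V : Matrix κ ι K) (U : Matrix ι κ K) (h : V * U = 1) :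
    ∃ f : κ → ι, (U.submatrix f id).det ≠ 0 := by
  classical
  by_contra hcon
  push Not at hcon
  have h1 : (V * U).det = 1 := by rw [h, Matrix.det_one]
  have h2 : (V * U).det = (Matrix.detRowAlternating (R := K) (n := κ)).toMultilinearMap
      (fun c => ∑ r, V c r • U r) := by
    change Matrix.det _ = Matrix.det _
    congr 1
    ext c c'
    simp [Matrix.mul_apply]
  rw [h2, MultilinearMap.map_sum] at h1
  have h3 : ∀ f : κ → ι, (Matrix.detRowAlternating (R := K) (n := κ)).toMultilinearMap
      (fun c => V c (f c) • U (f c)) = 0 := by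
    intro f
    rw [MultilinearMap.map_smul_univ]
    have : (Matrix.detRowAlternating (R := K) (n := κ)).toMultilinearMap (fun c => U (f c))
      = (U.submatrix f id).det := rfl
    rw [this, hcon f, smul_zero]
  simp [h3] at h1

lemma card_le_of_fiber_le {ι : Type*} [Fintype ι] [DecidableEq ι] (x : ι → ℤ) (h K : ℕ)
    (S : Finset (ι → ℤ)) (hS : S ⊆ intCube x h) (i : ι)
    (hK : ∀ b ∈ S, ∀ T ⊆ S, (∀ b' ∈ T, ∀ j, j ≠ i → b' j = b j) → T.card ≤ K) :
    S.card ≤ K * h ^ (Fintype.card ι - 1) := by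
  classical
  let f : (ι → ℤ) → ({j // j ≠ i} → ℤ) := fun b j => b j
  have h1 : S.card ≤ K * (S.image f).card := by
    refine Finset.card_le_mul_card_image S K ?_
    intro a ha
    obtain ⟨b, hb, rfl⟩ := Finset.mem_image.1 ha
    exact hK b hb _ (Finset.filter_subset _ _) fun b' hb' j hj =>
      congrFun (Finset.mem_filter.1 hb').2 ⟨j, hj⟩
  have h2 : S.image f ⊆ intCube (fun j : {j // j ≠ i} => x j) h := by
    intro a ha
    obtain ⟨b, hb, rfl⟩ := Finset.mem_image.1 ha
    rw [mem_intCube]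
    intro j
    exact mem_intCube.1 (hS hb) j
  have h3 := Finset.card_le_card h2
  rw [card_intCube] at h3
  have h4 : Fintype.card {j // j ≠ i} = Fintype.card ι - 1 := by
    simp
  rw [h4] at h3
  exact h1.trans (Nat.mul_le_mul_left K h3)

/-- The determinant of the bordered minor with rows `f` and `i`, and last column `b`. -/
def borderedMinor {R ι κ : Type*} [CommRing R] [Fintype κ] [DecidableEq κ] (U : Matrix ι κ R)
    (f : κ → ι) (i : ι) (b : ι → R) : R :=
  (U.submatrix f id).det * b i - ∑ c, U i c * ((U.submatrix f id).adjugate *ᵥ (b ∘ f)) c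

lemma borderedMinor_map {R S ι κ : Type*} [CommRing R] [CommRing S] [Fintype κ] [DecidableEq κ]
    (φ : R →+* S) (U : Matrix ι κ R) (f : κ → ι) (i : ι) (b : ι → R) :
    φ (borderedMinor U f i b) = borderedMinor (U.map φ) f i (φ ∘ b) := by
  have h1 : (U.map φ).submatrix f id = φ.mapMatrix (U.submatrix f id) := rfl
  unfold borderedMinor
  rw [h1, ← RingHom.map_det, ← RingHom.map_adjugate]
  simp [Matrix.mulVec, dotProduct]

lemma borderedMinor_eq_zero {R ι κ : Type*} [CommRing R] [Fintype κ] [DecidableEq κ]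
    (U : Matrix ι κ R) (f : κ → ι) (i : ι) (b : ι → R) (y : κ → R) (hb : b = U *ᵥ y) :
    borderedMinor U f i b = 0 := by
  have h1 : b ∘ f = (U.submatrix f id) *ᵥ y := by
    subst hb; rfl
  unfold borderedMinor
  rw [h1, Matrix.mulVec_mulVec, Matrix.adjugate_mul, hb, Matrix.smul_mulVec, Matrix.one_mulVec]
  simp only [Matrix.mulVec, dotProduct, Pi.smul_apply, smul_eq_mul, Finset.mul_sum]
  rw [← Finset.sum_sub_distrib]
  exact Finset.sum_eq_zero fun c _ => by ring

lemma abs_borderedMinor_le {d : ℕ} {κ : Type*} [Fintype κ] [DecidableEq κ]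
    (hκ : Fintype.card κ ≤ d) (U : Matrix (Fin d) κ ℤ)
    (f : κ → Fin d) (i : Fin d) (b : Fin d → ℤ) (H : ℤ) (hH : 1 ≤ H) (hU : ∀ r c, |U r c| ≤ H)
    (hb : ∀ r, |b r| ≤ H) :
    |borderedMinor U f i b| ≤ (d * d + 1) * d.factorial * H ^ (d + 2) := by
  have hdet : ∀ A : Matrix κ κ ℤ, (∀ r c, |A r c| ≤ H) → |A.det| ≤ d.factorial * H ^ d := by
    intro A hA
    have h1 := Matrix.det_le (abv := AbsoluteValue.abs) (A := A) (x := H) hA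
    simp only [AbsoluteValue.abs_apply, nsmul_eq_mul] at h1
    refine h1.trans ?_
    gcongr
  have hadj : ∀ r c, |(U.submatrix f id).adjugate r c| ≤ d.factorial * H ^ d := by
    intro r c
    rw [Matrix.adjugate_apply]
    refine hdet _ fun r' c' => ?_
    rw [Matrix.updateRow_apply]
    split_ifs
    · rw [Pi.single_apply]; split_ifs
      · simpa using hH
      · simp; linarith
    · exact hU _ _
  have hH0 : 0 ≤ H := by linarith
  have h2 : ∀ c, |((U.submatrix f id).adjugate *ᵥ (b ∘ f)) c| ≤ d * (d.factorial * H ^ d * H) := by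
    intro c
    refine (Finset.abs_sum_le_sum_abs _ _).trans ?_
    calc _ ≤ ∑ _j : κ, (d.factorial * H ^ d * H : ℤ) := by
          refine Finset.sum_le_sum fun j _ => ?_
          rw [abs_mul]
          exact mul_le_mul (hadj _ _) (hb _) (abs_nonneg _) (by positivity)
      _ = Fintype.card κ * (d.factorial * H ^ d * H) := by simp
      _ ≤ _ := by gcongr
  have h3 : |∑ c, U i c * ((U.submatrix f id).adjugate *ᵥ (b ∘ f)) c|
      ≤ d * (H * (d * (d.factorial * H ^ d * H))) := by
    refine (Finset.abs_sum_le_sum_abs _ _).trans ?_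
    calc _ ≤ ∑ _j : κ, (H * (d * (d.factorial * H ^ d * H)) : ℤ) := by
          refine Finset.sum_le_sum fun j _ => ?_
          rw [abs_mul]
          exact mul_le_mul (hU _ _) (h2 _) (abs_nonneg _) (by positivity)
      _ = Fintype.card κ * (H * (d * (d.factorial * H ^ d * H))) := by simp
      _ ≤ _ := by gcongr
  have h4 : |(U.submatrix f id).det * b i| ≤ d.factorial * H ^ d * H := by
    rw [abs_mul]
    exact mul_le_mul (hdet _ fun r c => hU _ _) (hb _) (abs_nonneg _) (by positivity)
  have h5 : d.factorial * H ^ d * H ≤ d.factorial * H ^ d * H * H :=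
    le_mul_of_one_le_right (by positivity) hH
  unfold borderedMinor
  refine (abs_sub _ _).trans ?_
  refine (add_le_add (h4.trans h5) h3).trans (le_of_eq ?_)
  ring

lemma card_primeFactors_gt_le {N h K : ℕ} (hN : N ≠ 0) (hh : 2 ≤ h) (hNK : N ≤ h ^ K) :
    (N.primeFactors.filter fun p => h < p).card ≤ K := by
  have h1 : h ^ (N.primeFactors.filter fun p => h < p).card ≤ ∏ p ∈ N.primeFactors.filter (fun p => h < p), p := by
    refine Finset.pow_card_le_prod _ _ _ fun p hp => ?_
    exact (Finset.mem_filter.1 hp).2.le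
  have h2 : ∏ p ∈ N.primeFactors.filter (fun p => h < p), p ≤ ∏ p ∈ N.primeFactors, p :=
    Finset.prod_le_prod_of_subset_of_one_le' (Finset.filter_subset _ _)
      fun p hp _ => (Nat.prime_of_mem_primeFactors hp).one_lt.le
  have h3 : ∏ p ∈ N.primeFactors, p ≤ N :=
    Nat.le_of_dvd (Nat.pos_of_ne_zero hN) (Nat.prod_primeFactors_dvd N)
  exact (Nat.pow_le_pow_iff_right (by omega)).1 (h1.trans (h2.trans (h3.trans hNK)))

open Classical in
lemma card_large_prime_dvd_le {d : ℕ} (h K : ℕ) (H : ℤ) (hh : 2 ≤ h) (hH : 1 ≤ H)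
    (hK : (d * d + 1) * d.factorial * H ^ (d + 2) ≤ (h : ℤ) ^ K)
    (V U : Matrix (Fin d) (Fin d) ℤ) (hVU : V * U = 1) (I : Finset (Fin d)) (hI : 2 ≤ I.card)
    (hU : ∀ r c, c ∉ I → |U r c| ≤ H) (x : Fin d → ℤ) (hx : ∀ i, |x i| + h ≤ H) :
    ((intCube x h).filter fun b => ∃ p : ℕ, p.Prime ∧ h < p ∧ ∀ i ∈ I, (p : ℤ) ∣ (V *ᵥ b) i).card
      ≤ d ^ d * (1 + K) * h ^ (d - 1) := by
  have hUV : U * V = 1 := mul_eq_one_comm.1 hVU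
  let κ := {c : Fin d // c ∉ I}
  have hκ : Fintype.card κ + 2 ≤ d := by
    have : Fintype.card κ = d - I.card := by
      rw [Fintype.card_subtype_compl]; simp
    have h2 : I.card ≤ d := by simpa using Finset.card_le_univ I
    omega
  have hd : 1 ≤ d := by omega
  let U' : Matrix (Fin d) κ ℤ := U.submatrix id Subtype.val
  let V' : Matrix κ (Fin d) ℤ := V.submatrix Subtype.val id
  have hVU' : V' * U' = 1 := by
    ext a b
    have h1 : (V' * U') a b = (V * U) a.1 b.1 := rfl
    rw [h1, hVU, Matrix.one_apply, Matrix.one_apply]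
    exact if_congr Subtype.ext_iff.symm rfl rfl
  have hbH : ∀ b ∈ intCube x h, ∀ r, |b r| ≤ H := by
    intro b hb r
    have h1 := mem_intCube.1 hb r
    have h2 := hx r
    have h3 := abs_le.1 (le_refl |x r|)
    rw [abs_le]
    constructor <;> linarith
  -- reduction modulo a large prime
  have hred : ∀ (p : ℕ) (b : Fin d → ℤ), (∀ i ∈ I, (p : ℤ) ∣ (V *ᵥ b) i) →
      (fun r => (b r : ZMod p)) = (U'.map (Int.castRingHom (ZMod p))) *ᵥ
        (fun c : κ => (((V *ᵥ b) c : ℤ) : ZMod p)) := by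
    intro p b hp
    have h1 : b = U *ᵥ (V *ᵥ b) := by rw [Matrix.mulVec_mulVec, hUV, Matrix.one_mulVec]
    funext r
    have h2 : (b r : ZMod p) = ∑ c, ((U r c : ℤ) : ZMod p) * (((V *ᵥ b) c : ℤ) : ZMod p) := by
      conv_lhs => rw [h1]
      simp only [Matrix.mulVec, dotProduct]
      push_cast
      rfl
    rw [h2, ← Fintype.sum_subtype_add_sum_subtype (fun c => c ∈ I)]
    refine (congrArg₂ (· + ·) (Finset.sum_eq_zero fun c _ => ?_) rfl).trans (zero_add _)
    rw [(ZMod.intCast_zmod_eq_zero_iff_dvd _ _).2 (hp c.1 c.2), mul_zero]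
  let S : (κ → Fin d) → Finset (Fin d → ℤ) := fun f => (intCube x h).filter fun b =>
    ∃ p : ℕ, p.Prime ∧ h < p ∧ ((U'.submatrix f id).det : ZMod p) ≠ 0 ∧
      ∀ i ∈ I, (p : ℤ) ∣ (V *ᵥ b) i
  have hcover : ((intCube x h).filter fun b => ∃ p : ℕ, p.Prime ∧ h < p ∧
      ∀ i ∈ I, (p : ℤ) ∣ (V *ᵥ b) i) ⊆ Finset.univ.biUnion S := by
    intro b hb
    obtain ⟨hb1, p, hp, hhp, hpI⟩ := Finset.mem_filter.1 hb
    have : Fact p.Prime := ⟨hp⟩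
    have h1 : V'.map (Int.castRingHom (ZMod p)) * U'.map (Int.castRingHom (ZMod p)) = 1 := by
      rw [← Matrix.map_mul, hVU']
      exact map_one ((Int.castRingHom (ZMod p)).mapMatrix (m := κ))
    obtain ⟨f, hf⟩ := exists_submatrix_det_ne_zero _ _ h1
    refine Finset.mem_biUnion.2 ⟨f, Finset.mem_univ _, Finset.mem_filter.2
      ⟨hb1, p, hp, hhp, ?_, hpI⟩⟩
    have h2 : (U'.map (Int.castRingHom (ZMod p))).submatrix f id
      = (Int.castRingHom (ZMod p)).mapMatrix (U'.submatrix f id) := rfl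
    rw [h2, ← RingHom.map_det] at hf
    simpa using hf
  have hSf : ∀ f, (S f).card ≤ (1 + K) * h ^ (d - 1) := by
    intro f
    obtain ⟨i, hi⟩ : ∃ i, i ∉ Finset.univ.image f := by
      by_contra hcon
      push Not at hcon
      have h1 : (Finset.univ : Finset (Fin d)) ⊆ Finset.univ.image f := fun i _ => hcon i
      have h2 := (Finset.card_le_card h1).trans Finset.card_image_le
      simp only [Finset.card_univ, Fintype.card_fin] at h2
      omega
    obtain ⟨i', hi'⟩ : ∃ i', i' ∉ insert i (Finset.univ.image f) := by
      by_contra hcon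
      push Not at hcon
      have h1 : (Finset.univ : Finset (Fin d)) ⊆ insert i (Finset.univ.image f) := fun i _ => hcon i
      have h2 := (Finset.card_le_card h1).trans (Finset.card_insert_le _ _)
      have h3 := Finset.card_image_le (s := (Finset.univ : Finset κ)) (f := f)
      simp only [Finset.card_univ, Fintype.card_fin] at h2 h3
      omega
    have hif : ∀ c, f c ≠ i := fun c hc => hi (Finset.mem_image.2 ⟨c, Finset.mem_univ _, hc⟩)
    have hif' : ∀ c, f c ≠ i' := fun c hc => hi' (Finset.mem_insert_of_mem
      (Finset.mem_image.2 ⟨c, Finset.mem_univ _, hc⟩))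
    have hii' : i ≠ i' := fun hc => hi' (hc ▸ Finset.mem_insert_self _ _)
    let W : (Fin d → ℤ) → ℤ := borderedMinor U' f i
    have hdvd : ∀ b (p : ℕ), (∀ i ∈ I, (p : ℤ) ∣ (V *ᵥ b) i) → (p : ℤ) ∣ W b := by
      intro b p hp
      rw [← ZMod.intCast_zmod_eq_zero_iff_dvd]
      have := borderedMinor_map (Int.castRingHom (ZMod p)) U' f i b
      simp only [eq_intCast] at this
      rw [this]
      exact borderedMinor_eq_zero _ _ _ _ _ (hred p b hp)
    have h0 : ((S f).filter fun b => W b = 0).card ≤ 1 * h ^ (d - 1) := by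
      have := card_le_of_fiber_le x h 1 ((S f).filter fun b => W b = 0)
        (fun b hb => (Finset.mem_filter.1 (Finset.mem_filter.1 hb).1).1) i ?_
      · simpa using this
      intro b hb T hT hTb
      rw [Finset.card_le_one]
      suffices hs : ∀ b' ∈ ((S f).filter fun b => W b = 0), (∀ j, j ≠ i → b' j = b j) → b' = b by
        intro b1 hb1 b2 hb2
        rw [hs b1 (hT hb1) (hTb b1 hb1), hs b2 (hT hb2) (hTb b2 hb2)]
      intro b' hb' hbb
      obtain ⟨hbS, hW⟩ := Finset.mem_filter.1 hb
      obtain ⟨-, hW'⟩ := Finset.mem_filter.1 hb'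
      obtain ⟨-, p, -, -, hdet, -⟩ := Finset.mem_filter.1 hbS
      have hdet0 : (U'.submatrix f id).det ≠ 0 := fun h => hdet (by rw [h]; simp)
      have hcomp : b' ∘ f = b ∘ f := funext fun c => hbb _ (hif c)
      simp only [W, borderedMinor, hcomp] at hW hW'
      have h3 : (U'.submatrix f id).det * b' i = (U'.submatrix f id).det * b i := by linarith
      have h4 := mul_left_cancel₀ hdet0 h3
      funext j
      by_cases hj : j = i
      · rw [hj, h4]
      · exact hbb j hj
    have h1 : ((S f).filter fun b => ¬ W b = 0).card ≤ K * h ^ (d - 1) := by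
      have := card_le_of_fiber_le x h K ((S f).filter fun b => ¬ W b = 0)
        (fun b hb => (Finset.mem_filter.1 (Finset.mem_filter.1 hb).1).1) i' ?_
      · simpa using this
      intro b hb T hT hTb
      obtain ⟨hbS, hW⟩ := Finset.mem_filter.1 hb
      obtain ⟨hbQ, -⟩ := Finset.mem_filter.1 hbS
      have hbound : (W b).natAbs ≤ h ^ K := by
        have h3 : |W b| ≤ (d * d + 1) * d.factorial * H ^ (d + 2) :=
          abs_borderedMinor_le (by omega) U' f i b H hH
            (fun r c => hU r c.1 c.2) (hbH b hbQ)
        have h4 := h3.trans hK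
        zify
        exact h4
      refine le_trans ?_ (card_primeFactors_gt_le (by simpa using hW) hh hbound)
      have hchoose : ∀ b' ∈ S f, ∃ p : ℕ, p.Prime ∧ h < p ∧
          ((U'.submatrix f id).det : ZMod p) ≠ 0 ∧ ∀ i ∈ I, (p : ℤ) ∣ (V *ᵥ b') i :=
        fun b' hb' => (Finset.mem_filter.1 hb').2
      choose! P hP using hchoose
      have hWeq : ∀ b', (∀ j, j ≠ i' → b' j = b j) → W b' = W b := by
        intro b' hb'
        have hcomp : b' ∘ f = b ∘ f := funext fun c => hb' _ (hif' c)
        simp only [W, borderedMinor, hcomp, hb' i hii']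
      refine Finset.card_le_card_of_injOn P ?_ ?_
      · intro b' hb'
        obtain ⟨h5, h6, -, h7⟩ := hP b' (Finset.mem_filter.1 (hT hb')).1
        rw [Finset.mem_coe, Finset.mem_filter, Nat.mem_primeFactors]
        refine ⟨⟨h5, ?_, by simpa using hW⟩, h6⟩
        have := hdvd b' (P b') h7
        rw [hWeq b' (hTb b' hb')] at this
        exact Int.natCast_dvd.1 this
      · intro b1 hb1 b2 hb2 hPP
        replace hb1 : b1 ∈ S f ∧ ∀ j, j ≠ i' → b1 j = b j :=
          ⟨(Finset.mem_filter.1 (hT hb1)).1, hTb b1 hb1⟩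
        replace hb2 : b2 ∈ S f ∧ ∀ j, j ≠ i' → b2 j = b j :=
          ⟨(Finset.mem_filter.1 (hT hb2)).1, hTb b2 hb2⟩
        obtain ⟨h5, h6, h8, h7⟩ := hP b1 hb1.1
        obtain ⟨-, -, -, h7'⟩ := hP b2 hb2.1
        rw [← hPP] at h7'
        set p := P b1
        have : Fact p.Prime := ⟨h5⟩
        have e1 := hred p b1 h7
        have e2 := hred p b2 h7'
        set A := (U'.map (Int.castRingHom (ZMod p)))
        have hA : ((A.submatrix f id).det) ≠ 0 := by
          have h2 : A.submatrix f id
            = (Int.castRingHom (ZMod p)).mapMatrix (U'.submatrix f id) := rfl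
          rw [h2, ← RingHom.map_det]
          simpa using h8
        have hy : (fun c : κ => (((V *ᵥ b1) c : ℤ) : ZMod p))
            = (fun c : κ => (((V *ᵥ b2) c : ℤ) : ZMod p)) := by
          have hinj := Matrix.mulVec_injective_iff_isUnit.2
            ((Matrix.isUnit_iff_isUnit_det _).2 (isUnit_iff_ne_zero.2 hA))
          apply hinj
          funext c
          have g1 := congrFun e1 (f c)
          have g2 := congrFun e2 (f c)
          have g3 : b1 (f c) = b2 (f c) := (hb1.2 _ (hif' c)).trans (hb2.2 _ (hif' c)).symm
          simp only [g3] at g1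
          exact g1.symm.trans g2
        rw [hy, ← e2] at e1
        funext r
        have g1 := congrFun e1 r
        have g2 := (ZMod.intCast_eq_intCast_iff_dvd_sub _ _ _).1 g1
        have g3 := mem_intCube.1 (Finset.mem_filter.1 hb1.1).1 r
        have g4 := mem_intCube.1 (Finset.mem_filter.1 hb2.1).1 r
        have g5 : |b2 r - b1 r| < p := by rw [abs_lt]; constructor <;> linarith
        have := Int.eq_zero_of_abs_lt_dvd g2 g5
        linarith
    have h2 := Finset.card_filter_add_card_filter_not (s := S f) (fun b => W b = 0)
    rw [← h2]
    linarith
  calc _ ≤ (Finset.univ.biUnion S).card := Finset.card_le_card hcover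
    _ ≤ ∑ f, (S f).card := Finset.card_biUnion_le
    _ ≤ ∑ _f : κ → Fin d, (1 + K) * h ^ (d - 1) := Finset.sum_le_sum fun f _ => hSf f
    _ = d ^ Fintype.card κ * ((1 + K) * h ^ (d - 1)) := by simp
    _ ≤ d ^ d * ((1 + K) * h ^ (d - 1)) := by
        exact Nat.mul_le_mul_right _ (Nat.pow_le_pow_right hd (by omega))
    _ = _ := by ring

/-- The Dirichlet series of the Möbius function at the natural number `c`. -/
def moebiusSum (c : ℕ) : ℝ := ∑' k : ℕ, ((ArithmeticFunction.moebius k : ℤ) : ℝ) / (k : ℝ) ^ c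

lemma abs_moebius_div_le (c k : ℕ) (hc : 2 ≤ c) :
    |((ArithmeticFunction.moebius k : ℤ) : ℝ) / (k : ℝ) ^ c| ≤ ((k : ℝ) ^ 2)⁻¹ := by
  have hmu : |((ArithmeticFunction.moebius k : ℤ) : ℝ)| ≤ 1 := by
    exact_mod_cast ArithmeticFunction.abs_moebius_le_one
  rcases Nat.eq_zero_or_pos k with rfl | hk
  · simp
  have hk1 : (1 : ℝ) ≤ k := by exact_mod_cast hk
  have hk2 : (k : ℝ) ^ 2 ≤ (k : ℝ) ^ c := pow_le_pow_right₀ hk1 hc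
  rw [abs_div, abs_of_pos (by positivity : (0 : ℝ) < (k : ℝ) ^ c), inv_eq_one_div]
  exact div_le_div₀ zero_le_one hmu (by positivity) hk2

lemma summable_moebius_div (c : ℕ) (hc : 2 ≤ c) :
    Summable fun k : ℕ => ((ArithmeticFunction.moebius k : ℤ) : ℝ) / (k : ℝ) ^ c := by
  refine Summable.of_norm_bounded (g := fun k : ℕ => ((k : ℝ) ^ 2)⁻¹)
    (Real.summable_nat_pow_inv.2 (by norm_num)) fun k => ?_
  exact abs_moebius_div_le c k hc

lemma abs_sum_Icc_moebius_sub_le (c z : ℕ) (hc : 2 ≤ c) (hz : 1 ≤ z) :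
    |∑ k ∈ Finset.Icc 1 z, ((ArithmeticFunction.moebius k : ℤ) : ℝ) / (k : ℝ) ^ c
      - moebiusSum c| ≤ 1 / z := by
  have h1 := (summable_moebius_div c hc).hasSum.tendsto_sum_nat
  have h2 : Filter.Tendsto (fun N : ℕ => |∑ k ∈ Finset.Icc 1 z,
      ((ArithmeticFunction.moebius k : ℤ) : ℝ) / (k : ℝ) ^ c
      - ∑ k ∈ Finset.range N, ((ArithmeticFunction.moebius k : ℤ) : ℝ) / (k : ℝ) ^ c|)
      Filter.atTop (nhds |∑ k ∈ Finset.Icc 1 z,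
      ((ArithmeticFunction.moebius k : ℤ) : ℝ) / (k : ℝ) ^ c - moebiusSum c|) :=
    (tendsto_const_nhds.sub h1).abs
  refine le_of_tendsto h2 ?_
  filter_upwards [Filter.eventually_ge_atTop (z + 1)] with N hN
  obtain ⟨N, rfl⟩ : ∃ M, N = M + 1 := ⟨N - 1, by omega⟩
  have h3 : Finset.range (N + 1) = insert 0 (Finset.Icc 1 z ∪ Finset.Ioc z N) := by
    ext k; simp; omega
  have h4 : Disjoint (Finset.Icc 1 z) (Finset.Ioc z N) := by
    rw [Finset.disjoint_left]; intro k; simp; omega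
  rw [h3, Finset.sum_insert (by simp), Finset.sum_union h4]
  simp only [ArithmeticFunction.map_zero, Int.cast_zero, zero_div, zero_add]
  rw [sub_add_cancel_left, abs_neg]
  calc _ ≤ ∑ k ∈ Finset.Ioc z N, |((ArithmeticFunction.moebius k : ℤ) : ℝ) / (k : ℝ) ^ c| :=
        Finset.abs_sum_le_sum_abs _ _
    _ ≤ ∑ k ∈ Finset.Ioc z N, ((k : ℝ) ^ 2)⁻¹ :=
        Finset.sum_le_sum fun k _ => abs_moebius_div_le c k hc
    _ ≤ (z : ℝ)⁻¹ - (N : ℝ)⁻¹ := sum_Ioc_inv_sq_le_sub (by omega) (by omega)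
    _ ≤ 1 / z := by
        have : (0 : ℝ) ≤ (N : ℝ)⁻¹ := by positivity
        rw [one_div]; linarith

lemma natCast_dvd_gcd_natAbs_iff {ι : Type*} (I : Finset ι) (y : ι → ℤ) (k : ℕ) :
    k ∣ (I.gcd y).natAbs ↔ ∀ i ∈ I, (k : ℤ) ∣ y i := by
  rw [← Int.natCast_dvd, Finset.dvd_gcd_iff]

lemma sieve_cube (d : ℕ) : ∃ C : ℝ, 0 < C ∧ ∀ (m : ℕ), 2 ≤ m → ∀ (V U : Matrix (Fin d) (Fin d) ℤ),
    V * U = 1 → ∀ I : Finset (Fin d), 2 ≤ I.card → (∀ r c, c ∉ I → |U r c| ≤ (m : ℤ) ^ 12) →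
    ∀ x : Fin d → ℤ, (∀ i, |x i| ≤ (m : ℤ) ^ 12) →
    |(((intCube x (m ^ 4)).filter fun b => I.gcd (V *ᵥ b) = 1).card : ℝ)
      - ((m : ℝ) ^ 4) ^ d * moebiusSum I.card| ≤ C * ((m : ℝ) ^ 4) ^ d / m := by
  classical
  set K := (d * d + 1) * d.factorial + 13 * (d + 2) with hKdef
  refine ⟨d * 2 ^ d + 2 * (d * 2 ^ d + 1) + d ^ d * (1 + K) + 1, by positivity, ?_⟩
  intro m hm V U hVU I hI hU x hx
  have hm0 : (0 : ℝ) < m := by exact_mod_cast (by omega : 0 < m)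
  have hm1 : (1 : ℝ) ≤ m := by exact_mod_cast (by omega : 1 ≤ m)
  have hmz : (2 : ℤ) ≤ m := by exact_mod_cast hm
  set h : ℕ := m ^ 4 with hh
  have hh0 : (0 : ℝ) < h := by rw [hh]; positivity
  have hhr : (m : ℝ) ^ 4 = h := by rw [hh]; push_cast; rfl
  rw [hhr]
  have hss : m ^ 2 * m ^ 2 = h := by rw [hh]; ring
  have hzh : m ≤ h := by rw [hh]; exact Nat.le_self_pow (by norm_num) m
  have hsh : m ^ 2 ≤ h := by rw [hh]; exact Nat.pow_le_pow_right (by omega) (by norm_num)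
  have hs2 : 2 ≤ m ^ 2 := by nlinarith
  have hd : 1 ≤ d := by
    have : I.card ≤ d := by simpa using Finset.card_le_univ I
    omega
  -- the large primes
  set E := ((intCube x h).filter fun b => ∃ p : ℕ, p.Prime ∧ h < p ∧ ∀ i ∈ I, (p : ℤ) ∣ (V *ᵥ b) i)
  have hE : (E.card : ℝ) ≤ d ^ d * (1 + K) * (h : ℝ) ^ d / h := by
    have h1 := card_large_prime_dvd_le h K ((m : ℤ) ^ 13) (by omega) (one_le_pow₀ (by omega)) ?_
      V U hVU I hI ?_ x ?_
    · have h2 : (h : ℝ) ^ d / h = (h : ℝ) ^ (d - 1) := by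
        rw [div_eq_iff hh0.ne', ← pow_succ]; congr 1; omega
      rw [mul_div_assoc, h2]
      exact_mod_cast h1
    · have e1 : ((d * d + 1) * d.factorial : ℤ) ≤ (m : ℤ) ^ ((d * d + 1) * d.factorial) := by
        have := (Nat.lt_pow_self (n := (d * d + 1) * d.factorial) (show 1 < m by omega)).le
        exact_mod_cast this
      calc ((d * d + 1) * d.factorial : ℤ) * ((m : ℤ) ^ 13) ^ (d + 2)
          ≤ (m : ℤ) ^ ((d * d + 1) * d.factorial) * ((m : ℤ) ^ 13) ^ (d + 2) := by gcongr
        _ = (m : ℤ) ^ K := by rw [← pow_mul, ← pow_add]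
        _ ≤ (h : ℤ) ^ K := by
            gcongr
    · intro r c hc
      exact (hU r c hc).trans (pow_le_pow_right₀ (by omega) (by norm_num))
    · intro i
      have h2 := hx i
      have h3 : (h : ℤ) ≤ (m : ℤ) ^ 12 := by
        rw [hh]; push_cast; exact pow_le_pow_right₀ (by omega) (by norm_num)
      have h4 : (m : ℤ) ^ 12 + (m : ℤ) ^ 12 ≤ (m : ℤ) ^ 13 := by
        have : (0 : ℤ) < (m : ℤ) ^ 12 := by positivity
        rw [pow_succ (m : ℤ) 12]; nlinarith
      linarith
  set A : ℕ → ℝ := fun k => (((intCube x h).filter fun b => ∀ i ∈ I, (k : ℤ) ∣ (V *ᵥ b) i).card : ℝ)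
  have hA1 : ∀ k, 0 < k → k ≤ h → A k ≤ (d * 2 ^ d + 1) * ((h : ℝ) ^ d * ((k : ℝ) ^ 2)⁻¹) := by
    intro k hk hkh
    refine (card_dvd_le h k hk hkh V U hVU I x).trans ?_
    have hk1 : (1 : ℝ) ≤ k := by exact_mod_cast hk
    rw [div_eq_mul_inv]
    gcongr
  have hA2 : ∀ w, 0 < w → w ≤ h → ∑ k ∈ Finset.Ioc w h, A k ≤ (d * 2 ^ d + 1) * (h : ℝ) ^ d / w := by
    intro w hw hwh
    calc ∑ k ∈ Finset.Ioc w h, A k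
        ≤ ∑ k ∈ Finset.Ioc w h, (d * 2 ^ d + 1) * ((h : ℝ) ^ d * ((k : ℝ) ^ 2)⁻¹) :=
          Finset.sum_le_sum fun k hk => hA1 k (by simp at hk; omega) (by simp at hk; omega)
      _ = (d * 2 ^ d + 1) * ((h : ℝ) ^ d * ∑ k ∈ Finset.Ioc w h, ((k : ℝ) ^ 2)⁻¹) := by
          rw [← Finset.mul_sum, ← Finset.mul_sum]
      _ ≤ (d * 2 ^ d + 1) * ((h : ℝ) ^ d * (w : ℝ)⁻¹) := by
          have h1 := sum_Ioc_inv_sq_le_sub (α := ℝ) hw.ne' hwh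
          have : (0 : ℝ) ≤ (h : ℝ)⁻¹ := by positivity
          gcongr
          linarith
      _ = _ := by ring
  have hsumA : ∀ T : Finset ℕ, ∑ k ∈ T, A k = ∑ b ∈ intCube x h, ∑ k ∈ T,
      (if k ∣ (I.gcd (V *ᵥ b)).natAbs then (1 : ℝ) else 0) := by
    intro T
    rw [Finset.sum_comm]
    refine Finset.sum_congr rfl fun k _ => ?_
    rw [← Finset.sum_filter, Finset.sum_const, nsmul_eq_mul, mul_one]
    simp only [natCast_dvd_gcd_natAbs_iff, A]
  -- main inequality
  set G := ((intCube x h).filter fun b => I.gcd (V *ᵥ b) = 1)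
  have hG : (G.card : ℝ) = ∑ b ∈ intCube x h, if (I.gcd (V *ᵥ b)).natAbs = 1 then (1 : ℝ) else 0 := by
    rw [← Finset.sum_filter, Finset.sum_const, nsmul_eq_mul, mul_one]
    congr 2
    ext b
    simp only [G, Finset.mem_filter]
    have hnn : 0 ≤ I.gcd (V *ᵥ b) := by
      rw [← Finset.normalize_gcd]; exact Int.nonneg_of_normalize_eq_self (by simp)
    constructor
    · rintro ⟨h1, h2⟩; exact ⟨h1, by rw [h2]; rfl⟩
    · rintro ⟨h1, h2⟩; exact ⟨h1, by omega⟩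
  have hEsum : (E.card : ℝ) = ∑ b ∈ intCube x h,
      if ∃ p, p.Prime ∧ m ^ 2 * m ^ 2 < p ∧ p ∣ (I.gcd (V *ᵥ b)).natAbs then (1 : ℝ) else 0 := by
    rw [← Finset.sum_filter, Finset.sum_const, nsmul_eq_mul, mul_one]
    simp only [natCast_dvd_gcd_natAbs_iff, hss, E]
  have hmuA : ∑ k ∈ Finset.Icc 1 m, ((ArithmeticFunction.moebius k : ℤ) : ℝ) * A k
      = ∑ b ∈ intCube x h, ∑ k ∈ Finset.Icc 1 m,
      (if k ∣ (I.gcd (V *ᵥ b)).natAbs then ((ArithmeticFunction.moebius k : ℤ) : ℝ) else 0) := by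
    rw [Finset.sum_comm]
    refine Finset.sum_congr rfl fun k _ => ?_
    rw [← Finset.sum_filter, Finset.sum_const, nsmul_eq_mul, mul_comm]
    simp only [natCast_dvd_gcd_natAbs_iff, A]
  have hmain : |(G.card : ℝ) - ∑ k ∈ Finset.Icc 1 m, ((ArithmeticFunction.moebius k : ℤ) : ℝ) * A k|
      ≤ ∑ k ∈ Finset.Ioc m h, A k + m * (∑ k ∈ Finset.Ioc (m ^ 2) h, A k + E.card) := by
    rw [hG, hmuA, ← Finset.sum_sub_distrib]
    refine (Finset.abs_sum_le_sum_abs _ _).trans ?_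
    rw [hsumA, hsumA, hEsum, ← Finset.sum_add_distrib, Finset.mul_sum, ← Finset.sum_add_distrib]
    refine Finset.sum_le_sum fun b _ => ?_
    have := abs_ite_sub_sum_moebius_le (g := (I.gcd (V *ᵥ b)).natAbs) (z := m) hs2 (by omega)
      (by omega)
    rw [hss] at this ⊢
    exact this
  have hlow : |∑ k ∈ Finset.Icc 1 m, ((ArithmeticFunction.moebius k : ℤ) : ℝ) * A k
      - (h : ℝ) ^ d * ∑ k ∈ Finset.Icc 1 m, ((ArithmeticFunction.moebius k : ℤ) : ℝ) / (k : ℝ) ^ I.card|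
      ≤ m * (d * 2 ^ d * (h : ℝ) ^ d / h) := by
    rw [Finset.mul_sum, ← Finset.sum_sub_distrib]
    refine (Finset.abs_sum_le_sum_abs _ _).trans ?_
    calc _ ≤ ∑ k ∈ Finset.Icc 1 m, (d * 2 ^ d * (h : ℝ) ^ d / h) := ?_
      _ = _ := by simp
    refine Finset.sum_le_sum fun k hk => ?_
    rw [Finset.mem_Icc] at hk
    have hk0 : (0 : ℝ) < k := by exact_mod_cast hk.1
    have hk1 : (1 : ℝ) ≤ k := by exact_mod_cast hk.1
    have hmu : |((ArithmeticFunction.moebius k : ℤ) : ℝ)| ≤ 1 := by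
      exact_mod_cast ArithmeticFunction.abs_moebius_le_one
    have h1 : ((ArithmeticFunction.moebius k : ℤ) : ℝ) * A k
        - (h : ℝ) ^ d * (((ArithmeticFunction.moebius k : ℤ) : ℝ) / (k : ℝ) ^ I.card)
        = ((ArithmeticFunction.moebius k : ℤ) : ℝ) * (A k - (h : ℝ) ^ d / (k : ℝ) ^ I.card) := by
      ring
    rw [h1, abs_mul]
    have h2 := abs_card_dvd_sub_le h k hk.1 (hk.2.trans hzh) V U hVU I x
    have h3 : (k : ℝ) / (k : ℝ) ^ I.card ≤ 1 := by
      rw [div_le_one (by positivity)]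
      exact le_self_pow₀ hk1 (by omega)
    calc _ ≤ 1 * |A k - (h : ℝ) ^ d / (k : ℝ) ^ I.card| := by gcongr
      _ ≤ d * 2 ^ d * ((h : ℝ) ^ d / (k : ℝ) ^ I.card) * (k / h) := by rw [one_mul]; exact h2
      _ = d * 2 ^ d * (h : ℝ) ^ d / h * ((k : ℝ) / (k : ℝ) ^ I.card) := by ring
      _ ≤ d * 2 ^ d * (h : ℝ) ^ d / h * 1 := by gcongr
      _ = _ := by ring
  have htail := abs_sum_Icc_moebius_sub_le I.card m hI (by omega)
  set Sm := ∑ k ∈ Finset.Icc 1 m, ((ArithmeticFunction.moebius k : ℤ) : ℝ) / (k : ℝ) ^ I.card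
  set Q := ∑ k ∈ Finset.Icc 1 m, ((ArithmeticFunction.moebius k : ℤ) : ℝ) * A k
  have hA3 := hA2 m (by omega) hzh
  have hA4 := hA2 (m ^ 2) (by omega) hsh
  set X : ℝ := (h : ℝ) ^ d with hX
  have hX0 : 0 < X := by positivity
  have hdec : (G.card : ℝ) - X * moebiusSum I.card = (G.card - Q) + (Q - X * Sm)
      + X * (Sm - moebiusSum I.card) := by ring
  have h5 : |X * (Sm - moebiusSum I.card)| ≤ X * (1 / m) := by
    rw [abs_mul, abs_of_pos hX0]; gcongr
  have h6 : (m : ℝ) * (1 / h) ≤ 1 / m := by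
    rw [← hhr, mul_one_div, div_le_div_iff₀ (by positivity) hm0]
    nlinarith [pow_le_pow_right₀ hm1 (show 2 ≤ 4 by norm_num)]
  calc |(G.card : ℝ) - X * moebiusSum I.card|
      ≤ |G.card - Q| + |Q - X * Sm| + |X * (Sm - moebiusSum I.card)| := by
        rw [hdec]
        exact (abs_add_le _ _).trans (add_le_add (abs_add_le _ _) le_rfl)
    _ ≤ ((d * 2 ^ d + 1) * X / m + m * ((d * 2 ^ d + 1) * X / (m ^ 2 : ℕ) + d ^ d * (1 + K) * X / h))
        + m * (d * 2 ^ d * X / h) + X * (1 / m) := by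
        refine add_le_add (add_le_add (hmain.trans ?_) hlow) h5
        gcongr
    _ = (d * 2 ^ d + 1) * X / m + m * ((d * 2 ^ d + 1) * X / (m ^ 2 : ℕ))
        + d ^ d * (1 + K) * X * (m * (1 / h)) + d * 2 ^ d * X * (m * (1 / h)) + X * (1 / m) := by ring
    _ ≤ (d * 2 ^ d + 1) * X / m + m * ((d * 2 ^ d + 1) * X / (m ^ 2 : ℕ))
        + d ^ d * (1 + K) * X * (1 / m) + d * 2 ^ d * X * (1 / m) + X * (1 / m) := by
        gcongr
    _ = _ := by
        push_cast
        field_simp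
        ring

lemma exists_unimodular_vecMul_eq_single {ι : Type*} [Fintype ι] [DecidableEq ι] (I : Finset ι)
    (hI : 2 ≤ I.card) (i₀ : ι) (hi₀ : i₀ ∈ I) (y : ι → ℤ) (hy : I.gcd y = 1) :
    ∃ X : Matrix ι ι ℤ, X.det = 1 ∧ (∀ i, i ∉ I → X i = Pi.single i 1) ∧
      y ᵥ* X = Pi.single i₀ 1 := by
  -- one elementary step
  have key : ∀ (y : ι → ℤ) (a b : ι) (c : ℤ), a ∈ I → a ≠ b →
      (∃ X : Matrix ι ι ℤ, X.det = 1 ∧ (∀ i, i ∉ I → X i = Pi.single i 1) ∧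
        (Function.update y b (y b + c * y a)) ᵥ* X = Pi.single i₀ 1) →
      ∃ X : Matrix ι ι ℤ, X.det = 1 ∧ (∀ i, i ∉ I → X i = Pi.single i 1) ∧
        y ᵥ* X = Pi.single i₀ 1 := by
    rintro y a b c ha hab ⟨X, hX1, hX2, hX3⟩
    refine ⟨Matrix.transvection a b c * X, ?_, ?_, ?_⟩
    · rw [Matrix.det_mul, Matrix.det_transvection_of_ne _ _ hab, hX1, one_mul]
    · intro i hi
      have hia : i ≠ a := fun h => hi (h ▸ ha)
      funext j
      rw [Matrix.transvection_mul_apply_of_ne _ _ _ _ hia, hX2 i hi]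
    · rw [← Matrix.vecMul_vecMul, ← hX3]
      congr 1
      funext j
      simp only [Matrix.transvection, Matrix.vecMul_add, Matrix.vecMul_one, Pi.add_apply]
      by_cases hj : j = b
      · subst hj
        simp [Matrix.vecMul, dotProduct, Matrix.single_apply, mul_comm]
      · have : ∀ i, (Matrix.single a b c : Matrix ι ι ℤ) i j = 0 := by
          intro i; simp [Ne.symm hj]
        simp [Matrix.vecMul, dotProduct, this, hj]
  have hgcd : ∀ (y : ι → ℤ) (a b : ι) (c : ℤ), a ∈ I → a ≠ b → I.gcd y = 1 →
      I.gcd (Function.update y b (y b + c * y a)) = 1 := by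
    intro y a b c ha hab hy
    have h1 : I.gcd (Function.update y b (y b + c * y a)) ∣ I.gcd y := by
      rw [Finset.dvd_gcd_iff]
      intro i hi
      have hda := Finset.gcd_dvd (f := Function.update y b (y b + c * y a)) ha
      rw [Function.update_of_ne hab] at hda
      have hdi := Finset.gcd_dvd (f := Function.update y b (y b + c * y a)) hi
      by_cases hib : i = b
      · subst hib
        rw [Function.update_self] at hdi
        exact (dvd_add_left (hda.mul_left c)).1 hdi
      · rwa [Function.update_of_ne hib] at hdi
    rw [hy] at h1
    have h2 := Finset.normalize_gcd (s := I) (f := Function.update y b (y b + c * y a))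
    rw [← h2]
    exact normalize_eq_one.2 (isUnit_of_dvd_one h1)
  -- clearing the coordinates away from `i₀`
  have clear : ∀ (n : ℕ) (y : ι → ℤ), y i₀ = 1 →
      (Finset.univ.filter fun i => i ≠ i₀ ∧ y i ≠ 0).card = n →
      ∃ X : Matrix ι ι ℤ, X.det = 1 ∧ (∀ i, i ∉ I → X i = Pi.single i 1) ∧
        y ᵥ* X = Pi.single i₀ 1 := by
    intro n
    induction n with
    | zero =>
      intro y h1 h2
      refine ⟨1, Matrix.det_one, fun i _ => ?_, ?_⟩
      · funext j; simp [Matrix.one_apply, Pi.single_apply, eq_comm]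
      · rw [Matrix.vecMul_one]
        funext j
        by_cases hj : j = i₀
        · subst hj; simp [h1]
        · rw [Finset.card_eq_zero, Finset.filter_eq_empty_iff] at h2
          have := h2 (Finset.mem_univ j)
          push Not at this
          simp [hj, this hj]
    | succ n ih =>
      intro y h1 h2
      obtain ⟨b, hb⟩ : (Finset.univ.filter fun i => i ≠ i₀ ∧ y i ≠ 0).Nonempty := by
        rw [← Finset.card_pos]; omega
      have hb' := (Finset.mem_filter.1 hb).2
      refine key y i₀ b (- y b) hi₀ hb'.1.symm (ih _ ?_ ?_)
      · rw [Function.update_of_ne hb'.1.symm, h1]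
      · have : (Finset.univ.filter fun i => i ≠ i₀ ∧
            Function.update y b (y b + -y b * y i₀) i ≠ 0)
            = (Finset.univ.filter fun i => i ≠ i₀ ∧ y i ≠ 0).erase b := by
          ext i
          simp only [Finset.mem_filter, Finset.mem_univ, true_and, Finset.mem_erase]
          by_cases hib : i = b
          · subst hib; simp [h1]
          · simp [hib]
        rw [this, Finset.card_erase_of_mem hb, h2]
        rfl
  -- the Euclidean algorithm
  have main : ∀ (n : ℕ) (y : ι → ℤ), I.gcd y = 1 → ∑ i ∈ I, (y i).natAbs = n →
      ∃ X : Matrix ι ι ℤ, X.det = 1 ∧ (∀ i, i ∉ I → X i = Pi.single i 1) ∧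
        y ᵥ* X = Pi.single i₀ 1 := by
    intro n
    induction n using Nat.strong_induction_on with
    | _ n ih =>
      intro y hy hn
      by_cases h2 : ∃ a ∈ I, ∃ b ∈ I, a ≠ b ∧ y a ≠ 0 ∧ y b ≠ 0 ∧ (y a).natAbs ≤ (y b).natAbs
      · obtain ⟨a, ha, b, hb, hab, hya, hyb, hle⟩ := h2
        have hstep : ∀ c : ℤ, (y b + c * y a).natAbs < (y b).natAbs →
            ∃ X : Matrix ι ι ℤ, X.det = 1 ∧ (∀ i, i ∉ I → X i = Pi.single i 1) ∧
              y ᵥ* X = Pi.single i₀ 1 := by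
          intro c hc
          refine key y a b c ha hab (ih _ ?_ _ (hgcd y a b c ha hab hy) rfl)
          rw [← hn]
          refine Finset.sum_lt_sum (fun i _ => ?_) ⟨b, hb, ?_⟩
          · by_cases hib : i = b
            · subst hib; rw [Function.update_self]; exact hc.le
            · rw [Function.update_of_ne hib]
          · rw [Function.update_self]; exact hc
        by_cases hsign : (y b + 1 * y a).natAbs < (y b).natAbs
        · exact hstep 1 hsign
        · exact hstep (-1) (by omega)
      · -- at most one nonzero coordinate in `I`
        push Not at h2
        obtain ⟨a, ha, hya⟩ : ∃ a ∈ I, y a ≠ 0 := by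
          by_contra hcon
          push Not at hcon
          have : I.gcd y = 0 := Finset.gcd_eq_zero_iff.2 hcon
          omega
        have hothers : ∀ b ∈ I, b ≠ a → y b = 0 := by
          intro b hb hba
          by_contra hyb
          have h3 := h2 a ha b hb hba.symm hya hyb
          have h4 := h2 b hb a ha hba hyb hya
          omega
        have hunit : y a ∣ 1 := by
          rw [← hy, Finset.dvd_gcd_iff]
          intro b hb
          by_cases hba : b = a
          · rw [hba]
          · rw [hothers b hb hba]; exact dvd_zero _
        have hya1 : y a = 1 ∨ y a = -1 := Int.isUnit_iff.1 (isUnit_of_dvd_one hunit)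
        -- move the unit to a coordinate different from `i₀`, then to `i₀`
        have hne : ∀ (y : ι → ℤ) (b : ι), b ∈ I → b ≠ i₀ → (y b = 1 ∨ y b = -1) →
            ∃ X : Matrix ι ι ℤ, X.det = 1 ∧ (∀ i, i ∉ I → X i = Pi.single i 1) ∧
              y ᵥ* X = Pi.single i₀ 1 := by
          intro y b hb hbi hyb
          refine key y b i₀ (y b * (1 - y i₀)) hb hbi (clear _ _ ?_ rfl)
          rw [Function.update_self]
          rcases hyb with h | h <;> rw [h] <;> ring
        by_cases hai : a = i₀
        · subst hai
          obtain ⟨b, hb, hba⟩ := Finset.exists_mem_ne (show 1 < I.card by omega) a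
          refine key y a b 1 ha hba.symm (hne _ b hb hba ?_)
          rw [Function.update_self, hothers b hb hba]
          simpa using hya1
        · exact hne y a ha hai hya1
  exact main _ y hy rfl

/-- The rows of `B` are the first `j` rows of a unimodular integer matrix. -/
def IsPrimTuple {j d : ℕ} (B : Fin j → Fin d → ℤ) : Prop :=
  ∃ U : Matrix (Fin d) (Fin d) ℤ, U.det = 1 ∧
    ∀ (i : Fin j) (i' : Fin d), (i : ℕ) = i' → U i' = B i

lemma isPrimTuple_snoc_iff {j d : ℕ} (hj : j + 2 ≤ d) (B : Fin j → Fin d → ℤ) (b : Fin d → ℤ)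
    (U V : Matrix (Fin d) (Fin d) ℤ) (hU : U.det = 1) (hVU : V * U = 1)
    (hUB : ∀ (i : Fin j) (i' : Fin d), (i : ℕ) = i' → U i' = B i) :
    IsPrimTuple (Fin.snoc (α := fun _ => Fin d → ℤ) B b) ↔
      (Finset.univ.filter fun i : Fin d => j ≤ i).gcd (b ᵥ* V) = 1 := by
  have hUV : U * V = 1 := mul_eq_one_comm.1 hVU
  set I := Finset.univ.filter fun i : Fin d => j ≤ i
  set i₀ : Fin d := ⟨j, by omega⟩
  have hi₀ : i₀ ∈ I := by simp [I, i₀]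
  constructor
  · rintro ⟨U', hU', hUB'⟩
    have hW : (U' * V).det = 1 := by
      have h1 : U.det * V.det = 1 := by rw [← Matrix.det_mul, hUV, Matrix.det_one]
      rw [hU, one_mul] at h1
      rw [Matrix.det_mul, hU', h1, one_mul]
    set W := U' * V
    have hrow : ∀ i : Fin d, i ∉ I → U' i = U i := by
      intro i hi
      have hij : (i : ℕ) < j := by simpa [I] using hi
      rw [hUB ⟨i, hij⟩ i rfl, hUB' (Fin.castSucc ⟨i, hij⟩) i rfl, Fin.snoc_castSucc]
    have hrow0 : U' i₀ = b := by
      rw [hUB' (Fin.last j) i₀ rfl, Fin.snoc_last]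
    have hWadj : W * W.adjugate = 1 := by rw [Matrix.mul_adjugate, hW, one_smul]
    have hWi : ∀ i : Fin d, i ∉ I → W i = (1 : Matrix (Fin d) (Fin d) ℤ) i := by
      intro i hi
      have h1 : W i = U' i ᵥ* V := Matrix.mul_apply_eq_vecMul _ _ _
      rw [h1, hrow i hi, ← Matrix.mul_apply_eq_vecMul, hUV]
    have hadj : ∀ i : Fin d, i ∉ I → W.adjugate i = (1 : Matrix (Fin d) (Fin d) ℤ) i := by
      intro i hi
      have h1 : (W * W.adjugate) i = W i ᵥ* W.adjugate := Matrix.mul_apply_eq_vecMul _ _ _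
      rw [hWi i hi, hWadj, ← Matrix.mul_apply_eq_vecMul, one_mul] at h1
      exact h1.symm
    have hW0 : W i₀ = b ᵥ* V := by
      have h1 : W i₀ = U' i₀ ᵥ* V := Matrix.mul_apply_eq_vecMul _ _ _
      rw [h1, hrow0]
    have h1 : ∑ i, W i₀ i * W.adjugate i i₀ = 1 := by
      rw [← Matrix.mul_apply, hWadj, Matrix.one_apply_eq]
    have h2 : I.gcd (b ᵥ* V) ∣ 1 := by
      rw [← h1]
      refine Finset.dvd_sum fun i _ => ?_
      by_cases hi : i ∈ I
      · rw [hW0]; exact (Finset.gcd_dvd hi).mul_right _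
      · have : i ≠ i₀ := fun h => hi (h ▸ hi₀)
        rw [hadj i hi, Matrix.one_apply_ne this, mul_zero]
        exact dvd_zero _
    rw [← Finset.normalize_gcd]
    exact normalize_eq_one.2 (isUnit_of_dvd_one h2)
  · intro hg
    have hI : 2 ≤ I.card := by
      have : ({⟨j, by omega⟩, ⟨j + 1, by omega⟩} : Finset (Fin d)) ⊆ I := by
        intro i hi
        simp only [Finset.mem_insert, Finset.mem_singleton] at hi
        rcases hi with rfl | rfl <;> simp [I]
      refine le_trans (le_of_eq ?_) (Finset.card_le_card this)
      rw [Finset.card_pair (by simp)]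
    obtain ⟨X, hX1, hX2, hX3⟩ := exists_unimodular_vecMul_eq_single I hI i₀ hi₀ _ hg
    have hXadj : X * X.adjugate = 1 := by rw [Matrix.mul_adjugate, hX1, one_smul]
    have hdet : X.adjugate.det = 1 := by
      rw [Matrix.det_adjugate, hX1, one_pow]
    refine ⟨X.adjugate * U, by rw [Matrix.det_mul, hdet, hU, one_mul], ?_⟩
    intro i i' hii
    rw [Matrix.mul_apply_eq_vecMul]
    induction i using Fin.lastCases with
    | last =>
      have : i' = i₀ := Fin.ext (by simpa [i₀] using hii.symm)
      subst this
      rw [Fin.snoc_last]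
      have h1 : X.adjugate i₀ = b ᵥ* V := by
        have h2 : (Pi.single i₀ 1 : Fin d → ℤ) ᵥ* X.adjugate = b ᵥ* V := by
          rw [← hX3, Matrix.vecMul_vecMul, hXadj, Matrix.vecMul_one]
        rw [← h2, Matrix.single_one_vecMul]
        rfl
      rw [h1, Matrix.vecMul_vecMul, hVU, Matrix.vecMul_one]
    | cast i =>
      rw [Fin.snoc_castSucc]
      have hiI : i' ∉ I := by
        simp only [I, Finset.mem_filter, Finset.mem_univ, true_and, not_le, ← hii]
        simp
      have hXi : X i' = (1 : Matrix (Fin d) (Fin d) ℤ) i' := by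
        rw [hX2 i' hiI]; funext k; simp [Matrix.one_apply, Pi.single_apply, eq_comm]
      have h1 : (X * X.adjugate) i' = X i' ᵥ* X.adjugate := Matrix.mul_apply_eq_vecMul _ _ _
      rw [hXi, hXadj, ← Matrix.mul_apply_eq_vecMul, one_mul] at h1
      rw [← h1, ← Matrix.mul_apply_eq_vecMul, one_mul]
      exact hUB i i' (by simpa using hii)

/-- Tuples of integer points, the `i`-th one in the cube with corner `x i` and side `h`. -/
def tupleCube {j d : ℕ} (x : Fin j → Fin d → ℤ) (h : ℕ) : Finset (Fin j → Fin d → ℤ) :=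
  Fintype.piFinset fun i => intCube (x i) h

lemma mem_tupleCube {j d : ℕ} {x B : Fin j → Fin d → ℤ} {h : ℕ} :
    B ∈ tupleCube x h ↔ ∀ i k, x i k ≤ B i k ∧ B i k < x i k + h := by
  simp [tupleCube, mem_intCube]

lemma card_tupleCube {j d : ℕ} (x : Fin j → Fin d → ℤ) (h : ℕ) :
    (tupleCube x h).card = (h ^ d) ^ j := by
  simp [tupleCube, card_intCube]

/-- The density of primitive tuples. -/
def primDensity (j d : ℕ) : ℝ := ∏ i ∈ Finset.range j, moebiusSum (d - i)

open Classical in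
lemma card_isPrimTuple_tupleCube (d j : ℕ) (hj : j + 1 ≤ d) : ∃ C : ℝ, 0 < C ∧
    ∀ (m : ℕ), 2 ≤ m → ∀ x : Fin j → Fin d → ℤ, (∀ i k, |x i k| + (m : ℤ) ^ 4 ≤ (m : ℤ) ^ 12) →
    |(((tupleCube x (m ^ 4)).filter IsPrimTuple).card : ℝ)
      - primDensity j d * (((m : ℝ) ^ 4) ^ d) ^ j| ≤ C * (((m : ℝ) ^ 4) ^ d) ^ j / m := by
  induction j with
  | zero =>
    refine ⟨1, one_pos, fun m hm x hx => ?_⟩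
    have h1 : (tupleCube x (m ^ 4)).filter IsPrimTuple = Finset.univ := by
      ext B
      simp only [Finset.mem_filter, mem_tupleCube, Finset.mem_univ, iff_true]
      exact ⟨fun i => i.elim0, 1, Matrix.det_one, fun i => i.elim0⟩
    rw [h1]
    simp [primDensity]
  | succ j ih =>
    obtain ⟨C₁, hC₁, ih⟩ := ih (by omega)
    obtain ⟨C₂, hC₂, hs⟩ := sieve_cube d
    set c := moebiusSum (d - j) with hc
    refine ⟨C₂ + |c| * C₁, by positivity, fun m hm x hx => ?_⟩
    have hm0 : (0 : ℝ) < m := by exact_mod_cast (by omega : 0 < m)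
    set h : ℕ := m ^ 4 with hh
    have hhr : (m : ℝ) ^ 4 = h := by rw [hh]; push_cast; rfl
    have hhz : (m : ℤ) ^ 4 = h := by rw [hh]; push_cast; rfl
    rw [hhr]
    rw [hhz] at hx
    have hhpos : (0 : ℝ) ≤ h := by positivity
    let x' : Fin j → Fin d → ℤ := fun i => x i.castSucc
    let P := (tupleCube x' h).filter IsPrimTuple
    let P' := (tupleCube x h).filter IsPrimTuple
    have hmaps : ∀ B ∈ P', Fin.init (α := fun _ => Fin d → ℤ) B ∈ P := by
      intro B hB
      obtain ⟨h1, U, hU, hUB⟩ := Finset.mem_filter.1 hB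
      refine Finset.mem_filter.2 ⟨mem_tupleCube.2 fun i k => mem_tupleCube.1 h1 i.castSucc k,
        U, hU, fun i i' hii => hUB i.castSucc i' (by simpa using hii)⟩
    have hfib : ∀ B ∈ P, |((P'.filter fun B' => Fin.init (α := fun _ => Fin d → ℤ) B' = B).card : ℝ)
        - (h : ℝ) ^ d * c| ≤ C₂ * (h : ℝ) ^ d / m := by
      intro B hB
      obtain ⟨hB1, U, hU, hUB⟩ := Finset.mem_filter.1 hB
      have hUadj : U.adjugate * U = 1 := by rw [Matrix.adjugate_mul, hU, one_smul]
      have hUadj' : U * U.adjugate = 1 := by rw [Matrix.mul_adjugate, hU, one_smul]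
      set I := Finset.univ.filter fun i : Fin d => j ≤ i
      have hIc : I.card = d - j := by
        have : I = Finset.Ici (⟨j, by omega⟩ : Fin d) := by
          ext i; simp [I, Fin.le_def]
        rw [this, Fin.card_Ici]
      have h1 : (P'.filter fun B' => Fin.init (α := fun _ => Fin d → ℤ) B' = B).card
          = ((intCube (x (Fin.last j)) h).filter fun b => I.gcd (U.adjugateᵀ *ᵥ b) = 1).card := by
        refine Finset.card_bij' (fun B' _ => B' (Fin.last j))
          (fun b _ => Fin.snoc (α := fun _ => Fin d → ℤ) B b) ?_ ?_ ?_ ?_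
        · intro B' hB'
          obtain ⟨h2, h3⟩ := Finset.mem_filter.1 hB'
          obtain ⟨h4, h5⟩ := Finset.mem_filter.1 h2
          refine Finset.mem_filter.2 ⟨mem_intCube.2 fun k => mem_tupleCube.1 h4 _ k, ?_⟩
          rw [Matrix.mulVec_transpose, ← isPrimTuple_snoc_iff (by omega) B _ U _ hU hUadj hUB,
            ← h3, Fin.snoc_init_self]
          exact h5
        · intro b hb
          obtain ⟨h2, h3⟩ := Finset.mem_filter.1 hb
          rw [Matrix.mulVec_transpose, ← isPrimTuple_snoc_iff (by omega) B _ U _ hU hUadj hUB] at h3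
          refine Finset.mem_filter.2 ⟨Finset.mem_filter.2 ⟨mem_tupleCube.2 fun i k => ?_, h3⟩,
            Fin.init_snoc _ _⟩
          induction i using Fin.lastCases with
          | last => rw [Fin.snoc_last]; exact mem_intCube.1 h2 k
          | cast i => rw [Fin.snoc_castSucc]; exact mem_tupleCube.1 hB1 i k
        · intro B' hB'
          obtain ⟨h2, h3⟩ := Finset.mem_filter.1 hB'
          rw [← h3]; exact Fin.snoc_init_self _
        · intro b hb
          exact Fin.snoc_last _ _
      have h2 := hs m hm U.adjugateᵀ Uᵀ (by rw [← Matrix.transpose_mul, hUadj', Matrix.transpose_one])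
        I (by omega) ?_ (x (Fin.last j)) ?_
      · rw [hhr, hIc] at h2
        rw [h1]
        exact h2
      · intro r k hk
        have hkj : (k : ℕ) < j := by simpa [I] using hk
        rw [Matrix.transpose_apply, hUB ⟨k, hkj⟩ k rfl]
        have h3 := mem_tupleCube.1 hB1 ⟨k, hkj⟩ r
        have h4 := hx (Fin.castSucc ⟨k, hkj⟩) r
        have h5 := abs_le.1 (le_refl |x (Fin.castSucc ⟨k, hkj⟩) r|)
        simp only [x'] at h3
        rw [abs_le]
        constructor <;> linarith
      · intro k
        have h4 := hx (Fin.last j) k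
        have : (0 : ℤ) ≤ h := by positivity
        linarith
    have hcard : (P'.card : ℝ) = ∑ B ∈ P,
        ((P'.filter fun B' => Fin.init (α := fun _ => Fin d → ℤ) B' = B).card : ℝ) := by
      rw [Finset.card_eq_sum_card_fiberwise hmaps]; push_cast; rfl
    have h1 : |(P'.card : ℝ) - P.card * ((h : ℝ) ^ d * c)| ≤ P.card * (C₂ * (h : ℝ) ^ d / m) := by
      have : (P.card : ℝ) * ((h : ℝ) ^ d * c) = ∑ B ∈ P, ((h : ℝ) ^ d * c) := by simp
      rw [hcard, this, ← Finset.sum_sub_distrib]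
      refine (Finset.abs_sum_le_sum_abs _ _).trans ?_
      refine (Finset.sum_le_sum hfib).trans (le_of_eq ?_)
      simp
    have h2 : (P.card : ℝ) ≤ ((h : ℝ) ^ d) ^ j := by
      have := (Finset.card_le_card (Finset.filter_subset IsPrimTuple (tupleCube x' h))).trans_eq
        (card_tupleCube x' h)
      exact_mod_cast this
    have h3 := ih m hm x' fun i k => by rw [hhz]; exact hx i.castSucc k
    rw [hhr] at h3
    have h4 : primDensity (j + 1) d = primDensity j d * c := by
      rw [primDensity, Finset.prod_range_succ]; rfl
    rw [h4]
    have hdec : (P'.card : ℝ) - primDensity j d * c * ((h : ℝ) ^ d) ^ (j + 1)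
        = (P'.card - P.card * ((h : ℝ) ^ d * c))
          + (P.card - primDensity j d * ((h : ℝ) ^ d) ^ j) * ((h : ℝ) ^ d * c) := by ring
    change |(P'.card : ℝ) - _| ≤ _
    rw [hdec]
    calc _ ≤ |(P'.card : ℝ) - P.card * ((h : ℝ) ^ d * c)|
          + |(P.card : ℝ) - primDensity j d * ((h : ℝ) ^ d) ^ j| * |(h : ℝ) ^ d * c| := by
          rw [← abs_mul]; exact abs_add_le _ _
      _ ≤ ((h : ℝ) ^ d) ^ j * (C₂ * (h : ℝ) ^ d / m)
          + (C₁ * ((h : ℝ) ^ d) ^ j / m) * ((h : ℝ) ^ d * |c|) := by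
          refine add_le_add (h1.trans (by gcongr)) (mul_le_mul h3 (le_of_eq ?_) (abs_nonneg _)
            (by positivity))
          rw [abs_mul, abs_of_nonneg (by positivity : (0 : ℝ) ≤ (h : ℝ) ^ d)]
      _ = _ := by ring

section CommRing

variable {R : Type*} [CommRing R] {n : ℕ}

lemma crossVec_last (B : Fin n → Fin (n + 1) → R) :
    crossVec B (Fin.last n) = (leftBlock B).det := by
  rw [crossVec, Fin.snoc_last]

lemma crossVec_castSucc (B : Fin n → Fin (n + 1) → R) (j : Fin n) :
    crossVec B j.castSucc = -((leftBlock B).adjugate *ᵥ lastCol B) j := by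
  rw [crossVec, Fin.snoc_castSucc]
  rfl

/-- The cross product is orthogonal to its factors. -/
lemma sum_mul_crossVec (B : Fin n → Fin (n + 1) → R) (i : Fin n) :
    ∑ j, B i j * crossVec B j = 0 := by
  rw [Fin.sum_univ_castSucc, crossVec_last]
  have h1 : ∑ j : Fin n, B i j.castSucc * crossVec B j.castSucc =
      -((leftBlock B) *ᵥ ((leftBlock B).adjugate *ᵥ lastCol B)) i := by
    simp only [crossVec_castSucc, mul_neg, Finset.sum_neg_distrib]
    rfl
  rw [h1, Matrix.mulVec_mulVec, Matrix.mul_adjugate, Matrix.smul_mulVec, Matrix.one_mulVec]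
  simp only [Pi.smul_apply, smul_eq_mul, lastCol]
  ring

/-- Left multiplication of a tuple of row vectors by a square matrix. -/
def tupleMul {m : ℕ} (γ : Matrix (Fin n) (Fin n) R) (B : Fin n → Fin m → R) : Fin n → Fin m → R :=
  fun i j => ∑ k, γ i k * B k j

lemma leftBlock_mul (γ : Matrix (Fin n) (Fin n) R) (B : Fin n → Fin (n + 1) → R) :
    leftBlock (tupleMul γ B) = γ * leftBlock B := by
  ext i j
  rfl

lemma lastCol_mul (γ : Matrix (Fin n) (Fin n) R) (B : Fin n → Fin (n + 1) → R) :
    lastCol (tupleMul γ B) = γ *ᵥ lastCol B := by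
  ext i
  rfl

lemma crossVec_mul (γ : Matrix (Fin n) (Fin n) R) (B : Fin n → Fin (n + 1) → R) :
    crossVec (tupleMul γ B) = γ.det • crossVec B := by
  funext j
  refine Fin.lastCases ?_ (fun j => ?_) j
  · simp only [crossVec_last, leftBlock_mul, Matrix.det_mul, Pi.smul_apply, smul_eq_mul]
  · simp only [crossVec_castSucc, leftBlock_mul, lastCol_mul, Pi.smul_apply, smul_eq_mul,
      Matrix.adjugate_mul_distrib]
    rw [Matrix.mulVec_mulVec, Matrix.mul_assoc, Matrix.adjugate_mul, Matrix.mul_smul,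
      Matrix.mul_one, Matrix.smul_mulVec]
    simp

lemma crossVec_map {S : Type*} [CommRing S] (f : R →+* S) (B : Fin n → Fin (n + 1) → R)
    (j : Fin (n + 1)) : crossVec (fun i j => f (B i j)) j = f (crossVec B j) := by
  have h1 : leftBlock (fun i j => f (B i j)) = (leftBlock B).map f := rfl
  refine Fin.lastCases ?_ (fun j => ?_) j
  · rw [crossVec_last, crossVec_last, h1, RingHom.map_det]
    rfl
  · rw [crossVec_castSucc, crossVec_castSucc, h1]
    have h2 : ((leftBlock B).map f).adjugate = (leftBlock B).adjugate.map f :=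
      (RingHom.map_adjugate f _).symm
    rw [h2, map_neg]
    congr 1
    simp only [Matrix.mulVec, dotProduct, Matrix.map_apply, map_sum, map_mul, lastCol]

lemma det_scaledBlock (B : Fin n → Fin (n + 1) → R) :
    (Matrix.of (scaledBlock B)).det = ∏ j, crossVec B j := by
  have h1 : Matrix.of (scaledBlock B) =
      leftBlock B * Matrix.diagonal fun j => crossVec B j.castSucc := by
    ext i j
    rw [Matrix.mul_diagonal]
    rfl
  rw [h1, Matrix.det_mul, Matrix.det_diagonal, Fin.prod_univ_castSucc, crossVec_last]
  ring

lemma adjugate_last_last {U : Matrix (Fin (n + 1)) (Fin (n + 1)) R}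
    {B : Fin n → Fin (n + 1) → R} (hB : ∀ i : Fin n, U i.castSucc = B i) :
    U.adjugate (Fin.last n) (Fin.last n) = crossVec B (Fin.last n) := by
  rw [crossVec_last, Matrix.adjugate_fin_succ_eq_det_submatrix]
  have h : (-1 : R) ^ (((Fin.last n : Fin (n + 1)) : ℕ) + ((Fin.last n : Fin (n + 1)) : ℕ)) = 1 := by
    rw [← two_mul, pow_mul]; simp
  rw [h, one_mul]
  congr 1
  ext i j
  simp only [Matrix.submatrix_apply, Fin.succAbove_last, hB]
  rfl

end CommRing

section Int

variable {n : ℕ}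

lemma mulVec_crossVec_of_isPrimTuple {U : Matrix (Fin (n + 1)) (Fin (n + 1)) ℤ} (hU : U.det = 1)
    {B : Fin n → Fin (n + 1) → ℤ} (hB : ∀ i : Fin n, U i.castSucc = B i)
    (hq : crossVec B (Fin.last n) ≠ 0) :
    U *ᵥ crossVec B = Pi.single (Fin.last n) 1 := by
  set s := (U *ᵥ crossVec B) (Fin.last n) with hs
  have h1 : U *ᵥ crossVec B = Pi.single (Fin.last n) s := by
    funext i
    refine Fin.lastCases ?_ (fun i => ?_) i
    · rw [Pi.single_eq_same]
    · rw [Pi.single_eq_of_ne (Fin.castSucc_lt_last i).ne, Matrix.mulVec, hB]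
      exact sum_mul_crossVec B i
  have h2 : crossVec B = U.adjugate *ᵥ Pi.single (Fin.last n) s := by
    rw [← h1, Matrix.mulVec_mulVec, Matrix.adjugate_mul, hU, one_smul, Matrix.one_mulVec]
  have h3 : crossVec B (Fin.last n) = crossVec B (Fin.last n) * s := by
    conv_lhs => rw [h2, Matrix.mulVec_single]
    simp [adjugate_last_last hB]
  have h4 : s = 1 := by
    have := mul_left_cancel₀ hq (h3.symm.trans (mul_one _).symm)
    exact this
  rw [h1, h4]

lemma gcd_crossVec_eq_one {B : Fin n → Fin (n + 1) → ℤ} (hB : IsPrimTuple B)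
    (hq : crossVec B (Fin.last n) ≠ 0) : Finset.univ.gcd (crossVec B) = 1 := by
  obtain ⟨U, hU, hUB⟩ := hB
  have h1 := mulVec_crossVec_of_isPrimTuple hU (fun i => hUB i i.castSucc rfl) hq
  have h2 := congrFun h1 (Fin.last n)
  rw [Pi.single_eq_same] at h2
  have h3 : Finset.univ.gcd (crossVec B) ∣ 1 := by
    rw [← h2]
    rw [Matrix.mulVec, dotProduct]
    exact Finset.dvd_sum fun i _ => (Finset.gcd_dvd (Finset.mem_univ i)).mul_left _
  have h4 := Finset.normalize_gcd (s := Finset.univ) (f := crossVec B)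
  rw [← h4]
  exact normalize_eq_one.2 (isUnit_of_dvd_one h3)

/-- Every primitive vector with non-zero last entry is the cross product of a primitive tuple. -/
lemma exists_isPrimTuple_crossVec_eq (hn : n ≠ 0) {a : Fin (n + 1) → ℤ}
    (ha : Finset.univ.gcd a = 1) (hq : a (Fin.last n) ≠ 0) :
    ∃ U : Matrix (Fin (n + 1)) (Fin (n + 1)) ℤ, U.det = 1 ∧ U *ᵥ a = Pi.single (Fin.last n) 1 ∧
      crossVec (fun i => U i.castSucc) = a := by
  obtain ⟨X, hX, -, hX2⟩ := exists_unimodular_vecMul_eq_single Finset.univ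
    (by rw [Finset.card_univ, Fintype.card_fin]; omega) (Fin.last n) (Finset.mem_univ _) a ha
  have hU : Xᵀ.det = 1 := by rw [Matrix.det_transpose, hX]
  have hUa : Xᵀ *ᵥ a = Pi.single (Fin.last n) 1 := by rw [Matrix.mulVec_transpose, hX2]
  refine ⟨Xᵀ, hU, hUa, ?_⟩
  set B : Fin n → Fin (n + 1) → ℤ := fun i => Xᵀ i.castSucc with hB
  have hcol : a = Xᵀ.adjugate *ᵥ Pi.single (Fin.last n) 1 := by
    rw [← hUa, Matrix.mulVec_mulVec, Matrix.adjugate_mul, hU, one_smul, Matrix.one_mulVec]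
  have h1 : a (Fin.last n) = crossVec B (Fin.last n) := by
    rw [← adjugate_last_last (U := Xᵀ) (B := B) fun i => rfl]
    conv_lhs => rw [hcol]
    simp
  have h2 := mulVec_crossVec_of_isPrimTuple (B := B) hU (fun i => rfl) (h1 ▸ hq)
  have : crossVec B = Xᵀ.adjugate *ᵥ Pi.single (Fin.last n) 1 := by
    rw [← h2, Matrix.mulVec_mulVec, Matrix.adjugate_mul, hU, one_smul, Matrix.one_mulVec]
  rw [this, ← hcol]

/-- Vectors orthogonal to the cross product of a primitive tuple are integer combinations of it. -/
lemma exists_eq_vecMul_of_sum_mul_eq_zero {U : Matrix (Fin (n + 1)) (Fin (n + 1)) ℤ} (hU : U.det = 1)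
    {a : Fin (n + 1) → ℤ} (hUa : U *ᵥ a = Pi.single (Fin.last n) 1) {v : Fin (n + 1) → ℤ}
    (hv : ∑ j, v j * a j = 0) :
    ∃ c : Fin n → ℤ, ∀ j, v j = ∑ i : Fin n, c i * U i.castSucc j := by
  set y := v ᵥ* U.adjugate with hy
  have h1 : v = y ᵥ* U := by
    rw [hy, Matrix.vecMul_vecMul, Matrix.adjugate_mul, hU, one_smul, Matrix.vecMul_one]
  have h2 : y (Fin.last n) = 0 := by
    have : v ⬝ᵥ a = y (Fin.last n) := by
      rw [h1, ← Matrix.dotProduct_mulVec, hUa]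
      simp
    rw [← this]
    exact hv
  refine ⟨fun i => y i.castSucc, fun j => ?_⟩
  conv_lhs => rw [h1]
  rw [Matrix.vecMul, dotProduct, Fin.sum_univ_castSucc, h2, zero_mul, add_zero]

/-- `B` has a given primitive cross product with non-zero last entry iff it differs from a fixed
such tuple by a determinant one base change. -/
lemma exists_mul_eq_of_crossVec_eq {U : Matrix (Fin (n + 1)) (Fin (n + 1)) ℤ} (hU : U.det = 1)
    {a : Fin (n + 1) → ℤ} (hUa : U *ᵥ a = Pi.single (Fin.last n) 1)
    (hcr : crossVec (fun i : Fin n => U i.castSucc) = a) (hq : a (Fin.last n) ≠ 0)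
    {B : Fin n → Fin (n + 1) → ℤ} (hB : crossVec B = a) :
    ∃ γ : Matrix (Fin n) (Fin n) ℤ, γ.det = 1 ∧
      B = tupleMul γ fun i : Fin n => U i.castSucc := by
  have h1 : ∀ i, ∃ c : Fin n → ℤ, ∀ j, B i j = ∑ k : Fin n, c k * U k.castSucc j := by
    intro i
    refine exists_eq_vecMul_of_sum_mul_eq_zero hU hUa ?_
    rw [← hB]
    exact sum_mul_crossVec B i
  choose c hc using h1
  have h2 : B = tupleMul (Matrix.of c) fun i : Fin n => U i.castSucc := by
    funext i j
    rw [hc]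
    rfl
  refine ⟨Matrix.of c, ?_, h2⟩
  have h3 : crossVec B = (Matrix.of c).det • a := by rw [h2, crossVec_mul, hcr]
  have h4 := congrFun h3 (Fin.last n)
  rw [hB, Pi.smul_apply, smul_eq_mul] at h4
  have := mul_right_cancel₀ hq (h4.symm.trans (one_mul _).symm)
  exact this

lemma det_of_last_col {R : Type*} [CommRing R] {V : Matrix (Fin (n + 1)) (Fin (n + 1)) R}
    (h0 : ∀ i : Fin n, V i.castSucc (Fin.last n) = 0) (h1 : V (Fin.last n) (Fin.last n) = 1) :
    V.det = (V.submatrix Fin.castSucc Fin.castSucc).det := by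
  rw [Matrix.det_succ_column V (Fin.last n), Fin.sum_univ_castSucc]
  simp only [h0, h1, mul_zero, zero_mul, Finset.sum_const_zero, zero_add, Fin.succAbove_last,
    mul_one]
  rw [← two_mul, pow_mul]
  simp

lemma isPrimTuple_of_gcd_crossVec (hn : n ≠ 0) {B : Fin n → Fin (n + 1) → ℤ}
    (hg : Finset.univ.gcd (crossVec B) = 1) (hq : crossVec B (Fin.last n) ≠ 0) :
    IsPrimTuple B := by
  obtain ⟨U, hU, hUa, hcr⟩ := exists_isPrimTuple_crossVec_eq hn hg hq
  obtain ⟨γ, hγ, hB⟩ := exists_mul_eq_of_crossVec_eq hU hUa hcr hq rfl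
  set V : Matrix (Fin (n + 1)) (Fin (n + 1)) ℤ := Matrix.of fun i =>
    Fin.snoc (α := fun _ => Fin (n + 1) → ℤ)
      (fun i => Fin.snoc (α := fun _ => ℤ) (γ i) 0) (Pi.single (Fin.last n) 1) i with hV
  have hVdet : V.det = 1 := by
    rw [det_of_last_col, ← hγ]
    · congr 1
      ext i j
      simp [hV]
    · intro i
      simp [hV]
    · simp [hV]
  refine ⟨V * U, by rw [Matrix.det_mul, hVdet, hU, one_mul], fun i i' hii' => ?_⟩
  have : i' = i.castSucc := Fin.ext hii'.symm
  subst this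
  rw [hB]
  funext j
  rw [Matrix.mul_apply, Fin.sum_univ_castSucc]
  simp [hV, tupleMul]

end Int

/-- An integer tuple viewed as a real tuple. -/
def castTuple {n m : ℕ} (B : Fin n → Fin m → ℤ) : Fin n → Fin m → ℝ := fun i j => (B i j : ℝ)

lemma crossVec_castTuple {n : ℕ} (B : Fin n → Fin (n + 1) → ℤ) (j : Fin (n + 1)) :
    crossVec (castTuple B) j = ((crossVec B j : ℤ) : ℝ) :=
  crossVec_map (Int.castRingHom ℝ) B j

lemma arrDet_scaledBlock_castTuple {n : ℕ} (B : Fin n → Fin (n + 1) → ℤ) :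
    arrDet (scaledBlock (castTuple B)) = ∏ j, ((crossVec B j : ℤ) : ℝ) := by
  rw [arrDet, det_scaledBlock]
  simp only [crossVec_castTuple]

lemma crossVec_tupleMul_transpose {n : ℕ} (γ : Matrix.SpecialLinearGroup (Fin n) ℤ)
    (B : Fin n → Fin (n + 1) → ℤ) :
    crossVec (tupleMul (γ : Matrix (Fin n) (Fin n) ℤ)ᵀ B) = crossVec B := by
  rw [crossVec_mul, Matrix.det_transpose, γ.det_coe, one_smul]

lemma arrNormalize_tupleMul_transpose {n : ℕ} (hn : n ≠ 0) {B : Fin n → Fin (n + 1) → ℤ}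
    (hB : ∀ i, 0 < crossVec B i) (γ : Matrix.SpecialLinearGroup (Fin n) ℤ) :
    arrNormalize (scaledBlock (castTuple (tupleMul (γ : Matrix (Fin n) (Fin n) ℤ)ᵀ B))) =
      arrNormalize (scaledBlock (castTuple B)) * toSLR γ := by
  have h1 : 0 < arrDet (scaledBlock (castTuple B)) := by
    rw [arrDet_scaledBlock_castTuple]
    exact Finset.prod_pos fun i _ => by exact_mod_cast hB i
  have h2 : arrDet (scaledBlock (castTuple (tupleMul (γ : Matrix (Fin n) (Fin n) ℤ)ᵀ B))) =
      arrDet (scaledBlock (castTuple B)) := by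
    rw [arrDet_scaledBlock_castTuple, arrDet_scaledBlock_castTuple, crossVec_tupleMul_transpose]
  apply Subtype.ext
  rw [coe_mul_toSLR, coe_arrNormalize hn (h2 ▸ h1), coe_arrNormalize hn h1]
  rw [arrRoot, arrRoot, h2, Matrix.smul_mul]
  congr 1
  ext i j
  simp only [Matrix.transpose_apply, Matrix.of_apply, scaledBlock, crossVec_castTuple,
    crossVec_tupleMul_transpose, Matrix.mul_apply, Matrix.map_apply]
  simp only [castTuple, tupleMul, Matrix.transpose_apply, Int.cast_sum, Int.cast_mul,
    Finset.sum_mul]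
  exact Finset.sum_congr rfl fun k _ => by ring

lemma simplexCovers_iff_frobNum_le {n : ℕ} (hn : n ≠ 0) {a : Fin (n + 1) → ℤ}
    (hg : Finset.univ.gcd a = 1) (ha : ∀ i, 2 ≤ a i) {B : Fin n → Fin (n + 1) → ℤ}
    (hB : crossVec B = a) (R : ℝ) :
    (∀ t, R < t → SimplexCovers (latticeOf (arrNormalize (scaledBlock (castTuple B)))) t) ↔
      (frobNum (n + 1) a : ℝ) + ∑ i, (a i : ℝ) ≤ R * (∏ i, (a i : ℝ)) ^ (1 / (n : ℝ)) := by
  have hq : crossVec B (Fin.last n) ≠ 0 := by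
    rw [hB]; have := ha (Fin.last n); omega
  have ha0 : ∀ i, (0 : ℝ) < a i := fun i => by
    have : 0 < a i := by have := ha i; omega
    exact_mod_cast this
  have hM : arrDet (scaledBlock (castTuple B)) = ∏ i, (a i : ℝ) := by
    rw [arrDet_scaledBlock_castTuple, hB]
  have hM0 : 0 < arrDet (scaledBlock (castTuple B)) := by
    rw [hM]; exact Finset.prod_pos fun i _ => ha0 i
  set t₀ : ℝ := (∏ i, (a i : ℝ)) ^ (1 / (n : ℝ)) with ht₀
  have ht₀' : arrRoot (scaledBlock (castTuple B)) = t₀ := by rw [arrRoot, hM]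
  have ht : 0 < t₀ := by rw [← ht₀']; exact arrRoot_pos hM0
  obtain ⟨U, hU, hUB⟩ := isPrimTuple_of_gcd_crossVec hn (by rwa [hB]) hq
  have hUB' : ∀ i : Fin n, U i.castSucc = B i := fun i => hUB i i.castSucc rfl
  have hUa := mulVec_crossVec_of_isPrimTuple hU hUB' hq
  have hlat : ∀ x, x ∈ frobLattice a ↔
      t₀⁻¹ • x ∈ latticeOf (arrNormalize (scaledBlock (castTuple B))) := by
    intro x
    simp only [frobLattice, latticeOf, matLattice, Set.mem_ofPred_eq, coe_arrNormalize hn hM0, ht₀']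
    have h1 : ∀ v : Fin n → ℤ, (t₀⁻¹ • x = (t₀⁻¹ • (Matrix.of (scaledBlock (castTuple B)))ᵀ) *ᵥ
        fun i => (v i : ℝ)) ↔ ∀ i, x i = a i.castSucc * (∑ k, v k * B k i.castSucc : ℤ) := by
      intro v
      rw [Matrix.smul_mulVec, smul_right_inj (inv_ne_zero ht.ne'), funext_iff]
      refine forall_congr' fun i => ?_
      have : ((Matrix.of (scaledBlock (castTuple B)))ᵀ *ᵥ fun i => (v i : ℝ)) i =
          a i.castSucc * (∑ k, v k * B k i.castSucc : ℤ) := by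
        simp only [Matrix.mulVec, dotProduct, Matrix.transpose_apply, Matrix.of_apply, scaledBlock,
          crossVec_castTuple, hB, castTuple]
        push_cast
        rw [Finset.mul_sum]
        exact Finset.sum_congr rfl fun k _ => by ring
      rw [this]
    simp only [h1]
    constructor
    · rintro ⟨w, ⟨c, hc⟩, hx⟩
      obtain ⟨v, hv⟩ := exists_eq_vecMul_of_sum_mul_eq_zero hU hUa
        (v := Fin.snoc (α := fun _ => ℤ) w (-c)) (by
          rw [Fin.sum_univ_castSucc, hB]
          simp only [Fin.snoc_castSucc, Fin.snoc_last]
          have : ∑ i : Fin n, w i * a i.castSucc = a (Fin.last n) * c := by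
            rw [← hc]; exact Finset.sum_congr rfl fun i _ => mul_comm _ _
          rw [this]; ring)
      refine ⟨v, fun i => ?_⟩
      rw [hx i]
      have := hv i.castSucc
      rw [Fin.snoc_castSucc] at this
      rw [this]
      simp only [hUB']
    · rintro ⟨v, hv⟩
      refine ⟨fun i => ∑ k, v k * B k i.castSucc, ?_, hv⟩
      have h2 : ∑ i : Fin n, a i.castSucc * ∑ k, v k * B k i.castSucc =
          ∑ k, v k * ∑ i : Fin n, B k i.castSucc * a i.castSucc := by
        simp only [Finset.mul_sum]
        rw [Finset.sum_comm]
        exact Finset.sum_congr rfl fun k _ => Finset.sum_congr rfl fun i _ => by ring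
      rw [h2]
      refine Finset.dvd_sum fun k _ => Dvd.dvd.mul_left ?_ _
      have h3 := sum_mul_crossVec B k
      rw [Fin.sum_univ_castSucc, hB] at h3
      exact ⟨-B k (Fin.last n), by linarith⟩
  rw [← simplexCovers_frobLattice_iff hg ha]
  constructor
  · intro h t htt
    have h2 := (simplexCovers_smul ht hlat (t := t / t₀)).2 (h _ (by rwa [lt_div_iff₀ ht]))
    rwa [mul_div_cancel₀ _ ht.ne'] at h2
  · intro h t htt
    exact (simplexCovers_smul ht hlat).1 (h _ (by rw [mul_comm t₀]; exact mul_lt_mul_of_pos_right htt ht))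

lemma boundedBaseChange_ncard_mul {n : ℕ} (ρ : ℝ) (g : SLR n)
    (γ : Matrix.SpecialLinearGroup (Fin n) ℤ) :
    (boundedBaseChange ρ (g * toSLR γ)).ncard = (boundedBaseChange ρ g).ncard := by
  have : boundedBaseChange ρ g = (fun γ' => γ * γ') '' boundedBaseChange ρ (g * toSLR γ) := by
    ext γ'
    simp only [boundedBaseChange, Set.mem_ofPred_eq, Set.mem_image]
    constructor
    · intro h'
      refine ⟨γ⁻¹ * γ', ?_, by group⟩
      rw [mul_assoc, ← map_mul]
      simpa using h'
    · rintro ⟨δ, hδ, rfl⟩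
      rw [map_mul, ← mul_assoc]
      exact hδ
  rw [this, Set.ncard_image_of_injective _ (mul_right_injective γ)]

/-- The tuples with a given cross product and shape in a reduced set. -/
lemma fiber_crossVec_reducedSet {n : ℕ} (hn : n ≠ 0) {B₀ : Fin n → Fin (n + 1) → ℤ}
    (hg : Finset.univ.gcd (crossVec B₀) = 1) (ha : ∀ i, 0 < crossVec B₀ i) (ρ R : ℝ) (k : ℕ) :
    {B : Fin n → Fin (n + 1) → ℤ | crossVec B = crossVec B₀ ∧
      arrNormalize (scaledBlock (castTuple B)) ∈ reducedSet n ρ R k} =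
    {B | ∃ γ ∈ boundedBaseChange ρ (arrNormalize (scaledBlock (castTuple B₀))),
      ((∀ t, R < t → SimplexCovers (latticeOf (arrNormalize (scaledBlock (castTuple B₀)))) t) ∧
        (boundedBaseChange ρ (arrNormalize (scaledBlock (castTuple B₀)))).ncard = k) ∧
      B = tupleMul (γ : Matrix (Fin n) (Fin n) ℤ)ᵀ B₀} := by
  ext B
  simp only [Set.mem_ofPred_eq]
  constructor
  · rintro ⟨h1, h2⟩
    obtain ⟨U, hU, hUB⟩ := isPrimTuple_of_gcd_crossVec hn hg (ha _).ne'
    have hUB' : ∀ i : Fin n, U i.castSucc = B₀ i := fun i => hUB i i.castSucc rfl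
    have hUB'' : (fun i : Fin n => U i.castSucc) = B₀ := funext hUB'
    have hUa := mulVec_crossVec_of_isPrimTuple hU hUB' (ha _).ne'
    obtain ⟨γ, hγ, hB⟩ := exists_mul_eq_of_crossVec_eq hU hUa (by rw [hUB'']) (ha _).ne' h1
    rw [hUB''] at hB
    obtain ⟨δ, hBB⟩ : ∃ δ : Matrix.SpecialLinearGroup (Fin n) ℤ,
        B = tupleMul (δ : Matrix (Fin n) (Fin n) ℤ)ᵀ B₀ :=
      ⟨⟨γᵀ, by rw [Matrix.det_transpose, hγ]⟩, hB⟩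
    rw [hBB, arrNormalize_tupleMul_transpose hn ha] at h2
    refine ⟨δ, h2.1, ⟨?_, ?_⟩, hBB⟩
    · have := h2.2.1
      rwa [latticeOf_mul_toSLR] at this
    · rw [← h2.2.2, boundedBaseChange_ncard_mul]
  · rintro ⟨γ, h1, ⟨h2, h3⟩, rfl⟩
    refine ⟨crossVec_tupleMul_transpose _ _, ?_⟩
    rw [arrNormalize_tupleMul_transpose hn ha]
    exact ⟨h1, by rwa [latticeOf_mul_toSLR], by rwa [boundedBaseChange_ncard_mul]⟩

lemma tupleMul_transpose_injective {n : ℕ} {B₀ : Fin n → Fin (n + 1) → ℤ}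
    (hq : crossVec B₀ (Fin.last n) ≠ 0) :
    Function.Injective fun γ : Matrix.SpecialLinearGroup (Fin n) ℤ =>
      tupleMul (γ : Matrix (Fin n) (Fin n) ℤ)ᵀ B₀ := by
  intro γ γ' h
  have h1 : (γ : Matrix (Fin n) (Fin n) ℤ)ᵀ * leftBlock B₀ =
      (γ' : Matrix (Fin n) (Fin n) ℤ)ᵀ * leftBlock B₀ := by
    rw [← leftBlock_mul, ← leftBlock_mul]
    exact congrArg leftBlock h
  rw [crossVec_last] at hq
  have h2 : (γ : Matrix (Fin n) (Fin n) ℤ)ᵀ = (γ' : Matrix (Fin n) (Fin n) ℤ)ᵀ := by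
    have h3 := congrArg (fun X => X * (leftBlock B₀).adjugate) h1
    simp only [Matrix.mul_assoc, Matrix.mul_adjugate, Matrix.mul_smul, Matrix.mul_one] at h3
    exact smul_right_injective _ hq h3
  exact Subtype.ext (Matrix.transpose_injective h2)

open Classical in
/-- Counting vectors with bounded Frobenius number by counting primitive tuples. -/
lemma ncard_frobNum_le_eq_sum {n : ℕ} (hn : n ≠ 0) {R ρ : ℝ} {K : ℕ}
    (hK : ∀ g : SLR n, (∀ t, R < t → SimplexCovers (latticeOf g) t) →
        (boundedBaseChange ρ g).Nonempty ∧ (boundedBaseChange ρ g).Finite ∧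
        (boundedBaseChange ρ g).ncard ≤ K)
    {𝓐 : Set (Fin (n + 1) → ℤ)} (hfin : 𝓐.Finite)
    (h𝓐 : ∀ a ∈ 𝓐, Finset.univ.gcd a = 1 ∧ ∀ i, 2 ≤ a i) :
    (∀ k, {B : Fin n → Fin (n + 1) → ℤ | crossVec B ∈ 𝓐 ∧
        arrNormalize (scaledBlock (castTuple B)) ∈ reducedSet n ρ R k}.Finite) ∧
    (({a ∈ 𝓐 | (frobNum (n + 1) a : ℝ) + ∑ i, (a i : ℝ) ≤
        R * (∏ i, (a i : ℝ)) ^ (1 / (n : ℝ))}.ncard : ℕ) : ℝ) =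
    ∑ k ∈ Finset.Icc 1 K, (({B : Fin n → Fin (n + 1) → ℤ | crossVec B ∈ 𝓐 ∧
        arrNormalize (scaledBlock (castTuple B)) ∈ reducedSet n ρ R k}.ncard : ℕ) : ℝ) / k := by
  have hex : ∀ a : Fin (n + 1) → ℤ, ∃ B : Fin n → Fin (n + 1) → ℤ, a ∈ 𝓐 → crossVec B = a := by
    intro a
    by_cases ha : a ∈ 𝓐
    · obtain ⟨U, -, -, h⟩ := exists_isPrimTuple_crossVec_eq hn (h𝓐 a ha).1
        (by have := (h𝓐 a ha).2 (Fin.last n); omega)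
      exact ⟨_, fun _ => h⟩
    · exact ⟨0, fun h => absurd h ha⟩
  choose B₀ hB₀ using hex
  set G : (Fin (n + 1) → ℤ) → SLR n := fun a => arrNormalize (scaledBlock (castTuple (B₀ a))) with hG
  set good : (Fin (n + 1) → ℤ) → Prop := fun a =>
    ∀ t, R < t → SimplexCovers (latticeOf (G a)) t with hgood
  set κ : (Fin (n + 1) → ℤ) → ℕ := fun a => (boundedBaseChange ρ (G a)).ncard with hκ
  set S : ℕ → Set (Fin n → Fin (n + 1) → ℤ) := fun k => {B | crossVec B ∈ 𝓐 ∧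
        arrNormalize (scaledBlock (castTuple B)) ∈ reducedSet n ρ R k} with hS
  have hfib : ∀ a ∈ 𝓐, ∀ k, {B : Fin n → Fin (n + 1) → ℤ | crossVec B = a ∧
      arrNormalize (scaledBlock (castTuple B)) ∈ reducedSet n ρ R k} =
      if good a ∧ κ a = k then (fun γ : Matrix.SpecialLinearGroup (Fin n) ℤ =>
        tupleMul (γ : Matrix (Fin n) (Fin n) ℤ)ᵀ (B₀ a)) '' boundedBaseChange ρ (G a) else ∅ := by
    intro a ha k
    have h1 := fiber_crossVec_reducedSet hn (B₀ := B₀ a) (by rw [hB₀ a ha]; exact (h𝓐 a ha).1)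
      (fun i => by rw [hB₀ a ha]; have := (h𝓐 a ha).2 i; omega) ρ R k
    rw [hB₀ a ha] at h1
    rw [h1]
    split_ifs with h
    · ext B
      constructor
      · rintro ⟨γ, h1, h2, rfl⟩
        exact ⟨γ, h1, rfl⟩
      · rintro ⟨γ, h1, rfl⟩
        exact ⟨γ, h1, h, rfl⟩
    · ext B
      simp only [Set.mem_ofPred_eq, Set.mem_empty_iff_false, iff_false]
      rintro ⟨γ, h1, h2, rfl⟩
      exact h h2
  have hfibfin : ∀ a ∈ 𝓐, ∀ k, {B : Fin n → Fin (n + 1) → ℤ | crossVec B = a ∧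
      arrNormalize (scaledBlock (castTuple B)) ∈ reducedSet n ρ R k}.Finite := by
    intro a ha k
    rw [hfib a ha k]
    split_ifs with h
    · exact ((hK _ h.1).2.1).image _
    · exact Set.finite_empty
  have hfibcard : ∀ a ∈ 𝓐, ∀ k, {B : Fin n → Fin (n + 1) → ℤ | crossVec B = a ∧
      arrNormalize (scaledBlock (castTuple B)) ∈ reducedSet n ρ R k}.ncard =
      if good a ∧ κ a = k then k else 0 := by
    intro a ha k
    rw [hfib a ha k]
    split_ifs with h
    · rw [Set.ncard_image_of_injective _ (tupleMul_transpose_injective (by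
        rw [hB₀ a ha]; have := (h𝓐 a ha).2 (Fin.last n); omega))]
      exact h.2
    · exact Set.ncard_empty _
  have hSfin : ∀ k, (S k).Finite := by
    intro k
    refine (hfin.biUnion fun a ha => hfibfin a ha k).subset ?_
    intro B hB
    exact Set.mem_biUnion hB.1 ⟨rfl, hB.2⟩
  refine ⟨hSfin, ?_⟩
  have hScard : ∀ k, (S k).ncard = (hfin.toFinset.filter fun a => good a ∧ κ a = k).card * k := by
    intro k
    rw [Set.ncard_eq_toFinset_card _ (hSfin k),
      Finset.card_eq_sum_card_fiberwise (f := crossVec) (t := hfin.toFinset)]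
    · rw [Finset.card_filter, Finset.sum_mul]
      refine Finset.sum_congr rfl fun a ha => ?_
      have ha' : a ∈ 𝓐 := hfin.mem_toFinset.1 ha
      have h1 := hfibcard a ha' k
      rw [Set.ncard_eq_toFinset_card _ (hfibfin a ha' k)] at h1
      rw [ite_mul, one_mul, zero_mul, ← h1]
      congr 1
      ext B
      simp only [Finset.mem_filter, Set.Finite.mem_toFinset, hS, Set.mem_ofPred_eq]
      constructor
      · rintro ⟨⟨h1, h2⟩, h3⟩
        exact ⟨h3, h2⟩
      · rintro ⟨h1, h2⟩
        exact ⟨⟨h1 ▸ ha', h2⟩, h1⟩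
    · intro B hB
      have : B ∈ S k := (hSfin k).mem_toFinset.1 hB
      exact hfin.mem_toFinset.2 this.1
  have hleft : {a ∈ 𝓐 | (frobNum (n + 1) a : ℝ) + ∑ i, (a i : ℝ) ≤
        R * (∏ i, (a i : ℝ)) ^ (1 / (n : ℝ))} = (hfin.toFinset.filter fun a => good a : Finset _) := by
    ext a
    simp only [Set.mem_ofPred_eq, Finset.coe_filter, Set.Finite.mem_toFinset]
    refine and_congr_right fun ha => ?_
    exact (simplexCovers_iff_frobNum_le hn (h𝓐 a ha).1 (h𝓐 a ha).2 (hB₀ a ha) R).symm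
  rw [hleft, Set.ncard_coe_finset, Finset.card_eq_sum_card_fiberwise (f := κ) (t := Finset.Icc 1 K)]
  · push_cast
    refine Finset.sum_congr rfl fun k hk => ?_
    rw [hScard, Finset.filter_filter]
    have : (k : ℝ) ≠ 0 := by
      have := (Finset.mem_Icc.1 hk).1
      positivity
    push_cast
    field_simp
  · intro a ha
    have h1 : good a := (Finset.mem_filter.1 ha).2
    obtain ⟨h2, h3, h4⟩ := hK _ h1
    refine Finset.mem_coe.2 (Finset.mem_Icc.2 ⟨?_, h4⟩)
    exact (Set.ncard_pos h3).2 h2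

/-- Points within distance `r` both of a set and of its complement. -/
def thick {X : Type*} [PseudoMetricSpace X] (r : ℝ) (Ω : Set X) : Set X :=
  {x | (∃ y ∈ Ω, dist x y ≤ r) ∧ ∃ y ∉ Ω, dist x y ≤ r}

/-- The grid cube with index `z` and side `r`. -/
def gridCube {j d : ℕ} (r : ℝ) (z : Fin j → Fin d → ℤ) : Set (Fin j → Fin d → ℝ) :=
  {y | ∀ i k, r * z i k ≤ y i k ∧ y i k < r * (z i k + 1)}

/-- The index of the grid cube containing a point. -/
def gridIndex {j d : ℕ} (r : ℝ) (y : Fin j → Fin d → ℝ) : Fin j → Fin d → ℤ :=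
  fun i k => ⌊y i k / r⌋

lemma mem_gridCube_iff {j d : ℕ} {r : ℝ} (hr : 0 < r) {z : Fin j → Fin d → ℤ}
    {y : Fin j → Fin d → ℝ} : y ∈ gridCube r z ↔ gridIndex r y = z := by
  rw [funext_iff]
  refine forall_congr' fun i => ?_
  rw [funext_iff]
  refine forall_congr' fun k => ?_
  rw [gridIndex, Int.floor_eq_iff, le_div_iff₀ hr, div_lt_iff₀ hr, mul_comm r, mul_comm r]

lemma gridCube_eq_pi {j d : ℕ} (r : ℝ) (z : Fin j → Fin d → ℤ) :
    gridCube r z = Set.pi Set.univ fun i => Set.pi Set.univ fun k =>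
      Set.Ico (r * z i k) (r * (z i k + 1)) := by
  ext y
  simp [gridCube, Set.mem_pi]

lemma measurableSet_gridCube {j d : ℕ} (r : ℝ) (z : Fin j → Fin d → ℤ) :
    MeasurableSet (gridCube r z) := by
  rw [gridCube_eq_pi]
  exact MeasurableSet.univ_pi fun i => MeasurableSet.univ_pi fun k => measurableSet_Ico

lemma volume_gridCube {j d : ℕ} {r : ℝ} (hr : 0 < r) (z : Fin j → Fin d → ℤ) :
    volume (gridCube r z) = ENNReal.ofReal ((r ^ d) ^ j) := by
  rw [gridCube_eq_pi, volume_pi_pi]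
  simp only [volume_pi_pi, Real.volume_Ico, mul_add, mul_one, add_sub_cancel_left,
    Finset.prod_const, Finset.card_univ, Fintype.card_fin]
  rw [ENNReal.ofReal_pow (by positivity), ENNReal.ofReal_pow hr.le]

lemma dist_le_of_mem_gridCube {j d : ℕ} {r : ℝ} (hr : 0 < r) {z : Fin j → Fin d → ℤ}
    {x y : Fin j → Fin d → ℝ} (hx : x ∈ gridCube r z) (hy : y ∈ gridCube r z) : dist x y ≤ r := by
  refine (dist_pi_le_iff hr.le).2 fun i => (dist_pi_le_iff hr.le).2 fun k => ?_
  have h1 := hx i k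
  have h2 := hy i k
  rw [Real.dist_eq, abs_le]
  constructor <;> linarith [h1.1, h1.2, h2.1, h2.2]

lemma volume_biUnion_gridCube {j d : ℕ} {r : ℝ} (hr : 0 < r) (Z : Finset (Fin j → Fin d → ℤ)) :
    volume (⋃ z ∈ Z, gridCube r z) = Z.card * ENNReal.ofReal ((r ^ d) ^ j) := by
  rw [measure_biUnion_finset]
  · simp only [volume_gridCube hr, Finset.sum_const, nsmul_eq_mul]
  · intro z _ z' _ hzz'
    refine Set.disjoint_left.2 fun y hy hy' => hzz' ?_
    rw [mem_gridCube_iff hr] at hy hy'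
    rw [← hy, ← hy']
  · exact fun z _ => measurableSet_gridCube r z

open Classical in
/-- Counting primitive tuples in a dilated region. -/
lemma exists_card_isPrimTuple_region (j d : ℕ) (hj : j + 1 ≤ d) :
    ∃ C : ℝ, 0 < C ∧ ∀ (Ω : Set (Fin j → Fin d → ℝ)) (A s τ : ℝ) (m : ℕ), 2 ≤ m → 0 < s → 0 ≤ τ →
      0 ≤ A → (∀ x ∈ Ω, ∀ i k, |x i k| ≤ A) → s * A + 2 * (m : ℝ) ^ 4 ≤ (m : ℝ) ^ 12 →
      volume (thick ((m : ℝ) ^ 4 / s) Ω) ≤ ENNReal.ofReal τ →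
      {B : Fin j → Fin d → ℤ | IsPrimTuple B ∧ s⁻¹ • castTuple B ∈ Ω}.Finite ∧
      |(({B : Fin j → Fin d → ℤ | IsPrimTuple B ∧ s⁻¹ • castTuple B ∈ Ω}.ncard : ℕ) : ℝ) -
        primDensity j d * (s ^ d) ^ j * (volume Ω).toReal| ≤
        C * (s ^ d) ^ j * ((volume Ω).toReal / m + τ) := by
  obtain ⟨C, hC, hcube⟩ := card_isPrimTuple_tupleCube d j hj
  refine ⟨C + 1 + |primDensity j d|, by positivity, ?_⟩
  intro Ω A s τ m hm hs hτ hA hΩ hsA hthick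
  have hm0 : (0 : ℝ) < m := by
    have : 0 < m := by omega
    exact_mod_cast this
  set h : ℝ := (m : ℝ) ^ 4 with hh
  have hh0 : 0 < h := by positivity
  set r : ℝ := h / s with hr
  have hr0 : 0 < r := by positivity
  have hsr : s * r = h := by rw [hr]; field_simp
  set V : ℝ := (r ^ d) ^ j with hV
  have hV0 : 0 < V := by positivity
  have hsV : (s ^ d) ^ j * V = (h ^ d) ^ j := by rw [hV, ← mul_pow, ← mul_pow, hsr]
  -- the cubes meeting the region
  have hbd : ∀ z : Fin j → Fin d → ℤ, (gridCube r z ∩ Ω).Nonempty → ∀ i k,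
      |h * z i k| ≤ s * A + h := by
    rintro z ⟨y, hy1, hy2⟩ i k
    have h1 := hΩ y hy2 i k
    have h2 := hy1 i k
    have h3 : s * (r * z i k) ≤ s * y i k := mul_le_mul_of_nonneg_left h2.1 hs.le
    have h4 : s * y i k ≤ s * (r * (z i k + 1)) := mul_le_mul_of_nonneg_left h2.2.le hs.le
    rw [← mul_assoc, hsr] at h3 h4
    have h5 : |s * y i k| ≤ s * A := by
      rw [abs_mul, abs_of_pos hs]; exact mul_le_mul_of_nonneg_left h1 hs.le
    rw [abs_le] at h5 ⊢
    constructor <;> linarith [h5.1, h5.2]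
  have hZfin : {z : Fin j → Fin d → ℤ | (gridCube r z ∩ Ω).Nonempty}.Finite := by
    set M : ℤ := ⌈(s * A + h) / h⌉ with hM
    refine (Set.Finite.pi' fun _ : Fin j => Set.Finite.pi' fun _ : Fin d =>
      Set.finite_Icc (-M) M).subset ?_
    intro z hz i k
    have h1 := hbd z hz i k
    rw [abs_mul, abs_of_pos hh0, mul_comm, ← le_div_iff₀ hh0] at h1
    have h2 : |(z i k : ℝ)| ≤ M := h1.trans (Int.le_ceil _)
    rw [abs_le] at h2
    exact ⟨by exact_mod_cast h2.1, by exact_mod_cast h2.2⟩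
  set Zin : Finset (Fin j → Fin d → ℤ) := hZfin.toFinset.filter fun z => gridCube r z ⊆ Ω with hZin
  set Zbd : Finset (Fin j → Fin d → ℤ) := hZfin.toFinset.filter fun z => ¬ gridCube r z ⊆ Ω with hZbd
  have hΩbdd : volume Ω ≠ ⊤ := by
    refine (Bornology.IsBounded.measure_lt_top ?_).ne
    refine (Metric.isBounded_closedBall (x := (0 : Fin j → Fin d → ℝ)) (r := A)).subset ?_
    intro x hx
    rw [mem_closedBall_zero_iff]
    exact (pi_norm_le_iff_of_nonneg hA).2 fun i => (pi_norm_le_iff_of_nonneg hA).2 fun k => hΩ x hx i k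
  -- volume comparisons
  have hv1 : (Zin.card : ℝ) * V ≤ (volume Ω).toReal := by
    have h1 : volume (⋃ z ∈ Zin, gridCube r z) ≤ volume Ω :=
      measure_mono (Set.iUnion₂_subset fun z hz => (Finset.mem_filter.1 hz).2)
    rw [volume_biUnion_gridCube hr0] at h1
    have h2 := ENNReal.toReal_mono hΩbdd h1
    rwa [ENNReal.toReal_mul, ENNReal.toReal_natCast, ENNReal.toReal_ofReal hV0.le] at h2
  have hv2 : (Zbd.card : ℝ) * V ≤ τ := by
    have h1 : volume (⋃ z ∈ Zbd, gridCube r z) ≤ volume (thick r Ω) := by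
      refine measure_mono (Set.iUnion₂_subset fun z hz x hx => ?_)
      obtain ⟨h2, h3⟩ := Finset.mem_filter.1 hz
      obtain ⟨y, hy, hyΩ⟩ := (hZfin.mem_toFinset.1 h2 : (gridCube r z ∩ Ω).Nonempty)
      obtain ⟨y', hy', hyΩ'⟩ := Set.not_subset.1 h3
      exact ⟨⟨y, hyΩ, dist_le_of_mem_gridCube hr0 hx hy⟩,
        ⟨y', hyΩ', dist_le_of_mem_gridCube hr0 hx hy'⟩⟩
    rw [volume_biUnion_gridCube hr0] at h1
    have h2 := ENNReal.toReal_mono ENNReal.ofReal_ne_top (h1.trans hthick)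
    rwa [ENNReal.toReal_mul, ENNReal.toReal_natCast, ENNReal.toReal_ofReal hV0.le,
      ENNReal.toReal_ofReal hτ] at h2
  have hcard : (hZfin.toFinset.card : ℝ) = Zin.card + Zbd.card := by
    rw [hZin, hZbd]
    exact_mod_cast (Finset.card_filter_add_card_filter_not _).symm
  have hv3 : (volume Ω).toReal ≤ (Zin.card : ℝ) * V + τ := by
    have h1 : volume Ω ≤ volume (⋃ z ∈ hZfin.toFinset, gridCube r z) := by
      refine measure_mono fun y hy => ?_
      have h2 : y ∈ gridCube r (gridIndex r y) := (mem_gridCube_iff hr0).2 rfl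
      exact Set.mem_biUnion (hZfin.mem_toFinset.2 ⟨y, h2, hy⟩) h2
    rw [volume_biUnion_gridCube hr0] at h1
    have h2 := ENNReal.toReal_mono (ENNReal.mul_ne_top (ENNReal.natCast_ne_top _) ENNReal.ofReal_ne_top) h1
    rw [ENNReal.toReal_mul, ENNReal.toReal_natCast, ENNReal.toReal_ofReal hV0.le, hcard] at h2
    linarith
  -- the counting set
  have hcubeZ : ∀ z : Fin j → Fin d → ℤ, ∀ B : Fin j → Fin d → ℤ,
      gridIndex r (s⁻¹ • castTuple B) = z ↔ B ∈ tupleCube (fun i k => (m : ℤ) ^ 4 * z i k) (m ^ 4) := by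
    intro z B
    rw [← mem_gridCube_iff hr0, mem_tupleCube]
    refine forall_congr' fun i => forall_congr' fun k => ?_
    have e1 : (s⁻¹ • castTuple B) i k = (B i k : ℝ) / s := by
      simp [castTuple, div_eq_inv_mul]
    have e2 : ∀ c : ℝ, r * c * s = h * c := fun c => by rw [← hsr]; ring
    rw [e1, le_div_iff₀ hs, div_lt_iff₀ hs, e2, e2]
    rw [hh, mul_add, mul_one]
    constructor
    · rintro ⟨h1, h2⟩
      constructor
      · exact_mod_cast h1
      · push_cast; exact_mod_cast h2
    · rintro ⟨h1, h2⟩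
      constructor
      · exact_mod_cast h1
      · push_cast at h2; exact_mod_cast h2
  set S : Set (Fin j → Fin d → ℤ) := {B | IsPrimTuple B ∧ s⁻¹ • castTuple B ∈ Ω} with hS
  have hSidx : ∀ B ∈ S, gridIndex r (s⁻¹ • castTuple B) ∈ hZfin.toFinset := fun B hB =>
    hZfin.mem_toFinset.2 ⟨s⁻¹ • castTuple B, (mem_gridCube_iff hr0).2 rfl, hB.2⟩
  have hSfin : S.Finite := by
    refine (hZfin.toFinset.biUnion fun z =>
      tupleCube (fun i k => (m : ℤ) ^ 4 * z i k) (m ^ 4)).finite_toSet.subset fun B hB => ?_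
    exact Finset.mem_coe.2 (Finset.mem_biUnion.2 ⟨_, hSidx B hB, (hcubeZ _ B).1 rfl⟩)
  refine ⟨hSfin, ?_⟩
  have hN : S.ncard = ∑ z ∈ Zin, (hSfin.toFinset.filter fun B =>
        gridIndex r (s⁻¹ • castTuple B) = z).card +
      ∑ z ∈ Zbd, (hSfin.toFinset.filter fun B => gridIndex r (s⁻¹ • castTuple B) = z).card := by
    rw [Set.ncard_eq_toFinset_card _ hSfin, Finset.card_eq_sum_card_fiberwise
      (f := fun B => gridIndex r (s⁻¹ • castTuple B)) (t := hZfin.toFinset)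
      fun B hB => hSidx B (hSfin.mem_toFinset.1 hB), hZin, hZbd,
      Finset.sum_filter_add_sum_filter_not]
  have hin : ∀ z ∈ Zin, |((hSfin.toFinset.filter fun B =>
      gridIndex r (s⁻¹ • castTuple B) = z).card : ℝ) - primDensity j d * (h ^ d) ^ j| ≤
      C * (h ^ d) ^ j / m := by
    intro z hz
    obtain ⟨hz1, hz2⟩ := Finset.mem_filter.1 hz
    have h1 : (hSfin.toFinset.filter fun B => gridIndex r (s⁻¹ • castTuple B) = z) =
        (tupleCube (fun i k => (m : ℤ) ^ 4 * z i k) (m ^ 4)).filter IsPrimTuple := by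
      ext B
      rw [Finset.mem_filter, Finset.mem_filter, hcubeZ, hSfin.mem_toFinset]
      constructor
      · rintro ⟨h2, h3⟩
        exact ⟨h3, h2.1⟩
      · rintro ⟨h2, h3⟩
        refine ⟨⟨h3, hz2 ?_⟩, h2⟩
        rw [mem_gridCube_iff hr0]
        exact (hcubeZ z B).2 h2
    rw [h1]
    refine hcube m hm _ fun i k => ?_
    have h2 := hbd z (hZfin.mem_toFinset.1 hz1) i k
    have h3 : |h * z i k| + h ≤ (m : ℝ) ^ 12 := by linarith
    rw [hh] at h3
    exact_mod_cast h3
  have hbdc : ∀ z ∈ Zbd, ((hSfin.toFinset.filter fun B =>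
      gridIndex r (s⁻¹ • castTuple B) = z).card : ℝ) ≤ (h ^ d) ^ j := by
    intro z _
    have h1 : (hSfin.toFinset.filter fun B => gridIndex r (s⁻¹ • castTuple B) = z) ⊆
        tupleCube (fun i k => (m : ℤ) ^ 4 * z i k) (m ^ 4) := by
      intro B hB
      exact (hcubeZ z B).1 (Finset.mem_filter.1 hB).2
    have h2 := Finset.card_le_card h1
    rw [card_tupleCube] at h2
    rw [hh]
    exact_mod_cast h2
  set N1 : ℝ := ∑ z ∈ Zin, ((hSfin.toFinset.filter fun B =>
        gridIndex r (s⁻¹ • castTuple B) = z).card : ℝ) with hN1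
  set N2 : ℝ := ∑ z ∈ Zbd, ((hSfin.toFinset.filter fun B =>
        gridIndex r (s⁻¹ • castTuple B) = z).card : ℝ) with hN2
  have hNr : (S.ncard : ℝ) = N1 + N2 := by rw [hN]; push_cast; rfl
  have b1 : |N1 - Zin.card * (primDensity j d * (h ^ d) ^ j)| ≤ Zin.card * (C * (h ^ d) ^ j / m) := by
    have : N1 - Zin.card * (primDensity j d * (h ^ d) ^ j) = ∑ z ∈ Zin,
        (((hSfin.toFinset.filter fun B => gridIndex r (s⁻¹ • castTuple B) = z).card : ℝ) -
          primDensity j d * (h ^ d) ^ j) := by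
      rw [Finset.sum_sub_distrib, Finset.sum_const, nsmul_eq_mul]
    rw [this, ← nsmul_eq_mul]
    exact (Finset.abs_sum_le_sum_abs _ _).trans (Finset.sum_le_card_nsmul _ _ _ hin)
  have b2 : N2 ≤ Zbd.card * (h ^ d) ^ j := by
    rw [← nsmul_eq_mul]
    exact Finset.sum_le_card_nsmul _ _ _ hbdc
  have b2' : 0 ≤ N2 := Finset.sum_nonneg fun _ _ => Nat.cast_nonneg _
  set W : ℝ := (s ^ d) ^ j with hW
  have hW0 : 0 < W := by positivity
  set v : ℝ := (volume Ω).toReal with hv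
  set p : ℝ := primDensity j d with hp
  have hv0 : 0 ≤ v := ENNReal.toReal_nonneg
  rw [hNr]
  rw [← hsV] at b1 b2
  have c1 : Zin.card * (C * (W * V) / m) ≤ C * W * (v / m) := by
    have : Zin.card * (C * (W * V) / m) = C * W * ((Zin.card * V) / m) := by ring
    rw [this]
    gcongr
  have c2 : Zbd.card * (W * V) ≤ W * τ := by
    have : Zbd.card * (W * V) = W * (Zbd.card * V) := by ring
    rw [this]
    gcongr
  have c3 : |Zin.card * (p * (W * V)) - p * W * v| ≤ |p| * W * τ := by
    have : Zin.card * (p * (W * V)) - p * W * v = p * W * (Zin.card * V - v) := by ring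
    rw [this, abs_mul, abs_mul, abs_of_pos hW0]
    gcongr
    rw [abs_le]
    constructor <;> linarith
  have c4 : N1 + N2 - p * W * v = (N1 - Zin.card * (p * (W * V))) +
      (Zin.card * (p * (W * V)) - p * W * v) + N2 := by ring
  rw [c4]
  have c5 := abs_add_three (N1 - Zin.card * (p * (W * V))) (Zin.card * (p * (W * V)) - p * W * v) N2
  rw [abs_of_nonneg b2'] at c5
  have c6 : 0 ≤ C * W * τ := by positivity
  have c7 : 0 ≤ (1 + |p|) * W * (v / m) := by positivity
  calc _ ≤ C * W * (v / m) + |p| * W * τ + W * τ := by linarith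
    _ ≤ (C + 1 + |p|) * W * (v / m + τ) := by nlinarith

/-- A homogeneous `C¹` function is Lipschitz on balls, with polynomially growing constants. -/
lemma exists_lipschitz_of_homogeneous {E F : Type*} [NormedAddCommGroup E] [NormedSpace ℝ E]
    [ProperSpace E] [NormedAddCommGroup F] [NormedSpace ℝ F] {f : E → F} (hf : ContDiff ℝ 1 f)
    {k : ℕ} (hk : k ≠ 0) (hom : ∀ (s : ℝ) (y : E), f (s • y) = s ^ k • f y) :
    ∃ L : ℝ, 0 < L ∧ ∀ A : ℝ, 0 < A → ∀ y y' : E, ‖y‖ ≤ A → ‖y'‖ ≤ A →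
      ‖f y - f y'‖ ≤ L * A ^ (k - 1) * ‖y - y'‖ := by
  obtain ⟨K, hK⟩ := (hf.locallyLipschitz.locallyLipschitzOn
    (s := Metric.closedBall (0 : E) 1)).exists_lipschitzOnWith_of_compact (isCompact_closedBall 0 1)
  refine ⟨K + 1, by positivity, fun A hA y y' hy hy' => ?_⟩
  have hmem : ∀ z : E, ‖z‖ ≤ A → A⁻¹ • z ∈ Metric.closedBall (0 : E) 1 := by
    intro z hz
    rw [mem_closedBall_zero_iff, norm_smul, norm_inv, Real.norm_of_nonneg hA.le, inv_mul_le_iff₀ hA,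
      mul_one]
    exact hz
  have h1 := hK.dist_le_mul _ (hmem y hy) _ (hmem y' hy')
  rw [dist_eq_norm, dist_eq_norm, ← smul_sub, norm_smul, norm_inv, Real.norm_of_nonneg hA.le] at h1
  have hs : ∀ z : E, f z = A ^ k • f (A⁻¹ • z) := by
    intro z
    rw [← hom, smul_inv_smul₀ hA.ne']
  rw [hs y, hs y', ← smul_sub, norm_smul, norm_pow, Real.norm_of_nonneg hA.le]
  obtain ⟨m, rfl⟩ := Nat.exists_eq_succ_of_ne_zero hk
  calc A ^ (m + 1) * ‖f (A⁻¹ • y) - f (A⁻¹ • y')‖ ≤ A ^ (m + 1) * (K * (A⁻¹ * ‖y - y'‖)) := by gcongr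
    _ = K * A ^ m * ‖y - y'‖ := by
      rw [pow_succ]
      field_simp
    _ ≤ (K + 1) * A ^ (m + 1 - 1) * ‖y - y'‖ := by
      rw [Nat.add_sub_cancel]
      gcongr
      linarith

lemma contDiff_matrix_det {E : Type*} [NormedAddCommGroup E] [NormedSpace ℝ E] {n : ℕ}
    {f : E → Matrix (Fin n) (Fin n) ℝ} (hf : ∀ i j, ContDiff ℝ 1 fun x => f x i j) :
    ContDiff ℝ 1 fun x => (f x).det := by
  simp only [Matrix.det_apply']
  exact ContDiff.sum fun σ _ => contDiff_const.mul (contDiff_prod fun i _ => hf _ _)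

lemma contDiff_crossVec {n : ℕ} :
    ContDiff ℝ 1 (crossVec : (Fin n → Fin (n + 1) → ℝ) → Fin (n + 1) → ℝ) := by
  refine contDiff_pi.2 fun j => ?_
  have hentry : ∀ (i : Fin n) (k : Fin (n + 1)),
      ContDiff ℝ 1 fun B : Fin n → Fin (n + 1) → ℝ => B i k := fun i k => by fun_prop
  refine Fin.lastCases ?_ (fun j => ?_) j
  · simp only [crossVec_last]
    exact contDiff_matrix_det fun i k => hentry i k.castSucc
  · simp only [crossVec_castSucc]
    refine ContDiff.neg ?_
    simp only [← Matrix.cramer_eq_adjugate_mulVec, Matrix.cramer_apply]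
    refine contDiff_matrix_det fun i k => ?_
    simp only [Matrix.updateCol_apply]
    split_ifs
    · exact hentry i _
    · exact hentry i k.castSucc

lemma contDiff_scaledBlock {n : ℕ} :
    ContDiff ℝ 1 (scaledBlock : (Fin n → Fin (n + 1) → ℝ) → Fin n → Fin n → ℝ) := by
  refine contDiff_pi.2 fun i => contDiff_pi.2 fun j => ?_
  have h1 : ContDiff ℝ 1 fun B : Fin n → Fin (n + 1) → ℝ => B i j.castSucc := by fun_prop
  exact h1.mul (contDiff_pi.1 contDiff_crossVec j.castSucc)

lemma crossVec_smul {n : ℕ} (s : ℝ) (B : Fin n → Fin (n + 1) → ℝ) :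
    crossVec (s • B) = s ^ n • crossVec B := by
  have h1 : s • B = tupleMul (s • (1 : Matrix (Fin n) (Fin n) ℝ)) B := by
    funext i k
    simp [tupleMul, Matrix.one_apply]
  rw [h1, crossVec_mul, Matrix.det_smul, Matrix.det_one, Fintype.card_fin, mul_one]

lemma scaledBlock_smul {n : ℕ} (s : ℝ) (B : Fin n → Fin (n + 1) → ℝ) :
    scaledBlock (s • B) = s ^ (n + 1) • scaledBlock B := by
  funext i j
  simp only [scaledBlock, crossVec_smul, Pi.smul_apply, smul_eq_mul]
  ring

lemma arrDet_scaledBlock {n : ℕ} (B : Fin n → Fin (n + 1) → ℝ) :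
    arrDet (scaledBlock B) = ∏ j, crossVec B j := det_scaledBlock B

lemma arrDet_smul {n : ℕ} (s : ℝ) (M : Fin n → Fin n → ℝ) : arrDet (s • M) = s ^ n * arrDet M := by
  have h1 : (Matrix.of (s • M)) = s • Matrix.of M := rfl
  rw [arrDet, h1, Matrix.det_smul, Fintype.card_fin]
  rfl

lemma arrNormalize_smul {n : ℕ} (hn : n ≠ 0) {s : ℝ} (hs : 0 < s) {M : Fin n → Fin n → ℝ}
    (hM : 0 < arrDet M) : arrNormalize (s • M) = arrNormalize M := by
  have h1 : 0 < arrDet (s • M) := by rw [arrDet_smul]; positivity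
  have h2 : arrRoot (s • M) = s * arrRoot M := by
    rw [arrRoot, arrDet_smul, Real.mul_rpow (by positivity) hM.le, ← Real.rpow_natCast,
      ← Real.rpow_mul hs.le]
    rw [mul_one_div_cancel (by exact_mod_cast hn), Real.rpow_one]
    rfl
  have h3 : ((arrNormalize (s • M) : SLR n) : Matrix (Fin n) (Fin n) ℝ) =
      ((arrNormalize M : SLR n) : Matrix (Fin n) (Fin n) ℝ) := by
    rw [coe_arrNormalize hn h1, coe_arrNormalize hn hM, h2]
    have h4 : (Matrix.of (s • M)) = s • Matrix.of M := rfl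
    rw [h4, Matrix.transpose_smul, smul_smul, mul_inv, mul_comm s⁻¹, mul_assoc,
      inv_mul_cancel₀ hs.ne', mul_one]
  exact Subtype.ext h3

lemma arrNormalize_apply {n : ℕ} (hn : n ≠ 0) {M : Fin n → Fin n → ℝ} (h : 0 < arrDet M)
    (i j : Fin n) : (arrNormalize M : Matrix (Fin n) (Fin n) ℝ) i j = (arrRoot M)⁻¹ * M j i := by
  rw [coe_arrNormalize hn h]
  rfl

/-- Polynomial Lipschitz bound for the normalization map. -/
lemma exists_lipschitz_arrNormalize {n : ℕ} (hn : n ≠ 0) :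
    ∃ L : ℝ, 0 < L ∧ ∃ c : ℕ, ∀ A : ℝ, 1 ≤ A → ∀ y y' : Fin n → Fin (n + 1) → ℝ,
      ‖y‖ ≤ A → ‖y'‖ ≤ A → (∀ i, A⁻¹ ≤ crossVec y i) → (∀ i, A⁻¹ ≤ crossVec y' i) →
      ∀ i j, |(arrNormalize (scaledBlock y) : Matrix (Fin n) (Fin n) ℝ) i j -
        (arrNormalize (scaledBlock y') : Matrix (Fin n) (Fin n) ℝ) i j| ≤ L * A ^ c * ‖y - y'‖ := by
  obtain ⟨L₂, hL₂, h₂⟩ := exists_lipschitz_of_homogeneous (contDiff_scaledBlock (n := n))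
    (Nat.succ_ne_zero n) scaledBlock_smul
  obtain ⟨L₃, hL₃, h₃⟩ := exists_lipschitz_of_homogeneous
    (f := fun y : Fin n → Fin (n + 1) → ℝ => arrDet (scaledBlock y)) (k := (n + 1) * n)
    (contDiff_matrix_det fun i j => contDiff_pi.1 (contDiff_pi.1 contDiff_scaledBlock i) j)
    (by positivity) (fun s y => by rw [scaledBlock_smul, arrDet_smul, ← pow_mul, smul_eq_mul])
  set c : ℕ := (n + 1) + (2 * (n + 1) + ((n + 1) * (n - 1) + ((n + 1) * n - 1))) with hc
  refine ⟨L₂ + L₂ * L₃, by positivity, c, ?_⟩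
  intro A hA y y' hy hy' hpos hpos' i j
  have hA0 : 0 < A := by linarith
  have hroot : ∀ z : Fin n → Fin (n + 1) → ℝ, (∀ i, A⁻¹ ≤ crossVec z i) →
      0 < arrDet (scaledBlock z) ∧ (arrRoot (scaledBlock z))⁻¹ ≤ A ^ (n + 1) := by
    intro z hz
    have h1 : (A ^ (n + 1))⁻¹ ≤ arrDet (scaledBlock z) := by
      rw [arrDet_scaledBlock, ← inv_pow]
      calc A⁻¹ ^ (n + 1) = ∏ _j : Fin (n + 1), A⁻¹ := by simp
        _ ≤ _ := Finset.prod_le_prod (fun _ _ => by positivity) fun j _ => hz j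
    have h2 : 0 < arrDet (scaledBlock z) := lt_of_lt_of_le (by positivity) h1
    refine ⟨h2, ?_⟩
    have h3 := arrRoot_pos h2
    refine inv_le_of_inv_le₀ (by positivity) ?_
    by_contra! h4
    have h5 : (A ^ (n + 1))⁻¹ ≤ 1 := inv_le_one_of_one_le₀ (one_le_pow₀ hA)
    have h6 : arrRoot (scaledBlock z) ^ n ≤ arrRoot (scaledBlock z) :=
      pow_le_of_le_one h3.le (h4.le.trans h5) hn
    rw [arrRoot_pow hn h2] at h6
    linarith
  obtain ⟨hd, ht⟩ := hroot y hpos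
  obtain ⟨hd', ht'⟩ := hroot y' hpos'
  rw [arrNormalize_apply hn hd, arrNormalize_apply hn hd']
  set t := arrRoot (scaledBlock y) with htdef
  set t' := arrRoot (scaledBlock y') with htdef'
  have htp : 0 < t := arrRoot_pos hd
  have htp' : 0 < t' := arrRoot_pos hd'
  set δ : ℝ := ‖y - y'‖ with hδ
  have hδ0 : 0 ≤ δ := norm_nonneg _
  -- the root
  have e1 : |t - t'| ≤ A ^ ((n + 1) * (n - 1)) * (L₃ * A ^ ((n + 1) * n - 1) * δ) := by
    have h1 : |t ^ n - t' ^ n| ≤ L₃ * A ^ ((n + 1) * n - 1) * δ := by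
      rw [htdef, htdef', arrRoot_pow hn hd, arrRoot_pow hn hd']
      exact h₃ A hA0 y y' hy hy'
    have h2 : t ^ (n - 1) * |t - t'| ≤ |t ^ n - t' ^ n| := by
      rw [← Commute.geom_sum₂_mul (Commute.all t t') n, abs_mul]
      refine mul_le_mul_of_nonneg_right ?_ (abs_nonneg _)
      refine le_trans ?_ (le_abs_self _)
      have h3 := Finset.single_le_sum (f := fun i => t ^ i * t' ^ (n - 1 - i))
        (fun i _ => by positivity) (Finset.mem_range.2 (Nat.sub_lt (Nat.pos_of_ne_zero hn) one_pos))
      simpa using h3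
    have h3 : |t - t'| = t⁻¹ ^ (n - 1) * (t ^ (n - 1) * |t - t'|) := by
      rw [← mul_assoc, ← mul_pow, inv_mul_cancel₀ htp.ne', one_pow, one_mul]
    rw [h3, pow_mul]
    exact mul_le_mul (pow_le_pow_left₀ (by positivity) ht _) (h2.trans h1) (by positivity)
      (by positivity)
  have e2 : |scaledBlock y j i - scaledBlock y' j i| ≤ L₂ * A ^ n * δ := by
    have h1 := h₂ A hA0 y y' hy hy'
    exact (norm_le_pi_norm ((scaledBlock y - scaledBlock y') j) i).trans
      ((norm_le_pi_norm (scaledBlock y - scaledBlock y') j).trans h1)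
  have e3 : |scaledBlock y' j i| ≤ L₂ * A ^ n * A := by
    have h0 : scaledBlock (0 : Fin n → Fin (n + 1) → ℝ) = 0 := by
      have := scaledBlock_smul (0 : ℝ) (0 : Fin n → Fin (n + 1) → ℝ)
      simpa using this
    have h1 := h₂ A hA0 y' 0 hy' (by simpa using hA0.le)
    rw [h0, sub_zero, sub_zero] at h1
    refine (norm_le_pi_norm ((scaledBlock y') j) i).trans
      ((norm_le_pi_norm (scaledBlock y') j).trans (h1.trans ?_))
    change L₂ * A ^ n * ‖y'‖ ≤ L₂ * A ^ n * A
    gcongr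
  have e4 : t⁻¹ * scaledBlock y j i - t'⁻¹ * scaledBlock y' j i =
      t⁻¹ * (scaledBlock y j i - scaledBlock y' j i) +
        scaledBlock y' j i * (t⁻¹ * t'⁻¹ * (t' - t)) := by
    field_simp
    ring
  rw [e4]
  refine (abs_add_le _ _).trans ?_
  rw [abs_mul, abs_mul, abs_mul (t⁻¹ * t'⁻¹), abs_mul t⁻¹ t'⁻¹, abs_of_pos (inv_pos.2 htp),
    abs_of_pos (inv_pos.2 htp'), abs_sub_comm t' t]
  calc _ ≤ A ^ (n + 1) * (L₂ * A ^ n * δ) + L₂ * A ^ n * A * (A ^ (n + 1) * A ^ (n + 1) *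
        (A ^ ((n + 1) * (n - 1)) * (L₃ * A ^ ((n + 1) * n - 1) * δ))) := by gcongr
    _ = L₂ * A ^ ((n + 1) + n) * δ + L₂ * L₃ * A ^ c * δ := by
      rw [hc]
      simp only [pow_add, two_mul, pow_one]
      ring
    _ ≤ L₂ * A ^ c * δ + L₂ * L₃ * A ^ c * δ := by
      have : A ^ ((n + 1) + n) ≤ A ^ c := pow_le_pow_right₀ hA (by omega)
      gcongr
    _ = (L₂ + L₂ * L₃) * A ^ c * δ := by ring

lemma exists_lipschitz_crossVec {n : ℕ} (hn : n ≠ 0) :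
    ∃ L : ℝ, 0 < L ∧ ∀ A : ℝ, 1 ≤ A → ∀ y y' : Fin n → Fin (n + 1) → ℝ,
      ‖y‖ ≤ A → ‖y'‖ ≤ A → ‖crossVec y - crossVec y'‖ ≤ L * A ^ (n - 1) * ‖y - y'‖ := by
  obtain ⟨L, hL, h⟩ := exists_lipschitz_of_homogeneous (contDiff_crossVec (n := n)) hn crossVec_smul
  exact ⟨L, hL, fun A hA => h A (by linarith)⟩

/-- Arrays with bounded normalization and cross product in a cube are bounded. -/
lemma norm_le_of_arrNormalize_lt {n : ℕ} (hn : n ≠ 0) {ρ η : ℝ} (hη : 0 < η)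
    {y : Fin n → Fin (n + 1) → ℝ} (h1 : ∀ i, η ≤ crossVec y i) (h2 : ∀ i, crossVec y i ≤ 1)
    (h3 : ∀ i j, |(arrNormalize (scaledBlock y) : Matrix (Fin n) (Fin n) ℝ) i j| < ρ) :
    ‖y‖ ≤ n * ρ / η := by
  have hpos : ∀ i, 0 < crossVec y i := fun i => hη.trans_le (h1 i)
  have hd : 0 < arrDet (scaledBlock y) := by
    rw [arrDet_scaledBlock]; exact Finset.prod_pos fun i _ => hpos i
  have hd1 : arrDet (scaledBlock y) ≤ 1 := by
    rw [arrDet_scaledBlock]; exact Finset.prod_le_one (fun i _ => (hpos i).le) fun i _ => h2 i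
  have ht := arrRoot_pos hd
  have ht1 : arrRoot (scaledBlock y) ≤ 1 := Real.rpow_le_one hd.le hd1 (by positivity)
  have hblock : ∀ i j, |scaledBlock y i j| ≤ ρ := by
    intro i j
    have h4 := (h3 j i).le
    rw [arrNormalize_apply hn hd, abs_mul, abs_of_pos (inv_pos.2 ht), inv_mul_le_iff₀ ht] at h4
    have hρ : 0 ≤ ρ := (abs_nonneg _).trans (h3 j i).le
    exact h4.trans (mul_le_of_le_one_left hρ ht1)
  obtain ⟨i₀⟩ : Nonempty (Fin n) := ⟨⟨0, Nat.pos_of_ne_zero hn⟩⟩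
  have hρ : 0 ≤ ρ := (abs_nonneg _).trans (hblock i₀ i₀)
  have hn1 : (1 : ℝ) ≤ n := by exact_mod_cast Nat.pos_of_ne_zero hn
  have key : ∀ (i : Fin n) (k : Fin (n + 1)), |y i k * crossVec y k| ≤ n * ρ := by
    intro i k
    refine Fin.lastCases ?_ (fun j => ?_) k
    · have h4 := sum_mul_crossVec y i
      rw [Fin.sum_univ_castSucc] at h4
      rw [eq_neg_of_add_eq_zero_right h4, abs_neg]
      refine (Finset.abs_sum_le_sum_abs _ _).trans ?_
      refine (Finset.sum_le_card_nsmul _ _ ρ fun j _ => hblock i j).trans ?_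
      simp
    · exact (hblock i j).trans (by nlinarith)
  have hnn : 0 ≤ n * ρ / η := by positivity
  refine (pi_norm_le_iff_of_nonneg hnn).2 fun i => (pi_norm_le_iff_of_nonneg hnn).2 fun k => ?_
  rw [le_div_iff₀ hη, Real.norm_eq_abs]
  have h4 := key i k
  rw [abs_mul, abs_of_pos (hpos k)] at h4
  exact (mul_le_mul_of_nonneg_left (h1 k) (abs_nonneg _)).trans h4

lemma infDist_frontier_le {E : Type*} [NormedAddCommGroup E] [NormedSpace ℝ E] {D : Set E}
    {x y y' : E} {δ : ℝ} (hy : y ∈ D) (hy' : y' ∉ D) (h : dist x y ≤ δ) (h' : dist x y' ≤ δ) :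
    Metric.infDist x (frontier D) ≤ δ := by
  have hc : IsPreconnected (Metric.closedBall x δ) := (convex_closedBall x δ).isPreconnected
  have hyb : y ∈ Metric.closedBall x δ := by rwa [Metric.mem_closedBall, dist_comm]
  have hyb' : y' ∈ Metric.closedBall x δ := by rwa [Metric.mem_closedBall, dist_comm]
  obtain ⟨z, hz, hz'⟩ : (Metric.closedBall x δ ∩ frontier D).Nonempty := by
    by_contra hne
    have h1 : ∀ z ∈ Metric.closedBall x δ, z ∉ frontier D := fun z hz hz' => hne ⟨z, hz, hz'⟩
    have h2 : ∀ z ∈ Metric.closedBall x δ, z ∈ D → z ∈ interior D := by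
      intro z hz hzD
      by_contra h3
      exact h1 z hz ⟨subset_closure hzD, h3⟩
    have h3 : ∀ z ∈ Metric.closedBall x δ, z ∉ D → z ∈ interior Dᶜ := by
      intro z hz hzD
      rw [interior_compl]
      intro h4
      exact h1 z hz ⟨h4, fun h5 => hzD (interior_subset h5)⟩
    obtain ⟨z, -, hz1, hz2⟩ := hc _ _ isOpen_interior isOpen_interior
      (fun z hz => (em (z ∈ D)).imp (h2 z hz) (h3 z hz)) ⟨y, hyb, h2 y hyb hy⟩
      ⟨y', hyb', h3 y' hyb' hy'⟩
    exact interior_subset hz2 (interior_subset hz1)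
  rw [Metric.mem_closedBall, dist_comm] at hz
  exact (Metric.infDist_le_dist_of_mem hz').trans hz

lemma measurableSet_forall_abs_lt (n : ℕ) (ρ : ℝ) :
    MeasurableSet {g : SLR n | ∀ i j, |(g : Matrix (Fin n) (Fin n) ℝ) i j| < ρ} := by
  simp only [Set.ofPred_forall]
  refine MeasurableSet.iInter fun i => MeasurableSet.iInter fun j => ?_
  exact measurableSet_lt (((SLR.continuous_coe n).matrix_elem i j).abs).measurable
    measurable_const

lemma abs_arrPair_sub_le {n : ℕ} (W M M' : Fin n → Fin n → ℝ) {δ : ℝ}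
    (h : ∀ i j, |M i j - M' i j| ≤ δ) :
    |arrPair W M - arrPair W M'| ≤ (∑ i, ∑ j, |W i j|) * δ := by
  simp only [arrPair, ← Finset.sum_sub_distrib, ← mul_sub]
  refine (Finset.abs_sum_le_sum_abs _ _).trans ?_
  rw [Finset.sum_mul]
  refine Finset.sum_le_sum fun i _ => (Finset.abs_sum_le_sum_abs _ _).trans ?_
  rw [Finset.sum_mul]
  refine Finset.sum_le_sum fun j _ => ?_
  rw [abs_mul]
  exact mul_le_mul_of_nonneg_left (h i j) (abs_nonneg _)

lemma volume_box_two (d : ℕ) :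
    volume {x : Fin d → ℝ | ∀ i, 0 < x i ∧ x i < 2} = ENNReal.ofReal (2 ^ d) := by
  have h1 : {x : Fin d → ℝ | ∀ i, 0 < x i ∧ x i < 2} = Set.univ.pi fun _ => Set.Ioo 0 2 := by
    ext x; simp [Set.mem_pi]
  rw [h1, volume_pi_pi]
  simp only [Real.volume_Ioo, sub_zero, Finset.prod_const, Finset.card_univ, Fintype.card_fin]
  rw [ENNReal.ofReal_pow (by norm_num)]

lemma volume_box_slab_le {n : ℕ} (i : Fin (n + 1)) (η : ℝ) {δ : ℝ} (hδ : 0 ≤ δ) :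
    volume {x : Fin (n + 1) → ℝ | (∀ k, 0 < x k ∧ x k < 2) ∧ |x i - η| ≤ δ} ≤
      ENNReal.ofReal (2 * δ * 2 ^ n) := by
  refine (measure_mono (t := Set.univ.pi fun k => if k = i then Set.Icc (η - δ) (η + δ) else
    Set.Ioo 0 2) ?_).trans (le_of_eq ?_)
  · rintro x ⟨h1, h2⟩ k -
    rw [abs_le] at h2
    by_cases hk : k = i
    · subst hk
      simp only [if_true]
      exact ⟨by linarith [h2.1], by linarith [h2.2]⟩
    · simp only [hk, if_false]
      exact h1 k
  · rw [volume_pi_pi, ← Finset.mul_prod_erase _ _ (Finset.mem_univ i)]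
    rw [Finset.prod_congr rfl (g := fun _ => ENNReal.ofReal 2)]
    · rw [if_pos rfl, Real.volume_Icc, Finset.prod_const, Finset.card_erase_of_mem
        (Finset.mem_univ i), Finset.card_univ, Fintype.card_fin, Nat.add_sub_cancel,
        ← ENNReal.ofReal_pow (by norm_num), ← ENNReal.ofReal_mul (by linarith)]
      congr 1
      ring
    · intro k hk
      rw [if_neg (Finset.ne_of_mem_erase hk), Real.volume_Ioo, sub_zero]

/-- Arrays with normalization in `A` and cross product in the part of `D` away from the
coordinate hyperplanes. -/
def crossRegion {n : ℕ} (A : Set (SLR n)) (D : Set (Fin (n + 1) → ℝ)) (η : ℝ) :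
    Set (Fin n → Fin (n + 1) → ℝ) :=
  {B | crossVec B ∈ {x ∈ D | ∀ i, η < x i} ∧ arrNormalize (scaledBlock B) ∈ A}

/-- Covering of the boundary layer of a region by explicit sets. -/
lemma exists_thick_crossRegion_subset {n : ℕ} (hn : n ≠ 0) :
    ∃ c : ℕ, ∀ ρ : ℝ, 0 < ρ → ∃ M : ℝ, 0 < M ∧
      ∀ (A : Set (SLR n)) (D : Set (Fin (n + 1) → ℝ)) (𝓦 : Finset ((Fin n → Fin n → ℝ) × ℝ)),
      (∀ g ∈ A, ∀ i j, |(g : Matrix (Fin n) (Fin n) ℝ) i j| < ρ) →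
      (∀ g h : SLR n, (∀ w ∈ 𝓦, (w.2 < arrPair w.1 (g : Matrix (Fin n) (Fin n) ℝ) ↔
        w.2 < arrPair w.1 (h : Matrix (Fin n) (Fin n) ℝ))) → (g ∈ A ↔ h ∈ A)) →
      (∀ x ∈ D, ∀ i, x i < 1) →
      ∀ η r : ℝ, 0 < η → η ≤ 1 → 0 < r → r ≤ 1 → M * (η⁻¹ ^ c * r) ≤ η / 2 →
      ∀ x ∈ thick r (crossRegion A D η),
        (∀ i, 0 < crossVec x i ∧ crossVec x i < 2) ∧
        (∀ i j, |(arrNormalize (scaledBlock x) : Matrix (Fin n) (Fin n) ℝ) i j| < ρ + 1) ∧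
        ((∃ w ∈ 𝓦, |arrPair w.1 (arrNormalize (scaledBlock x) : Matrix (Fin n) (Fin n) ℝ) - w.2| ≤
            (∑ i, ∑ j, |w.1 i j|) * (M * (η⁻¹ ^ c * r))) ∨
          Metric.infDist (crossVec x) (frontier D) ≤ M * (η⁻¹ ^ c * r) ∨
          ∃ i, |crossVec x i - η| ≤ M * (η⁻¹ ^ c * r)) := by
  obtain ⟨L, hL, c, hlip⟩ := exists_lipschitz_arrNormalize hn
  obtain ⟨L', hL', hlip'⟩ := exists_lipschitz_crossVec hn
  refine ⟨(n - 1) + c, fun ρ hρ => ⟨(L + L') * (n * ρ + 2) ^ ((n - 1) + c), by positivity, ?_⟩⟩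
  intro A D 𝓦 hAρ h𝓦 hD η r hη hη1 hr hr1 hsmall x hx
  set δ : ℝ := (L + L') * (n * ρ + 2) ^ ((n - 1) + c) * (η⁻¹ ^ ((n - 1) + c) * r) with hδ
  obtain ⟨⟨y, ⟨⟨hyD, hyη⟩, hyA⟩, hxy⟩, y', hy'Ω, hxy'⟩ := hx
  set A₀ : ℝ := (n * ρ + 2) / η with hA₀
  have hnρ : 0 ≤ n * ρ := by positivity
  have h2A : 2 / η ≤ A₀ := by rw [hA₀]; gcongr; linarith
  have h2η : 2 ≤ 2 / η := by rw [le_div_iff₀ hη]; linarith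
  have hA1 : 1 ≤ A₀ := by linarith
  have hA₀inv : A₀⁻¹ ≤ η / 2 := by
    rw [inv_le_comm₀ (by linarith) (by linarith), inv_div]; exact h2A
  have hδA : (L + L') * A₀ ^ ((n - 1) + c) * r = δ := by
    rw [hδ, hA₀, div_eq_mul_inv, mul_pow]; ring
  have hny : ‖y‖ + 1 ≤ A₀ := by
    have h1 := norm_le_of_arrNormalize_lt hn hη (fun i => (hyη i).le) (fun i => (hD _ hyD i).le)
      (hAρ _ hyA)
    have h3 : A₀ = n * ρ / η + 2 / η := by rw [hA₀, add_div]
    linarith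
  have hnx : ‖x‖ ≤ ‖y‖ + r := by
    have := norm_sub_norm_le x y
    rw [dist_eq_norm] at hxy
    linarith
  have hny' : ‖y'‖ ≤ A₀ := by
    have h1 := norm_sub_norm_le y' x
    rw [dist_comm, dist_eq_norm] at hxy'
    have h3 : A₀ = n * ρ / η + 2 / η := by rw [hA₀, add_div]
    have h4 := norm_le_of_arrNormalize_lt hn hη (fun i => (hyη i).le) (fun i => (hD _ hyD i).le)
      (hAρ _ hyA)
    linarith
  have hp1 : A₀ ^ (n - 1) ≤ A₀ ^ ((n - 1) + c) := pow_le_pow_right₀ hA1 (by omega)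
  have hp2 : A₀ ^ c ≤ A₀ ^ ((n - 1) + c) := pow_le_pow_right₀ hA1 (by omega)
  have hA₀0 : 0 < A₀ := by linarith
  -- nearby points have nearby cross products
  have hcr : ∀ z z' : Fin n → Fin (n + 1) → ℝ, ‖z‖ ≤ A₀ → ‖z'‖ ≤ A₀ → dist z z' ≤ r →
      dist (crossVec z) (crossVec z') ≤ δ := by
    intro z z' hz hz' hzz'
    rw [dist_eq_norm] at hzz' ⊢
    refine (hlip' A₀ hA1 z z' hz hz').trans ?_
    rw [← hδA]
    gcongr
    linarith
  have hxA : ‖x‖ ≤ A₀ := by linarith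
  have hyA₀ : ‖y‖ ≤ A₀ := by linarith
  have hcxy := hcr x y hxA hyA₀ hxy
  have hcxy' := hcr x y' hxA hny' hxy'
  have hcoord : ∀ {u v : Fin (n + 1) → ℝ}, dist u v ≤ δ → ∀ i, |u i - v i| ≤ δ := by
    intro u v huv i
    exact (dist_le_pi_dist u v i).trans huv
  have hxpos : ∀ i, η / 2 ≤ crossVec x i ∧ crossVec x i < 2 := by
    intro i
    have h1 := abs_le.1 (hcoord hcxy i)
    have h2 := hyη i
    have h3 := hD _ hyD i
    constructor <;> linarith [h1.1, h1.2]
  have hxinv : ∀ i, A₀⁻¹ ≤ crossVec x i := fun i => hA₀inv.trans (hxpos i).1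
  have hnorm : ∀ z : Fin n → Fin (n + 1) → ℝ, ‖z‖ ≤ A₀ → dist x z ≤ r →
      (∀ i, η ≤ crossVec z i) → ∀ i j,
      |(arrNormalize (scaledBlock x) : Matrix (Fin n) (Fin n) ℝ) i j -
        (arrNormalize (scaledBlock z) : Matrix (Fin n) (Fin n) ℝ) i j| ≤ δ := by
    intro z hz hxz hzη i j
    rw [dist_eq_norm] at hxz
    refine (hlip A₀ hA1 x z hxA hz hxinv
      (fun i => hA₀inv.trans ((by linarith : η / 2 ≤ η).trans (hzη i))) i j).trans ?_
    rw [← hδA]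
    gcongr
    linarith
  have hgxy := hnorm y hyA₀ hxy fun i => (hyη i).le
  refine ⟨fun i => ⟨lt_of_lt_of_le (by linarith) (hxpos i).1, (hxpos i).2⟩, ?_, ?_⟩
  · intro i j
    have h1 := hgxy i j
    have h2 := hAρ _ hyA i j
    have h3 := abs_sub_abs_le_abs_sub
      ((arrNormalize (scaledBlock x) : Matrix (Fin n) (Fin n) ℝ) i j)
      ((arrNormalize (scaledBlock y) : Matrix (Fin n) (Fin n) ℝ) i j)
    linarith
  · by_cases hy'D : crossVec y' ∈ D
    · by_cases hy'η : ∀ i, η < crossVec y' i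
      · left
        have hy'A : arrNormalize (scaledBlock y') ∉ A := fun h => hy'Ω ⟨⟨hy'D, hy'η⟩, h⟩
        have h1 : ¬ ∀ w ∈ 𝓦,
            (w.2 < arrPair w.1 (arrNormalize (scaledBlock y) : Matrix (Fin n) (Fin n) ℝ) ↔
            w.2 < arrPair w.1 (arrNormalize (scaledBlock y') : Matrix (Fin n) (Fin n) ℝ)) :=
          fun h => hy'A ((h𝓦 _ _ h).1 hyA)
        push Not at h1
        obtain ⟨w, hw, hw'⟩ := h1
        refine ⟨w, hw, ?_⟩
        have h2 := abs_le.1 (abs_arrPair_sub_le w.1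
          (arrNormalize (scaledBlock x) : Matrix (Fin n) (Fin n) ℝ) _ hgxy)
        have h3 := abs_le.1 (abs_arrPair_sub_le w.1
          (arrNormalize (scaledBlock x) : Matrix (Fin n) (Fin n) ℝ) _
          (hnorm y' hny' hxy' fun i => (hy'η i).le))
        rw [abs_le]
        rcases hw' with ⟨h4, h5⟩ | ⟨h4, h5⟩ <;> constructor <;> linarith [h2.1, h2.2, h3.1, h3.2]
      · right; right
        push Not at hy'η
        obtain ⟨i, hi⟩ := hy'η
        refine ⟨i, ?_⟩
        have h1 := abs_le.1 (hcoord hcxy i)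
        have h2 := abs_le.1 (hcoord hcxy' i)
        have h3 := hyη i
        rw [abs_le]
        constructor <;> linarith [h1.1, h1.2, h2.1, h2.2]
    · right; left
      exact infDist_frontier_le hyD hy'D hcxy hcxy'

lemma volume_crossVec_le {n : ℕ} (hn : n ≠ 0) {A : Set (SLR n)} (hA : MeasurableSet A)
    {D : Set (Fin (n + 1) → ℝ)} (hD : MeasurableSet D) (hD0 : ∀ x ∈ D, ∀ i, 0 < x i)
    {u v : ℝ} (hu : 0 ≤ u) (hAu : coneMeasure n A ≤ ENNReal.ofReal u)
    (hDv : volume D ≤ ENNReal.ofReal v) :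
    volume {B : Fin n → Fin (n + 1) → ℝ | crossVec B ∈ D ∧ arrNormalize (scaledBlock B) ∈ A} ≤
      ENNReal.ofReal (n * u * v) := by
  rw [volume_crossVec hn hA (ne_top_of_le_ne_top ENNReal.ofReal_ne_top hAu) hD hD0,
    ENNReal.ofReal_mul (by positivity), ENNReal.ofReal_mul (by positivity),
    ENNReal.ofReal_natCast]
  gcongr

/-- The boundary layers of the counting regions have small volume. -/
lemma exists_volume_thick_crossRegion_le {n : ℕ} (hn : 2 ≤ n) :
    ∃ c : ℕ, ∀ ρ : ℝ, 0 < ρ → ∀ (A : Set (SLR n)) (D : Set (Fin (n + 1) → ℝ)), SignDefinable A →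
      (∀ g ∈ A, ∀ i j, |(g : Matrix (Fin n) (Fin n) ℝ) i j| < ρ) →
      (∀ x ∈ D, ∀ i, x i < 1) →
      (∃ C' : ℝ, 0 < C' ∧ ∀ r : ℝ, 0 < r → r < 1 →
          volume {x : Fin (n + 1) → ℝ | Metric.infDist x (frontier D) < r}
            < ENNReal.ofReal (C' * r)) →
      ∃ C : ℝ, 0 < C ∧ ∀ η r : ℝ, 0 < η → η ≤ 1 → 0 < r → r ≤ 1 → C * (η⁻¹ ^ c * r) ≤ η →
        volume (thick r (crossRegion A D η)) ≤
          ENNReal.ofReal (C * (η⁻¹ ^ c * r) ^ (1 / (n : ℝ))) := by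
  have hn0 : n ≠ 0 := by omega
  obtain ⟨c, hc⟩ := exists_thick_crossRegion_subset hn0
  refine ⟨c, fun ρ hρ A D hA hAρ hD hC' => ?_⟩
  obtain ⟨M, hM, hcov⟩ := hc ρ hρ
  obtain ⟨𝓦, h𝓦0, h𝓦⟩ := hA
  obtain ⟨C', hC'0, hC'⟩ := hC'
  have hslab : ∀ w : (Fin n → Fin n → ℝ) × ℝ, ∃ C : ℝ, 0 < C ∧ (w ∈ 𝓦 → ∀ δ : ℝ, 0 < δ → δ ≤ 1 →
      coneMeasure n {g : SLR n | (∀ i j, |(g : Matrix (Fin n) (Fin n) ℝ) i j| < ρ + 1) ∧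
        |arrPair w.1 (g : Matrix (Fin n) (Fin n) ℝ) - w.2| ≤ δ} ≤
        ENNReal.ofReal (C * δ ^ (1 / (n : ℝ)))) := by
    intro w
    by_cases hw : w ∈ 𝓦
    · obtain ⟨C, hC, h⟩ := coneMeasure_slab_le hn (h𝓦0 w hw) w.2 (ρ + 1)
      exact ⟨C, hC, fun _ => h⟩
    · exact ⟨1, one_pos, fun h => absurd h hw⟩
  choose Cw hCw0 hCw using hslab
  set S : ℝ := 1 + ∑ w ∈ 𝓦, ∑ i, ∑ j, |w.1 i j| with hS
  have hSsum : ∀ w ∈ 𝓦, 0 ≤ ∑ i, ∑ j, |w.1 i j| := fun w _ =>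
    Finset.sum_nonneg fun i _ => Finset.sum_nonneg fun j _ => abs_nonneg _
  have hS1 : 1 ≤ S := by
    have := Finset.sum_nonneg hSsum
    linarith
  have hSw : ∀ w ∈ 𝓦, ∑ i, ∑ j, |w.1 i j| ≤ S := fun w hw => by
    have := Finset.single_le_sum hSsum hw
    linarith
  set G : ℝ := (coneMeasure n
    {g : SLR n | ∀ i j, |(g : Matrix (Fin n) (Fin n) ℝ) i j| < ρ + 1}).toReal with hG
  have hGle : coneMeasure n {g : SLR n | ∀ i j, |(g : Matrix (Fin n) (Fin n) ℝ) i j| < ρ + 1} ≤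
      ENNReal.ofReal G := by
    rw [hG, ENNReal.ofReal_toReal (coneMeasure_lt_top hn0 _).ne]
  have hG0 : 0 ≤ G := ENNReal.toReal_nonneg
  set MS : ℝ := M * S with hMS
  have hMS0 : 0 < MS := by positivity
  set K : ℝ := ∑ w ∈ 𝓦, n * Cw w * 2 ^ (n + 1) + n * G * (C' * 2) +
    (n + 1) * (n * G * (2 * 2 ^ n)) with hK
  have hK1 : 0 ≤ ∑ w ∈ 𝓦, n * Cw w * 2 ^ (n + 1) :=
    Finset.sum_nonneg fun w _ => by have := hCw0 w; positivity
  have hK0 : 0 ≤ K := by positivity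
  refine ⟨4 * MS + K * MS ^ (1 / (n : ℝ)), by positivity, ?_⟩
  intro η r hη hη1 hr hr1 hsmall
  set θ : ℝ := η⁻¹ ^ c * r with hθ
  have hθ0 : 0 < θ := by positivity
  have h4 : 4 * MS * θ ≤ η := by
    refine le_trans ?_ hsmall
    have : 0 ≤ K * MS ^ (1 / (n : ℝ)) * θ := by positivity
    linarith
  have hMMS : M ≤ MS := le_mul_of_one_le_right hM.le hS1
  set δ : ℝ := MS * θ with hδ
  have hδ0 : 0 < δ := by positivity
  have hδ1 : δ ≤ 1 / 4 := by linarith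
  have hMθ : M * θ ≤ δ := mul_le_mul_of_nonneg_right hMMS hθ0.le
  have hδp : δ ≤ δ ^ (1 / (n : ℝ)) := by
    refine Real.self_le_rpow_of_le_one hδ0.le (by linarith) ?_
    rw [div_le_one (by positivity)]
    exact_mod_cast (by omega : 1 ≤ n)
  set P : ℝ := δ ^ (1 / (n : ℝ)) with hP
  have hP0 : 0 ≤ P := by positivity
  have hx := hcov A D 𝓦 hAρ h𝓦 hD η r hη hη1 hr hr1 (by linarith)
  set box : Set (Fin (n + 1) → ℝ) := {x | ∀ i, 0 < x i ∧ x i < 2} with hbox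
  have hboxm : MeasurableSet box := by
    have : box = Set.univ.pi fun _ => Set.Ioo (0 : ℝ) 2 := by ext x; simp [hbox, Set.mem_pi]
    rw [this]
    exact MeasurableSet.univ_pi fun _ => measurableSet_Ioo
  set gset : Set (SLR n) := {g | ∀ i j, |(g : Matrix (Fin n) (Fin n) ℝ) i j| < ρ + 1} with hgset
  have hgm : MeasurableSet gset := measurableSet_forall_abs_lt n _
  set X₁ : (Fin n → Fin n → ℝ) × ℝ → Set (Fin n → Fin (n + 1) → ℝ) := fun w =>
    {B | crossVec B ∈ box ∧ arrNormalize (scaledBlock B) ∈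
      {g : SLR n | (∀ i j, |(g : Matrix (Fin n) (Fin n) ℝ) i j| < ρ + 1) ∧
        |arrPair w.1 (g : Matrix (Fin n) (Fin n) ℝ) - w.2| ≤ δ}} with hX₁
  set X₂ : Set (Fin n → Fin (n + 1) → ℝ) :=
    {B | crossVec B ∈ box ∩ {x | Metric.infDist x (frontier D) < 2 * δ} ∧
      arrNormalize (scaledBlock B) ∈ gset} with hX₂
  set X₃ : Fin (n + 1) → Set (Fin n → Fin (n + 1) → ℝ) := fun i =>
    {B | crossVec B ∈ {x | (∀ k, 0 < x k ∧ x k < 2) ∧ |x i - η| ≤ δ} ∧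
      arrNormalize (scaledBlock B) ∈ gset} with hX₃
  have hsub : thick r (crossRegion A D η) ⊆
      ((⋃ w ∈ 𝓦, X₁ w) ∪ X₂) ∪ ⋃ i ∈ (Finset.univ : Finset (Fin (n + 1))), X₃ i := by
    intro x hxt
    obtain ⟨h1, h2, h3⟩ := hx x hxt
    rcases h3 with ⟨w, hw, h3⟩ | h3 | ⟨i, h3⟩
    · refine Or.inl (Or.inl (Set.mem_biUnion hw ⟨h1, h2, h3.trans ?_⟩))
      calc _ ≤ S * (M * θ) := by gcongr; exact hSw w hw
        _ = δ := by rw [hδ, hMS]; ring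
    · exact Or.inl (Or.inr ⟨⟨h1, lt_of_le_of_lt h3 (by linarith)⟩, h2⟩)
    · exact Or.inr (Set.mem_biUnion (Finset.mem_univ i) ⟨⟨h1, h3.trans hMθ⟩, h2⟩)
  have hv1 : ∀ w ∈ 𝓦, volume (X₁ w) ≤ ENNReal.ofReal (n * Cw w * 2 ^ (n + 1) * P) := by
    intro w hw
    have hm : MeasurableSet {g : SLR n | (∀ i j, |(g : Matrix (Fin n) (Fin n) ℝ) i j| < ρ + 1) ∧
        |arrPair w.1 (g : Matrix (Fin n) (Fin n) ℝ) - w.2| ≤ δ} :=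
      MeasurableSet.inter
        (s₁ := {g : SLR n | ∀ i j, |(g : Matrix (Fin n) (Fin n) ℝ) i j| < ρ + 1})
        (s₂ := {g : SLR n | |arrPair w.1 (g : Matrix (Fin n) (Fin n) ℝ) - w.2| ≤ δ}) hgm
        (measurableSet_le ((measurable_arrPair_coe w.1).sub_const w.2).abs measurable_const)
    have h1 := volume_crossVec_le hn0 hm hboxm (fun x hx i => (hx i).1)
      (u := Cw w * P) (v := 2 ^ (n + 1)) (by have := hCw0 w; positivity)
      (hCw w hw δ hδ0 (by linarith)) (volume_box_two (n + 1)).le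
    refine h1.trans (le_of_eq ?_)
    congr 1
    ring
  have hv2 : volume X₂ ≤ ENNReal.ofReal (n * G * (C' * 2) * P) := by
    have hm : MeasurableSet {x : Fin (n + 1) → ℝ | Metric.infDist x (frontier D) < 2 * δ} :=
      measurableSet_lt (Metric.continuous_infDist_pt _).measurable measurable_const
    have h1 := volume_crossVec_le hn0 hgm (hboxm.inter hm) (fun x hx i => (hx.1 i).1)
      (u := G) (v := C' * (2 * δ)) hG0 hGle ((measure_mono Set.inter_subset_right).trans
        (hC' (2 * δ) (by linarith) (by linarith)).le)
    refine h1.trans (ENNReal.ofReal_le_ofReal ?_)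
    calc _ = n * G * (C' * 2) * δ := by ring
      _ ≤ _ := by gcongr
  have hv3 : ∀ i, volume (X₃ i) ≤ ENNReal.ofReal (n * G * (2 * 2 ^ n) * P) := by
    intro i
    have hm : MeasurableSet {x : Fin (n + 1) → ℝ | (∀ k, 0 < x k ∧ x k < 2) ∧ |x i - η| ≤ δ} :=
      MeasurableSet.inter (s₁ := box) (s₂ := {x : Fin (n + 1) → ℝ | |x i - η| ≤ δ}) hboxm
        (isClosed_le (f := fun x : Fin (n + 1) → ℝ => |x i - η|) (by fun_prop)
          continuous_const).measurableSet
    have h1 := volume_crossVec_le hn0 hgm hm (fun x hx k => (hx.1 k).1)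
      (u := G) (v := 2 * δ * 2 ^ n) hG0 hGle (volume_box_slab_le i η hδ0.le)
    refine h1.trans (ENNReal.ofReal_le_ofReal ?_)
    calc _ = n * G * (2 * 2 ^ n) * δ := by ring
      _ ≤ _ := by gcongr
  calc volume (thick r (crossRegion A D η)) ≤ _ := measure_mono hsub
    _ ≤ (volume (⋃ w ∈ 𝓦, X₁ w) + volume X₂) +
        volume (⋃ i ∈ (Finset.univ : Finset (Fin (n + 1))), X₃ i) :=
      (measure_union_le _ _).trans (by gcongr; exact measure_union_le _ _)
    _ ≤ (∑ w ∈ 𝓦, ENNReal.ofReal (n * Cw w * 2 ^ (n + 1) * P) +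
        ENNReal.ofReal (n * G * (C' * 2) * P)) +
        ∑ _i : Fin (n + 1), ENNReal.ofReal (n * G * (2 * 2 ^ n) * P) := by
      gcongr
      · exact (measure_biUnion_finset_le _ _).trans (Finset.sum_le_sum hv1)
      · exact (measure_biUnion_finset_le _ _).trans (Finset.sum_le_sum fun i _ => hv3 i)
    _ = ENNReal.ofReal (K * P) := by
      rw [← ENNReal.ofReal_sum_of_nonneg fun w _ => by have := hCw0 w; positivity,
        ← ENNReal.ofReal_sum_of_nonneg fun w _ => by positivity,
        ← ENNReal.ofReal_add (Finset.sum_nonneg fun w _ => by have := hCw0 w; positivity)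
          (by positivity), ← ENNReal.ofReal_add (add_nonneg (Finset.sum_nonneg fun w _ => by
          have := hCw0 w; positivity) (by positivity)) (by positivity)]
      congr 1
      rw [hK, ← Finset.sum_mul]
      simp only [Finset.sum_const, Finset.card_univ, Fintype.card_fin, nsmul_eq_mul]
      push_cast
      ring
    _ ≤ _ := by
      refine ENNReal.ofReal_le_ofReal ?_
      rw [hP, hδ, Real.mul_rpow hMS0.le hθ0.le, ← mul_assoc]
      gcongr
      linarith

lemma inv_smul_castTuple_mem_crossRegion {n : ℕ} (hn : n ≠ 0) {A : Set (SLR n)}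
    {D : Set (Fin (n + 1) → ℝ)} {η s : ℝ} (hη : 0 < η) (hs : 0 < s) (B : Fin n → Fin (n + 1) → ℤ) :
    s⁻¹ • castTuple B ∈ crossRegion A D η ↔
      (fun i => ((crossVec B i : ℤ) : ℝ) / s ^ n) ∈ {x ∈ D | ∀ i, η < x i} ∧
        arrNormalize (scaledBlock (castTuple B)) ∈ A := by
  have h1 : crossVec (s⁻¹ • castTuple B) = fun i => ((crossVec B i : ℤ) : ℝ) / s ^ n := by
    funext i
    rw [crossVec_smul, Pi.smul_apply, crossVec_castTuple, smul_eq_mul, inv_pow, div_eq_inv_mul]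
  have h2 : s⁻¹ • castTuple B ∈ crossRegion A D η ↔
      crossVec (s⁻¹ • castTuple B) ∈ {x ∈ D | ∀ i, η < x i} ∧
        arrNormalize (scaledBlock (s⁻¹ • castTuple B)) ∈ A := Iff.rfl
  rw [h2, h1]
  refine and_congr_right fun h3 => ?_
  have h4 : 0 < arrDet (scaledBlock (castTuple B)) := by
    rw [arrDet_scaledBlock_castTuple]
    refine Finset.prod_pos fun i _ => ?_
    have h5 := hη.trans (h3.2 i)
    exact (div_pos_iff_of_pos_right (by positivity)).1 h5
  rw [scaledBlock_smul, arrNormalize_smul hn (by positivity) h4]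

/-- Counting primitive tuples with prescribed normalization and cross product in a dilated set. -/
lemma exists_card_crossRegion {n : ℕ} (hn : 2 ≤ n) :
    ∃ q : ℕ, 0 < q ∧ ∀ ρ : ℝ, 0 < ρ → ∀ (A : Set (SLR n)) (D : Set (Fin (n + 1) → ℝ)),
      SignDefinable A → (∀ g ∈ A, ∀ i j, |(g : Matrix (Fin n) (Fin n) ℝ) i j| < ρ) →
      IsOpen D → D ⊆ {x | ∀ i, x i ∈ Set.Ioo (0 : ℝ) 1} →
      (∃ C' : ℝ, 0 < C' ∧ ∀ r : ℝ, 0 < r → r < 1 →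
          volume {x : Fin (n + 1) → ℝ | Metric.infDist x (frontier D) < r}
            < ENNReal.ofReal (C' * r)) →
      ∃ C : ℝ, 0 < C ∧ ∃ v₀ : ℝ, 1 ≤ v₀ ∧ ∀ v : ℝ, v₀ ≤ v →
        {B : Fin n → Fin (n + 1) → ℤ | IsPrimTuple B ∧
          (fun i => ((crossVec B i : ℤ) : ℝ) / (v ^ (12 * q)) ^ n) ∈ {x ∈ D | ∀ i, v⁻¹ < x i} ∧
          arrNormalize (scaledBlock (castTuple B)) ∈ A}.Finite ∧
        |(({B : Fin n → Fin (n + 1) → ℤ | IsPrimTuple B ∧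
          (fun i => ((crossVec B i : ℤ) : ℝ) / (v ^ (12 * q)) ^ n) ∈ {x ∈ D | ∀ i, v⁻¹ < x i} ∧
          arrNormalize (scaledBlock (castTuple B)) ∈ A}.ncard : ℕ) : ℝ) -
          primDensity n (n + 1) * ((v ^ (12 * q)) ^ n) ^ (n + 1) *
            (n * (coneMeasure n A).toReal * (volume {x ∈ D | ∀ i, v⁻¹ < x i}).toReal)| ≤
          C * ((v ^ (12 * q)) ^ n) ^ (n + 1) * (v ^ (1 / (n : ℝ)))⁻¹ := by
  have hn0 : n ≠ 0 := by omega
  obtain ⟨c, hc⟩ := exists_volume_thick_crossRegion_le hn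
  obtain ⟨C₁, hC₁, hcount⟩ := exists_card_isPrimTuple_region n (n + 1) le_rfl
  refine ⟨c + 1, Nat.succ_pos c, ?_⟩
  intro ρ hρ A D hA hAρ hDo hD hC'
  obtain ⟨C₂, hC₂, hthick⟩ := hc ρ hρ A D hA hAρ (fun x hx i => (hD hx i).2) hC'
  have hfin : coneMeasure n A ≠ ⊤ := ne_top_of_le_ne_top (coneMeasure_lt_top hn0 ρ).ne
    (measure_mono fun g hg => hAρ g hg)
  set G : ℝ := (coneMeasure n A).toReal with hG
  have hG0 : 0 ≤ G := ENNReal.toReal_nonneg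
  set q := c + 1 with hq
  refine ⟨C₁ * (n * G + C₂ * 16 ^ (1 / (n : ℝ))) + 1, by positivity,
    16 * C₂ + n * ρ + 32, by nlinarith [mul_nonneg (Nat.cast_nonneg n : (0 : ℝ) ≤ n) hρ.le], ?_⟩
  intro v hv
  have hnρ : 0 ≤ n * ρ := by positivity
  have hv32 : 32 ≤ v := by linarith
  have hv1 : 1 ≤ v := by linarith
  have hv0 : 0 < v := by linarith
  set s : ℝ := v ^ (12 * q) with hs
  have hs0 : 0 < s := by positivity
  set m : ℕ := ⌈v ^ (2 * q)⌉₊ with hm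
  have hm1 : v ^ (2 * q) ≤ m := Nat.le_ceil _
  have hvq : v ≤ v ^ (2 * q) := le_self_pow₀ hv1 (by omega)
  have hm2 : (m : ℝ) ≤ 2 * v ^ (2 * q) := by
    have := Nat.ceil_lt_add_one (pow_nonneg hv0.le (2 * q))
    rw [← hm] at this
    linarith
  have hm2' : 2 ≤ m := by
    have : (2 : ℝ) ≤ m := by linarith
    exact_mod_cast this
  have hm0 : (0 : ℝ) < m := by linarith
  have hm4 : (m : ℝ) ^ 4 ≤ 16 * v ^ (8 * q) := by
    calc (m : ℝ) ^ 4 ≤ (2 * v ^ (2 * q)) ^ 4 := by gcongr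
      _ = 16 * v ^ (8 * q) := by ring
  have hm12 : v ^ (24 * q) ≤ (m : ℝ) ^ 12 := by
    calc v ^ (24 * q) = (v ^ (2 * q)) ^ 12 := by ring
      _ ≤ _ := by gcongr
  set r : ℝ := (m : ℝ) ^ 4 / s with hr
  have hr0 : 0 < r := by positivity
  have hrle : r * v ^ (4 * q) ≤ 16 := by
    rw [hr, div_mul_eq_mul_div, div_le_iff₀ hs0]
    calc (m : ℝ) ^ 4 * v ^ (4 * q) ≤ 16 * v ^ (8 * q) * v ^ (4 * q) := by gcongr
      _ = 16 * s := by rw [hs]; ring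
  set θ : ℝ := v⁻¹⁻¹ ^ c * r with hθ
  have hθ0 : 0 < θ := by positivity
  have hθv : θ * v ≤ 16 * v⁻¹ := by
    rw [← div_eq_mul_inv, le_div_iff₀ hv0, hθ, inv_inv]
    calc v ^ c * r * v * v = r * v ^ (c + 2) := by ring
      _ ≤ r * v ^ (4 * q) := by
        have : v ^ (c + 2) ≤ v ^ (4 * q) := pow_le_pow_right₀ hv1 (by omega)
        gcongr
      _ ≤ 16 := hrle
  have hθ1 : θ ≤ 16 * v⁻¹ := le_trans (le_mul_of_one_le_right hθ0.le hv1) hθv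
  have hr1 : r ≤ 1 := by
    have h1 : v ≤ v ^ (4 * q) := le_self_pow₀ hv1 (by omega)
    nlinarith
  have hsmall : C₂ * θ ≤ v⁻¹ := by
    rw [← one_div, le_div_iff₀ hv0]
    have h1 : θ * v ≤ 16 / v := by rw [div_eq_mul_inv]; exact hθv
    have h2 : C₂ * (16 / v) ≤ 1 := by
      rw [← mul_div_assoc, div_le_one hv0]; linarith
    calc C₂ * θ * v = C₂ * (θ * v) := by ring
      _ ≤ C₂ * (16 / v) := by gcongr
      _ ≤ 1 := h2
  have hη0 : 0 < v⁻¹ := inv_pos.2 hv0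
  have hth := hthick v⁻¹ r hη0 (inv_le_one_of_one_le₀ hv1) hr0 hr1 hsmall
  have hbound : ∀ x ∈ crossRegion A D v⁻¹, ∀ i k, |x i k| ≤ n * ρ * v := by
    intro x hx i k
    have h1 := norm_le_of_arrNormalize_lt hn0 hη0 (fun i => (hx.1.2 i).le)
      (fun i => (hD hx.1.1 i).2.le) (hAρ _ hx.2)
    rw [div_inv_eq_mul] at h1
    exact (norm_le_pi_norm (x i) k).trans ((norm_le_pi_norm x i).trans h1)
  have hsA : s * (n * ρ * v) + 2 * (m : ℝ) ^ 4 ≤ (m : ℝ) ^ 12 := by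
    refine le_trans ?_ hm12
    have h1 : v * v ^ (8 * q) ≤ v ^ (24 * q) := by
      rw [← pow_succ']; exact pow_le_pow_right₀ hv1 (by omega)
    have h2 : v * (v ^ (12 * q) * v) ≤ v ^ (24 * q) := by
      rw [← pow_succ, ← pow_succ']; exact pow_le_pow_right₀ hv1 (by omega)
    have h3 : v ^ (8 * q) ≤ v ^ (12 * q) * v := by
      rw [← pow_succ]; exact pow_le_pow_right₀ hv1 (by omega)
    have h4 : 0 < v ^ (12 * q) * v := by positivity
    calc s * (n * ρ * v) + 2 * (m : ℝ) ^ 4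
        ≤ s * (n * ρ * v) + 2 * (16 * v ^ (8 * q)) := by gcongr
      _ ≤ n * ρ * (v ^ (12 * q) * v) + 32 * (v ^ (12 * q) * v) := by
        rw [hs]; nlinarith
      _ ≤ v * (v ^ (12 * q) * v) := by nlinarith
      _ ≤ _ := h2
  have hτ0 : 0 ≤ C₂ * θ ^ (1 / (n : ℝ)) := by positivity
  obtain ⟨hf, hmain⟩ := hcount (crossRegion A D v⁻¹) (n * ρ * v) s (C₂ * θ ^ (1 / (n : ℝ))) m hm2'
    hs0 hτ0 (by positivity) hbound hsA hth
  have hDm : MeasurableSet {x ∈ D | ∀ i, v⁻¹ < x i} := by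
    refine MeasurableSet.inter (s₁ := D) (s₂ := {x : Fin (n + 1) → ℝ | ∀ i, v⁻¹ < x i})
      hDo.measurableSet ?_
    simp only [Set.ofPred_forall]
    exact MeasurableSet.iInter fun i => measurableSet_lt measurable_const (measurable_pi_apply i)
  have hvol : (volume (crossRegion A D v⁻¹)).toReal =
      n * G * (volume {x ∈ D | ∀ i, v⁻¹ < x i}).toReal := by
    rw [crossRegion, volume_crossVec hn0 hA.measurableSet hfin hDm
      (fun x hx i => hη0.trans (hx.2 i)), ENNReal.toReal_mul, ENNReal.toReal_mul,
      ENNReal.toReal_natCast]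
  have hvolD : (volume {x ∈ D | ∀ i, v⁻¹ < x i}).toReal ≤ 1 := by
    have h1 : volume {x ∈ D | ∀ i, v⁻¹ < x i} ≤ 1 := by
      refine (measure_mono (t := Set.univ.pi fun _ => Set.Ioo (0 : ℝ) 1) ?_).trans (le_of_eq ?_)
      · intro x hx i _
        exact hD hx.1 i
      · rw [volume_pi_pi]; simp
    have := ENNReal.toReal_mono ENNReal.one_ne_top h1
    simpa using this
  rw [hvol] at hmain
  have hset : {B : Fin n → Fin (n + 1) → ℤ | IsPrimTuple B ∧ s⁻¹ • castTuple B ∈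
      crossRegion A D v⁻¹} = {B : Fin n → Fin (n + 1) → ℤ | IsPrimTuple B ∧
          (fun i => ((crossVec B i : ℤ) : ℝ) / s ^ n) ∈ {x ∈ D | ∀ i, v⁻¹ < x i} ∧
          arrNormalize (scaledBlock (castTuple B)) ∈ A} := by
    ext B
    exact and_congr_right fun _ => inv_smul_castTuple_mem_crossRegion hn0 hη0 hs0 B
  have hsw : (s ^ (n + 1)) ^ n = (s ^ n) ^ (n + 1) := pow_right_comm _ _ _
  rw [hset, hsw] at hmain
  rw [hset] at hf
  refine ⟨hf, hmain.trans ?_⟩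
  have hn1 : 1 / (n : ℝ) ≤ 1 := by
    rw [div_le_one (by positivity)]
    exact_mod_cast (by omega : 1 ≤ n)
  set P : ℝ := (v ^ (1 / (n : ℝ)))⁻¹ with hP
  have hP0 : 0 < P := by positivity
  have hvP : v⁻¹ ≤ P := by
    rw [hP]
    gcongr
    exact Real.rpow_le_self_of_one_le hv1 hn1
  have e1 : n * G * (volume {x ∈ D | ∀ i, v⁻¹ < x i}).toReal / m ≤ n * G * P := by
    have h1 : (m : ℝ)⁻¹ ≤ P := le_trans (by gcongr; linarith) hvP
    calc _ ≤ n * G * 1 / m := by gcongr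
      _ = n * G * (m : ℝ)⁻¹ := by rw [mul_one, div_eq_mul_inv]
      _ ≤ _ := by gcongr
  have e2 : C₂ * θ ^ (1 / (n : ℝ)) ≤ C₂ * 16 ^ (1 / (n : ℝ)) * P := by
    rw [mul_assoc, hP, ← Real.inv_rpow hv0.le, ← Real.mul_rpow (by norm_num) hη0.le]
    gcongr
  have hsn : 0 < (s ^ n) ^ (n + 1) := by positivity
  calc C₁ * (s ^ n) ^ (n + 1) * (n * G * (volume {x ∈ D | ∀ i, v⁻¹ < x i}).toReal / m +
        C₂ * θ ^ (1 / (n : ℝ)))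
      ≤ C₁ * (s ^ n) ^ (n + 1) * (n * G * P + C₂ * 16 ^ (1 / (n : ℝ)) * P) := by gcongr
    _ = C₁ * (n * G + C₂ * 16 ^ (1 / (n : ℝ))) * (s ^ n) ^ (n + 1) * P := by ring
    _ ≤ _ := by
      gcongr
      linarith

/-- If the layers `P k \ P (k - 1)` of a finite abelian group are reached by steps in `P 1`, and
`P 1` contains the differences of a set `A`, then the number of layers is at most
`2 |G| / |A|`. -/
lemma mem_layer_of_card_le {G : Type*} [AddCommGroup G] [Finite G] (P : ℕ → Set G)
    (A : Finset G) (hmono : ∀ k, P k ⊆ P (k + 1))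
    (hadd : ∀ k, ∀ x ∈ P k, ∀ y ∈ P 1, x + y ∈ P (k + 1))
    (hsplit : ∀ k, ∀ x ∈ P (k + 1), ∃ y ∈ P k, x - y ∈ P 1) (hall : ∀ x, ∃ k, x ∈ P k)
    (hA : ∀ a ∈ A, ∀ b ∈ A, a - b ∈ P 1) (hA0 : 0 < A.card) {K : ℕ}
    (hK : Nat.card G ≤ K * A.card) (x : G) : x ∈ P (2 * K) := by
  classical
  have : Fintype G := Fintype.ofFinite G
  have hmono' : Monotone P := monotone_nat_of_le_succ hmono
  set r : G → ℕ := fun x => Nat.find (hall x) with hr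
  have hmem : ∀ x, x ∈ P (r x) := fun x => Nat.find_spec (hall x)
  have hle : ∀ x k, x ∈ P k → r x ≤ k := fun x k h => Nat.find_min' (hall x) h
  have hdown : ∀ j, ∀ y, r y = j → ∀ k ≤ j, ∃ z, r z = k := by
    intro j
    induction j with
    | zero => exact fun y hy k hk => ⟨y, by omega⟩
    | succ j ih =>
      intro y hy k hk
      rcases Nat.lt_or_ge j k with h | h
      · exact ⟨y, by omega⟩
      · obtain ⟨z, hz, hyz⟩ := hsplit j y (hy ▸ hmem y)
        have h1 := hle z j hz
        have h2 := hle y (r z + 1) (by simpa using hadd (r z) z (hmem z) _ hyz)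
        exact ih z (by omega) k h
  by_contra hx
  have hrx : 2 * K < r x := by
    by_contra h
    exact hx (hmono' (not_lt.1 h) (hmem x))
  have hex : ∀ j : Fin (K + 1), ∃ z, r z = 2 * (j : ℕ) := fun j =>
    hdown (r x) x rfl _ (by omega)
  choose p hp using hex
  have key : ∀ j j' : Fin (K + 1), ∀ a ∈ A, ∀ b ∈ A, p j + a = p j' + b → ¬ j < j' := by
    intro j j' a ha b hb h hlt
    have h1 : p j' = p j + (a - b) := by rw [add_sub, h, add_sub_cancel_right]
    have h2 := hle (p j') (2 * j + 1) (by rw [h1, ← hp]; exact hadd _ _ (hmem _) _ (hA a ha b hb))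
    rw [hp] at h2
    omega
  have hinj : Set.InjOn (fun t : Fin (K + 1) × G => p t.1 + t.2)
      ((Finset.univ ×ˢ A : Finset (Fin (K + 1) × G)) : Set (Fin (K + 1) × G)) := by
    rintro ⟨j, a⟩ h1 ⟨j', b⟩ h2 h
    simp only [Finset.coe_product, Set.mem_prod, Finset.mem_coe] at h1 h2 h
    have hj : j = j' := le_antisymm (not_lt.1 (key j' j b h2.2 a h1.2 h.symm))
      (not_lt.1 (key j j' a h1.2 b h2.2 h))
    subst hj
    rw [add_left_cancel h]
  have hc := Finset.card_le_card_of_injOn (t := Finset.univ) _ (fun _ _ => Finset.mem_univ _) hinj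
  rw [Finset.card_product, Finset.card_univ, Finset.card_univ, Fintype.card_fin,
    ← Nat.card_eq_fintype_card] at hc
  nlinarith

lemma exists_div_of_abs_le_succ_mul {z : ℤ} {k H : ℕ} (hz : |z| ≤ ((k + 1 : ℕ) : ℤ) * H) :
    ∃ w : ℤ, |w| ≤ (k : ℤ) * H ∧ |z - w| ≤ H := by
  push_cast at hz
  rw [add_mul, one_mul, abs_le] at hz
  have hk : (0 : ℤ) ≤ k * H := by positivity
  have hH : (0 : ℤ) ≤ H := by positivity
  refine ⟨max (-(k * H)) (min z (k * H)), abs_le.2 ⟨le_max_left _ _, ?_⟩, abs_le.2 ?_⟩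
  · exact max_le (by linarith) (min_le_right _ _)
  · rcases le_total z (k * H) with h | h
    · rw [min_eq_left h]
      rcases le_total z (-(k * H)) with h' | h'
      · rw [max_eq_left h']; constructor <;> linarith
      · rw [max_eq_right h']; constructor <;> linarith
    · rw [min_eq_right h, max_eq_right (by linarith)]; constructor <;> linarith

/-- If the vector `a` has no short integer relations, its Frobenius number is small. -/
lemma frobNum_le_of_no_short_relation {n : ℕ} {a : Fin (n + 1) → ℤ} (hg : Finset.univ.gcd a = 1)
    (ha : ∀ i, 2 ≤ a i) {H K : ℕ} (hH : 1 ≤ H)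
    (hrel : ∀ v : Fin (n + 1) → ℤ, v ≠ 0 → (∀ i : Fin n, |v i.castSucc| ≤ H) →
      ∑ i, a i * v i ≠ 0)
    (hK : a (Fin.last n) ≤ K * (H + 1) ^ n) :
    (frobNum (n + 1) a : ℤ) ≤ 4 * K * H * ∑ i : Fin n, a i.castSucc := by
  classical
  set q : ℕ := (a (Fin.last n)).toNat with hq
  have hq2 : (2 : ℤ) ≤ a (Fin.last n) := ha _
  have hqz : (q : ℤ) = a (Fin.last n) := Int.toNat_of_nonneg (by linarith)
  have : NeZero q := ⟨by omega⟩
  let φ : (Fin n → ℤ) → ZMod q := fun z => ∑ i, ((a i.castSucc : ℤ) : ZMod q) * ((z i : ℤ) : ZMod q)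
  have hφ : ∀ z, φ z = ((∑ i : Fin n, a i.castSucc * z i : ℤ) : ZMod q) := by
    intro z; simp only [φ]; push_cast; rfl
  have hφa : ∀ y z, φ (y + z) = φ y + φ z := by
    intro y z
    simp only [φ, Pi.add_apply, Int.cast_add, mul_add, Finset.sum_add_distrib]
  have hφs : ∀ y z, φ (y - z) = φ y - φ z := by
    intro y z
    simp only [φ, Pi.sub_apply, Int.cast_sub, mul_sub, Finset.sum_sub_distrib]
  let P : ℕ → Set (ZMod q) := fun k => {x | ∃ z : Fin n → ℤ, (∀ i, |z i| ≤ (k : ℤ) * H) ∧ φ z = x}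
  let B : Finset (Fin n → ℤ) := Fintype.piFinset fun _ => Finset.Icc (0 : ℤ) H
  have hB : ∀ z, z ∈ B ↔ ∀ i, 0 ≤ z i ∧ z i ≤ H := by intro z; simp [B]
  have hBsub : ∀ y ∈ B, ∀ z ∈ B, ∀ i, |(y - z) i| ≤ H := by
    intro y hy z hz i
    have h1 := (hB y).1 hy i
    have h2 := (hB z).1 hz i
    rw [Pi.sub_apply, abs_le]
    constructor <;> linarith
  have hinj : Set.InjOn φ B := by
    intro y hy z hz h
    by_contra hne
    have h1 : φ (y - z) = 0 := by rw [hφs, h, sub_self]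
    rw [hφ, ZMod.intCast_zmod_eq_zero_iff_dvd, hqz] at h1
    obtain ⟨w, hw⟩ := h1
    refine hrel (Fin.snoc (y - z) (-w)) ?_ ?_ ?_
    · intro h0
      apply hne
      funext i
      have := congrFun h0 i.castSucc
      simp only [Fin.snoc_castSucc, Pi.zero_apply, Pi.sub_apply] at this
      linarith
    · intro i
      rw [Fin.snoc_castSucc]
      exact hBsub y hy z hz i
    · rw [Fin.sum_univ_castSucc]
      simp only [Fin.snoc_castSucc, Fin.snoc_last]
      rw [hw]; ring
  have hcard : (B.image φ).card = (H + 1) ^ n := by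
    rw [Finset.card_image_of_injOn hinj]
    simp [B]
  have hmem : ∀ x : ZMod q, x ∈ P (2 * K) := by
    refine mem_layer_of_card_le P (B.image φ) ?_ ?_ ?_ ?_ ?_ (by rw [hcard]; positivity) ?_
    · rintro k x ⟨z, hz, rfl⟩
      refine ⟨z, fun i => (hz i).trans ?_, rfl⟩
      gcongr
      omega
    · rintro k x ⟨y, hy, rfl⟩ _ ⟨z, hz, rfl⟩
      refine ⟨y + z, fun i => ?_, hφa y z⟩
      have h1 := hy i
      have h2 := hz i
      push_cast at h2 ⊢
      exact (abs_add_le _ _).trans (by linarith)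
    · rintro k x ⟨z, hz, rfl⟩
      choose w hw1 hw2 using fun i => exists_div_of_abs_le_succ_mul (hz i)
      refine ⟨φ w, ⟨w, hw1, rfl⟩, z - w, fun i => ?_, hφs z w⟩
      simpa using hw2 i
    · intro x
      obtain ⟨u, hu⟩ := Finset.gcd_eq_sum_mul Finset.univ a
      rw [hg, Fin.sum_univ_castSucc] at hu
      refine ⟨∑ i : Fin n, (x.val * u i.castSucc).natAbs, fun i => x.val * u i.castSucc,
        fun i => ?_, ?_⟩
      · have h1 := Finset.single_le_sum (f := fun i : Fin n => ((x.val : ℤ) * u i.castSucc).natAbs)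
          (fun j _ => Nat.zero_le _) (Finset.mem_univ i)
        rw [Int.abs_eq_natAbs]
        have h2 := Nat.mul_le_mul h1 hH
        rw [mul_one] at h2
        exact_mod_cast h2
      · have h1 : φ (fun i => x.val * u i.castSucc) =
            ((x.val * (1 - a (Fin.last n) * u (Fin.last n)) : ℤ) : ZMod q) := by
          rw [hφ, hu, add_sub_cancel_right, Finset.mul_sum]
          congr 1
          exact Finset.sum_congr rfl fun i _ => by ring
        rw [h1, ← hqz]
        push_cast
        simp
    · intro x hx y hy
      simp only [Finset.mem_image] at hx hy
      obtain ⟨x, hx, rfl⟩ := hx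
      obtain ⟨y, hy, rfl⟩ := hy
      exact ⟨x - y, fun i => by simpa using hBsub x hx y hy i, hφs x y⟩
    · rw [hcard, Nat.card_zmod]
      zify
      rw [hqz]
      exact hK
  by_contra hlt
  push Not at hlt
  apply frobNum_mem hg ha
  set F := frobNum (n + 1) a
  obtain ⟨z, hz, hzx⟩ := hmem (((F - 2 * K * H * ∑ i : Fin n, a i.castSucc : ℤ) : ZMod q))
  have hz' : ∀ i, 0 ≤ z i + 2 * K * H ∧ z i + 2 * K * H ≤ 4 * K * H := by
    intro i
    have := abs_le.1 (hz i)
    push_cast at this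
    constructor <;> linarith
  rw [hφ, ZMod.intCast_eq_intCast_iff_dvd_sub, hqz] at hzx
  obtain ⟨c, hc⟩ := hzx
  have hF : (F : ℤ) = ∑ i : Fin n, (z i + 2 * K * H) * a i.castSucc + c * a (Fin.last n) := by
    simp only [add_mul, Finset.sum_add_distrib, ← Finset.mul_sum]
    have : ∑ i : Fin n, z i * a i.castSucc = ∑ i : Fin n, a i.castSucc * z i :=
      Finset.sum_congr rfl fun i _ => mul_comm _ _
    linarith
  have hs : ∑ i : Fin n, (z i + 2 * K * H) * a i.castSucc ≤ 4 * K * H * ∑ i : Fin n, a i.castSucc := by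
    rw [Finset.mul_sum]
    exact Finset.sum_le_sum fun i _ =>
      mul_le_mul_of_nonneg_right (hz' i).2 (by linarith [ha i.castSucc])
  have hc0 : 0 ≤ c := by nlinarith
  refine ⟨Fin.snoc (fun i => (z i + 2 * K * H).toNat) c.toNat, ?_⟩
  rw [Fin.sum_univ_castSucc]
  simp only [Fin.snoc_castSucc, Fin.snoc_last, Int.toNat_of_nonneg hc0,
    Int.toNat_of_nonneg (hz' _).1]
  exact hF

lemma card_intCube_orthogonal_mul_le {n : ℕ} {v : Fin (n + 1) → ℤ} (hv : Finset.univ.gcd v = 1)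
    {j : Fin (n + 1)} {m T : ℕ} (hm : 0 < m) (hj : |v j| = m) (hmT : m ≤ T) :
    ((intCube (0 : Fin (n + 1) → ℤ) T).filter fun a => ∑ i, a i * v i = 0).card * m
      ≤ (2 * T) ^ n := by
  classical
  obtain ⟨u, hu⟩ := Finset.gcd_eq_sum_mul Finset.univ v
  rw [hv] at hu
  set S := (intCube (0 : Fin (n + 1) → ℤ) T).filter fun a => ∑ i, a i * v i = 0 with hS
  let f : (Fin (n + 1) → ℤ) × ℕ → (Fin (n + 1) → ℤ) := fun t i =>
    if i = j then 0 else t.1 i + ((t.2 : ℤ) * u i) % m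
  let Y : Finset (Fin (n + 1) → ℤ) := Fintype.piFinset fun i =>
    if i = j then {0} else Finset.Ico (0 : ℤ) (2 * T)
  have hmz : (0 : ℤ) < m := by exact_mod_cast hm
  have hvj : v j ≠ 0 := by
    intro h
    rw [h, abs_zero] at hj
    omega
  have hdvd : (m : ℤ) ∣ v j := by rw [← hj]; exact (abs_dvd _ _).2 dvd_rfl
  have hYcard : Y.card = (2 * T) ^ n := by
    rw [Fintype.card_piFinset, Fin.prod_univ_succAbove _ j]
    simp [Fin.succAbove_ne]
    norm_cast
  have hmaps : Set.MapsTo f ((S ×ˢ Finset.range m : Finset _) : Set _) Y := by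
    rintro ⟨a, k⟩ h
    simp only [Finset.coe_product, Set.mem_prod, Finset.mem_coe, hS, Finset.mem_filter,
      mem_intCube, Finset.mem_range] at h
    simp only [Y, Finset.mem_coe, Fintype.mem_piFinset, f]
    intro i
    split_ifs with hi
    · simp
    · have h1 := h.1.1 i
      have h2 := Int.emod_nonneg ((k : ℤ) * u i) hmz.ne'
      have h3 := Int.emod_lt_of_pos ((k : ℤ) * u i) hmz
      simp only [Pi.zero_apply, zero_add] at h1
      have : (m : ℤ) ≤ T := by exact_mod_cast hmT
      rw [Finset.mem_Ico]
      constructor <;> linarith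
  have hmod : ∀ a ∈ S, ∀ k : ℕ, (m : ℤ) ∣ ∑ i, f (a, k) i * v i - k := by
    intro a ha k
    rw [hS, Finset.mem_filter] at ha
    have h1 : (k : ℤ) = ∑ i, (k : ℤ) * u i * v i := by
      rw [Finset.sum_congr rfl fun i _ => show (k : ℤ) * u i * v i = k * (v i * u i) by ring,
        ← Finset.mul_sum, ← hu, mul_one]
    have h2 : ∑ i, f (a, k) i * v i - k =
        ∑ i, (f (a, k) i - a i - (k : ℤ) * u i) * v i := by
      simp only [sub_mul, Finset.sum_sub_distrib]
      rw [← h1, ha.2]; ring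
    rw [h2]
    refine Finset.dvd_sum fun i _ => ?_
    by_cases hi : i = j
    · subst hi
      exact Dvd.dvd.mul_left hdvd _
    · refine Dvd.dvd.mul_right ?_ _
      simp only [f, if_neg hi]
      refine ⟨-((k : ℤ) * u i / m), ?_⟩
      have := Int.emod_add_mul_ediv ((k : ℤ) * u i) m
      linarith
  have hinj : Set.InjOn f ((S ×ˢ Finset.range m : Finset _) : Set _) := by
    rintro ⟨a, k⟩ h ⟨b, l⟩ h' hf
    simp only [Finset.coe_product, Set.mem_prod, Finset.mem_coe, Finset.mem_range] at h h'
    have hkl : k = l := by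
      have h1 := hmod a h.1 k
      have h2 := hmod b h'.1 l
      rw [hf] at h1
      have h3 := dvd_sub h2 h1
      rw [sub_sub_sub_cancel_left] at h3
      have h4 : ((k : ℤ) - l) = 0 := Int.eq_zero_of_abs_lt_dvd h3 (by
        rw [abs_lt]; constructor <;> linarith [h.2, h'.2, (by exact_mod_cast h.2 : (k : ℤ) < m),
          (by exact_mod_cast h'.2 : (l : ℤ) < m)])
      omega
    subst hkl
    have hne : ∀ i, i ≠ j → a i = b i := by
      intro i hi
      have := congrFun hf i
      simp only [f, if_neg hi] at this
      linarith
    have hab : a = b := by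
      funext i
      by_cases hi : i = j
      · subst hi
        have h1 := (Finset.mem_filter.1 h.1).2
        have h2 := (Finset.mem_filter.1 h'.1).2
        rw [← Finset.add_sum_erase _ _ (Finset.mem_univ i)] at h1 h2
        rw [Finset.sum_congr rfl (g := fun k => b k * v k) (fun k hk => by
          rw [hne k (Finset.ne_of_mem_erase hk)])] at h1
        exact mul_right_cancel₀ hvj (by linarith)
      · exact hne i hi
    rw [hab]
  have := Finset.card_le_card_of_injOn f hmaps hinj
  rwa [Finset.card_product, Finset.card_range, hYcard] at this

lemma exists_primitive_of_orthogonal {d : ℕ} {a v : Fin d → ℤ} (hv : v ≠ 0)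
    (h : ∑ i, a i * v i = 0) :
    ∃ w : Fin d → ℤ, Finset.univ.gcd w = 1 ∧ (∀ i, |w i| ≤ |v i|) ∧ ∑ i, a i * w i = 0 := by
  obtain ⟨i₀, hi₀⟩ := Function.ne_iff.1 hv
  obtain ⟨w, hw, hw1⟩ := Finset.extract_gcd v (Finset.univ_nonempty_iff.2 ⟨i₀⟩)
  have hg : Finset.univ.gcd v ≠ 0 := by
    rw [Ne, Finset.gcd_eq_zero_iff]
    exact fun h => hi₀ (h i₀ (Finset.mem_univ _))
  refine ⟨w, hw1, fun i => ?_, ?_⟩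
  · rw [hw i (Finset.mem_univ _), abs_mul]
    exact le_mul_of_one_le_left (abs_nonneg _) (Int.one_le_abs hg)
  · refine mul_left_cancel₀ hg ?_
    rw [mul_zero, ← h, Finset.mul_sum]
    exact Finset.sum_congr rfl fun i _ => by rw [hw i (Finset.mem_univ _)]; ring

open Classical in
lemma card_short_relation_le {n M T : ℕ} (hn : n ≠ 0) (hMT : M ≤ T) :
    ((intCube (0 : Fin (n + 1) → ℤ) T).filter fun a =>
      ∃ v : Fin (n + 1) → ℤ, v ≠ 0 ∧ (∀ i, |v i| ≤ M) ∧ ∑ i, a i * v i = 0).card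
      ≤ M ^ n * ((n + 1) * (2 * 6 ^ n * T ^ n)) := by
  let V : ℕ → Fin (n + 1) → Finset (Fin (n + 1) → ℤ) := fun m j =>
    (Fintype.piFinset fun i => if i = j then {(m : ℤ), -(m : ℤ)} else
      Finset.Icc (-(m : ℤ)) m).filter fun v => Finset.univ.gcd v = 1
  let O : (Fin (n + 1) → ℤ) → Finset (Fin (n + 1) → ℤ) := fun v =>
    (intCube (0 : Fin (n + 1) → ℤ) T).filter fun a => ∑ i, a i * v i = 0
  have hsub : ((intCube (0 : Fin (n + 1) → ℤ) T).filter fun a =>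
      ∃ v : Fin (n + 1) → ℤ, v ≠ 0 ∧ (∀ i, |v i| ≤ M) ∧ ∑ i, a i * v i = 0) ⊆
      (Finset.Icc 1 M).biUnion fun m => Finset.univ.biUnion fun j => (V m j).biUnion O := by
    intro a ha
    obtain ⟨haT, v, hv0, hvM, hv⟩ := Finset.mem_filter.1 ha
    obtain ⟨w, hw1, hwv, hw⟩ := exists_primitive_of_orthogonal hv0 hv
    obtain ⟨j, -, hj⟩ := Finset.exists_max_image Finset.univ (fun i => |w i|)
      ⟨0, Finset.mem_univ _⟩
    simp only [Finset.mem_biUnion]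
    have hwj : w j ≠ 0 := by
      intro h0
      have : Finset.univ.gcd w = 0 := Finset.gcd_eq_zero_iff.2 fun i hi => by
        have := hj i hi
        rw [h0, abs_zero] at this
        exact abs_nonpos_iff.1 this
      rw [this] at hw1
      exact zero_ne_one hw1
    have habs : ((w j).natAbs : ℤ) = |w j| := Int.natCast_natAbs _
    refine ⟨(w j).natAbs, ?_, j, Finset.mem_univ _, w, ?_, Finset.mem_filter.2 ⟨haT, hw⟩⟩
    · have h1 := (hwv j).trans (hvM j)
      have h2 := Int.one_le_abs hwj
      rw [Finset.mem_Icc]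
      constructor <;> omega
    · refine Finset.mem_filter.2 ⟨Fintype.mem_piFinset.2 fun i => ?_, hw1⟩
      split_ifs with hi
      · subst hi
        rw [habs]
        rcases abs_choice (w i) with h | h <;> rw [h] <;> simp
      · rw [habs, Finset.mem_Icc]
        exact abs_le.1 (hj i (Finset.mem_univ _))
  have hV : ∀ m j, 0 < m → (V m j).card ≤ 2 * (3 * m) ^ n := by
    intro m j hm
    refine (Finset.card_filter_le _ _).trans ?_
    rw [Fintype.card_piFinset, Fin.prod_univ_succAbove _ j]
    have h1 : ∀ i : Fin n, (if j.succAbove i = j then ({(m : ℤ), -(m : ℤ)} : Finset ℤ) else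
        Finset.Icc (-(m : ℤ)) m).card = 2 * m + 1 := by
      intro i
      rw [if_neg (Fin.succAbove_ne j i), Int.card_Icc]
      omega
    rw [Finset.prod_congr rfl fun i _ => h1 i, if_pos rfl, Finset.prod_const, Finset.card_univ,
      Fintype.card_fin]
    exact Nat.mul_le_mul Finset.card_le_two (Nat.pow_le_pow_left (by omega) n)
  obtain ⟨k, rfl⟩ := Nat.exists_eq_succ_of_ne_zero hn
  have hterm : ∀ m ∈ Finset.Icc 1 M, ∀ j, ((V m j).biUnion O).card
      ≤ M ^ k * (2 * 6 ^ (k + 1) * T ^ (k + 1)) := by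
    intro m hm j
    rw [Finset.mem_Icc] at hm
    by_cases hV0 : (V m j).Nonempty
    · have hle : ∀ v ∈ V m j, (O v).card ≤ (2 * T) ^ (k + 1) / m := by
        intro v hv
        obtain ⟨h1, h2⟩ := Finset.mem_filter.1 hv
        have h3 := Fintype.mem_piFinset.1 h1 j
        rw [if_pos rfl, Finset.mem_insert, Finset.mem_singleton] at h3
        rw [Nat.le_div_iff_mul_le (by omega)]
        refine card_intCube_orthogonal_mul_le h2 (by omega) (j := j) ?_ (hm.2.trans hMT)
        rcases h3 with h3 | h3 <;> rw [h3] <;> simp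
      refine (Finset.card_biUnion_le_card_mul _ _ _ hle).trans ?_
      calc (V m j).card * ((2 * T) ^ (k + 1) / m)
          ≤ 2 * (3 * m) ^ (k + 1) * ((2 * T) ^ (k + 1) / m) :=
            Nat.mul_le_mul_right _ (hV m j (by omega))
        _ = 2 * 3 ^ (k + 1) * m ^ k * (m * ((2 * T) ^ (k + 1) / m)) := by
            rw [mul_pow 3 m, pow_succ m]; ring
        _ ≤ 2 * 3 ^ (k + 1) * M ^ k * (2 * T) ^ (k + 1) :=
            Nat.mul_le_mul (Nat.mul_le_mul_left _ (Nat.pow_le_pow_left hm.2 k))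
              (Nat.mul_div_le _ _)
        _ = _ := by
            rw [mul_pow, show (6 : ℕ) = 3 * 2 by norm_num, mul_pow]; ring
    · rw [Finset.not_nonempty_iff_eq_empty] at hV0
      rw [hV0]
      simp
  refine (Finset.card_le_card hsub).trans ((Finset.card_biUnion_le_card_mul _ _
    ((k + 1 + 1) * (M ^ k * (2 * 6 ^ (k + 1) * T ^ (k + 1)))) fun m hm => ?_).trans
    (le_of_eq ?_))
  · refine (Finset.card_biUnion_le_card_mul _ _ _ fun j _ => hterm m hm j).trans ?_
    simp
  · rw [Nat.card_Icc, Nat.add_sub_cancel, Nat.succ_eq_add_one]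
    ring

open Classical in
lemma card_intCube_coord_lt_le {n T : ℕ} (h : ℕ) :
    ((intCube (0 : Fin (n + 1) → ℤ) T).filter fun a => ∃ i, a i < (h : ℤ)).card ≤
      (n + 1) * (h * T ^ n) := by
  let Y : Fin (n + 1) → Finset (Fin (n + 1) → ℤ) := fun j => Fintype.piFinset fun i =>
    if i = j then Finset.Ico (0 : ℤ) h else Finset.Ico (0 : ℤ) T
  have hY : ∀ j, (Y j).card ≤ h * T ^ n := by
    intro j
    rw [Fintype.card_piFinset, Fin.prod_univ_succAbove _ j]
    simp [Fin.succAbove_ne]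
  have hsub : ((intCube (0 : Fin (n + 1) → ℤ) T).filter fun a => ∃ i, a i < (h : ℤ)) ⊆
      Finset.univ.biUnion Y := by
    intro a ha
    obtain ⟨ha, j, hj⟩ := Finset.mem_filter.1 ha
    rw [mem_intCube] at ha
    refine Finset.mem_biUnion.2 ⟨j, Finset.mem_univ _, Fintype.mem_piFinset.2 fun i => ?_⟩
    have h1 := ha i
    simp only [Pi.zero_apply, zero_add] at h1
    split_ifs with hi
    · subst hi
      exact Finset.mem_Ico.2 ⟨h1.1, hj⟩
    · exact Finset.mem_Ico.2 h1
  refine (Finset.card_le_card hsub).trans ((Finset.card_biUnion_le_card_mul _ _ _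
    fun j _ => hY j).trans ?_)
  simp

set_option maxHeartbeats 1000000 in
/-- Among the integer vectors in a large cube, all but a small proportion have a Frobenius number
of the typical order of magnitude. -/
lemma exists_frobNum_tight {n : ℕ} (hn : n ≠ 0) {ε : ℝ} (hε : 0 < ε) (hε1 : ε ≤ 1) :
    ∃ R : ℝ, 0 < R ∧ ∃ T₀ : ℕ, ∀ T : ℕ, T₀ ≤ T → ∀ S : Finset (Fin (n + 1) → ℤ),
      (∀ a ∈ S, a ∈ intCube (0 : Fin (n + 1) → ℤ) T ∧ Finset.univ.gcd a = 1 ∧ (∀ i, 2 ≤ a i) ∧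
        R * (∏ i, (a i : ℝ)) ^ (1 / (n : ℝ)) < (frobNum (n + 1) a : ℝ) + ∑ i, (a i : ℝ)) →
      (S.card : ℝ) ≤ ε * T ^ (n + 1) := by
  classical
  have hn0 : (0 : ℝ) < n := by exact_mod_cast Nat.pos_of_ne_zero hn
  have hn1 : (1 : ℝ) ≤ n := by exact_mod_cast Nat.one_le_iff_ne_zero.2 hn
  set η : ℝ := ε / (4 * (n + 1)) with hη
  have hη0 : 0 < η := by positivity
  have hη1 : η ≤ 1 := by rw [hη, div_le_one (by positivity)]; linarith
  set θ : ℝ := ε / (4 * ((n + 1) * 6 ^ n)) with hθ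
  have hθ0 : 0 < θ := by positivity
  have hθ1 : θ ≤ 1 := by
    rw [hθ, div_le_one (by positivity)]
    have : (1 : ℝ) ≤ (n + 1) * 6 ^ n := one_le_mul_of_one_le_of_one_le (by linarith)
      (one_le_pow₀ (by norm_num))
    linarith
  set K : ℕ := ⌈((η / (2 * n)) ^ n * θ)⁻¹⌉₊ with hK
  have hK1 : 1 ≤ (K : ℝ) * ((η / (2 * n)) ^ n * θ) := by
    have h0 : 0 < (η / (2 * n)) ^ n * θ := by positivity
    have h1 := Nat.le_ceil ((η / (2 * n)) ^ n * θ)⁻¹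
    rw [← inv_mul_cancel₀ h0.ne']
    gcongr
  set p : ℝ := 1 / (n : ℝ) with hp
  have hp0 : 0 < p := by positivity
  have hp1 : p ≤ 1 := by rw [hp, div_le_one hn0]; exact hn1
  refine ⟨(4 * K * n + n + 1) / (η ^ (n + 1)) ^ p, by positivity,
    ⌈η⁻¹ + (2 * n / η) ^ n / θ⌉₊, ?_⟩
  intro T hT S hS
  have hT' : η⁻¹ + (2 * n / η) ^ n / θ ≤ T := (Nat.le_ceil _).trans (by exact_mod_cast hT)
  have hTη : η⁻¹ ≤ T := le_trans (le_add_of_nonneg_right (by positivity)) hT'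
  have hTθ : (2 * n / η) ^ n / θ ≤ T := le_trans (le_add_of_nonneg_left (by positivity)) hT'
  have hT0 : (0 : ℝ) < T := (inv_pos.2 hη0).trans_le hTη
  have hT1 : (1 : ℝ) ≤ T := (one_le_inv_iff₀.2 ⟨hη0, hη1⟩).trans hTη
  have hηT : 1 ≤ η * T := by rwa [inv_le_iff_one_le_mul₀' hη0] at hTη
  set y : ℝ := (θ * T) ^ p with hy
  have hyn : y ^ n = θ * T := by
    rw [hy, hp, one_div, Real.rpow_inv_natCast_pow (by positivity) hn]
  have hy0 : 0 < y := by positivity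
  have hyη : 2 * n / η ≤ y := by
    refine le_of_pow_le_pow_left₀ hn hy0.le ?_
    rw [hyn]
    rw [div_le_iff₀ hθ0] at hTθ
    linarith
  have hyη' : 2 * n ≤ η * y := by rwa [div_le_iff₀' hη0] at hyη
  have hy1 : 2 ≤ y := by nlinarith
  set M : ℕ := ⌊y⌋₊ with hM
  have hMy : (M : ℝ) ≤ y := Nat.floor_le hy0.le
  have hyT : y ≤ (T : ℝ) ^ p := Real.rpow_le_rpow (by positivity) (by nlinarith) hp0.le
  have hMT : M ≤ T := by
    have : (T : ℝ) ^ p ≤ T := Real.rpow_le_self_of_one_le hT1 hp1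
    exact_mod_cast hMy.trans (hyT.trans this)
  have hMy' : y / 2 ≤ M := by
    have := Nat.lt_floor_add_one y
    linarith
  set H : ℕ := ⌊η * M / n⌋₊ with hH
  have hHle : (H : ℝ) ≤ η * M / n := Nat.floor_le (by positivity)
  have hH1 : 1 ≤ H := by
    rw [hH, Nat.one_le_floor_iff, one_le_div hn0]
    nlinarith
  have hHgt : η * M / n ≤ H + 1 := (Nat.lt_floor_add_one _).le
  have hHM : (H : ℝ) ≤ M := by
    refine hHle.trans ?_
    rw [div_le_iff₀ hn0]
    have : (0 : ℝ) ≤ M := Nat.cast_nonneg _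
    nlinarith
  have hHn : (T : ℝ) ≤ K * (H + 1) ^ n := by
    have h1 : η / (2 * n) * y ≤ H + 1 := by
      refine le_trans ?_ hHgt
      rw [show η / (2 * n) * y = η * (y / 2) / n by field_simp]
      gcongr
    calc (T : ℝ) ≤ K * ((η / (2 * n)) ^ n * θ) * T := le_mul_of_one_le_left hT0.le hK1
      _ = K * (η / (2 * n) * y) ^ n := by rw [mul_pow, hyn]; ring
      _ ≤ _ := by gcongr
  have hsub : S ⊆ ((intCube (0 : Fin (n + 1) → ℤ) T).filter fun a => ∃ i, a i < (⌈η * T⌉₊ : ℤ)) ∪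
      ((intCube (0 : Fin (n + 1) → ℤ) T).filter fun a =>
        ∃ v : Fin (n + 1) → ℤ, v ≠ 0 ∧ (∀ i, |v i| ≤ M) ∧ ∑ i, a i * v i = 0) := by
    intro a ha
    obtain ⟨haT, hag, ha2, hlt⟩ := hS a ha
    by_contra hnot
    rw [Finset.mem_union, Finset.mem_filter, Finset.mem_filter, not_or, not_and, not_and] at hnot
    have hbig := hnot.1 haT
    have hno := hnot.2 haT
    push Not at hbig hno
    refine absurd hlt (not_lt.2 ?_)
    have haT1 : ∀ i, (a i : ℝ) ≤ T := by
      intro i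
      have := ((mem_intCube.1 haT) i).2
      simp only [Pi.zero_apply, zero_add] at this
      exact_mod_cast this.le
    have haη : ∀ i, η * T ≤ a i := by
      intro i
      refine (Nat.le_ceil _).trans ?_
      exact_mod_cast hbig i
    have hF := frobNum_le_of_no_short_relation (K := K) hag ha2 hH1 ?_ ?_
    · have hFr : (frobNum (n + 1) a : ℝ) ≤ 4 * K * H * ∑ i : Fin n, (a i.castSucc : ℝ) := by
        exact_mod_cast hF
      have hs1 : ∑ i : Fin n, (a i.castSucc : ℝ) ≤ n * T := by
        refine (Finset.sum_le_sum fun i _ => haT1 _).trans ?_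
        simp
      have hs2 : ∑ i, (a i : ℝ) ≤ (n + 1) * T := by
        refine (Finset.sum_le_sum fun i _ => haT1 _).trans ?_
        simp
      have hprod : (η * T) ^ (n + 1) ≤ ∏ i, (a i : ℝ) := by
        calc (η * T) ^ (n + 1) = ∏ _i : Fin (n + 1), (η * T) := by simp
          _ ≤ _ := Finset.prod_le_prod (fun _ _ => by positivity) fun i _ => haη i
      have hTp : ((T : ℝ) ^ (n + 1)) ^ p = T * (T : ℝ) ^ p := by
        rw [pow_succ, Real.mul_rpow (by positivity) hT0.le, hp, one_div,
          Real.pow_rpow_inv_natCast hT0.le hn]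
      have hTp1 : 1 ≤ (T : ℝ) ^ p := Real.one_le_rpow hT1 hp0.le
      have hHp : (H : ℝ) ≤ (T : ℝ) ^ p := hHM.trans (hMy.trans hyT)
      calc (frobNum (n + 1) a : ℝ) + ∑ i, (a i : ℝ)
          ≤ 4 * K * (T : ℝ) ^ p * (n * T) + (n + 1) * (T * (T : ℝ) ^ p) := by
            have hs0 : 0 ≤ ∑ i : Fin n, (a i.castSucc : ℝ) := Finset.sum_nonneg fun i _ =>
              (by positivity : 0 ≤ η * (T : ℝ)).trans (haη _)
            refine add_le_add (hFr.trans (by gcongr)) (hs2.trans ?_)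
            gcongr
            exact le_mul_of_one_le_right hT0.le hTp1
        _ = (4 * K * n + n + 1) / (η ^ (n + 1)) ^ p * ((η * T) ^ (n + 1)) ^ p := by
            rw [mul_pow, Real.mul_rpow (by positivity) (by positivity), hTp]
            have : (η ^ (n + 1)) ^ p ≠ 0 := by positivity
            field_simp
            ring
        _ ≤ _ := by gcongr
    · intro v hv hvH h0
      refine hno v hv (fun i => ?_) h0
      refine Fin.lastCases ?_ (fun i => ?_) i
      · rw [Fin.sum_univ_castSucc] at h0
        have h1 : (a (Fin.last n) : ℝ) * |(v (Fin.last n) : ℝ)| ≤ n * (T * H) := by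
          have h2 : (a (Fin.last n) : ℝ) * v (Fin.last n) =
              -∑ i : Fin n, (a i.castSucc : ℝ) * v i.castSucc := by
            have : (a (Fin.last n)) * v (Fin.last n) =
              -∑ i : Fin n, (a i.castSucc) * v i.castSucc := by linarith
            exact_mod_cast this
          have h3 : (0 : ℝ) ≤ a (Fin.last n) := (by positivity : 0 ≤ η * (T : ℝ)).trans (haη _)
          rw [← abs_of_nonneg h3, ← abs_mul, h2, abs_neg]
          refine (Finset.abs_sum_le_sum_abs _ _).trans ((Finset.sum_le_sum
            (g := fun _ => (T : ℝ) * H) fun i _ => ?_).trans (by simp))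
          have h4 : (0 : ℝ) ≤ a i.castSucc := (by positivity : 0 ≤ η * (T : ℝ)).trans (haη _)
          have h5 : |(v i.castSucc : ℝ)| ≤ H := by exact_mod_cast hvH i
          rw [abs_mul, abs_of_nonneg h4]
          exact mul_le_mul (haT1 _) h5 (abs_nonneg _) hT0.le
        have h2 : η * T * |(v (Fin.last n) : ℝ)| ≤ η * T * M := by
          refine (mul_le_mul_of_nonneg_right (haη _) (abs_nonneg _)).trans (h1.trans ?_)
          rw [le_div_iff₀ hn0] at hHle
          nlinarith
        have h3 : |(v (Fin.last n) : ℝ)| ≤ M := le_of_mul_le_mul_left h2 (by positivity)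
        exact_mod_cast h3
      · have : (H : ℤ) ≤ M := by exact_mod_cast hHM
        exact (hvH i).trans this
    · have h1 : (a (Fin.last n) : ℝ) ≤ K * (H + 1) ^ n := (haT1 _).trans hHn
      exact_mod_cast h1
  have h1 : (((intCube (0 : Fin (n + 1) → ℤ) T).filter fun a => ∃ i, a i < (⌈η * T⌉₊ : ℤ)).card : ℝ) ≤
      (n + 1) * (⌈η * T⌉₊ * T ^ n) := by
    exact_mod_cast card_intCube_coord_lt_le (n := n) (T := T) ⌈η * T⌉₊
  have h2 : (((intCube (0 : Fin (n + 1) → ℤ) T).filter fun a =>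
        ∃ v : Fin (n + 1) → ℤ, v ≠ 0 ∧ (∀ i, |v i| ≤ M) ∧ ∑ i, a i * v i = 0).card : ℝ) ≤
      M ^ n * ((n + 1) * (2 * 6 ^ n * T ^ n)) := by
    exact_mod_cast card_short_relation_le hn hMT
  have h3 : (⌈η * T⌉₊ : ℝ) ≤ 2 * (η * T) := by
    have := (Nat.ceil_lt_add_one (by positivity : 0 ≤ η * (T : ℝ))).le
    linarith
  have h4 : (M : ℝ) ^ n ≤ θ * T := by rw [← hyn]; gcongr
  have h5 := Nat.cast_le (α := ℝ).2 ((Finset.card_le_card hsub).trans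
    (Finset.card_union_le _ _))
  rw [Nat.cast_add] at h5
  refine (h5.trans (add_le_add h1 h2)).trans ?_
  calc (n + 1) * (⌈η * T⌉₊ * (T : ℝ) ^ n) + M ^ n * ((n + 1) * (2 * 6 ^ n * T ^ n))
      ≤ (n + 1) * (2 * (η * T) * (T : ℝ) ^ n) + θ * T * ((n + 1) * (2 * 6 ^ n * T ^ n)) := by
        gcongr
    _ = ε * T ^ (n + 1) := by
        rw [hη, hθ]
        field_simp
        ring

/-- The set of integer vectors counted in the limit theorem. -/
def frobSet (n : ℕ) (R T : ℝ) (D : Set (Fin (n + 1) → ℝ)) : Set (Fin (n + 1) → ℤ) :=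
  {a | Finset.univ.gcd a = 1 ∧ (∀ i, 2 ≤ a i) ∧ (fun i => (a i : ℝ) / T) ∈ D ∧
    (frobNum (n + 1) a : ℝ) + ∑ i, (a i : ℝ) ≤ R * (∏ i, (a i : ℝ)) ^ (1 / (n : ℝ))}

lemma mem_Icc_one_floor {a : ℤ} {T : ℝ} (h0 : 0 < a) (hT : (a : ℝ) ≤ T) :
    a ∈ Finset.Icc (1 : ℤ) ⌊T⌋₊ := by
  rw [Finset.mem_Icc]
  refine ⟨h0, ?_⟩
  have h1 : ((a.toNat : ℕ) : ℝ) ≤ T := by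
    have : ((a.toNat : ℕ) : ℤ) = a := Int.toNat_of_nonneg h0.le
    rw [← Int.cast_natCast, this]
    exact hT
  have h2 := Nat.le_floor h1
  omega

lemma finite_ncard_le_pow {d : ℕ} {T : ℝ} (hT : 0 < T) {S : Set (Fin d → ℤ)}
    (hS : ∀ a ∈ S, ∀ i, 0 < a i ∧ (a i : ℝ) ≤ T) : S.Finite ∧ (S.ncard : ℝ) ≤ T ^ d := by
  classical
  have hsub : S ⊆ (Fintype.piFinset fun _ : Fin d => Finset.Icc (1 : ℤ) ⌊T⌋₊ : Finset _) := by
    intro a ha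
    simp only [Finset.mem_coe, Fintype.mem_piFinset]
    exact fun i => mem_Icc_one_floor (hS a ha i).1 (hS a ha i).2
  refine ⟨(Finset.finite_toSet _).subset hsub, ?_⟩
  have h1 := Set.ncard_le_ncard hsub (Finset.finite_toSet _)
  rw [Set.ncard_coe_finset, Fintype.card_piFinset] at h1
  calc (S.ncard : ℝ) ≤ ((∏ _i : Fin d, (Finset.Icc (1 : ℤ) ⌊T⌋₊).card : ℕ) : ℝ) := by
        exact_mod_cast h1
    _ = (⌊T⌋₊ : ℝ) ^ d := by simp
    _ ≤ T ^ d := by gcongr; exact Nat.floor_le hT.le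

lemma ncard_coord_le_le {n : ℕ} {T U : ℝ} (hT : 0 < T) (hU : 0 ≤ U) {S : Set (Fin (n + 1) → ℤ)}
    (hS : ∀ a ∈ S, (∀ i, 0 < a i ∧ (a i : ℝ) ≤ T) ∧ ∃ i, (a i : ℝ) ≤ U) :
    (S.ncard : ℝ) ≤ (n + 1) * (U * T ^ n) := by
  classical
  let Y : Fin (n + 1) → Finset (Fin (n + 1) → ℤ) := fun j => Fintype.piFinset fun i =>
    if i = j then Finset.Icc (1 : ℤ) ⌊U⌋₊ else Finset.Icc (1 : ℤ) ⌊T⌋₊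
  have hsub : S ⊆ (Finset.univ.biUnion Y : Finset _) := by
    intro a ha
    obtain ⟨h1, j, hj⟩ := hS a ha
    simp only [Finset.mem_coe, Finset.mem_biUnion]
    refine ⟨j, Finset.mem_univ _, Fintype.mem_piFinset.2 fun i => ?_⟩
    split_ifs with hi
    · subst hi
      exact mem_Icc_one_floor (h1 i).1 hj
    · exact mem_Icc_one_floor (h1 i).1 (h1 i).2
  have hY : ∀ j, (Y j).card ≤ ⌊U⌋₊ * ⌊T⌋₊ ^ n := by
    intro j
    rw [Fintype.card_piFinset, Fin.prod_univ_succAbove _ j]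
    simp [Fin.succAbove_ne]
  have h1 := Set.ncard_le_ncard hsub (Finset.finite_toSet _)
  rw [Set.ncard_coe_finset] at h1
  have h2 := h1.trans (Finset.card_biUnion_le_card_mul _ _ _ fun j _ => hY j)
  rw [Finset.card_univ, Fintype.card_fin] at h2
  calc (S.ncard : ℝ) ≤ (n + 1) * (⌊U⌋₊ * (⌊T⌋₊ : ℝ) ^ n) := by exact_mod_cast h2
    _ ≤ _ := by gcongr <;> exact Nat.floor_le (by linarith)

lemma frobSet_bounds {n : ℕ} {R T : ℝ} (hT : 0 < T) {D : Set (Fin (n + 1) → ℝ)}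
    (hD : D ⊆ {x | ∀ i, x i ∈ Set.Ioo (0 : ℝ) 1}) {a : Fin (n + 1) → ℤ}
    (ha : a ∈ frobSet n R T D) (i : Fin (n + 1)) : 0 < a i ∧ (a i : ℝ) ≤ T := by
  refine ⟨by linarith [ha.2.1 i], ?_⟩
  have := (hD ha.2.2.1 i).2
  rw [div_lt_one hT] at this
  exact this.le

lemma ncard_frobSet_le {n : ℕ} {R T : ℝ} (hT : 0 < T) {D : Set (Fin (n + 1) → ℝ)}
    (hD : D ⊆ {x | ∀ i, x i ∈ Set.Ioo (0 : ℝ) 1}) :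
    (frobSet n R T D).Finite ∧ ((frobSet n R T D).ncard : ℝ) ≤ T ^ (n + 1) :=
  finite_ncard_le_pow hT fun _ ha => frobSet_bounds hT hD ha

lemma abs_ncard_frobSet_sub_le {n : ℕ} {R T η : ℝ} (hT : 0 < T) (hη : 0 ≤ η)
    {D : Set (Fin (n + 1) → ℝ)} (hD : D ⊆ {x | ∀ i, x i ∈ Set.Ioo (0 : ℝ) 1}) :
    |((frobSet n R T D).ncard : ℝ) - (frobSet n R T {x ∈ D | ∀ i, η < x i}).ncard| ≤
      (n + 1) * η * T ^ (n + 1) := by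
  have hsub : frobSet n R T {x ∈ D | ∀ i, η < x i} ⊆ frobSet n R T D := by
    rintro a ⟨h1, h2, h3, h4⟩
    exact ⟨h1, h2, h3.1, h4⟩
  have hfin := (ncard_frobSet_le (R := R) hT hD).1
  have h1 := Set.ncard_sdiff_add_ncard_of_subset hsub hfin
  have h2 : ((frobSet n R T D \ frobSet n R T {x ∈ D | ∀ i, η < x i}).ncard : ℝ) ≤
      (n + 1) * (η * T * T ^ n) := by
    refine ncard_coord_le_le hT (by positivity) fun a ha => ⟨frobSet_bounds hT hD ha.1, ?_⟩
    by_contra hno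
    push Not at hno
    refine ha.2 ⟨ha.1.1, ha.1.2.1, ⟨ha.1.2.2.1, fun i => ?_⟩, ha.1.2.2.2⟩
    rw [lt_div_iff₀ hT]
    exact hno i
  rw [← h1, Nat.cast_add, add_sub_cancel_right, abs_of_nonneg (Nat.cast_nonneg _)]
  refine h2.trans (le_of_eq ?_)
  ring

lemma volume_le_one {n : ℕ} {D : Set (Fin (n + 1) → ℝ)}
    (hD : D ⊆ {x | ∀ i, x i ∈ Set.Ioo (0 : ℝ) 1}) : volume D ≤ 1 := by
  refine (measure_mono (t := Set.univ.pi fun _ => Set.Ioo (0 : ℝ) 1) ?_).trans (le_of_eq ?_)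
  · intro x hx i _
    exact hD hx i
  · rw [volume_pi_pi]; simp

lemma abs_volume_sub_le {n : ℕ} {η : ℝ} (hη : 0 ≤ η) {D : Set (Fin (n + 1) → ℝ)}
    (hD : D ⊆ {x | ∀ i, x i ∈ Set.Ioo (0 : ℝ) 1}) :
    |(volume D).toReal - (volume {x ∈ D | ∀ i, η < x i}).toReal| ≤
      (n + 1) * (2 * η * 2 ^ n) := by
  have hD1 := volume_le_one hD
  have hDη : volume {x ∈ D | ∀ i, η < x i} ≤ 1 := (measure_mono fun x hx => hx.1).trans hD1
  have hfin := ne_top_of_le_ne_top ENNReal.one_ne_top hD1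
  have hfin' := ne_top_of_le_ne_top ENNReal.one_ne_top hDη
  have h1 : volume D ≤ volume {x ∈ D | ∀ i, η < x i} +
      ∑ _i : Fin (n + 1), ENNReal.ofReal (2 * η * 2 ^ n) := by
    refine (measure_mono (t := {x ∈ D | ∀ i, η < x i} ∪ ⋃ i ∈ (Finset.univ : Finset (Fin (n + 1))),
      {x : Fin (n + 1) → ℝ | (∀ k, 0 < x k ∧ x k < 2) ∧ |x i - 0| ≤ η}) ?_).trans
      ((measure_union_le _ _).trans (add_le_add le_rfl ((measure_biUnion_finset_le _ _).trans
        (Finset.sum_le_sum fun i _ => volume_box_slab_le i 0 hη))))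
    intro x hx
    by_cases h : ∀ i, η < x i
    · exact Or.inl ⟨hx, h⟩
    · push Not at h
      obtain ⟨i, hi⟩ := h
      refine Or.inr (Set.mem_biUnion (Finset.mem_coe.2 (Finset.mem_univ i)) ⟨fun k => ?_, ?_⟩)
      · exact ⟨(hD hx k).1, (hD hx k).2.trans one_lt_two⟩
      · rw [sub_zero, abs_of_pos (hD hx i).1]
        exact hi
  rw [Finset.sum_const, Finset.card_univ, Fintype.card_fin, nsmul_eq_mul] at h1
  have h2 := ENNReal.toReal_mono (by finiteness) h1
  rw [ENNReal.toReal_add hfin' (by finiteness), ENNReal.toReal_mul, ENNReal.toReal_natCast,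
    ENNReal.toReal_ofReal (by positivity)] at h2
  have h3 : (volume {x ∈ D | ∀ i, η < x i}).toReal ≤ (volume D).toReal :=
    ENNReal.toReal_mono hfin (measure_mono fun x hx => hx.1)
  rw [abs_of_nonneg (by linarith)]
  push_cast at h2
  linarith

/-- The asymptotic count of vectors all of whose coordinates are not too small. -/
lemma exists_ncard_frobSet_cut {n : ℕ} (hn : 2 ≤ n) :
    ∃ q : ℕ, 0 < q ∧ ∀ (μ₀ : Measure (XQuot n)) [IsProbabilityMeasure μ₀],
      (∀ g : SLR n, Measure.map (fun x => g • x) μ₀ = μ₀) →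
      ∃ c₂ : ℝ, ∀ R : ℝ, 0 < R → ∀ D : Set (Fin (n + 1) → ℝ), IsOpen D →
      D ⊆ {x | ∀ i, x i ∈ Set.Ioo (0 : ℝ) 1} →
      (∃ C' : ℝ, 0 < C' ∧ ∀ r : ℝ, 0 < r → r < 1 →
          volume {x : Fin (n + 1) → ℝ | Metric.infDist x (frontier D) < r}
            < ENNReal.ofReal (C' * r)) →
      ∃ C : ℝ, 0 < C ∧ ∃ v₀ : ℝ, 1 ≤ v₀ ∧ ∀ v : ℝ, v₀ ≤ v →
        |((frobSet n R ((v ^ (12 * q)) ^ n) {x ∈ D | ∀ i, v⁻¹ < x i}).ncard : ℝ) -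
          ((v ^ (12 * q)) ^ n) ^ (n + 1) * (c₂ * (volume {x ∈ D | ∀ i, v⁻¹ < x i}).toReal *
            (μ₀ (QuotientGroup.mk ''
              {g : SLR n | covRad n (simplexStd n) (latticeOf g) ≤ R})).toReal)| ≤
          C * ((v ^ (12 * q)) ^ n) ^ (n + 1) * (v ^ (1 / (n : ℝ)))⁻¹ := by
  have hn0 : n ≠ 0 := by omega
  obtain ⟨q, hq, hcount⟩ := exists_card_crossRegion hn
  refine ⟨q, hq, fun μ₀ _ hinv => ?_⟩
  obtain ⟨b, hb, hμ⟩ := measure_lattices_eq_sum hn0 μ₀ hinv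
  refine ⟨primDensity n (n + 1) * n * b, fun R hR D hDo hD hC' => ?_⟩
  obtain ⟨ρ, hρ, K, hK, hsum⟩ := hμ R hR
  have hk := fun k : ℕ => hcount ρ hρ (reducedSet n ρ R k) D
    (signDefinable_reducedSet n hρ hR k) (fun g hg => hg.1) hDo hD hC'
  choose C hC v₀ hv₀ hmain using hk
  refine ⟨∑ k ∈ Finset.Icc 1 K, C k + 1, add_pos_of_nonneg_of_pos
    (Finset.sum_nonneg fun k _ => (hC k).le) one_pos, 2 + ∑ k ∈ Finset.Icc 1 K, v₀ k,
    le_add_of_le_of_nonneg one_le_two (Finset.sum_nonneg fun k _ => zero_le_one.trans (hv₀ k)), ?_⟩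
  intro v hv
  have hv2 : 2 ≤ v := le_trans (le_add_of_nonneg_right
    (Finset.sum_nonneg fun k _ => zero_le_one.trans (hv₀ k))) hv
  have hvk : ∀ k ∈ Finset.Icc 1 K, v₀ k ≤ v := by
    intro k hk
    have := Finset.single_le_sum (f := v₀) (fun j _ => zero_le_one.trans (hv₀ j)) hk
    linarith
  have hv1 : 1 ≤ v := by linarith
  have hv0 : 0 < v := by linarith
  set T : ℝ := (v ^ (12 * q)) ^ n with hT
  have hT0 : 0 < T := by positivity
  have hvT : 2 ≤ v⁻¹ * T := by
    have h1 : v ^ 2 ≤ T := by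
      rw [hT, ← pow_mul]
      refine pow_le_pow_right₀ hv1 ?_
      nlinarith
    rw [inv_mul_eq_div, le_div_iff₀ hv0]
    nlinarith
  set Dη : Set (Fin (n + 1) → ℝ) := {x ∈ D | ∀ i, v⁻¹ < x i} with hDη
  have hDη1 : Dη ⊆ {x | ∀ i, x i ∈ Set.Ioo (0 : ℝ) 1} := fun x hx => hD hx.1
  have hbig : ∀ a : Fin (n + 1) → ℤ, (fun i => (a i : ℝ) / T) ∈ Dη → ∀ i, 2 ≤ a i := by
    intro a ha i
    have h1 := ha.2 i
    rw [lt_div_iff₀ hT0] at h1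
    have h2 : (2 : ℝ) < a i := hvT.trans_lt h1
    exact_mod_cast h2.le
  set 𝓐 : Set (Fin (n + 1) → ℤ) := {a | Finset.univ.gcd a = 1 ∧ (∀ i, 2 ≤ a i) ∧
    (fun i => (a i : ℝ) / T) ∈ Dη} with h𝓐
  have h𝓐fin : 𝓐.Finite := by
    refine (finite_ncard_le_pow hT0 fun a ha i => ⟨by linarith [ha.2.1 i], ?_⟩).1
    have := (hDη1 ha.2.2 i).2
    rw [div_lt_one hT0] at this
    exact this.le
  obtain ⟨-, hS⟩ := ncard_frobNum_le_eq_sum hn0 hK h𝓐fin fun a ha => ⟨ha.1, ha.2.1⟩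
  have hfrob : frobSet n R T Dη = {a ∈ 𝓐 | (frobNum (n + 1) a : ℝ) + ∑ i, (a i : ℝ) ≤
      R * (∏ i, (a i : ℝ)) ^ (1 / (n : ℝ))} := by
    ext a
    simp only [frobSet, h𝓐, Set.mem_ofPred_eq, and_assoc]
  have hset : ∀ k, {B : Fin n → Fin (n + 1) → ℤ | crossVec B ∈ 𝓐 ∧
      arrNormalize (scaledBlock (castTuple B)) ∈ reducedSet n ρ R k} =
      {B : Fin n → Fin (n + 1) → ℤ | IsPrimTuple B ∧
        (fun i => ((crossVec B i : ℤ) : ℝ) / T) ∈ Dη ∧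
          arrNormalize (scaledBlock (castTuple B)) ∈ reducedSet n ρ R k} := by
    intro k
    ext B
    constructor
    · rintro ⟨⟨h1, h2, h3⟩, h4⟩
      exact ⟨isPrimTuple_of_gcd_crossVec hn0 h1 (by have := h2 (Fin.last n); omega), h3, h4⟩
    · rintro ⟨h1, h2, h3⟩
      have h4 := hbig _ h2
      exact ⟨⟨gcd_crossVec_eq_one h1 (by have := h4 (Fin.last n); omega), h4, h2⟩, h3⟩
  rw [hfrob, hS, hsum]
  set P : ℝ := (v ^ (1 / (n : ℝ)))⁻¹ with hP
  have hP0 : 0 < P := by positivity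
  have hrew : T ^ (n + 1) * (primDensity n (n + 1) * n * b * (volume Dη).toReal *
      ∑ k ∈ Finset.Icc 1 K, (coneMeasure n (reducedSet n ρ R k)).toReal / (b * k)) =
      ∑ k ∈ Finset.Icc 1 K, primDensity n (n + 1) * T ^ (n + 1) *
        (n * (coneMeasure n (reducedSet n ρ R k)).toReal * (volume Dη).toReal) / k := by
    rw [Finset.mul_sum, Finset.mul_sum]
    refine Finset.sum_congr rfl fun k hk => ?_
    have : (k : ℝ) ≠ 0 := by
      have := (Finset.mem_Icc.1 hk).1
      exact_mod_cast (by omega : k ≠ 0)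
    field_simp
  rw [hrew, ← Finset.sum_sub_distrib]
  calc _ ≤ ∑ k ∈ Finset.Icc 1 K, C k * T ^ (n + 1) * P := by
        refine (Finset.abs_sum_le_sum_abs _ _).trans (Finset.sum_le_sum fun k hk => ?_)
        have h1 : (1 : ℝ) ≤ k := by exact_mod_cast (Finset.mem_Icc.1 hk).1
        rw [← sub_div, abs_div, abs_of_pos (by linarith : (0 : ℝ) < k), hset]
        exact (div_le_self (abs_nonneg _) h1).trans (hmain k v (hvk k hk)).2
    _ = (∑ k ∈ Finset.Icc 1 K, C k) * T ^ (n + 1) * P := by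
        rw [Finset.sum_mul, Finset.sum_mul]
    _ ≤ _ := by
        gcongr
        linarith

/-- The limit distribution with a polynomial error term, up to the value of the constant. -/
lemma exists_frobSet_asymptotic {n : ℕ} (hn : 2 ≤ n) :
    ∃ κ : ℝ, 0 < κ ∧ ∀ (μ₀ : Measure (XQuot n)) [IsProbabilityMeasure μ₀],
      (∀ g : SLR n, Measure.map (fun x => g • x) μ₀ = μ₀) →
      ∃ c₂ : ℝ, ∀ R : ℝ, 0 < R → ∀ D : Set (Fin (n + 1) → ℝ), IsOpen D →
      D ⊆ {x | ∀ i, x i ∈ Set.Ioo (0 : ℝ) 1} →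
      (∃ C' : ℝ, 0 < C' ∧ ∀ r : ℝ, 0 < r → r < 1 →
          volume {x : Fin (n + 1) → ℝ | Metric.infDist x (frontier D) < r}
            < ENNReal.ofReal (C' * r)) →
      ∃ C : ℝ, 0 < C ∧ ∀ T : ℝ, 1 ≤ T →
        |((frobSet n R T D).ncard : ℝ) / T ^ (n + 1) - c₂ * (volume D).toReal *
            (μ₀ (QuotientGroup.mk ''
              {g : SLR n | covRad n (simplexStd n) (latticeOf g) ≤ R})).toReal| <
          C * T ^ (-κ) := by
  have hn0 : (0 : ℝ) < n := by exact_mod_cast (by omega : 0 < n)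
  obtain ⟨q, hq, h⟩ := exists_ncard_frobSet_cut hn
  have hq0 : (0 : ℝ) < q := by exact_mod_cast hq
  set w : ℕ := 12 * q * n with hw
  have hw0' : w ≠ 0 := by positivity
  have hw0 : (0 : ℝ) < w := by exact_mod_cast Nat.pos_of_ne_zero hw0'
  refine ⟨1 / w * (1 / n), by positivity, fun μ₀ _ hinv => ?_⟩
  obtain ⟨c₂, h⟩ := h μ₀ hinv
  refine ⟨c₂, fun R hR D hDo hD hC' => ?_⟩
  obtain ⟨C, hC, v₀, hv₀, h⟩ := h R hR D hDo hD hC'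
  set m := (μ₀ (QuotientGroup.mk ''
    {g : SLR n | covRad n (simplexStd n) (latticeOf g) ≤ R})).toReal with hm
  have hm0 : 0 ≤ m := ENNReal.toReal_nonneg
  have hm1 : m ≤ 1 := measureReal_le_one
  have hV0 : 0 ≤ (volume D).toReal := ENNReal.toReal_nonneg
  have hV1 : (volume D).toReal ≤ 1 := by
    simpa using ENNReal.toReal_mono ENNReal.one_ne_top (volume_le_one hD)
  set Q : ℝ := (n + 1) + |c₂| * ((n + 1) * (2 * 2 ^ n)) with hQ
  have hQ0 : 0 ≤ Q := by positivity
  refine ⟨C + Q + (1 + |c₂|) * v₀ ^ (1 / (n : ℝ)) + 1, by positivity, fun T hT => ?_⟩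
  have hT0 : 0 < T := by linarith
  set v : ℝ := T ^ (1 / (w : ℝ)) with hv
  have hv1 : 1 ≤ v := Real.one_le_rpow hT (by positivity)
  have hv0 : 0 < v := by linarith
  have hvT : (v ^ (12 * q)) ^ n = T := by
    rw [← pow_mul, ← hw, hv, one_div, Real.rpow_inv_natCast_pow hT0.le hw0']
  set P : ℝ := (v ^ (1 / (n : ℝ)))⁻¹ with hP
  have hP0 : 0 < P := by positivity
  have hPT : T ^ (-(1 / (w : ℝ) * (1 / n))) = P := by
    rw [hP, hv, ← Real.rpow_mul hT0.le, Real.rpow_neg hT0.le]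
  rw [hPT]
  have hTn : 0 < T ^ (n + 1) := by positivity
  by_cases hvv : v₀ ≤ v
  · have h1 := h v hvv
    rw [hvT] at h1
    have hη0 : 0 ≤ v⁻¹ := by positivity
    have h2 := abs_ncard_frobSet_sub_le (R := R) hT0 hη0 hD
    have h3 := abs_volume_sub_le hη0 hD
    have hvP : v⁻¹ ≤ P := by
      rw [hP]
      gcongr
      refine Real.rpow_le_self_of_one_le hv1 ?_
      rw [div_le_one hn0]
      exact_mod_cast (by omega : 1 ≤ n)
    set N : ℝ := ((frobSet n R T D).ncard : ℝ)
    set N' : ℝ := ((frobSet n R T {x ∈ D | ∀ i, v⁻¹ < x i}).ncard : ℝ)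
    set V : ℝ := (volume D).toReal
    set V' : ℝ := (volume {x ∈ D | ∀ i, v⁻¹ < x i}).toReal
    have h4 : N / T ^ (n + 1) - c₂ * V * m = (N - N') / T ^ (n + 1) +
        (N' - T ^ (n + 1) * (c₂ * V' * m)) / T ^ (n + 1) - c₂ * m * (V - V') := by
      field_simp
      ring
    have e1 : |(N - N') / T ^ (n + 1)| ≤ (n + 1) * v⁻¹ := by
      rw [abs_div, abs_of_pos hTn, div_le_iff₀ hTn]
      exact h2
    have e2 : |(N' - T ^ (n + 1) * (c₂ * V' * m)) / T ^ (n + 1)| ≤ C * P := by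
      rw [abs_div, abs_of_pos hTn, div_le_iff₀ hTn]
      exact h1.trans (le_of_eq (by ring))
    have e3 : |c₂ * m * (V - V')| ≤ |c₂| * 1 * ((n + 1) * (2 * v⁻¹ * 2 ^ n)) := by
      rw [abs_mul, abs_mul, abs_of_nonneg hm0]
      gcongr
    rw [h4]
    calc _ ≤ (n + 1) * v⁻¹ + C * P + |c₂| * 1 * ((n + 1) * (2 * v⁻¹ * 2 ^ n)) :=
          (abs_sub _ _).trans (add_le_add ((abs_add_le _ _).trans (add_le_add e1 e2)) e3)
      _ = C * P + Q * v⁻¹ := by rw [hQ]; ring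
      _ ≤ C * P + Q * P := by gcongr
      _ = (C + Q) * P := by ring
      _ < _ := by
        refine mul_lt_mul_of_pos_right ?_ hP0
        have : 0 ≤ (1 + |c₂|) * v₀ ^ (1 / (n : ℝ)) := by positivity
        linarith
  · push Not at hvv
    have h1 : 1 ≤ v₀ ^ (1 / (n : ℝ)) * P := by
      rw [hP, ← div_eq_mul_inv, one_le_div (by positivity)]
      exact Real.rpow_le_rpow hv0.le hvv.le (by positivity)
    have h2 : ((frobSet n R T D).ncard : ℝ) / T ^ (n + 1) ≤ 1 := by
      rw [div_le_one hTn]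
      exact (ncard_frobSet_le hT0 hD).2
    have h3 : |((frobSet n R T D).ncard : ℝ) / T ^ (n + 1)| ≤ 1 := by
      rwa [abs_of_nonneg (by positivity)]
    have h4 : |c₂ * (volume D).toReal * m| ≤ |c₂| * 1 * 1 := by
      rw [abs_mul, abs_mul, abs_of_nonneg hm0, abs_of_nonneg hV0]
      gcongr
    calc _ ≤ 1 + |c₂| * 1 * 1 := (abs_sub _ _).trans (add_le_add h3 h4)
      _ = (1 + |c₂|) * 1 := by ring
      _ ≤ (1 + |c₂|) * (v₀ ^ (1 / (n : ℝ)) * P) := by gcongr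
      _ = (1 + |c₂|) * v₀ ^ (1 / (n : ℝ)) * P := by ring
      _ < _ := by
        refine mul_lt_mul_of_pos_right ?_ hP0
        linarith

lemma moebiusSum_mul_zetaVal {d : ℕ} (hd : 2 ≤ d) : moebiusSum d * zetaVal d = 1 := by
  have hs : 1 < (d : ℂ).re := by
    rw [Complex.natCast_re]
    exact_mod_cast (by omega : 1 < d)
  have h1 := LSeries_one_mul_Lseries_moebius hs
  rw [LSeries_one_eq_riemannZeta hs, zeta_eq_tsum_one_div_nat_add_one_cpow hs]
    at h1
  have h2 : (∑' k : ℕ, 1 / ((k : ℂ) + 1) ^ (d : ℂ)) = ((zetaVal d : ℝ) : ℂ) := by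
    rw [zetaVal, Complex.ofReal_tsum]
    refine tsum_congr fun k => ?_
    push_cast
    rw [Complex.cpow_natCast]
  have h3 : LSeries (fun k => ((ArithmeticFunction.moebius k : ℤ) : ℂ)) (d : ℂ) =
      ((moebiusSum d : ℝ) : ℂ) := by
    rw [moebiusSum, Complex.ofReal_tsum, LSeries]
    refine tsum_congr fun k => ?_
    rcases eq_or_ne k 0 with rfl | hk
    · simp
    · rw [LSeries.term_of_ne_zero hk, Complex.cpow_natCast]
      push_cast
      rfl
  rw [h2, h3] at h1
  rw [mul_comm]
  exact_mod_cast h1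

/-- The open unit cube. -/
def openCube (n : ℕ) : Set (Fin n → ℝ) := {x | ∀ i, x i ∈ Set.Ioo (0 : ℝ) 1}

lemma openCube_eq_pi (n : ℕ) : openCube n = Set.univ.pi fun _ => Set.Ioo (0 : ℝ) 1 := by
  ext x
  simp [openCube]

lemma isOpen_openCube (n : ℕ) : IsOpen (openCube n) := by
  rw [openCube_eq_pi]
  exact isOpen_set_pi Set.finite_univ fun _ _ => isOpen_Ioo

lemma volume_openCube (n : ℕ) : volume (openCube n) = 1 := by
  rw [openCube_eq_pi, volume_pi_pi]
  simp

lemma volume_wide_slab_le {n : ℕ} (i : Fin (n + 1)) (c : ℝ) {δ : ℝ} (hδ : 0 ≤ δ) :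
    volume {x : Fin (n + 1) → ℝ | (∀ k, -1 < x k ∧ x k < 2) ∧ |x i - c| ≤ δ} ≤
      ENNReal.ofReal (2 * δ * 3 ^ n) := by
  refine (measure_mono (t := Set.univ.pi fun k => if k = i then Set.Icc (c - δ) (c + δ) else
    Set.Ioo (-1) 2) ?_).trans (le_of_eq ?_)
  · rintro x ⟨h1, h2⟩ k -
    rw [abs_le] at h2
    by_cases hk : k = i
    · subst hk
      simp only [if_true]
      exact ⟨by linarith [h2.1], by linarith [h2.2]⟩
    · simp only [hk, if_false]
      exact h1 k
  · rw [volume_pi_pi, ← Finset.mul_prod_erase _ _ (Finset.mem_univ i)]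
    rw [Finset.prod_congr rfl (g := fun _ => ENNReal.ofReal 3)]
    · rw [if_pos rfl, Real.volume_Icc, Finset.prod_const, Finset.card_erase_of_mem
        (Finset.mem_univ i), Finset.card_univ, Fintype.card_fin, Nat.add_sub_cancel,
        ← ENNReal.ofReal_pow (by norm_num), ← ENNReal.ofReal_mul (by linarith)]
      congr 1
      ring
    · intro k hk
      rw [if_neg (Finset.ne_of_mem_erase hk), Real.volume_Ioo]
      norm_num

lemma volume_infDist_frontier_openCube_lt (n : ℕ) :
    ∃ C' : ℝ, 0 < C' ∧ ∀ r : ℝ, 0 < r → r < 1 →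
      volume {x : Fin (n + 1) → ℝ | Metric.infDist x (frontier (openCube (n + 1))) < r}
        < ENNReal.ofReal (C' * r) := by
  refine ⟨(n + 1) * (2 * 3 ^ n + 2 * 3 ^ n) + 1, by positivity, fun r hr hr1 => ?_⟩
  have hne : (frontier (openCube (n + 1))).Nonempty := by
    rw [nonempty_frontier_iff]
    refine ⟨⟨fun _ => 1 / 2, fun i => by norm_num⟩, fun h => ?_⟩
    have : (0 : Fin (n + 1) → ℝ) ∈ openCube (n + 1) := h ▸ Set.mem_univ _
    exact lt_irrefl _ (this 0).1
  have hcl : closure (openCube (n + 1)) ⊆ Set.univ.pi fun _ => Set.Icc (0 : ℝ) 1 := by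
    refine closure_minimal ?_ (isClosed_set_pi fun _ _ => isClosed_Icc)
    exact fun x hx i _ => ⟨(hx i).1.le, (hx i).2.le⟩
  have hsub : {x : Fin (n + 1) → ℝ | Metric.infDist x (frontier (openCube (n + 1))) < r} ⊆
      ⋃ i ∈ (Finset.univ : Finset (Fin (n + 1))),
        ({x : Fin (n + 1) → ℝ | (∀ k, -1 < x k ∧ x k < 2) ∧ |x i - 0| ≤ r} ∪
          {x : Fin (n + 1) → ℝ | (∀ k, -1 < x k ∧ x k < 2) ∧ |x i - 1| ≤ r}) := by
    intro x hx
    obtain ⟨y, hy, hxy⟩ := (Metric.infDist_lt_iff hne).1 hx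
    rw [frontier, (isOpen_openCube _).interior_eq] at hy
    have hd : ∀ k, |x k - y k| < r := fun k => by
      have := (dist_le_pi_dist x y k).trans_lt hxy
      rwa [Real.dist_eq] at this
    have hyk : ∀ k, y k ∈ Set.Icc (0 : ℝ) 1 := fun k => hcl hy.1 k (Set.mem_univ k)
    have hbox : ∀ k, -1 < x k ∧ x k < 2 := fun k => by
      have h1 := abs_lt.1 (hd k)
      have h2 := hyk k
      exact ⟨by linarith [h2.1, h1.1], by linarith [h2.2, h1.2]⟩
    obtain ⟨i, hi⟩ : ∃ i, y i ∉ Set.Ioo (0 : ℝ) 1 := by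
      by_contra! h
      exact hy.2 h
    refine Set.mem_biUnion (Finset.mem_coe.2 (Finset.mem_univ i)) ?_
    rcases (hyk i).1.eq_or_lt with h0 | h0
    · exact Or.inl ⟨hbox, by rw [h0]; exact (hd i).le⟩
    · have h1 : y i = 1 := le_antisymm (hyk i).2 (not_lt.1 fun h => hi ⟨h0, h⟩)
      exact Or.inr ⟨hbox, by rw [← h1]; exact (hd i).le⟩
  refine ((measure_mono hsub).trans ((measure_biUnion_finset_le _ _).trans (Finset.sum_le_sum
    fun i _ => (measure_union_le _ _).trans
      (add_le_add (volume_wide_slab_le i 0 hr.le) (volume_wide_slab_le i 1 hr.le))))).trans_lt ?_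
  rw [Finset.sum_const, Finset.card_univ, Fintype.card_fin, nsmul_eq_mul,
    ← ENNReal.ofReal_add (by positivity) (by positivity), ← ENNReal.ofReal_natCast,
    ← ENNReal.ofReal_mul (by positivity)]
  refine (ENNReal.ofReal_lt_ofReal_iff (by positivity)).2 ?_
  push_cast
  linarith

lemma tendsto_measure_covRad_le {n : ℕ} (μ₀ : Measure (XQuot n)) [IsProbabilityMeasure μ₀] :
    Filter.Tendsto (fun k : ℕ => (μ₀ (QuotientGroup.mk ''
      {g : SLR n | covRad n (simplexStd n) (latticeOf g) ≤ (k : ℝ) + 1})).toReal)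
      Filter.atTop (nhds 1) := by
  set E : ℕ → Set (XQuot n) := fun k => QuotientGroup.mk ''
    {g : SLR n | covRad n (simplexStd n) (latticeOf g) ≤ (k : ℝ) + 1} with hE
  have hmono : Monotone E := fun i j hij => Set.image_mono fun g hg =>
    le_trans (Set.mem_ofPred_eq ▸ hg) (by
      have : (i : ℝ) ≤ j := by exact_mod_cast hij
      linarith)
  have hU : ⋃ k, E k = Set.univ := by
    refine Set.eq_univ_of_forall fun x => ?_
    obtain ⟨g, rfl⟩ := QuotientGroup.mk_surjective x
    obtain ⟨k, hk⟩ := exists_nat_ge (covRad n (simplexStd n) (latticeOf g))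
    exact Set.mem_iUnion.2 ⟨k, g, hk.trans (by simp), rfl⟩
  have h := tendsto_measure_iUnion_atTop (μ := μ₀) hmono
  rw [hU, measure_univ] at h
  have hlim := (ENNReal.tendsto_toReal ENNReal.one_ne_top).comp h
  rwa [ENNReal.toReal_one] at hlim

/-- The number of primitive points of a large cube. -/
lemma exists_card_primitive {n : ℕ} (hn : 1 ≤ n) : ∃ C : ℝ, 0 < C ∧ ∀ m : ℕ, 2 ≤ m →
    |(((intCube (0 : Fin (n + 1) → ℤ) (m ^ 4)).filter fun b => Finset.univ.gcd b = 1).card : ℝ)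
      - ((m : ℝ) ^ 4) ^ (n + 1) * moebiusSum (n + 1)| ≤
        C * ((m : ℝ) ^ 4) ^ (n + 1) / m := by
  obtain ⟨C, hC, h⟩ := sieve_cube (n + 1)
  refine ⟨C, hC, fun m hm => ?_⟩
  have := h m hm 1 1 (one_mul 1) Finset.univ (by simp; omega)
    (fun _ c hc => absurd (Finset.mem_univ c) hc) 0 (fun i => by simp)
  simpa using this

open Classical in
/-- The set counted for the open cube lies among the primitive points. -/
lemma ncard_frobSet_openCube_le {n T : ℕ} (R : ℝ) (hT : 0 < T) :
    (frobSet n R T (openCube (n + 1))).ncard ≤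
      ((intCube (0 : Fin (n + 1) → ℤ) T).filter fun b => Finset.univ.gcd b = 1).card := by
  have hT0 : (0 : ℝ) < T := by exact_mod_cast hT
  rw [← Set.ncard_coe_finset]
  refine Set.ncard_le_ncard (fun a ha => ?_) (Finset.finite_toSet _)
  rw [Finset.coe_filter]
  refine ⟨mem_intCube.2 fun i => ⟨by have := ha.2.1 i; simp; omega, ?_⟩, ha.1⟩
  have h1 := (ha.2.2.1 i).2
  rw [div_lt_one hT0] at h1
  rw [Pi.zero_apply, zero_add]
  exact_mod_cast h1

open Classical in
lemma le_ncard_frobSet_openCube {n T : ℕ} {R : ℝ} (hT : 0 < T) {B : ℝ}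
    (hB : ∀ S : Finset (Fin (n + 1) → ℤ),
      (∀ a ∈ S, a ∈ intCube (0 : Fin (n + 1) → ℤ) T ∧ Finset.univ.gcd a = 1 ∧ (∀ i, 2 ≤ a i) ∧
        R * (∏ i, (a i : ℝ)) ^ (1 / (n : ℝ)) < (frobNum (n + 1) a : ℝ) + ∑ i, (a i : ℝ)) →
      (S.card : ℝ) ≤ B) :
    (((intCube (0 : Fin (n + 1) → ℤ) T).filter fun b => Finset.univ.gcd b = 1).card : ℝ) ≤
      (frobSet n R T (openCube (n + 1))).ncard + (n + 1) * (2 * T ^ n) + B := by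
  have hT0 : (0 : ℝ) < T := by exact_mod_cast hT
  set I := intCube (0 : Fin (n + 1) → ℤ) T
  set S := I.filter fun a : Fin (n + 1) → ℤ => Finset.univ.gcd a = 1 ∧ (∀ i, 2 ≤ a i) ∧
    R * (∏ i, (a i : ℝ)) ^ (1 / (n : ℝ)) < (frobNum (n + 1) a : ℝ) + ∑ i, (a i : ℝ) with hS
  have h1 := hB S fun a ha => Finset.mem_filter.1 ha
  have h2 : (((I.filter fun a => ∃ i, a i < ((2 : ℕ) : ℤ)).card : ℕ) : ℝ) ≤
      (n + 1) * (2 * T ^ n) := by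
    exact_mod_cast card_intCube_coord_lt_le (n := n) (T := T) 2
  have hfin := (ncard_frobSet_le (R := R) (D := openCube (n + 1)) hT0 fun x hx => hx).1
  have hsub : I.filter (fun b => Finset.univ.gcd b = 1) ⊆ hfin.toFinset ∪
      (I.filter fun a => ∃ i, a i < ((2 : ℕ) : ℤ)) ∪ S := by
    intro a ha
    obtain ⟨haI, hg⟩ := Finset.mem_filter.1 ha
    simp only [Finset.mem_union, Finset.mem_filter, Set.Finite.mem_toFinset, hS]
    by_cases h2 : ∃ i, a i < ((2 : ℕ) : ℤ)
    · exact Or.inl (Or.inr ⟨haI, h2⟩)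
    push Not at h2
    by_cases h3 : R * (∏ i, (a i : ℝ)) ^ (1 / (n : ℝ)) <
        (frobNum (n + 1) a : ℝ) + ∑ i, (a i : ℝ)
    · exact Or.inr ⟨haI, hg, h2, h3⟩
    refine Or.inl (Or.inl ⟨hg, h2, fun i => ⟨?_, ?_⟩, not_lt.1 h3⟩)
    · have : (2 : ℤ) ≤ a i := h2 i
      exact div_pos (by exact_mod_cast (by omega : 0 < a i)) hT0
    · have h4 := (mem_intCube.1 haI i).2
      rw [Pi.zero_apply, zero_add] at h4
      rw [div_lt_one hT0]
      exact_mod_cast h4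
  have h3 := (Finset.card_le_card hsub).trans ((Finset.card_union_le _ _).trans
    (add_le_add (Finset.card_union_le _ _) le_rfl))
  rw [← Set.ncard_eq_toFinset_card _ hfin] at h3
  have h4 : (((I.filter fun b => Finset.univ.gcd b = 1).card : ℕ) : ℝ) ≤
      (frobSet n R T (openCube (n + 1))).ncard +
        ((I.filter fun a => ∃ i, a i < ((2 : ℕ) : ℤ)).card : ℕ) + (S.card : ℕ) := by
    exact_mod_cast h3
  linarith

lemma tendsto_card_primitive {n : ℕ} (hn : 1 ≤ n) :
    Filter.Tendsto (fun m : ℕ =>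
      (((intCube (0 : Fin (n + 1) → ℤ) (m ^ 4)).filter fun b => Finset.univ.gcd b = 1).card : ℝ) /
        ((m : ℝ) ^ 4) ^ (n + 1)) Filter.atTop (nhds (moebiusSum (n + 1))) := by
  obtain ⟨C, hC, h⟩ := exists_card_primitive hn
  rw [tendsto_iff_norm_sub_tendsto_zero]
  refine squeeze_zero' (Filter.Eventually.of_forall fun _ => norm_nonneg _) ?_
    (tendsto_const_nhds.div_atTop tendsto_natCast_atTop_atTop : Filter.Tendsto
      (fun m : ℕ => C / (m : ℝ)) Filter.atTop (nhds 0))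
  filter_upwards [Filter.eventually_ge_atTop 2] with m hm
  have hm0 : (0 : ℝ) < m := by exact_mod_cast (by omega : 0 < m)
  have hX : (0 : ℝ) < ((m : ℝ) ^ 4) ^ (n + 1) := by positivity
  have h1 := h m hm
  set N : ℝ := (((intCube (0 : Fin (n + 1) → ℤ) (m ^ 4)).filter
    fun b => Finset.univ.gcd b = 1).card : ℝ)
  have e : N / ((m : ℝ) ^ 4) ^ (n + 1) - moebiusSum (n + 1) =
      (N - ((m : ℝ) ^ 4) ^ (n + 1) * moebiusSum (n + 1)) / ((m : ℝ) ^ 4) ^ (n + 1) := by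
    field_simp
  rw [Real.norm_eq_abs, e, abs_div, abs_of_pos hX, div_le_iff₀ hX]
  exact h1.trans (le_of_eq (by ring))

/-- The constant in the limit distribution is determined by the count of primitive points. -/
lemma eq_moebiusSum_of_tendsto {n : ℕ} (hn : 2 ≤ n) {c : ℝ} {p : ℝ → ℝ}
    (hp1 : ∀ R, p R ≤ 1)
    (hp : Filter.Tendsto (fun k : ℕ => p ((k : ℝ) + 1)) Filter.atTop (nhds 1))
    (hc : ∀ R, 0 < R → Filter.Tendsto (fun m : ℕ =>
      ((frobSet n R (((m ^ 4 : ℕ) : ℝ)) (openCube (n + 1))).ncard : ℝ) /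
        ((m : ℝ) ^ 4) ^ (n + 1)) Filter.atTop (nhds (c * p R))) :
    c = moebiusSum (n + 1) := by
  have hprim := tendsto_card_primitive (n := n) (by omega)
  have hup : ∀ R, 0 < R → c * p R ≤ moebiusSum (n + 1) := fun R hR => by
    refine le_of_tendsto_of_tendsto (hc R hR) hprim ?_
    filter_upwards [Filter.eventually_gt_atTop 0] with m hm
    gcongr
    classical
    exact_mod_cast ncard_frobSet_openCube_le R (by positivity : 0 < m ^ 4)
  have hle : c ≤ moebiusSum (n + 1) := by
    refine le_of_tendsto (by simpa using hp.const_mul c) ?_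
    exact Filter.Eventually.of_forall fun k => hup _ (by positivity)
  have hcp : ∀ R, 0 < R → 0 ≤ c * p R := fun R hR =>
    ge_of_tendsto' (hc R hR) fun m => by positivity
  have hc0 : 0 ≤ c := by
    refine ge_of_tendsto (by simpa using hp.const_mul c) ?_
    exact Filter.Eventually.of_forall fun k => hcp _ (by positivity)
  have hlow : ∀ ε, 0 < ε → ε ≤ 1 → ∃ R, 0 < R ∧ moebiusSum (n + 1) ≤ c * p R + ε := by
    intro ε hε hε1
    obtain ⟨R, hR, T₀, h⟩ := exists_frobNum_tight (by omega : n ≠ 0) hε hε1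
    refine ⟨R, hR, ?_⟩
    have ht : Filter.Tendsto (fun m : ℕ => 2 * ((n : ℝ) + 1) / (m : ℝ) ^ 4)
        Filter.atTop (nhds 0) :=
      tendsto_const_nhds.div_atTop ((Filter.tendsto_pow_atTop (by norm_num)).comp
        tendsto_natCast_atTop_atTop)
    have ht' := ((hc R hR).add ht).add_const ε
    rw [add_zero] at ht'
    refine le_of_tendsto_of_tendsto hprim ht' ?_
    filter_upwards [Filter.eventually_ge_atTop (T₀ + 1)] with m hm
    have hm0 : (0 : ℝ) < m := by exact_mod_cast (by omega : 0 < m)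
    have hmT : T₀ ≤ m ^ 4 := by
      have := Nat.le_self_pow (by norm_num : 4 ≠ 0) m
      omega
    classical
    have h1 := le_ncard_frobSet_openCube (R := R) (pow_pos (by omega) 4 : 0 < m ^ 4) (h (m ^ 4) hmT)
    have e : ((frobSet n R (((m ^ 4 : ℕ) : ℝ)) (openCube (n + 1))).ncard : ℝ) /
        ((m : ℝ) ^ 4) ^ (n + 1) + 2 * ((n : ℝ) + 1) / (m : ℝ) ^ 4 + ε =
        (((frobSet n R (((m ^ 4 : ℕ) : ℝ)) (openCube (n + 1))).ncard : ℝ) +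
          (n + 1) * (2 * ((m ^ 4 : ℕ) : ℝ) ^ n) + ε * ((m ^ 4 : ℕ) : ℝ) ^ (n + 1)) /
          ((m : ℝ) ^ 4) ^ (n + 1) := by
      have hX : (0 : ℝ) < (m : ℝ) ^ 4 := by positivity
      push_cast
      generalize (m : ℝ) ^ 4 = X at hX ⊢
      rw [pow_succ]
      field_simp
    rw [e]
    gcongr
  refine le_antisymm hle (le_of_forall_pos_le_add fun ε hε => ?_)
  obtain ⟨R, hR, h⟩ := hlow (min ε 1) (lt_min hε one_pos) (min_le_right _ _)
  have h1 : c * p R ≤ c := mul_le_of_le_one_right hc0 (hp1 R)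
  linarith [min_le_left ε 1]

/-- Effective limit distribution of Frobenius numbers: for domains `𝒟` inside
the unit cube with well-behaved (e.g. piecewise smooth) boundary, the error in
Marklof's limit theorem is at most polynomial in the enlarging factor `T`.
Here `e = d - 1 ≥ 2`, so the dimension is `d = e + 1 ≥ 3`. -/
theorem effective_limit_distribution (e : ℕ) (he : 2 ≤ e) :
    ∃ κ : ℝ, 0 < κ ∧
      ∀ R : ℝ, 0 < R →
      ∀ (μ₀ : Measure (XQuot e)), IsProbabilityMeasure μ₀ →
        (∀ g : SLR e, Measure.map (fun x => g • x) μ₀ = μ₀) →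
      ∀ D : Set (Fin (e + 1) → ℝ), IsOpen D →
        D ⊆ {x | ∀ i, x i ∈ Set.Ioo (0 : ℝ) 1} →
        (∃ C' : ℝ, 0 < C' ∧ ∀ r : ℝ, 0 < r → r < 1 →
          volume {x : Fin (e + 1) → ℝ | Metric.infDist x (frontier D) < r}
            < ENNReal.ofReal (C' * r)) →
        ∃ C : ℝ, 0 < C ∧ ∀ T : ℝ, 1 ≤ T →
          |(Set.ncard {a : Fin (e + 1) → ℤ |
              Finset.univ.gcd a = 1 ∧ (∀ i, 2 ≤ a i) ∧
              (fun i => (a i : ℝ) / T) ∈ D ∧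
              (frobNum (e + 1) a : ℝ) + ∑ i, (a i : ℝ)
                ≤ R * (∏ i, (a i : ℝ)) ^ (1 / (e : ℝ))} : ℝ) / T ^ (e + 1)
            - (volume D).toReal / zetaVal (e + 1) *
              (μ₀ (QuotientGroup.mk ''
                {g : SLR e | covRad e (simplexStd e) (latticeOf g) ≤ R})).toReal|
            < C * T ^ (-κ) := by
  obtain ⟨κ, hκ, h⟩ := exists_frobSet_asymptotic he
  refine ⟨κ, hκ, fun R hR μ₀ _ hinv D hDo hD hC' => ?_⟩
  obtain ⟨c, hc⟩ := h μ₀ hinv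
  have hcz : c = 1 / zetaVal (e + 1) := by
    have hz := moebiusSum_mul_zetaVal (d := e + 1) (by omega)
    have hcm : c = moebiusSum (e + 1) := by
      refine eq_moebiusSum_of_tendsto he (p := fun R => (μ₀ (QuotientGroup.mk ''
        {g : SLR e | covRad e (simplexStd e) (latticeOf g) ≤ R})).toReal)
        (fun _ => measureReal_le_one) (tendsto_measure_covRad_le μ₀) fun R hR => ?_
      obtain ⟨C, hC, h1⟩ := hc R hR (openCube (e + 1)) (isOpen_openCube _) (fun x hx => hx)
        (volume_infDist_frontier_openCube_lt e)
      rw [tendsto_iff_norm_sub_tendsto_zero]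
      have h0 : Filter.Tendsto (fun m : ℕ => C * ((m ^ 4 : ℕ) : ℝ) ^ (-κ))
          Filter.atTop (nhds 0) := by
        rw [← mul_zero C]
        exact (((tendsto_rpow_neg_atTop hκ).comp tendsto_natCast_atTop_atTop).comp
          (Filter.tendsto_pow_atTop (by norm_num))).const_mul C
      refine squeeze_zero' (Filter.Eventually.of_forall fun _ => norm_nonneg _) ?_ h0
      filter_upwards [Filter.eventually_ge_atTop 1] with m hm
      have h2 := h1 ((m ^ 4 : ℕ) : ℝ) (by exact_mod_cast Nat.one_le_pow 4 m hm)
      rw [volume_openCube, ENNReal.toReal_one, mul_one] at h2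
      rw [Real.norm_eq_abs]
      rw [← Nat.cast_pow]
      exact h2.le
    rw [hcm]
    exact eq_one_div_of_mul_eq_one_left hz
  obtain ⟨C, hC, h1⟩ := hc R hR D hDo hD hC'
  refine ⟨C, hC, fun T hT => ?_⟩
  rw [div_eq_mul_one_div _ (zetaVal (e + 1)), ← hcz, mul_comm _ c]
  exact h1 T hT
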